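/- Let 1 < p < ∞ and let L^Δ_{c,p,d} be the best constant in the upper dyadic Littlewood-Paley inequality on R^d. Then L^Δ_{c,p,d} ≈_d (p')^{3d/2} for 1 < p ≤ 2, and L^Δ_{c,p,d} ≈_d p^d for 2 < p < ∞. -/

import Mathlib

open MeasureTheory ENNReal FourierTransform

noncomputable section

/-- The dyadic intervals of `ℝ`: `[2^{k-1}, 2^k)` (for `s = true`) and
`(-2^k, -2^{k-1}]` (for `s = false`), `k ∈ ℤ`. -/
def dyadicInterval (k : ℤ) (s : Bool) : Set ℝ :=
  if s then Set.Ico ((2 : ℝ) ^ (k - 1)) ((2 : ℝ) ^ k)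
  else Set.Ioc (-(2 : ℝ) ^ k) (-(2 : ℝ) ^ (k - 1))

/-- A dyadic rectangle of `ℝ^d`: a `d`-fold product of dyadic intervals.
The family of all of them is the dyadic partition `Δ` of `ℝ^d` (minus the origin). -/
def dyadicRect (d : ℕ) (k : Fin d → ℤ) (s : Fin d → Bool) :
    Set (EuclideanSpace ℝ (Fin d)) :=
  {ξ | ∀ i, ξ i ∈ dyadicInterval (k i) (s i)}

/-- The partial sum operator `S_R`, `(S_R f)^ = 1_R f̂`, for the dyadic rectangle
`R` determined by `(k, s)`. -/
def dyadicPartialSum (d : ℕ) (k : Fin d → ℤ) (s : Fin d → Bool)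
    (f : EuclideanSpace ℝ (Fin d) → ℂ) : EuclideanSpace ℝ (Fin d) → ℂ :=
  𝓕⁻ ((dyadicRect d k s).indicator (𝓕 f))

/-- The dyadic Littlewood–Paley square function `S^Δ(f) = (∑_{R∈Δ} |S_R f|²)^{1/2}`. -/
def dyadicSquareFn (d : ℕ) (f : EuclideanSpace ℝ (Fin d) → ℂ)
    (x : EuclideanSpace ℝ (Fin d)) : ℝ :=
  Real.sqrt (∑' ks : (Fin d → ℤ) × (Fin d → Bool), ‖dyadicPartialSum d ks.1 ks.2 f x‖ ^ 2)

/-- The best constant `L^Δ_{c,p,d}` in `‖S^Δ(f)‖_p ≤ L^Δ_{c,p,d} ‖f‖_p`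
(tested on compactly supported smooth functions, which are dense in `L_p(ℝ^d)`). -/
def dyadicUpperConst (d : ℕ) (p : ℝ) : ℝ≥0∞ :=
  sInf {C : ℝ≥0∞ | ∀ f : EuclideanSpace ℝ (Fin d) → ℂ,
    ContDiff ℝ (⊤ : ℕ∞) f → HasCompactSupport f →
      eLpNorm (dyadicSquareFn d f) (ENNReal.ofReal p) volume ≤
        C * eLpNorm f (ENNReal.ofReal p) volume}

/-- The best constant `L^Δ_{t,p,d}` in `(L^Δ_{t,p,d})⁻¹ ‖f‖_p ≤ ‖S^Δ(f)‖_p`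
(tested on compactly supported smooth functions, which are dense in `L_p(ℝ^d)`). -/
def dyadicLowerConst (d : ℕ) (p : ℝ) : ℝ≥0∞ :=
  sInf {C : ℝ≥0∞ | ∀ f : EuclideanSpace ℝ (Fin d) → ℂ,
    ContDiff ℝ (⊤ : ℕ∞) f → HasCompactSupport f →
      eLpNorm f (ENNReal.ofReal p) volume ≤
        C * eLpNorm (dyadicSquareFn d f) (ENNReal.ofReal p) volume}

namespace DyadicLP

section

/-- Euclidean space of dimension `d`. -/
abbrev E (d : ℕ) := EuclideanSpace ℝ (Fin d)

/-- The Hilbert space `L²(ℝ^d)`. -/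
abbrev L2 (d : ℕ) := Lp (α := E d) ℂ 2 volume

variable {d : ℕ}

theorem continuous_fourierInv {h : E d → ℂ} (h1 : Integrable h) : Continuous (𝓕⁻ h) := by
  refine VectorFourier.fourierIntegral_continuous (L := -innerₗ (E d))
    Real.continuous_fourierChar ?_ h1
  have : (fun p : E d × E d ↦ (-innerₗ (E d)) p.1 p.2) = fun p ↦ -inner ℝ p.1 p.2 := by
    ext p; simp
  rw [this]
  fun_prop

theorem integral_fourierInv_mul_flip {f g : E d → ℂ} (hf : Integrable f) (hg : Integrable g) :
    ∫ ξ, 𝓕⁻ f ξ * g ξ = ∫ x, f x * 𝓕⁻ g x := by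
  have hL : (fun p : E d × E d ↦ (-innerₗ (E d)) p.1 p.2) = fun p ↦ -inner ℝ p.1 p.2 := by
    ext p; simp
  have := VectorFourier.integral_fourierIntegral_smul_eq_flip (L := -innerₗ (E d))
    Real.continuous_fourierChar (by rw [hL]; fun_prop) hf hg
  have h2 : (-innerₗ (E d)).flip = -innerₗ (E d) := by
    ext x y; simp [real_inner_comm]
  rw [h2] at this
  exact this

/-- The `L²` inverse Fourier transform agrees with the integral one on `L¹ ∩ L²`. -/
theorem fourierInv_toLp_ae {h : E d → ℂ} (h1 : Integrable h) (h2 : MemLp h 2) :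
    (𝓕⁻ (h2.toLp h) : L2 d) =ᵐ[volume] 𝓕⁻ h := by
  refine ae_eq_of_integral_contDiff_smul_eq
    ((Lp.memLp _).locallyIntegrable (by norm_num))
    (continuous_fourierInv h1).locallyIntegrable fun g hg hgc ↦ ?_
  have hgc' : HasCompactSupport (fun x ↦ (g x : ℂ)) := hgc.comp_left Complex.ofReal_zero
  have hg' : ContDiff ℝ (⊤ : ℕ∞) (fun x ↦ (g x : ℂ)) :=
    Complex.ofRealCLM.contDiff.comp hg
  let φ : SchwartzMap (E d) ℂ := hgc'.toSchwartzMap hg'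
  have hφ : ∀ x, φ x = g x := fun x ↦ rfl
  have h3 := congrArg (fun T ↦ T φ) (Lp.fourierInv_toTemperedDistribution_eq (h2.toLp h))
  simp only [TemperedDistribution.fourierInv_apply, Lp.toTemperedDistribution_apply] at h3
  have h4 : ∫ x, (𝓕⁻ φ : SchwartzMap (E d) ℂ) x • (h2.toLp h) x = ∫ x, φ x * 𝓕⁻ h x := by
    rw [← integral_fourierInv_mul_flip φ.integrable h1]
    refine integral_congr_ae ?_
    filter_upwards [h2.coeFn_toLp] with x hx
    rw [hx, SchwartzMap.fourierInv_coe]; rfl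
  rw [h4] at h3
  simp only [hφ] at h3
  simp only [Complex.real_smul]
  exact h3.symm

/-- Bounded measurable Fourier multipliers. -/
structure IsMult (m : E d → ℂ) : Prop where
  meas : Measurable m
  bdd : ∃ C : ℝ, ∀ ξ, ‖m ξ‖ ≤ C

theorem IsMult.memLp {m : E d → ℂ} (hm : IsMult m) (f : L2 d) :
    MemLp (fun ξ ↦ m ξ * f ξ) 2 volume := by
  obtain ⟨C, hC⟩ := hm.bdd
  refine (Lp.memLp f).of_le_mul (c := C)
    (hm.meas.aestronglyMeasurable.mul (Lp.aestronglyMeasurable f)) (.of_forall fun x ↦ ?_)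
  rw [norm_mul]
  exact mul_le_mul_of_nonneg_right (hC x) (norm_nonneg _)

theorem IsMult.mul {m n : E d → ℂ} (hm : IsMult m) (hn : IsMult n) :
    IsMult (fun ξ ↦ m ξ * n ξ) := by
  obtain ⟨C, hC⟩ := hm.bdd
  obtain ⟨D, hD⟩ := hn.bdd
  refine ⟨hm.meas.mul hn.meas, C * D, fun ξ ↦ ?_⟩
  rw [norm_mul]
  exact mul_le_mul (hC ξ) (hD ξ) (norm_nonneg _) ((norm_nonneg _).trans (hC ξ))

theorem IsMult.add {m n : E d → ℂ} (hm : IsMult m) (hn : IsMult n) :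
    IsMult (fun ξ ↦ m ξ + n ξ) := by
  obtain ⟨C, hC⟩ := hm.bdd
  obtain ⟨D, hD⟩ := hn.bdd
  exact ⟨hm.meas.add hn.meas, C + D, fun ξ ↦ (norm_add_le _ _).trans (add_le_add (hC ξ) (hD ξ))⟩

theorem IsMult.const (c : ℂ) : IsMult (fun _ : E d ↦ c) :=
  ⟨measurable_const, ‖c‖, fun _ ↦ le_rfl⟩

theorem IsMult.sub {m n : E d → ℂ} (hm : IsMult m) (hn : IsMult n) :
    IsMult (fun ξ ↦ m ξ - n ξ) := by
  have := hm.add ((IsMult.const (-1)).mul hn)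
  convert this using 2
  ring

theorem IsMult.finsum {ι : Type*} {s : Finset ι} {m : ι → E d → ℂ} (hm : ∀ i ∈ s, IsMult (m i)) :
    IsMult (fun ξ ↦ ∑ i ∈ s, m i ξ) := by
  classical
  induction s using Finset.induction_on with
  | empty => simpa using IsMult.const (d := d) 0
  | insert a s ha ih =>
    simp only [Finset.sum_insert ha]
    exact (hm a (by simp)).add (ih fun i hi ↦ hm i (by simp [hi]))

open Classical in
/-- Multiplication of an `L²` function by `m`, with junk value `0`. -/
def mulL (m : E d → ℂ) (f : L2 d) : L2 d :=
  if h : MemLp (fun ξ ↦ m ξ * f ξ) 2 volume then h.toLp _ else 0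

theorem coeFn_mulL {m : E d → ℂ} (hm : IsMult m) (f : L2 d) :
    mulL m f =ᵐ[volume] fun ξ ↦ m ξ * f ξ := by
  rw [mulL, dif_pos (hm.memLp f)]
  exact MemLp.coeFn_toLp _

/-- The Fourier multiplier operator on `L²` with symbol `m`. -/
def Fm (m : E d → ℂ) (f : L2 d) : L2 d := 𝓕⁻ (mulL m (𝓕 f))

theorem fourier_Fm {m : E d → ℂ} (hm : IsMult m) (f : L2 d) :
    (𝓕 (Fm m f) : L2 d) =ᵐ[volume] fun ξ ↦ m ξ * (𝓕 f : L2 d) ξ := by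
  rw [Fm, FourierTransform.fourier_fourierInv_eq]
  exact coeFn_mulL hm _

theorem eq_of_fourier_ae {f g : L2 d} (h : (𝓕 f : L2 d) =ᵐ[volume] (𝓕 g : L2 d)) : f = g := by
  have : (𝓕 f : L2 d) = 𝓕 g := Lp.ext h
  exact (Lp.fourierTransformₗᵢ (E d) ℂ).injective this

theorem Fm_Fm {m n : E d → ℂ} (hm : IsMult m) (hn : IsMult n) (f : L2 d) :
    Fm m (Fm n f) = Fm (fun ξ ↦ m ξ * n ξ) f := by
  apply eq_of_fourier_ae
  filter_upwards [fourier_Fm hm (Fm n f), fourier_Fm hn f, fourier_Fm (hm.mul hn) f] with ξ h1 h2 h3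
  rw [h1, h2, h3, mul_assoc]

theorem Fm_congr_ae {m n : E d → ℂ} (hm : IsMult m) (hn : IsMult n) (h : m =ᵐ[volume] n) (f : L2 d) :
    Fm m f = Fm n f := by
  apply eq_of_fourier_ae
  filter_upwards [fourier_Fm hm f, fourier_Fm hn f, h] with ξ h1 h2 h3
  rw [h1, h2, h3]

theorem Fm_add {m n : E d → ℂ} (hm : IsMult m) (hn : IsMult n) (f : L2 d) :
    Fm (fun ξ ↦ m ξ + n ξ) f = Fm m f + Fm n f := by
  apply eq_of_fourier_ae
  rw [FourierTransform.fourier_add]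
  filter_upwards [fourier_Fm hm f, fourier_Fm hn f, fourier_Fm (hm.add hn) f,
    Lp.coeFn_add (𝓕 (Fm m f) : L2 d) (𝓕 (Fm n f))] with ξ h1 h2 h3 h4
  rw [h4, Pi.add_apply, h1, h2, h3, add_mul]

theorem Fm_sub {m n : E d → ℂ} (hm : IsMult m) (hn : IsMult n) (f : L2 d) :
    Fm (fun ξ ↦ m ξ - n ξ) f = Fm m f - Fm n f := by
  have := Fm_add (hm.sub hn) hn f
  simp only [sub_add_cancel] at this
  exact eq_sub_of_add_eq this.symm

theorem Fm_add_right {m : E d → ℂ} (hm : IsMult m) (f g : L2 d) :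
    Fm m (f + g) = Fm m f + Fm m g := by
  apply eq_of_fourier_ae
  rw [FourierTransform.fourier_add]
  filter_upwards [fourier_Fm hm f, fourier_Fm hm g, fourier_Fm hm (f + g),
    Lp.coeFn_add (𝓕 (Fm m f) : L2 d) (𝓕 (Fm m g)),
    Lp.coeFn_add (𝓕 f : L2 d) (𝓕 g)] with ξ h1 h2 h3 h4 h5
  rw [h4, Pi.add_apply, h1, h2, h3, FourierTransform.fourier_add, h5, Pi.add_apply, mul_add]

theorem Fm_sub_right {m : E d → ℂ} (hm : IsMult m) (f g : L2 d) :
    Fm m (f - g) = Fm m f - Fm m g := by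
  have := Fm_add_right hm (f - g) g
  rw [sub_add_cancel] at this
  exact eq_sub_of_add_eq this.symm

theorem Fm_zero_right {m : E d → ℂ} (hm : IsMult m) : Fm m (0 : L2 d) = 0 := by
  have := Fm_sub_right hm (0 : L2 d) 0
  simpa using this

theorem Fm_sum_right {ι : Type*} {s : Finset ι} {m : E d → ℂ} (hm : IsMult m) (f : ι → L2 d) :
    Fm m (∑ i ∈ s, f i) = ∑ i ∈ s, Fm m (f i) := by
  classical
  induction s using Finset.induction_on with
  | empty => simpa using Fm_zero_right hm
  | insert a s ha ih => rw [Finset.sum_insert ha, Finset.sum_insert ha, Fm_add_right hm, ih]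

theorem Fm_sum {ι : Type*} {s : Finset ι} {m : ι → E d → ℂ} (hm : ∀ i, IsMult (m i)) (f : L2 d) :
    Fm (fun ξ ↦ ∑ i ∈ s, m i ξ) f = ∑ i ∈ s, Fm (m i) f := by
  classical
  induction s using Finset.induction_on with
  | empty =>
    have := Fm_sub (IsMult.const 0) (IsMult.const 0) f
    simpa using this
  | insert a s ha ih =>
    simp only [Finset.sum_insert ha]
    rw [Fm_add (hm a) (IsMult.finsum fun i _ ↦ hm i), ih]

theorem Fm_one (f : L2 d) : Fm (fun _ ↦ 1) f = f := by
  apply eq_of_fourier_ae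
  filter_upwards [fourier_Fm (IsMult.const 1) f] with ξ h
  rw [h, one_mul]

theorem Fm_const_mul {m : E d → ℂ} (c : ℂ) (hm : IsMult m) (f : L2 d) :
    Fm (fun ξ ↦ c * m ξ) f = c • Fm m f := by
  apply eq_of_fourier_ae
  rw [FourierTransform.fourier_smul]
  filter_upwards [fourier_Fm hm f, fourier_Fm ((IsMult.const c).mul hm) f,
    Lp.coeFn_smul c (𝓕 (Fm m f) : L2 d)] with ξ h1 h2 h3
  rw [h3, Pi.smul_apply, h1, h2, smul_eq_mul, mul_assoc]

/-- The squared `L²` norm with weight `ω`. -/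
def Q (ω : E d → ℝ≥0∞) (f : E d → ℂ) : ℝ≥0∞ := ∫⁻ x, ‖f x‖ₑ ^ 2 * ω x

theorem Q_one (f : L2 d) : Q (fun _ ↦ 1) f = ‖f‖ₑ ^ 2 := by
  have h := Lp.enorm_def f
  rw [h, eLpNorm_eq_lintegral_rpow_enorm_toReal (by norm_num) (by norm_num)]
  simp only [Q, mul_one, toReal_ofNat, one_div]
  rw [← ENNReal.rpow_natCast, ← ENNReal.rpow_mul]
  norm_num

theorem Q_one_fourier (f : L2 d) :
    Q (fun _ ↦ 1) (𝓕 f : L2 d) = Q (fun _ ↦ 1) f := by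
  rw [Q_one, Q_one, ← ofReal_norm, ← ofReal_norm, Lp.norm_fourier_eq]

theorem Q_congr {ω : E d → ℝ≥0∞} {f g : E d → ℂ} (h : f =ᵐ[volume] g) : Q ω f = Q ω g :=
  lintegral_congr_ae (h.mono fun x hx ↦ by simp only [hx])

theorem Q_mono {ω ω' : E d → ℝ≥0∞} (f : E d → ℂ) (h : ∀ x, ω x ≤ ω' x) : Q ω f ≤ Q ω' f :=
  lintegral_mono fun x ↦ mul_le_mul_right (h x) _

theorem Q_const_mul (ω : E d → ℝ≥0∞) (f : E d → ℂ) {c : ℝ≥0∞} (hc : c ≠ ∞) :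
    Q (fun x ↦ c * ω x) f = c * Q ω f := by
  rw [Q, Q, ← lintegral_const_mul' _ _ hc]
  exact lintegral_congr fun x ↦ by ring

theorem Q_Fm {m : E d → ℂ} (hm : IsMult m) (f : L2 d) :
    Q (fun _ ↦ 1) (Fm m f) = Q (fun ξ ↦ ‖m ξ‖ₑ ^ 2) (𝓕 f : L2 d) := by
  rw [← Q_one_fourier, Q_congr (fourier_Fm hm f)]
  refine lintegral_congr fun ξ ↦ ?_
  rw [enorm_mul]; ring

theorem tsum_Q_Fm_le {ι : Type*} [Countable ι] {m : ι → E d → ℂ} (hm : ∀ i, IsMult (m i))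
    {c : ℝ≥0∞} (hc : c ≠ ∞) (h : ∀ ξ, ∑' i, ‖m i ξ‖ₑ ^ 2 ≤ c) (f : L2 d) :
    ∑' i, Q (fun _ ↦ 1) (Fm (m i) f) ≤ c * Q (fun _ ↦ 1) f := by
  simp only [Q_Fm (hm _)]
  rw [← Q_one_fourier, ← Q_const_mul _ _ hc]
  unfold Q
  rw [← lintegral_tsum (f := fun i ξ ↦ ‖(𝓕 f : L2 d) ξ‖ₑ ^ 2 * ‖m i ξ‖ₑ ^ 2)
    fun i ↦ ((Lp.aestronglyMeasurable _).enorm.pow_const 2).mul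
    ((hm i).meas.enorm.pow_const 2).aemeasurable]
  refine lintegral_mono fun ξ ↦ ?_
  rw [ENNReal.tsum_mul_left, mul_one]
  exact mul_le_mul_right (h ξ) _

end

section

variable {d : ℕ}

/-- The vector `t • e_i`. -/
abbrev sg (i : Fin d) (t : ℝ) : E d := EuclideanSpace.single i t

theorem continuous_sg (i : Fin d) : Continuous (sg i) := by
  have : sg i = fun t ↦ t • sg i (1 : ℝ) := by
    ext t j; simp [sg]
  rw [this]; fun_prop

theorem measurable_sg (i : Fin d) : Measurable (sg i) := (continuous_sg i).measurable

theorem sg_add (i : Fin d) (s t : ℝ) : sg i (s + t) = sg i s + sg i t := by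
  ext j; simp only [sg, PiLp.add_apply, PiLp.single_apply]; split_ifs <;> simp

theorem sg_neg (i : Fin d) (t : ℝ) : sg i (-t) = -sg i t := by
  ext j; simp only [sg, PiLp.neg_apply, PiLp.single_apply]; split_ifs <;> simp

/-- The character `u ↦ exp (-2πiu)`. -/
def ch (u : ℝ) : ℂ := Complex.exp (-(2 * Real.pi * Complex.I * u))

theorem norm_ch (u : ℝ) : ‖ch u‖ = 1 := by
  have : -(2 * Real.pi * Complex.I * u) = ((-(2 * Real.pi * u) : ℝ) : ℂ) * Complex.I := by
    push_cast; ring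
  rw [ch, this, Complex.norm_exp_ofReal_mul_I]

theorem ch_add (u v : ℝ) : ch (u + v) = ch u * ch v := by
  rw [ch, ch, ch, ← Complex.exp_add]; congr 1; push_cast; ring

theorem ch_zero : ch 0 = 1 := by simp [ch]

@[fun_prop]
theorem continuous_ch : Continuous ch := by unfold ch; fun_prop

/-- The Fourier transform of the measure `κ dμ` on the line. -/
def ft (μ : Measure ℝ) (κ : ℝ → ℂ) (u : ℝ) : ℂ := ∫ t, κ t * ch (t * u) ∂μ

/-- Convolution with `κ dμ` in the direction `e_i`. -/
def cv (μ : Measure ℝ) (κ : ℝ → ℂ) (i : Fin d) (f : E d → ℂ) (x : E d) : ℂ :=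
  ∫ t, κ t * f (x - sg i t) ∂μ

theorem norm_ft_le (μ : Measure ℝ) (κ : ℝ → ℂ) (u : ℝ) : ‖ft μ κ u‖ ≤ ∫ t, ‖κ t‖ ∂μ := by
  refine (norm_integral_le_integral_norm _).trans_eq ?_
  simp [norm_ch]

theorem measurable_ft (μ : Measure ℝ) [SFinite μ] {κ : ℝ → ℂ} (hκ : Measurable κ) :
    Measurable (ft μ κ) := by
  refine (StronglyMeasurable.integral_prod_right (f := fun u t ↦ κ t * ch (t * u)) ?_).measurable
  refine Measurable.stronglyMeasurable ?_
  have : Measurable ch := continuous_ch.measurable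
  fun_prop

theorem isMult_coord {m : ℝ → ℂ} (i : Fin d) (hm : Measurable m) {C : ℝ} (h : ∀ u, ‖m u‖ ≤ C) :
    IsMult (fun ξ : E d ↦ m (ξ i)) :=
  ⟨hm.comp (by fun_prop), C, fun ξ ↦ h _⟩

theorem isMult_ft (μ : Measure ℝ) [SFinite μ] {κ : ℝ → ℂ} (hκ : Measurable κ) (i : Fin d) :
    IsMult (fun ξ : E d ↦ ft μ κ (ξ i)) :=
  isMult_coord i (measurable_ft μ hκ) (norm_ft_le μ κ)

variable {μ : Measure ℝ} {κ : ℝ → ℂ} {i : Fin d}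

theorem enorm_cv_le (f : E d → ℂ) (x : E d) :
    ‖cv μ κ i f x‖ₑ ≤ ∫⁻ t, ‖κ t‖ₑ * ‖f (x - sg i t)‖ₑ ∂μ := by
  refine (enorm_integral_le_lintegral_enorm _).trans_eq ?_
  simp [enorm_mul]

theorem enorm_ft_le (u : ℝ) : ‖ft μ κ u‖ₑ ≤ ∫⁻ t, ‖κ t‖ₑ ∂μ := by
  refine (enorm_integral_le_lintegral_enorm _).trans_eq ?_
  refine lintegral_congr fun t ↦ ?_
  rw [enorm_mul]
  simp [← ofReal_norm, norm_ch]

variable [SFinite μ]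

theorem sq_lintegral_mul_le {α : Type*} [MeasurableSpace α] {ν : Measure α} {a b : α → ℝ≥0∞}
    (ha : Measurable a) (hb : Measurable b) :
    (∫⁻ t, a t * b t ∂ν) ^ 2 ≤ (∫⁻ t, a t ∂ν) * ∫⁻ t, a t * b t ^ 2 ∂ν := by
  have h := ENNReal.lintegral_mul_le_Lp_mul_Lq ν (Real.HolderConjugate.two_two)
    (f := fun t ↦ a t ^ (1 / 2 : ℝ)) (g := fun t ↦ a t ^ (1 / 2 : ℝ) * b t)
    (by fun_prop) (by fun_prop)
  have e1 : ∀ t, ((fun t ↦ a t ^ (1 / 2 : ℝ)) * fun t ↦ a t ^ (1 / 2 : ℝ) * b t) t = a t * b t := by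
    intro t
    simp only [Pi.mul_apply]
    rw [← mul_assoc, ← ENNReal.rpow_add_of_nonneg _ _ (by norm_num) (by norm_num)]
    norm_num
  have e2 : ∀ t, (a t ^ (1 / 2 : ℝ)) ^ (2 : ℝ) = a t := by
    intro t; rw [← ENNReal.rpow_mul]; norm_num
  have e3 : ∀ t, (a t ^ (1 / 2 : ℝ) * b t) ^ (2 : ℝ) = a t * b t ^ 2 := by
    intro t; rw [ENNReal.mul_rpow_of_nonneg _ _ (by norm_num), e2]; norm_num
  simp only [e1, e2, e3] at h
  calc _ ≤ _ := pow_le_pow_left' h 2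
    _ = _ := by
      rw [mul_pow, ← ENNReal.rpow_natCast, ← ENNReal.rpow_natCast, ← ENNReal.rpow_mul,
        ← ENNReal.rpow_mul]
      norm_num

theorem measurable_shift {α : Type*} [MeasurableSpace α] {f : E d → α} (hf : Measurable f)
    (i : Fin d) : Measurable (fun p : E d × ℝ ↦ f (p.1 - sg i p.2)) :=
  hf.comp (measurable_fst.sub ((measurable_sg i).comp measurable_snd))

theorem measurable_shift' {α : Type*} [MeasurableSpace α] {f : E d → α} (hf : Measurable f)
    (i : Fin d) : Measurable (fun p : E d × ℝ ↦ f (p.1 + sg i p.2)) :=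
  hf.comp (measurable_fst.add ((measurable_sg i).comp measurable_snd))

theorem lintegral_shift (F : E d → ℝ≥0∞) (v : E d) : ∫⁻ x, F (x - v) = ∫⁻ x, F x :=
  lintegral_sub_right_eq_self F v

theorem Q_lconv_le {f : E d → ℂ} (hf : Measurable f) (hκ : Measurable κ) {ω : E d → ℝ≥0∞}
    (hω : Measurable ω) :
    ∫⁻ x, (∫⁻ t, ‖κ t‖ₑ * ‖f (x - sg i t)‖ₑ ∂μ) ^ 2 * ω x ≤
      (∫⁻ t, ‖κ t‖ₑ ∂μ) * Q (fun x ↦ ∫⁻ t, ‖κ t‖ₑ * ω (x + sg i t) ∂μ) f := by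
  have m1 : ∀ x : E d, Measurable fun t ↦ ‖f (x - sg i t)‖ₑ := fun x ↦
    (hf.comp (measurable_const.sub (measurable_sg i))).enorm
  calc _ ≤ ∫⁻ x, ((∫⁻ t, ‖κ t‖ₑ ∂μ) * ∫⁻ t, ‖κ t‖ₑ * ‖f (x - sg i t)‖ₑ ^ 2 ∂μ) * ω x :=
        lintegral_mono fun x ↦ mul_le_mul_left (sq_lintegral_mul_le hκ.enorm (m1 x)) _
    _ = (∫⁻ t, ‖κ t‖ₑ ∂μ) *
          ∫⁻ x, ∫⁻ t, ‖κ t‖ₑ * ‖f (x - sg i t)‖ₑ ^ 2 * ω x ∂μ := by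
        rw [← lintegral_const_mul]
        · refine lintegral_congr fun x ↦ ?_
          rw [lintegral_mul_const _ (by have := m1 x; fun_prop), mul_assoc]
        · refine Measurable.lintegral_prod_right
            (f := fun x t ↦ ‖κ t‖ₑ * ‖f (x - sg i t)‖ₑ ^ 2 * ω x) ?_
          have := (measurable_shift hf i).enorm
          exact (((hκ.comp measurable_snd).enorm.mul (this.pow_const 2))).mul
            (hω.comp measurable_fst)
    _ = (∫⁻ t, ‖κ t‖ₑ ∂μ) *
          ∫⁻ t, (∫⁻ x : E d, ‖κ t‖ₑ * ‖f (x - sg i t)‖ₑ ^ 2 * ω x) ∂μ := by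
        rw [lintegral_lintegral_swap]
        have := (measurable_shift hf i).enorm
        exact ((((hκ.comp measurable_snd).enorm.mul (this.pow_const 2))).mul
            (hω.comp measurable_fst)).aemeasurable
    _ = (∫⁻ t, ‖κ t‖ₑ ∂μ) *
          ∫⁻ t, (∫⁻ x : E d, ‖κ t‖ₑ * ‖f x‖ₑ ^ 2 * ω (x + sg i t)) ∂μ := by
        congr 1
        refine lintegral_congr fun t ↦ ?_
        rw [← lintegral_shift (fun x ↦ ‖κ t‖ₑ * ‖f x‖ₑ ^ 2 * ω (x + sg i t)) (sg i t)]
        simp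
    _ = _ := by
        congr 1
        rw [lintegral_lintegral_swap]
        · refine lintegral_congr fun x ↦ ?_
          rw [← lintegral_const_mul]
          · exact lintegral_congr fun t ↦ by ring
          · exact hκ.enorm.mul (hω.comp (measurable_const.add (measurable_sg i)))
        · have := measurable_shift' hω i
          have h2 : Measurable (fun p : ℝ × E d ↦ ω (p.2 + sg i p.1)) := this.comp measurable_swap
          exact (((hκ.comp measurable_fst).enorm.mul
            ((hf.comp measurable_snd).enorm.pow_const 2)).mul h2).aemeasurable

/-- Weighted `L²` bound for a convolution. -/
theorem Q_cv_le {f : E d → ℂ} (hf : Measurable f) (hκ : Measurable κ) {ω : E d → ℝ≥0∞}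
    (hω : Measurable ω) :
    Q ω (cv μ κ i f) ≤
      (∫⁻ t, ‖κ t‖ₑ ∂μ) * Q (fun x ↦ ∫⁻ t, ‖κ t‖ₑ * ω (x + sg i t) ∂μ) f :=
  (lintegral_mono fun x ↦ mul_le_mul_left (pow_le_pow_left' (enorm_cv_le f x) 2) _).trans
    (Q_lconv_le hf hκ hω)

theorem Q_one_lconv_le {f : E d → ℂ} (hf : Measurable f) (hκ : Measurable κ) :
    ∫⁻ x, (∫⁻ t, ‖κ t‖ₑ * ‖f (x - sg i t)‖ₑ ∂μ) ^ 2 ≤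
      (∫⁻ t, ‖κ t‖ₑ ∂μ) ^ 2 * Q (fun _ ↦ 1) f := by
  have := Q_lconv_le (i := i) (μ := μ) hf hκ (ω := fun _ ↦ 1) measurable_const
  simp only [mul_one] at this
  refine this.trans ?_
  unfold Q
  simp only [mul_one]
  rw [lintegral_mul_const _ (by fun_prop)]
  apply le_of_eq; ring

theorem ae_integrable_cv {f : E d → ℂ} (hf : Measurable f) (hf2 : Q (fun _ ↦ 1) f ≠ ∞)
    (hκ : Measurable κ) (hκi : Integrable κ μ) :
    ∀ᵐ x, Integrable (fun t ↦ κ t * f (x - sg i t)) μ := by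
  have h := Q_one_lconv_le (i := i) (μ := μ) hf hκ
  have h2 : (∫⁻ t, ‖κ t‖ₑ ∂μ) ^ 2 * Q (fun _ ↦ 1) f ≠ ∞ :=
    ENNReal.mul_ne_top (ENNReal.pow_ne_top hκi.hasFiniteIntegral.ne) hf2
  have hm : Measurable fun x : E d ↦ (∫⁻ t, ‖κ t‖ₑ * ‖f (x - sg i t)‖ₑ ∂μ) ^ 2 := by
    refine Measurable.pow_const (Measurable.lintegral_prod_right
      (f := fun x t ↦ ‖κ t‖ₑ * ‖f (x - sg i t)‖ₑ) ?_) 2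
    exact (hκ.comp measurable_snd).enorm.mul (measurable_shift hf i).enorm
  filter_upwards [ae_lt_top hm (h.trans_lt h2.lt_top).ne] with x hx
  refine ⟨(hκ.mul (hf.comp (measurable_const.sub (measurable_sg i)))).aestronglyMeasurable, ?_⟩
  simp only [HasFiniteIntegral, enorm_mul]
  by_contra hc
  rw [not_lt, top_le_iff] at hc
  rw [hc] at hx
  simp at hx

theorem cv_congr_ae {f g : E d → ℂ} (hf : Measurable f) (hg : Measurable g)
    (h : f =ᵐ[volume] g) : cv μ κ i f =ᵐ[volume] cv μ κ i g := by
  have hN : MeasurableSet {x | f x ≠ g x} := measurableSet_eq_fun hf hg |>.compl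
  have h0 : ∫⁻ x, ∫⁻ t, ({x | f x ≠ g x}.indicator 1 (x - sg i t) : ℝ≥0∞) ∂μ = 0 := by
    rw [lintegral_lintegral_swap
      (measurable_shift ((measurable_const (a := (1 : ℝ≥0∞))).indicator hN) i).aemeasurable]
    refine (lintegral_congr fun t ↦ lintegral_shift ({x | f x ≠ g x}.indicator 1) (sg i t)).trans ?_
    rw [lintegral_indicator_one hN]
    have : volume {x | f x ≠ g x} = 0 := h
    simp [this]
  have hm : Measurable fun x : E d ↦
      ∫⁻ t, ({x | f x ≠ g x}.indicator 1 (x - sg i t) : ℝ≥0∞) ∂μ :=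
    Measurable.lintegral_prod_right (f := fun x t ↦
      ({x | f x ≠ g x}.indicator 1 (x - sg i t) : ℝ≥0∞))
      (measurable_shift ((measurable_const (a := (1 : ℝ≥0∞))).indicator hN) i)
  rw [lintegral_eq_zero_iff hm] at h0
  filter_upwards [h0] with x hx
  have hm2 : Measurable fun t ↦ ({x | f x ≠ g x}.indicator 1 (x - sg i t) : ℝ≥0∞) :=
    ((measurable_const (a := (1 : ℝ≥0∞))).indicator hN).comp
      (measurable_const.sub (measurable_sg i))
  rw [Pi.zero_apply, lintegral_eq_zero_iff hm2] at hx
  refine integral_congr_ae ?_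
  filter_upwards [hx] with t ht
  have : f (x - sg i t) = g (x - sg i t) := by
    by_contra hne
    have : x - sg i t ∈ {x | f x ≠ g x} := hne
    simp [this] at ht
  rw [this]

theorem inner_sg (i : Fin d) (t : ℝ) (ξ : E d) : inner ℝ (sg i t) ξ = t * ξ i := by
  simp [sg, EuclideanSpace.inner_single_left]

theorem fourierChar_eq_ch (u : ℝ) : (Real.fourierChar u : ℂ) = ch (-u) := by
  rw [Real.fourierChar_apply, ch]; congr 1; push_cast; ring

theorem fourierInv_eq_ch (h : E d → ℂ) (x : E d) :
    𝓕⁻ h x = ∫ ξ, ch (-inner ℝ ξ x) * h ξ := by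
  rw [Real.fourierInv_eq]
  simp only [Circle.smul_def, fourierChar_eq_ch, smul_eq_mul]

/-- Multiplication of `g` by `ft μ κ (ξ i)` corresponds to convolution of `𝓕⁻ g`. -/
theorem fourierInv_ft_mul {g : E d → ℂ} (hg : Integrable g)
    (hκi : Integrable κ μ) (x : E d) :
    𝓕⁻ (fun ξ ↦ ft μ κ (ξ i) * g ξ) x = cv μ κ i (𝓕⁻ g) x := by
  rw [fourierInv_eq_ch, cv]
  simp only [fourierInv_eq_ch, ft]
  have e1 : ∀ ξ : E d, ch (-inner ℝ ξ x) * ((∫ t, κ t * ch (t * ξ i) ∂μ) * g ξ) =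
      ∫ t, κ t * (ch (-inner ℝ ξ (x - sg i t)) * g ξ) ∂μ := by
    intro ξ
    rw [← integral_mul_const, ← integral_const_mul]
    refine integral_congr_ae (.of_forall fun t ↦ ?_)
    have : -inner ℝ ξ (x - sg i t) = -inner ℝ ξ x + t * ξ i := by
      rw [inner_sub_right, real_inner_comm (sg i t), inner_sg]; ring
    simp only [this, ch_add]; ring
  simp only [e1]
  rw [integral_integral_swap]
  · refine integral_congr_ae (.of_forall fun t ↦ ?_)
    simp only [integral_const_mul]
  · have h1 := hg.mul_prod hκi
    have hc : Continuous fun p : E d × ℝ ↦ ch (-inner ℝ p.1 (x - sg i p.2)) := by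
      have := continuous_sg i
      fun_prop
    refine (h1.bdd_mul (c := 1) hc.aestronglyMeasurable
      (.of_forall fun p ↦ (norm_ch _).le)).congr (.of_forall fun p ↦ ?_)
    simp only [Function.uncurry]; ring

theorem Q_add_le {ω : E d → ℝ≥0∞} {f g : E d → ℂ} (hf : AEMeasurable f) (hω : AEMeasurable ω) :
    Q ω (fun x ↦ f x + g x) ≤ 2 * Q ω f + 2 * Q ω g := by
  unfold Q
  rw [← lintegral_const_mul' _ _ (by norm_num), ← lintegral_const_mul' _ _ (by norm_num),
    ← lintegral_add_left' (f := fun x ↦ 2 * (‖f x‖ₑ ^ 2 * ω x))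
      (((hf.enorm.pow_const 2).mul hω).const_mul 2)]
  refine lintegral_mono fun x ↦ ?_
  rw [← mul_assoc, ← mul_assoc, ← add_mul]
  refine mul_le_mul_left ?_ _
  refine (pow_le_pow_left' (enorm_add_le _ _) 2).trans ?_
  have := ENNReal.rpow_add_le_mul_rpow_add_rpow ‖f x‖ₑ ‖g x‖ₑ (p := 2) (by norm_num)
  norm_num at this
  rwa [mul_add] at this

/-- On Schwartz functions the multiplier is given by the integral formula. -/
theorem Fm_toLp_ae {m : E d → ℂ} (hm : IsMult m) (φ : SchwartzMap (E d) ℂ) :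
    Fm m (φ.toLp 2) =ᵐ[volume] 𝓕⁻ (fun ξ ↦ m ξ * 𝓕 (φ : E d → ℂ) ξ) := by
  have hφ : Integrable (𝓕 φ : SchwartzMap (E d) ℂ) := (𝓕 φ : SchwartzMap (E d) ℂ).integrable
  obtain ⟨C, hC⟩ := hm.bdd
  have h1 : Integrable (fun ξ ↦ m ξ * (𝓕 φ : SchwartzMap (E d) ℂ) ξ) :=
    hφ.bdd_mul hm.meas.aestronglyMeasurable (.of_forall hC)
  have h0 := hm.memLp ((𝓕 φ : SchwartzMap (E d) ℂ).toLp 2)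
  have h0' := (𝓕 φ : SchwartzMap (E d) ℂ).coeFn_toLp 2 volume
  have h2 : MemLp (fun ξ ↦ m ξ * (𝓕 φ : SchwartzMap (E d) ℂ) ξ) 2 :=
    (memLp_congr_ae (h0'.mono fun ξ hξ ↦ by simp only [hξ])).1 h0
  have h3 := fourierInv_toLp_ae h1 h2
  have h4 : Fm m (φ.toLp 2) = 𝓕⁻ (h2.toLp _ : L2 d) := by
    rw [Fm, SchwartzMap.toLp_fourier_eq]
    congr 1
    apply Lp.ext
    filter_upwards [coeFn_mulL hm ((𝓕 φ : SchwartzMap (E d) ℂ).toLp 2), h2.coeFn_toLp, h0']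
      with ξ a b c
    rw [a, b, c]
  rw [h4]
  exact h3

theorem Q_one_lt_top (f : L2 d) : Q (fun _ ↦ 1) f < ∞ := by
  rw [Q_one]; exact ENNReal.pow_lt_top enorm_lt_top

theorem Q_one_Fm_le {m : E d → ℂ} (hm : IsMult m) {C : ℝ≥0∞} (hC : ∀ ξ, ‖m ξ‖ₑ ≤ C) (f : L2 d) :
    Q (fun _ ↦ 1) (Fm m f) ≤ C ^ 2 * Q (fun _ ↦ 1) f := by
  rw [Q_Fm hm, ← Q_one_fourier f]
  unfold Q
  rw [← lintegral_const_mul _ (by fun_prop)]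
  refine lintegral_mono fun ξ ↦ ?_
  rw [mul_one, mul_comm]
  exact mul_le_mul_left (pow_le_pow_left' (hC ξ) 2) _

theorem measurable_L2 (f : L2 d) : Measurable f := (Lp.stronglyMeasurable f).measurable

theorem measurable_cv {f : E d → ℂ} (hf : Measurable f) (hκ : Measurable κ) :
    Measurable (cv μ κ i f) := by
  refine (StronglyMeasurable.integral_prod_right (f := fun x t ↦ κ t * f (x - sg i t))
    (Measurable.stronglyMeasurable ?_)).measurable
  exact (hκ.comp measurable_snd).mul (measurable_shift hf i)

/-- A multiplier of the form `ft μ κ (ξ i)` is convolution with `κ dμ`. -/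
theorem Fm_ft_ae (hκ : Measurable κ) (hκi : Integrable κ μ) (f : L2 d) :
    Fm (fun ξ ↦ ft μ κ (ξ i)) f =ᵐ[volume] cv μ κ i f := by
  set m : E d → ℂ := fun ξ ↦ ft μ κ (ξ i) with hmdef
  have hm : IsMult m := isMult_ft μ hκ i
  have hS : ∀ φ : SchwartzMap (E d) ℂ, Fm m (φ.toLp 2) =ᵐ[volume] cv μ κ i (φ.toLp 2) := by
    intro φ
    have h1 := Fm_toLp_ae hm φ
    have h2 : 𝓕⁻ (fun ξ ↦ m ξ * 𝓕 (φ : E d → ℂ) ξ) = cv μ κ i φ := by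
      ext x
      have := fourierInv_ft_mul (i := i) (𝓕 φ : SchwartzMap (E d) ℂ).integrable hκi x
      refine this.trans ?_
      congr 1
      have h3 : (𝓕⁻ (𝓕 φ) : SchwartzMap (E d) ℂ) = φ := FourierTransform.fourierInv_fourier_eq φ
      rw [← SchwartzMap.fourierInv_coe, h3]
    rw [h2] at h1
    exact h1.trans (cv_congr_ae φ.continuous.measurable (measurable_L2 _)
      (φ.coeFn_toLp 2 volume).symm)
  set K := ∫⁻ t, ‖κ t‖ₑ ∂μ with hK
  have hKf : K ≠ ∞ := hκi.hasFiniteIntegral.ne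
  set D := Q (fun _ ↦ 1) (fun x ↦ Fm m f x - cv μ κ i f x) with hD
  have key : ∀ φ : SchwartzMap (E d) ℂ, D ≤ 4 * K ^ 2 * ‖f - φ.toLp 2 volume‖ₑ ^ 2 := by
    intro φ
    set f' : L2 d := φ.toLp 2 volume with hf'
    have e1 : (fun x ↦ Fm m f x - cv μ κ i f x) =ᵐ[volume]
        fun x ↦ Fm m (f - f') x + -cv μ κ i (f - f' : L2 d) x := by
      have h1 := cv_congr_ae (μ := μ) (κ := κ) (i := i) (measurable_L2 (f - f'))
        ((measurable_L2 f).sub (measurable_L2 f')) (Lp.coeFn_sub f f')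
      filter_upwards [Lp.coeFn_sub (Fm m f) (Fm m f'), h1, hS φ,
        ae_integrable_cv (i := i) (measurable_L2 f) (Q_one_lt_top f).ne hκ hκi,
        ae_integrable_cv (i := i) (measurable_L2 f') (Q_one_lt_top f').ne hκ hκi]
        with x a b c i1 i2
      rw [Fm_sub_right hm, a, b, Pi.sub_apply, c]
      have : cv μ κ i (⇑f - ⇑f') x = cv μ κ i f x - cv μ κ i f' x := by
        unfold cv
        rw [← integral_sub i1 i2]
        refine integral_congr_ae (.of_forall fun t ↦ ?_)
        simp only [Pi.sub_apply]; ring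
      rw [this]; ring
    rw [hD, Q_congr e1]
    refine (Q_add_le (measurable_L2 _).aemeasurable measurable_const.aemeasurable).trans ?_
    have h1 := Q_one_Fm_le hm (fun ξ ↦ enorm_ft_le (ξ i)) (f - f')
    have h2 : Q (fun _ ↦ 1) (fun x ↦ -cv μ κ i (f - f' : L2 d) x) ≤
        K ^ 2 * Q (fun _ ↦ 1) (f - f' : L2 d) := by
      refine le_trans ?_ (Q_one_lconv_le (i := i) (measurable_L2 (f - f')) hκ)
      refine lintegral_mono fun x ↦ ?_
      rw [mul_one, enorm_neg]
      exact pow_le_pow_left' (enorm_cv_le _ x) 2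
    rw [← Q_one]
    calc _ ≤ 2 * (K ^ 2 * Q (fun _ ↦ 1) (f - f' : L2 d)) +
          2 * (K ^ 2 * Q (fun _ ↦ 1) (f - f' : L2 d)) := by gcongr
      _ = _ := by ring
  have hD0 : D = 0 := by
    have hdense := SchwartzMap.denseRange_toLpCLM (E := E d) (F := ℂ) (p := 2) (μ := volume)
      ENNReal.ofNat_ne_top
    have hc : Continuous fun g : L2 d ↦ 4 * K ^ 2 * ‖f - g‖ₑ ^ 2 := by
      have h1 : Continuous fun g : L2 d ↦ ‖f - g‖ₑ ^ 2 := by fun_prop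
      exact (ENNReal.continuous_const_mul
        (ENNReal.mul_ne_top (by norm_num) (ENNReal.pow_ne_top hKf))).comp h1
    have := hdense.induction_on (p := fun g ↦ D ≤ 4 * K ^ 2 * ‖f - g‖ₑ ^ 2) f
      (isClosed_le continuous_const hc) key
    simpa using this
  have hmD : Measurable fun x ↦ ‖Fm m f x - cv μ κ i f x‖ₑ ^ 2 * 1 :=
    ((((measurable_L2 _).sub (measurable_cv (measurable_L2 f) hκ)).enorm.pow_const 2)).mul
      measurable_const
  rw [hD, Q, lintegral_eq_zero_iff hmD] at hD0
  filter_upwards [hD0] with x hx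
  simpa [sub_eq_zero] using hx

end

section

variable {d : ℕ}

/-- `m` is the Fourier transform of an integrable kernel supported in `[-Y, Y]`. -/
def LK (Y : ℝ) (m : ℝ → ℂ) : Prop :=
  ∃ κ : ℝ → ℂ, Measurable κ ∧ Integrable κ ∧ (∀ t, Y < |t| → κ t = 0) ∧ ∀ u, m u = ft volume κ u

theorem LK.mono {Y Z : ℝ} {m : ℝ → ℂ} (h : LK Y m) (hYZ : Y ≤ Z) : LK Z m := by
  obtain ⟨κ, h1, h2, h3, h4⟩ := h
  exact ⟨κ, h1, h2, fun t ht ↦ h3 t (hYZ.trans_lt ht), h4⟩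

theorem LK.measurable {Y : ℝ} {m : ℝ → ℂ} (h : LK Y m) : Measurable m := by
  obtain ⟨κ, h1, h2, h3, h4⟩ := h
  rw [funext h4]
  exact measurable_ft volume h1

theorem LK.isMult {Y : ℝ} {m : ℝ → ℂ} (h : LK Y m) (i : Fin d) :
    IsMult (fun ξ : E d ↦ m (ξ i)) := by
  obtain ⟨κ, h1, h2, h3, h4⟩ := h
  rw [funext h4]
  exact isMult_ft volume h1 i

theorem fourier_eq_ft (κ : ℝ → ℂ) (u : ℝ) : 𝓕 κ u = ft volume κ u := by
  rw [Real.fourier_real_eq, ft]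
  refine integral_congr_ae (.of_forall fun t ↦ ?_)
  simp only [Circle.smul_def, fourierChar_eq_ch, neg_neg, smul_eq_mul, mul_comm]

theorem integrable_mul_ch {κ : ℝ → ℂ} (h : Integrable κ) (u : ℝ) :
    Integrable (fun t ↦ κ t * ch (t * u)) := by
  have hc : Continuous fun t ↦ ch (t * u) := by fun_prop
  exact h.mul_bdd (c := 1) hc.aestronglyMeasurable (.of_forall fun t ↦ (norm_ch _).le)

theorem LK.mul {Y Z : ℝ} {m n : ℝ → ℂ} (hm : LK Y m) (hn : LK Z n) :
    LK (Y + Z) (fun u ↦ m u * n u) := by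
  obtain ⟨κ, h1, h2, h3, h4⟩ := hm
  obtain ⟨l, k1, k2, k3, k4⟩ := hn
  have he : convolution κ l (ContinuousLinearMap.mul ℂ ℂ) volume = fun t ↦ ∫ s, κ s * l (t - s) := by
    ext t; simp [convolution]
  refine ⟨fun t ↦ ∫ s, κ s * l (t - s), ?_, ?_, ?_, ?_⟩
  · refine (StronglyMeasurable.integral_prod_right (f := fun t s ↦ κ s * l (t - s)) ?_).measurable
    exact Measurable.stronglyMeasurable (by fun_prop)
  · rw [← he]
    exact h2.integrable_convolution _ k2
  · intro t ht
    beta_reduce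
    rw [integral_eq_zero_of_ae]
    refine .of_forall fun s ↦ ?_
    by_cases hs : Y < |s|
    · simp [h3 s hs]
    · have : Z < |t - s| := by
        have := abs_sub_abs_le_abs_sub t s
        push Not at hs
        linarith
      simp [k3 _ this]
  · intro u
    beta_reduce
    rw [h4, k4, ← fourier_eq_ft, ← fourier_eq_ft, ← he,
      ← fourier_eq_ft]
    exact (Real.fourier_mul_convolution_eq h2 k2 u).symm

theorem LK.add {Y Z : ℝ} {m n : ℝ → ℂ} (hm : LK Y m) (hn : LK Z n) :
    LK (max Y Z) (fun u ↦ m u + n u) := by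
  obtain ⟨κ, h1, h2, h3, h4⟩ := hm
  obtain ⟨l, k1, k2, k3, k4⟩ := hn
  refine ⟨fun t ↦ κ t + l t, h1.add k1, h2.add k2, fun t ht ↦ ?_, fun u ↦ ?_⟩
  · beta_reduce
    rw [h3 t ((le_max_left _ _).trans_lt ht), k3 t ((le_max_right _ _).trans_lt ht), add_zero]
  · simp only [h4, k4, ft, add_mul]
    rw [integral_add (integrable_mul_ch h2 u) (integrable_mul_ch k2 u)]

theorem LK.const_mul {Y : ℝ} {m : ℝ → ℂ} (hm : LK Y m) (c : ℂ) :
    LK Y (fun u ↦ c * m u) := by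
  obtain ⟨κ, h1, h2, h3, h4⟩ := hm
  refine ⟨fun t ↦ c * κ t, h1.const_mul c, h2.const_mul c, fun t ht ↦ ?_, fun u ↦ ?_⟩
  · beta_reduce
    rw [h3 t ht, mul_zero]
  · simp only [h4, ft, mul_assoc, integral_const_mul]

theorem LK.dil {Y : ℝ} {m : ℝ → ℂ} (hm : LK Y m) {c : ℝ} (hc : 0 < c) :
    LK (c * Y) (fun u ↦ m (c * u)) := by
  obtain ⟨κ, h1, h2, h3, h4⟩ := hm
  refine ⟨fun t ↦ (c⁻¹ : ℝ) * κ (c⁻¹ * t), by fun_prop,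
    (h2.comp_mul_left' (inv_ne_zero hc.ne')).const_mul _, fun t ht ↦ ?_, fun u ↦ ?_⟩
  · beta_reduce
    rw [h3, mul_zero]
    rw [abs_mul, abs_of_pos (inv_pos.2 hc), ← div_eq_inv_mul, lt_div_iff₀ hc]
    linarith
  · simp only [h4, ft]
    have := Measure.integral_comp_mul_left (fun t ↦ κ t * ch (t * (c * u))) c⁻¹
    simp only [inv_inv, abs_of_pos hc] at this
    simp only [mul_assoc, integral_const_mul]
    have e : ∀ t : ℝ, ch (c⁻¹ * (t * (c * u))) = ch (t * u) := by
      intro t; congr 1; field_simp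
    simp only [mul_assoc, e] at this
    rw [this, Complex.real_smul, ← mul_assoc]
    push_cast
    rw [inv_mul_cancel₀ (by exact_mod_cast hc.ne'), one_mul]

theorem LK.trans {Y : ℝ} {m : ℝ → ℂ} (hm : LK Y m) (a : ℝ) :
    LK Y (fun u ↦ m (u - a)) := by
  obtain ⟨κ, h1, h2, h3, h4⟩ := hm
  refine ⟨fun t ↦ κ t * ch (t * -a), ?_, integrable_mul_ch h2 _, fun t ht ↦ ?_, fun u ↦ ?_⟩
  · have : Measurable ch := continuous_ch.measurable
    fun_prop
  · beta_reduce
    rw [h3 t ht, zero_mul]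
  · simp only [h4, ft]
    refine integral_congr_ae (.of_forall fun t ↦ ?_)
    simp only [mul_assoc, ← ch_add]
    ring_nf

theorem Fm_local {Y : ℝ} {m : ℝ → ℂ} (hm : LK Y m) (i : Fin d) (f : L2 d) {g : E d → ℂ}
    (hg : Measurable g) (hfg : f =ᵐ[volume] g) {S : Set (E d)}
    (hS : ∀ x ∈ S, ∀ t, |t| ≤ Y → g (x - sg i t) = 0) :
    ∀ᵐ x, x ∈ S → Fm (fun ξ ↦ m (ξ i)) f x = 0 := by
  obtain ⟨κ, h1, h2, h3, h4⟩ := hm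
  rw [funext h4]
  filter_upwards [Fm_ft_ae (i := i) h1 h2 f, cv_congr_ae (μ := volume) (κ := κ) (i := i)
    (measurable_L2 f) hg hfg] with x a b hx
  rw [a, b, cv, integral_eq_zero_of_ae]
  refine .of_forall fun t ↦ ?_
  by_cases ht : |t| ≤ Y
  · simp [hS x hx t ht]
  · simp [h3 t (not_le.1 ht)]

theorem lintegral_layer (a : ℝ≥0∞) :
    ∫⁻ t in Set.Ioi (0 : ℝ), (if ENNReal.ofReal t < a then 1 else 0 : ℝ≥0∞) = a := by
  have : (fun t : ℝ ↦ (if ENNReal.ofReal t < a then 1 else 0 : ℝ≥0∞)) =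
      {t : ℝ | ENNReal.ofReal t < a}.indicator 1 := by
    ext t; simp [Set.indicator_apply]
  have hm : MeasurableSet {t : ℝ | ENNReal.ofReal t < a} :=
    measurableSet_lt ENNReal.measurable_ofReal measurable_const
  rw [this, lintegral_indicator_one hm, Measure.restrict_apply hm]
  induction a with
  | top =>
    have : {t : ℝ | ENNReal.ofReal t < ∞} ∩ Set.Ioi 0 = Set.Ioi 0 := by ext; simp
    rw [this, Real.volume_Ioi]
  | coe a =>
    have : {t : ℝ | ENNReal.ofReal t < a} ∩ Set.Ioi 0 = Set.Ioo 0 (a : ℝ) := by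
      ext t
      simp only [Set.mem_inter_iff, Set.mem_ofPred_eq, Set.mem_Ioi, Set.mem_Ioo]
      constructor
      · rintro ⟨h1, h2⟩
        exact ⟨h2, by rwa [← ENNReal.ofReal_coe_nnreal, ENNReal.ofReal_lt_ofReal_iff_of_nonneg h2.le]
          at h1⟩
      · rintro ⟨h1, h2⟩
        exact ⟨by rwa [← ENNReal.ofReal_coe_nnreal,
          ENNReal.ofReal_lt_ofReal_iff_of_nonneg h1.le], h1⟩
    rw [this, Real.volume_Ioo]; simp

theorem Q_layer {ω : E d → ℝ≥0∞} (hω : Measurable ω) {f : E d → ℂ} (hf : Measurable f) :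
    Q ω f = ∫⁻ t in Set.Ioi (0 : ℝ),
      Q (fun x ↦ if ENNReal.ofReal t < ω x then 1 else 0) f := by
  unfold Q
  rw [lintegral_lintegral_swap]
  · refine lintegral_congr fun x ↦ ?_
    rw [lintegral_const_mul, lintegral_layer]
    exact Measurable.ite (measurableSet_lt ENNReal.measurable_ofReal measurable_const)
      measurable_const measurable_const
  · refine (Measurable.mul (by fun_prop) ?_).aemeasurable
    exact Measurable.ite (measurableSet_lt (ENNReal.measurable_ofReal.comp measurable_fst)
      (hω.comp measurable_snd)) measurable_const measurable_const

/-- Layer cake argument: an unweighted square function bound for local operators gives weighted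
bounds. -/
theorem tsum_Q_local_le {ι : Type*} [Countable ι] (i : Fin d) {m : ι → ℝ → ℂ} {Y : ι → ℝ}
    (hm : ∀ j, LK (Y j) (m j)) {c : ℝ≥0∞} (hc : c ≠ ∞) (h : ∀ u, ∑' j, ‖m j u‖ₑ ^ 2 ≤ c)
    {ω : ι → E d → ℝ≥0∞} {V : E d → ℝ≥0∞} (hω : ∀ j, Measurable (ω j)) (hV : Measurable V)
    (hωV : ∀ j x t, |t| ≤ Y j → ω j x ≤ V (x - sg i t)) (f : L2 d) :
    ∑' j, Q (ω j) (Fm (fun ξ ↦ m j (ξ i)) f) ≤ c * Q V f := by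
  have hmeasQ : ∀ (ω : E d → ℝ≥0∞) (g : L2 d), Measurable ω → Measurable fun t : ℝ ↦
      Q (fun x ↦ if ENNReal.ofReal t < ω x then 1 else 0) g := by
    intro ω g hω
    refine Measurable.lintegral_prod_right (f := fun (t : ℝ) (x : E d) ↦
      ‖g x‖ₑ ^ 2 * (if ENNReal.ofReal t < ω x then 1 else 0)) ?_
    have := measurable_L2 g
    refine (Measurable.mul (by fun_prop) ?_)
    exact Measurable.ite (measurableSet_lt (ENNReal.measurable_ofReal.comp measurable_fst)
      (hω.comp measurable_snd)) measurable_const measurable_const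
  calc _ = ∑' j, ∫⁻ t in Set.Ioi (0 : ℝ),
        Q (fun x ↦ if ENNReal.ofReal t < ω j x then 1 else 0) (Fm (fun ξ ↦ m j (ξ i)) f) := by
        congr 1; ext j; rw [Q_layer (hω j) (measurable_L2 _)]
    _ = ∫⁻ t in Set.Ioi (0 : ℝ), ∑' j,
        Q (fun x ↦ if ENNReal.ofReal t < ω j x then 1 else 0) (Fm (fun ξ ↦ m j (ξ i)) f) := by
        rw [lintegral_tsum]
        exact fun j ↦ (hmeasQ _ _ (hω j)).aemeasurable
    _ ≤ ∫⁻ t in Set.Ioi (0 : ℝ), c * Q (fun x ↦ if ENNReal.ofReal t < V x then 1 else 0) f := by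
        refine lintegral_mono fun t ↦ ?_
        set S : Set (E d) := {x | ENNReal.ofReal t < V x} with hS
        have hSm : MeasurableSet S := measurableSet_lt measurable_const hV
        have hmem := (Lp.memLp f).indicator hSm
        set g : L2 d := hmem.toLp _ with hg
        have hgf : g =ᵐ[volume] S.indicator f := hmem.coeFn_toLp
        have e2 : Q (fun _ ↦ 1) g = Q (fun x ↦ if ENNReal.ofReal t < V x then 1 else 0) f := by
          rw [Q_congr hgf]
          refine lintegral_congr fun x ↦ ?_
          by_cases hx : ENNReal.ofReal t < V x
          · have : x ∈ S := hx
            simp [this, hx]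
          · have : x ∉ S := hx
            simp [this, hx]
        rw [← e2]
        refine le_trans ?_ (tsum_Q_Fm_le (fun j ↦ (hm j).isMult i) hc (fun ξ ↦ h (ξ i)) g)
        refine ENNReal.tsum_le_tsum fun j ↦ ?_
        have hfg : (f - g : L2 d) =ᵐ[volume] Sᶜ.indicator f := by
          filter_upwards [Lp.coeFn_sub f g, hgf] with x a b
          rw [a, Pi.sub_apply, b]
          by_cases hx : x ∈ S <;> simp [hx]
        have hloc := Fm_local (hm j) i (f - g) ((measurable_L2 f).indicator hSm.compl) hfg
          (S := {x | ENNReal.ofReal t < ω j x}) (by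
            intro x hx s hs
            have : x - sg i s ∈ S := lt_of_lt_of_le hx (hωV j x s hs)
            simp [this])
        refine lintegral_mono_ae ?_
        rw [Fm_sub_right ((hm j).isMult i)] at hloc
        filter_upwards [hloc, Lp.coeFn_sub (Fm (fun ξ ↦ m j (ξ i)) f)
          (Fm (fun ξ ↦ m j (ξ i)) g)] with x a b
        by_cases hx : ENNReal.ofReal t < ω j x
        · have := a hx
          rw [b, Pi.sub_apply, sub_eq_zero] at this
          simp [hx, this]
        · simp [hx]
    _ = c * Q V f := by
        rw [lintegral_const_mul' _ _ hc, ← Q_layer hV (measurable_L2 f)]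

end

section

variable {d : ℕ} {i : Fin d}

/-- The averaging kernel at scale `y` as a real function. -/
def kr (y t : ℝ) : ℝ := y / (y + |t|) ^ 2

/-- The averaging kernel at scale `y`. -/
def kap (y t : ℝ) : ℝ≥0∞ := ENNReal.ofReal (kr y t)

@[fun_prop]
theorem measurable_kr {α : Type*} [MeasurableSpace α] {y : ℝ} {f : α → ℝ} (hf : Measurable f) :
    Measurable fun x ↦ kr y (f x) := by
  unfold kr; fun_prop

@[fun_prop]
theorem measurable_kap {α : Type*} [MeasurableSpace α] {y : ℝ} {f : α → ℝ} (hf : Measurable f) :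
    Measurable fun x ↦ kap y (f x) := by
  unfold kap; fun_prop

theorem kr_pos {y : ℝ} (hy : 0 < y) (t : ℝ) : 0 < kr y t := by
  unfold kr; positivity

theorem kap_neg (y t : ℝ) : kap y (-t) = kap y t := by simp [kap, kr]

theorem kr_harnack {y : ℝ} (hy : 0 < y) (t s : ℝ) :
    kr y (t + s) ≤ (1 + |s| / y) ^ 2 * kr y t := by
  unfold kr
  rw [← mul_div_assoc, div_le_div_iff₀ (by positivity) (by positivity)]
  have h1 : y + |t| ≤ (1 + |s| / y) * (y + |t + s|) := by
    have : |t| ≤ |t + s| + |s| := by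
      have := abs_sub (t + s) s; simpa using this
    have e : (1 + |s| / y) * (y + |t + s|) = y + |t + s| + |s| + |s| / y * |t + s| := by
      field_simp; ring
    have : 0 ≤ |s| / y * |t + s| := by positivity
    linarith
  calc y * (y + |t|) ^ 2 ≤ y * ((1 + |s| / y) * (y + |t + s|)) ^ 2 := by gcongr
    _ = _ := by ring

theorem kap_harnack {y : ℝ} (hy : 0 < y) (t s : ℝ) :
    kap y (t + s) ≤ ENNReal.ofReal ((1 + |s| / y) ^ 2) * kap y t := by
  rw [kap, kap, ← ENNReal.ofReal_mul (by positivity)]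
  exact ENNReal.ofReal_le_ofReal (kr_harnack hy t s)

theorem kap_le_dil {y l : ℝ} (hy : 0 < y) (hl : 1 ≤ l) (t : ℝ) :
    kap y t ≤ ENNReal.ofReal l * kap (l * y) t := by
  rw [kap, kap, ← ENNReal.ofReal_mul (by positivity)]
  refine ENNReal.ofReal_le_ofReal ?_
  unfold kr
  have : 0 ≤ |t| := abs_nonneg t
  rw [← mul_div_assoc, div_le_div_iff₀ (by positivity) (by positivity)]
  have h1 : l * y + |t| ≤ l * (y + |t|) := by nlinarith
  calc y * (l * y + |t|) ^ 2 ≤ y * (l * (y + |t|)) ^ 2 := by gcongr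
    _ = _ := by ring

theorem kap_le_dil' {y Y : ℝ} (hy : 0 < y) (hl : y ≤ Y) (t : ℝ) :
    kap y t ≤ ENNReal.ofReal (Y / y) * kap Y t := by
  have := kap_le_dil hy ((one_le_div hy).2 hl) t
  rwa [div_mul_cancel₀ _ hy.ne'] at this

theorem lintegral_kap_le {y : ℝ} (hy : 0 < y) : ∫⁻ t, kap y t ≤ 4 := by
  have h1 : ∀ t, kap y t ≤ ENNReal.ofReal (y⁻¹ * (1 + (y⁻¹ * t) ^ 2)⁻¹) := by
    intro t
    refine ENNReal.ofReal_le_ofReal ?_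
    unfold kr
    have e : y⁻¹ * (1 + (y⁻¹ * t) ^ 2)⁻¹ = y / (y ^ 2 + |t| ^ 2) := by
      rw [sq_abs]; field_simp
    rw [e]
    gcongr
    nlinarith [abs_nonneg t]
  refine (lintegral_mono h1).trans ?_
  have hInt : Integrable fun t : ℝ ↦ y⁻¹ * (1 + (y⁻¹ * t) ^ 2)⁻¹ :=
    (integrable_inv_one_add_sq.comp_mul_left' (inv_ne_zero hy.ne')).const_mul _
  rw [← ofReal_integral_eq_lintegral_ofReal hInt (.of_forall fun t ↦ by positivity),
    integral_const_mul, Measure.integral_comp_mul_left (fun t ↦ (1 + t ^ 2)⁻¹),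
    integral_univ_inv_one_add_sq]
  rw [inv_inv, abs_of_pos hy, smul_eq_mul, ← mul_assoc, inv_mul_cancel₀ hy.ne', one_mul]
  calc ENNReal.ofReal Real.pi ≤ ENNReal.ofReal 4 := ENNReal.ofReal_le_ofReal Real.pi_le_four
    _ = 4 := by simp

theorem kr_mul_kr {y Y : ℝ} (hy : 0 < y) (hY : y ≤ Y) (t s : ℝ) :
    kr y (t - s) * kr Y s ≤ 16 * kr Y t * (kr y (t - s) + kr Y s) := by
  have hY0 : 0 < Y := hy.trans_le hY
  have p1 := kr_pos hy (t - s)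
  have p2 := kr_pos hY0 s
  have p3 := kr_pos hY0 t
  have ht := abs_nonneg t
  have hs := abs_nonneg s
  by_cases h : Y + |t| ≤ 4 * (Y + |s|)
  · have : kr Y s ≤ 16 * kr Y t := by
      unfold kr
      rw [← mul_div_assoc, div_le_div_iff₀ (by positivity) (by positivity)]
      calc Y * (Y + |t|) ^ 2 ≤ Y * (4 * (Y + |s|)) ^ 2 := by gcongr
        _ = _ := by ring
    nlinarith
  · have h3 : |t| ≤ |t - s| + |s| := by
      have := abs_add_le (t - s) s; simpa using this
    have : kr y (t - s) ≤ 16 * kr Y t := by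
      unfold kr
      rw [← mul_div_assoc, div_le_div_iff₀ (by positivity) (by positivity)]
      have h4 : Y + |t| ≤ 4 * (y + |t - s|) := by linarith
      calc y * (Y + |t|) ^ 2 ≤ Y * (4 * (y + |t - s|)) ^ 2 := by gcongr
        _ = _ := by ring
    nlinarith

theorem kap_mul_kap {y Y : ℝ} (hy : 0 < y) (hY : y ≤ Y) (t s : ℝ) :
    kap y (t - s) * kap Y s ≤ 16 * kap Y t * (kap y (t - s) + kap Y s) := by
  have hY0 : 0 < Y := hy.trans_le hY
  have p1 := kr_pos hy (t - s)
  have p2 := kr_pos hY0 s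
  have p3 := kr_pos hY0 t
  have : (16 : ℝ≥0∞) = ENNReal.ofReal 16 := by simp
  rw [kap, kap, kap, this, ← ENNReal.ofReal_mul p1.le, ← ENNReal.ofReal_mul (by norm_num),
    ← ENNReal.ofReal_add p1.le p2.le, ← ENNReal.ofReal_mul (by positivity)]
  exact ENNReal.ofReal_le_ofReal (kr_mul_kr hy hY t s)

@[fun_prop]
theorem measurable_single {α : Type*} [MeasurableSpace α] {f : α → ℝ} (hf : Measurable f) :
    Measurable fun x ↦ (PiLp.single 2 i (f x) : E d) :=
  (measurable_sg i).comp hf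

/-- Average of the weight `W` at scale `y` in the direction `e_i`. -/
def wk (i : Fin d) (y : ℝ) (W : E d → ℝ≥0∞) (x : E d) : ℝ≥0∞ :=
  ∫⁻ t, kap y t * W (x - sg i t)

@[fun_prop]
theorem measurable_wk {y : ℝ} {W : E d → ℝ≥0∞} (hW : Measurable W) :
    Measurable (wk i y W) := by
  refine Measurable.lintegral_prod_right (f := fun (x : E d) (t : ℝ) ↦ kap y t * W (x - sg i t)) ?_
  exact Measurable.mul (by fun_prop) (measurable_shift hW i)

theorem measurable_wk_aux {W : E d → ℝ≥0∞} (hW : Measurable W) (x : E d) :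
    Measurable fun t ↦ W (x - sg i t) :=
  hW.comp (measurable_const.sub (measurable_sg i))

theorem wk_mono {y : ℝ} {W U : E d → ℝ≥0∞} (h : ∀ x, W x ≤ U x) (x : E d) :
    wk i y W x ≤ wk i y U x :=
  lintegral_mono fun _ ↦ mul_le_mul_right (h _) _

theorem wk_const_le {y : ℝ} (hy : 0 < y) (c : ℝ≥0∞) (x : E d) :
    wk i y (fun _ ↦ c) x ≤ 4 * c := by
  unfold wk
  rw [lintegral_mul_const _ (by fun_prop)]
  gcongr
  exact lintegral_kap_le hy

theorem wk_shift (y : ℝ) (W : E d → ℝ≥0∞) (x : E d) (s : ℝ) :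
    wk i y W (x + sg i s) = ∫⁻ t, kap y (t + s) * W (x - sg i t) := by
  rw [wk, ← lintegral_add_right_eq_self _ s]
  refine lintegral_congr fun t ↦ ?_
  congr 2
  rw [sg_add]; abel

theorem wk_harnack {y : ℝ} (hy : 0 < y) {W : E d → ℝ≥0∞} (hW : Measurable W) (x : E d) (s : ℝ) :
    wk i y W (x + sg i s) ≤ ENNReal.ofReal ((1 + |s| / y) ^ 2) * wk i y W x := by
  have := measurable_wk_aux (i := i) hW x
  rw [wk_shift, wk, ← lintegral_const_mul _ (by fun_prop)]
  refine lintegral_mono fun t ↦ ?_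
  rw [← mul_assoc]
  gcongr
  exact kap_harnack hy t s

theorem wk_le_dil {y Y : ℝ} (hy : 0 < y) (hl : y ≤ Y) {W : E d → ℝ≥0∞} (hW : Measurable W)
    (x : E d) : wk i y W x ≤ ENNReal.ofReal (Y / y) * wk i Y W x := by
  have := measurable_wk_aux (i := i) hW x
  rw [wk, wk, ← lintegral_const_mul _ (by fun_prop)]
  refine lintegral_mono fun t ↦ ?_
  rw [← mul_assoc]
  gcongr
  exact kap_le_dil' hy hl t

theorem wk_comp (y Y : ℝ) {W : E d → ℝ≥0∞} (hW : Measurable W) (x : E d) :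
    wk i y (wk i Y W) x = ∫⁻ t, (∫⁻ s, kap y (t - s) * kap Y s) * W (x - sg i t) := by
  have hm : Measurable fun p : ℝ × ℝ ↦ W (x - sg i p.1 - sg i p.2) := by
    have := measurable_sg i
    fun_prop
  have e : wk i y (wk i Y W) x = ∫⁻ s, ∫⁻ t, kap y t * (kap Y s * W (x - sg i t - sg i s)) := by
    have hm2 : Measurable fun p : ℝ × ℝ ↦ kap y p.1 * (kap Y p.2 * W (x - sg i p.1 - sg i p.2)) :=
      Measurable.mul (by fun_prop) (Measurable.mul (by fun_prop) hm)
    rw [← lintegral_lintegral_swap (f := fun t s ↦ kap y t * (kap Y s * W (x - sg i t - sg i s)))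
      hm2.aemeasurable]
    refine lintegral_congr fun t ↦ ?_
    have := measurable_wk_aux (i := i) hW (x - sg i t)
    have h3 : Measurable fun s ↦ kap Y s * W (x - sg i t - sg i s) :=
      Measurable.mul (by fun_prop) this
    rw [lintegral_const_mul _ h3, wk]
  have e2 : ∀ s, ∫⁻ t, kap y t * (kap Y s * W (x - sg i t - sg i s)) =
      ∫⁻ t, kap y (t - s) * kap Y s * W (x - sg i t) := by
    intro s
    rw [← lintegral_sub_right_eq_self _ s]
    refine lintegral_congr fun t ↦ ?_
    rw [← mul_assoc, sub_sub, ← sg_add, sub_add_cancel]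
  rw [e]
  simp only [e2]
  have hm3 : Measurable fun p : ℝ × ℝ ↦ kap y (p.2 - p.1) * kap Y p.1 * W (x - sg i p.2) :=
    Measurable.mul (by fun_prop) ((measurable_wk_aux hW x).comp measurable_snd)
  rw [lintegral_lintegral_swap (f := fun s t ↦ kap y (t - s) * kap Y s * W (x - sg i t))
    hm3.aemeasurable]
  refine lintegral_congr fun t ↦ ?_
  rw [lintegral_mul_const _ (by fun_prop)]

theorem lintegral_kap_conv_le {y Y : ℝ} (hy : 0 < y) (hY : y ≤ Y) (t : ℝ) :
    ∫⁻ s, kap y (t - s) * kap Y s ≤ 128 * kap Y t := by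
  calc _ ≤ ∫⁻ s, 16 * kap Y t * (kap y (t - s) + kap Y s) :=
        lintegral_mono fun s ↦ kap_mul_kap hy hY t s
    _ = 16 * kap Y t * ((∫⁻ s, kap y (t - s)) + ∫⁻ s, kap Y s) := by
        rw [lintegral_const_mul _ (by fun_prop), lintegral_add_left (by fun_prop)]
    _ ≤ 16 * kap Y t * (4 + 4) := by
        rw [lintegral_sub_left_eq_self]
        gcongr
        · exact lintegral_kap_le hy
        · exact lintegral_kap_le (hy.trans_le hY)
    _ = _ := by ring

theorem wk_wk_le {y Y : ℝ} (hy : 0 < y) (hY : 0 < Y) {W : E d → ℝ≥0∞} (hW : Measurable W)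
    (x : E d) : wk i y (wk i Y W) x ≤ 128 * wk i (max y Y) W x := by
  have := measurable_wk_aux (i := i) hW x
  rw [wk_comp y Y hW, wk, ← lintegral_const_mul _ (by fun_prop)]
  refine lintegral_mono fun t ↦ ?_
  rw [← mul_assoc]
  gcongr
  rcases le_total y Y with h | h
  · rw [max_eq_right h]; exact lintegral_kap_conv_le hy h t
  · rw [max_eq_left h]
    refine le_trans (le_of_eq ?_) (lintegral_kap_conv_le hY h t)
    rw [← lintegral_sub_left_eq_self _ t]
    refine lintegral_congr fun s ↦ ?_
    rw [_root_.sub_sub_cancel, mul_comm]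

theorem wk_rpow_le {y θ : ℝ} (hy : 0 < y) (h0 : 0 ≤ θ) (h1 : θ ≤ 1) {W : E d → ℝ≥0∞}
    (hW : Measurable W) (x : E d) :
    wk i y (fun x ↦ W x ^ θ) x ≤ 4 * wk i y W x ^ θ := by
  have := measurable_wk_aux (i := i) hW x
  have hk : ∀ t, kap y t ≠ ∞ := fun t ↦ ENNReal.ofReal_ne_top
  have hk0 : ∀ t, kap y t ≠ 0 := fun t ↦ by
    rw [kap]; simpa using kr_pos hy t
  have e : wk i y (fun x ↦ W x ^ θ) x =
      ∫⁻ t, (kap y t * W (x - sg i t)) ^ θ * kap y t ^ (1 - θ) := by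
    refine lintegral_congr fun t ↦ ?_
    rw [ENNReal.mul_rpow_of_nonneg _ _ h0, mul_right_comm, ← ENNReal.rpow_add _ _ (hk0 t) (hk t)]
    simp
  rw [e]
  refine (ENNReal.lintegral_mul_norm_pow_le (by fun_prop) (by fun_prop) h0
    (sub_nonneg.2 h1) (by ring)).trans ?_
  rw [mul_comm]
  refine mul_le_mul' ?_ le_rfl
  calc (∫⁻ t, kap y t) ^ (1 - θ) ≤ 4 ^ (1 - θ) :=
        ENNReal.rpow_le_rpow (lintegral_kap_le hy) (sub_nonneg.2 h1)
    _ ≤ 4 ^ (1 : ℝ) := ENNReal.rpow_le_rpow_of_exponent_le (by norm_num) (by linarith)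
    _ = 4 := ENNReal.rpow_one _

/-- `m` is the Fourier transform of a kernel with rapid decay at scale `y`. -/
def Sc (c : ℝ≥0∞) (y : ℝ) (m : ℝ → ℂ) : Prop :=
  ∃ κ : ℝ → ℂ, Measurable κ ∧ (∀ t, ‖κ t‖ₑ * ENNReal.ofReal ((1 + |t| / y) ^ 2) ≤ c * kap y t) ∧
    ∀ u, m u = ft volume κ u

theorem lintegral_kernel_le {y : ℝ} (hy : 0 < y) {c : ℝ≥0∞} {κ : ℝ → ℂ}
    (h : ∀ t, ‖κ t‖ₑ * ENNReal.ofReal ((1 + |t| / y) ^ 2) ≤ c * kap y t) (t : ℝ) :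
    ‖κ t‖ₑ ≤ c * kap y t := by
  refine le_trans ?_ (h t)
  refine le_mul_of_one_le_right' ?_
  rw [ENNReal.one_le_ofReal]
  have : 0 ≤ |t| / y := by positivity
  nlinarith

theorem integrable_of_le_kap {y : ℝ} (hy : 0 < y) {c : ℝ≥0∞} (hc : c ≠ ∞) {κ : ℝ → ℂ}
    (hκ : Measurable κ) (h : ∀ t, ‖κ t‖ₑ ≤ c * kap y t) : Integrable κ := by
  refine ⟨hκ.aestronglyMeasurable, ?_⟩
  refine (lintegral_mono h).trans_lt ?_
  rw [lintegral_const_mul _ (by fun_prop)]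
  exact ENNReal.mul_lt_top hc.lt_top ((lintegral_kap_le hy).trans_lt (by norm_num))

theorem Sc.isMult {c : ℝ≥0∞} {y : ℝ} {m : ℝ → ℂ} (h : Sc c y m) (i : Fin d) :
    IsMult (fun ξ : E d ↦ m (ξ i)) := by
  obtain ⟨κ, h1, h2, h3⟩ := h
  rw [funext h3]
  exact isMult_ft volume h1 i

theorem Sc.dil {c : ℝ≥0∞} {m : ℝ → ℂ} (h : Sc c 1 m) {y : ℝ} (hy : 0 < y) :
    Sc c y (fun u ↦ m (y * u)) := by
  obtain ⟨κ, h1, h2, h4⟩ := h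
  refine ⟨fun t ↦ (y⁻¹ : ℝ) * κ (y⁻¹ * t), by fun_prop, fun t ↦ ?_, fun u ↦ ?_⟩
  · have e : kap y t = ‖((y⁻¹ : ℝ) : ℂ)‖ₑ * kap 1 (y⁻¹ * t) := by
      rw [← ofReal_norm, Complex.norm_real, Real.norm_of_nonneg (by positivity), kap, kap,
        ← ENNReal.ofReal_mul (by positivity)]
      congr 1
      unfold kr
      rw [abs_mul, abs_of_pos (inv_pos.2 hy)]
      field_simp
    have := h2 (y⁻¹ * t)
    rw [abs_mul, abs_of_pos (inv_pos.2 hy), div_one, ← div_eq_inv_mul |t|] at this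
    rw [enorm_mul, e]
    calc _ = ‖((y⁻¹ : ℝ) : ℂ)‖ₑ * (‖κ (y⁻¹ * t)‖ₑ * ENNReal.ofReal ((1 + |t| / y) ^ 2)) := by ring
      _ ≤ ‖((y⁻¹ : ℝ) : ℂ)‖ₑ * (c * kap 1 (y⁻¹ * t)) := mul_le_mul_right this _
      _ = _ := by ring
  · simp only [h4, ft]
    have := Measure.integral_comp_mul_left (fun t ↦ κ t * ch (t * (y * u))) y⁻¹
    simp only [inv_inv, abs_of_pos hy] at this
    simp only [mul_assoc, integral_const_mul]
    have e : ∀ t : ℝ, ch (y⁻¹ * (t * (y * u))) = ch (t * u) := by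
      intro t; congr 1; field_simp
    simp only [mul_assoc, e] at this
    rw [this, Complex.real_smul, ← mul_assoc]
    push_cast
    rw [inv_mul_cancel₀ (by exact_mod_cast hy.ne'), one_mul]

theorem rpow_harnack {a : ℝ≥0∞} {b θ : ℝ} (hb : 1 ≤ b) (h1 : θ ≤ 1) (h0 : 0 ≤ θ) :
    (ENNReal.ofReal b * a) ^ θ ≤ ENNReal.ofReal b * a ^ θ := by
  rw [ENNReal.mul_rpow_of_nonneg _ _ h0]
  gcongr
  calc ENNReal.ofReal b ^ θ ≤ ENNReal.ofReal b ^ (1 : ℝ) :=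
        ENNReal.rpow_le_rpow_of_exponent_le (by simpa using hb) h1
    _ = _ := ENNReal.rpow_one _

theorem one_le_harnack {y : ℝ} (hy : 0 < y) (t : ℝ) : 1 ≤ (1 + |t| / y) ^ 2 := by
  have : 0 ≤ |t| / y := by positivity
  nlinarith

/-- Multipliers with kernel localised at a scale below that of the weight. -/
theorem Q_wk_ft_le {μ : Measure ℝ} [SFinite μ] {κ : ℝ → ℂ} (hκ : Measurable κ)
    {c : ℝ≥0∞} (hc : c ≠ ∞) {Y θ : ℝ} (hY : 0 < Y)
    (h : ∫⁻ t, ‖κ t‖ₑ * ENNReal.ofReal ((1 + |t| / Y) ^ 2) ∂μ ≤ c)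
    (h0 : 0 ≤ θ) (h1 : θ ≤ 1) {W : E d → ℝ≥0∞} (hW : Measurable W) (f : L2 d) :
    Q (fun x ↦ wk i Y W x ^ θ) (Fm (fun ξ ↦ ft μ κ (ξ i)) f) ≤
      c ^ 2 * Q (fun x ↦ wk i Y W x ^ θ) f := by
  have hle : ∫⁻ t, ‖κ t‖ₑ ∂μ ≤ c := by
    refine (lintegral_mono fun t ↦ ?_).trans h
    refine le_mul_of_one_le_right' ?_
    rw [ENNReal.one_le_ofReal]
    exact one_le_harnack hY t
  have hi : Integrable κ μ := ⟨hκ.aestronglyMeasurable, hle.trans_lt hc.lt_top⟩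
  rw [Q_congr (Fm_ft_ae hκ hi f)]
  have hm : Measurable fun x ↦ wk i Y W x ^ θ := (measurable_wk hW).pow_const θ
  refine (Q_cv_le (measurable_L2 f) hκ hm).trans ?_
  rw [sq, mul_assoc, ← Q_const_mul _ _ hc]
  gcongr
  refine Q_mono _ fun x ↦ ?_
  calc _ ≤ ∫⁻ t, ‖κ t‖ₑ * ENNReal.ofReal ((1 + |t| / Y) ^ 2) * wk i Y W x ^ θ ∂μ := by
        refine lintegral_mono fun t ↦ ?_
        rw [mul_assoc]
        gcongr
        refine (ENNReal.rpow_le_rpow (wk_harnack hY hW x t) h0).trans ?_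
        exact rpow_harnack (one_le_harnack hY t) h1 h0
    _ ≤ c * wk i Y W x ^ θ := by
        rw [lintegral_mul_const _ (by fun_prop)]
        gcongr

theorem Q_wk_Sc_le {c : ℝ≥0∞} (hc : c ≠ ∞) {y Y θ : ℝ} (hy : 0 < y) (hY : y ≤ Y) {m : ℝ → ℂ}
    (hm : Sc c y m) (h0 : 0 ≤ θ) (h1 : θ ≤ 1) {W : E d → ℝ≥0∞} (hW : Measurable W) (f : L2 d) :
    Q (fun x ↦ wk i Y W x ^ θ) (Fm (fun ξ ↦ m (ξ i)) f) ≤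
      (4 * c) ^ 2 * Q (fun x ↦ wk i Y W x ^ θ) f := by
  obtain ⟨κ, k1, k2, k3⟩ := hm
  simp only [k3]
  refine Q_wk_ft_le k1 (by finiteness) (hy.trans_le hY) ?_ h0 h1 hW f
  calc _ ≤ ∫⁻ t, c * kap y t := by
        refine lintegral_mono fun t ↦ le_trans ?_ (k2 t)
        have : 0 ≤ 1 + |t| / Y := by have := hy.trans_le hY; positivity
        gcongr
    _ ≤ c * 4 := by
        rw [lintegral_const_mul _ (by fun_prop)]
        gcongr
        exact lintegral_kap_le hy
    _ = _ := mul_comm _ _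

/-- Multipliers with kernel at an arbitrary scale, with a weight given by a power. -/
theorem Q_rpow_Sc_le {c : ℝ≥0∞} (hc : c ≠ ∞) {y θ : ℝ} (hy : 0 < y) {m : ℝ → ℂ}
    (hm : Sc c y m) (h0 : 0 ≤ θ) (h1 : θ ≤ 1) {W : E d → ℝ≥0∞} (hW : Measurable W) (f : L2 d) :
    Q (fun x ↦ W x ^ θ) (Fm (fun ξ ↦ m (ξ i)) f) ≤
      (4 * c) ^ 2 * Q (fun x ↦ wk i y W x ^ θ) f := by
  obtain ⟨κ, k1, k2, k3⟩ := hm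
  simp only [k3]
  have k4 := lintegral_kernel_le hy k2
  rw [Q_congr (Fm_ft_ae k1 (integrable_of_le_kap hy hc k1 k4) f)]
  have hm : Measurable fun x ↦ W x ^ θ := hW.pow_const θ
  refine (Q_cv_le (measurable_L2 f) k1 hm).trans ?_
  have h4 : ∫⁻ t, ‖κ t‖ₑ ≤ 4 * c := by
    refine (lintegral_mono k4).trans ?_
    rw [lintegral_const_mul _ (by fun_prop), mul_comm]
    gcongr
    exact lintegral_kap_le hy
  have hc4 : 4 * c ≠ ∞ := by finiteness
  rw [sq, mul_assoc, ← Q_const_mul _ _ hc4]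
  refine mul_le_mul' h4 (Q_mono _ fun x ↦ ?_)
  have e : ∫⁻ t, kap y t * W (x + sg i t) ^ θ = wk i y (fun x ↦ W x ^ θ) x := by
    rw [wk, ← lintegral_neg_eq_self]
    refine lintegral_congr fun t ↦ ?_
    rw [kap_neg, sg_neg, sub_eq_add_neg]
  have hmm : Measurable fun t ↦ W (x + sg i t) := by
    have := measurable_sg i
    fun_prop
  calc _ ≤ ∫⁻ t, c * (kap y t * W (x + sg i t) ^ θ) := by
        refine lintegral_mono fun t ↦ ?_
        rw [← mul_assoc]
        gcongr
        exact k4 t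
    _ = c * wk i y (fun x ↦ W x ^ θ) x := by
        rw [lintegral_const_mul _ (by fun_prop), e]
    _ ≤ c * (4 * wk i y W x ^ θ) := by gcongr; exact wk_rpow_le hy h0 h1 hW x
    _ = _ := by ring

theorem Q_wk_Sc_le' {c : ℝ≥0∞} (hc : c ≠ ∞) {y Y θ : ℝ} (hy : 0 < y) (hY : 0 < Y) {m : ℝ → ℂ}
    (hm : Sc c y m) (h0 : 0 ≤ θ) (h1 : θ ≤ 1) {W : E d → ℝ≥0∞} (hW : Measurable W) (f : L2 d) :
    Q (fun x ↦ wk i Y W x ^ θ) (Fm (fun ξ ↦ m (ξ i)) f) ≤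
      128 * (4 * c) ^ 2 * Q (fun x ↦ wk i (max y Y) W x ^ θ) f := by
  refine (Q_rpow_Sc_le hc hy hm h0 h1 (measurable_wk hW) f).trans ?_
  rw [mul_comm 128, mul_assoc, ← Q_const_mul (c := 128) _ _ (by norm_num)]
  refine mul_le_mul_right (Q_mono _ fun x ↦ ?_) _
  have e : (128 : ℝ≥0∞) = ENNReal.ofReal 128 := by simp
  refine (ENNReal.rpow_le_rpow (wk_wk_le hy hY hW x) h0).trans ?_
  rw [e]
  exact rpow_harnack (by norm_num) h1 h0

end

section

variable {d : ℕ} {i : Fin d}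

theorem rpow_le_mix {x θ : ℝ} (hx : 0 ≤ x) (h0 : 1 / 2 ≤ θ) (h1 : θ ≤ 1) :
    x ^ θ ≤ (2 * θ - 1) * x + (2 - 2 * θ) * Real.sqrt x := by
  have := Real.geom_mean_le_arith_mean2_weighted (w₁ := 2 * θ - 1) (w₂ := 2 - 2 * θ)
    (by linarith) (by linarith) hx (Real.sqrt_nonneg x) (by ring)
  refine le_trans (le_of_eq ?_) this
  rw [Real.sqrt_eq_rpow, ← Real.rpow_mul hx, ← Real.rpow_add_of_nonneg hx (by linarith)
    (by linarith)]
  congr 1; ring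

theorem two_point_even {τ θ : ℝ} (hτ : |τ| ≤ 1) (h0 : 1 / 2 ≤ θ) (h1 : θ ≤ 1) :
    ((1 + τ) ^ θ + (1 - τ) ^ θ) / 2 ≤ 1 - (1 - θ) * τ ^ 2 / 4 := by
  obtain ⟨h2, h3⟩ := abs_le.1 hτ
  have ha := rpow_le_mix (x := 1 + τ) (by linarith) h0 h1
  have hb := rpow_le_mix (x := 1 - τ) (by linarith) h0 h1
  set a := Real.sqrt (1 + τ)
  set b := Real.sqrt (1 - τ)
  have ea : a ^ 2 = 1 + τ := Real.sq_sqrt (by linarith)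
  have eb : b ^ 2 = 1 - τ := Real.sq_sqrt (by linarith)
  have pa : 0 ≤ a := Real.sqrt_nonneg _
  have pb : 0 ≤ b := Real.sqrt_nonneg _
  have hab : a * b ≤ 1 - τ ^ 2 / 2 := by
    refine abs_le_of_sq_le_sq' ?_ (by nlinarith) |>.2
    have : (a * b) ^ 2 = 1 - τ ^ 2 := by rw [mul_pow, ea, eb]; ring
    nlinarith [sq_nonneg (τ ^ 2)]
  have hs : (a + b) / 2 ≤ 1 - τ ^ 2 / 8 := by
    refine abs_le_of_sq_le_sq' ?_ (by nlinarith) |>.2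
    nlinarith [sq_nonneg (τ ^ 2)]
  nlinarith

theorem two_point_odd {τ θ : ℝ} (hτ : |τ| ≤ 1) (h0 : 0 ≤ θ) (h1 : θ ≤ 1) :
    |(1 + τ) ^ θ - (1 - τ) ^ θ| ≤ 2 * |τ| := by
  wlog hp : 0 ≤ τ generalizing τ
  · have := this (τ := -τ) (by rwa [abs_neg]) (by linarith)
    rwa [abs_neg, sub_neg_eq_add, ← sub_eq_add_neg, abs_sub_comm] at this
  rw [abs_of_nonneg hp] at hτ ⊢
  have ha : (1 + τ) ^ θ ≤ 1 + τ := Real.rpow_le_self_of_one_le (by linarith) h1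
  have ha' : 1 ≤ (1 + τ) ^ θ := Real.one_le_rpow (by linarith) h0
  have hb : 1 - τ ≤ (1 - τ) ^ θ := by
    rcases (sub_nonneg.2 hτ).eq_or_lt with h | h
    · rw [← h]; exact Real.rpow_nonneg le_rfl _
    · exact Real.self_le_rpow_of_le_one h.le (by linarith) h1
  have hb' : (1 - τ) ^ θ ≤ 1 := Real.rpow_le_one (by linarith) (by linarith) h0
  rw [abs_of_nonneg (by linarith)]
  linarith

theorem two_point {θ : ℝ} (h0 : 1 / 2 ≤ θ) (h1 : θ < 1) (x₁ x₂ : ℂ) {s₁ s₂ : ℝ}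
    (hs₁ : 0 ≤ s₁) (hs₂ : 0 ≤ s₂) :
    (‖x₁‖ ^ 2 * s₁ ^ θ + ‖x₂‖ ^ 2 * s₂ ^ θ) / 2 ≤
      ((s₁ + s₂) / 2) ^ θ *
        (‖(x₁ + x₂) / 2‖ ^ 2 + 5 / (1 - θ) * ‖(x₁ - x₂) / 2‖ ^ 2) := by
  have hθ : 0 < θ := by linarith
  have he : 0 < 1 - θ := by linarith
  set σ := (s₁ + s₂) / 2 with hσ
  rcases (show 0 ≤ σ by positivity).eq_or_lt with h | h
  · have e1 : s₁ = 0 := by linarith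
    have e2 : s₂ = 0 := by linarith
    rw [e1, e2, Real.zero_rpow hθ.ne', ← h, Real.zero_rpow hθ.ne']
    simp
  set τ := (s₁ - s₂) / (2 * σ) with hτ
  have e1 : s₁ = σ * (1 + τ) := by rw [hτ]; field_simp; rw [hσ]; ring
  have e2 : s₂ = σ * (1 - τ) := by rw [hτ]; field_simp; rw [hσ]; ring
  have hτ1 : |τ| ≤ 1 := by
    rw [hτ, abs_div, abs_of_pos (by positivity : 0 < 2 * σ), div_le_one (by positivity), abs_le]
    constructor <;> linarith
  obtain ⟨g1, g2⟩ := abs_le.1 hτ1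
  rw [e1, e2, Real.mul_rpow h.le (by linarith), Real.mul_rpow h.le (by linarith)]
  have hE := two_point_even hτ1 h0 h1.le
  have hO := two_point_odd hτ1 hθ.le h1.le
  set m := (x₁ + x₂) / 2 with hm
  set D := (x₁ - x₂) / 2 with hD
  have x1 : x₁ = m + D := by rw [hm, hD]; ring
  have x2 : x₂ = m - D := by rw [hm, hD]; ring
  have n1 : ‖x₁‖ ^ 2 = ‖m‖ ^ 2 + 2 * inner ℝ m D + ‖D‖ ^ 2 := by
    rw [x1]; exact norm_add_sq_real m D
  have n2 : ‖x₂‖ ^ 2 = ‖m‖ ^ 2 - 2 * inner ℝ m D + ‖D‖ ^ 2 := by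
    rw [x2]; exact norm_sub_sq_real m D
  have hin := abs_real_inner_le_norm m D
  set r := inner ℝ m D
  set P := (1 + τ) ^ θ
  set N := (1 - τ) ^ θ
  rw [n1, n2]
  have main : ((‖m‖ ^ 2 + ‖D‖ ^ 2) * (P + N) / 2 + r * (P - N)) ≤
      ‖m‖ ^ 2 + 5 / (1 - θ) * ‖D‖ ^ 2 := by
    have a1 : (‖m‖ ^ 2 + ‖D‖ ^ 2) * ((P + N) / 2) ≤
        (‖m‖ ^ 2 + ‖D‖ ^ 2) * (1 - (1 - θ) * τ ^ 2 / 4) := by gcongr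
    have a2 : r * (P - N) ≤ (‖m‖ * ‖D‖) * (2 * |τ|) := by
      refine (le_abs_self _).trans ?_
      rw [abs_mul]; gcongr
    have a3 : (‖m‖ * ‖D‖) * (2 * |τ|) ≤ (1 - θ) * τ ^ 2 / 4 * ‖m‖ ^ 2 + 4 / (1 - θ) * ‖D‖ ^ 2 := by
      rw [← sq_abs τ]
      have : 0 ≤ ((1 - θ) * |τ| * ‖m‖ - 4 * ‖D‖) ^ 2 / (4 * (1 - θ)) := by positivity
      have e : ((1 - θ) * |τ| * ‖m‖ - 4 * ‖D‖) ^ 2 / (4 * (1 - θ)) =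
        (1 - θ) * |τ| ^ 2 / 4 * ‖m‖ ^ 2 + 4 / (1 - θ) * ‖D‖ ^ 2 - (‖m‖ * ‖D‖) * (2 * |τ|) := by
        field_simp; ring
      linarith
    have a4 : 1 * ‖D‖ ^ 2 ≤ 1 / (1 - θ) * ‖D‖ ^ 2 := by
      gcongr; rw [le_div_iff₀ he]; linarith
    have a5 : 0 ≤ (1 - θ) * τ ^ 2 / 4 * ‖D‖ ^ 2 := by positivity
    have e5 : 5 / (1 - θ) * ‖D‖ ^ 2 = 4 / (1 - θ) * ‖D‖ ^ 2 + 1 / (1 - θ) * ‖D‖ ^ 2 := by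
      field_simp; ring
    rw [e5]
    nlinarith
  have : 0 ≤ σ ^ θ := by positivity
  calc _ = σ ^ θ * ((‖m‖ ^ 2 + ‖D‖ ^ 2) * (P + N) / 2 + r * (P - N)) := by ring
    _ ≤ _ := by gcongr

theorem two_point_enn {θ : ℝ} (h0 : 1 / 2 ≤ θ) (h1 : θ < 1) (x₁ x₂ : ℂ) {s₁ s₂ : ℝ≥0∞}
    (hs₁ : s₁ ≠ ∞) (hs₂ : s₂ ≠ ∞) :
    ‖x₁‖ₑ ^ 2 * s₁ ^ θ + ‖x₂‖ₑ ^ 2 * s₂ ^ θ ≤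
      2 * (‖(x₁ + x₂) / 2‖ₑ ^ 2 * ((s₁ + s₂) / 2) ^ θ +
        ENNReal.ofReal (5 / (1 - θ)) * (‖(x₁ - x₂) / 2‖ₑ ^ 2 * ((s₁ + s₂) / 2) ^ θ)) := by
  lift s₁ to NNReal using hs₁
  lift s₂ to NNReal using hs₂
  have he : 0 ≤ 5 / (1 - θ) := div_nonneg (by norm_num) (by linarith)
  have hθ : 0 ≤ θ := by linarith
  have h := two_point h0 h1 x₁ x₂ s₁.coe_nonneg s₂.coe_nonneg
  have e3 : ((s₁ : ℝ≥0∞) + s₂) / 2 = ENNReal.ofReal (((s₁ : ℝ) + s₂) / 2) := by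
    rw [ENNReal.ofReal_div_of_pos (by norm_num), ENNReal.ofReal_add s₁.coe_nonneg s₂.coe_nonneg]
    simp
  rw [e3, ← ENNReal.ofReal_coe_nnreal, ← ENNReal.ofReal_coe_nnreal]
  simp only [← ofReal_norm]
  rw [ENNReal.ofReal_rpow_of_nonneg s₁.coe_nonneg hθ, ENNReal.ofReal_rpow_of_nonneg s₂.coe_nonneg hθ,
    ENNReal.ofReal_rpow_of_nonneg (by positivity) hθ]
  simp only [← ENNReal.ofReal_pow (norm_nonneg _)]
  have e2 : (2 : ℝ≥0∞) = ENNReal.ofReal 2 := by simp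
  rw [e2, ← ENNReal.ofReal_mul (by positivity), ← ENNReal.ofReal_mul (by positivity),
    ← ENNReal.ofReal_mul (by positivity), ← ENNReal.ofReal_mul (by positivity),
    ← ENNReal.ofReal_mul (by positivity), ← ENNReal.ofReal_add (by positivity) (by positivity),
    ← ENNReal.ofReal_add (by positivity) (by positivity), ← ENNReal.ofReal_mul (by positivity)]
  refine ENNReal.ofReal_le_ofReal ?_
  nlinarith

/-- The Fourier transform of the indicator function of the unit interval. -/
def bb (u : ℝ) : ℂ := ft volume ((Set.Ioc (0 : ℝ) 1).indicator 1) u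

theorem bb_eq (u : ℝ) : bb u = ∫ t in (0 : ℝ)..1, ch (t * u) := by
  rw [bb, ft, intervalIntegral.integral_of_le zero_le_one, ← integral_indicator measurableSet_Ioc]
  congr 1; ext t
  by_cases h : t ∈ Set.Ioc (0 : ℝ) 1 <;> simp [h]

theorem hasDerivAt_ch (u t : ℝ) :
    HasDerivAt (fun t : ℝ ↦ ch (t * u)) (-(2 * Real.pi * Complex.I * u) * ch (t * u)) t := by
  have h : HasDerivAt (fun t : ℝ ↦ -(2 * Real.pi * Complex.I * ((t * u : ℝ) : ℂ)))
      (-(2 * Real.pi * Complex.I * u)) t := by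
    have h1 : HasDerivAt (fun t : ℝ ↦ (t : ℂ)) 1 t := Complex.ofRealCLM.hasDerivAt
    have := (h1.mul_const (-(2 * Real.pi * Complex.I * u)))
    rw [one_mul] at this
    refine this.congr_of_eventuallyEq (.of_forall fun t ↦ ?_)
    push_cast; ring
  unfold ch
  convert h.cexp using 1
  ring

theorem bb_mul (u : ℝ) : bb u * (2 * Real.pi * Complex.I * u) = 1 - ch u := by
  have h := intervalIntegral.integral_eq_sub_of_hasDerivAt (a := 0) (b := 1)
    (fun t _ ↦ hasDerivAt_ch u t) (by apply Continuous.intervalIntegrable; fun_prop)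
  rw [intervalIntegral.integral_const_mul, ← bb_eq] at h
  simp only [one_mul, zero_mul, ch_zero] at h
  linear_combination -h

theorem bb_zero : bb 0 = 1 := by
  rw [bb_eq]; simp [ch_zero]

theorem ch_two (u : ℝ) : ch (2 * u) = ch u ^ 2 := by
  rw [two_mul, ch_add, sq]

theorem bb_double (u : ℝ) : bb (2 * u) = (1 + ch u) / 2 * bb u := by
  by_cases h : u = 0
  · simp [h, bb_zero, ch_zero]
  have h2 : (2 * Real.pi * Complex.I * u : ℂ) ≠ 0 := by
    simp [h, Real.pi_ne_zero]
  have e1 := bb_mul u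
  have e2 := bb_mul (2 * u)
  rw [ch_two] at e2
  push_cast at e2
  apply mul_right_cancel₀ h2
  linear_combination e2 / 2 - (1 + ch u) / 2 * e1

theorem norm_bb_le (u : ℝ) : ‖bb u‖ ≤ 1 := by
  rw [bb_eq]
  refine (intervalIntegral.norm_integral_le_of_norm_le_const (C := 1) fun t _ ↦ (norm_ch _).le).trans
    (by simp)

theorem norm_bb_mul_le (u : ℝ) : ‖bb u‖ * |u| ≤ 1 := by
  have h := congrArg norm (bb_mul u)
  have h2 : ‖1 - ch u‖ ≤ 2 := (norm_sub_le _ _).trans (by rw [norm_ch]; norm_num)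
  rw [← h] at h2
  simp only [norm_mul, Complex.norm_real, Complex.norm_I, Real.norm_eq_abs, Complex.norm_ofNat,
    abs_of_pos Real.pi_pos] at h2
  nlinarith [Real.pi_gt_three, norm_nonneg (bb u), abs_nonneg u,
    mul_nonneg (norm_nonneg (bb u)) (abs_nonneg u)]

theorem measurable_bb : Measurable bb :=
  measurable_ft volume ((measurable_const (a := (1 : ℂ))).indicator measurableSet_Ioc)

/-- The difference multiplier. -/
def hh (u : ℝ) : ℂ := (1 - ch u) / 2 * bb u

theorem measurable_ch : Measurable ch := continuous_ch.measurable

theorem measurable_hh : Measurable hh := by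
  have := measurable_bb
  have := measurable_ch
  unfold hh; fun_prop

theorem norm_one_sub_ch (u : ℝ) : ‖(1 - ch u) / 2‖ ≤ 1 := by
  rw [norm_div]
  have h2 : ‖1 - ch u‖ ≤ 2 := (norm_sub_le _ _).trans (by rw [norm_ch]; norm_num)
  simp only [Complex.norm_ofNat]; linarith

theorem norm_hh_le (u : ℝ) : ‖hh u‖ ≤ ‖bb u‖ := by
  rw [hh, norm_mul]
  exact mul_le_of_le_one_left (norm_nonneg _) (norm_one_sub_ch u)

theorem isMult_bb (i : Fin d) (y a : ℝ) : IsMult (fun ξ : E d ↦ bb (y * (ξ i - a))) :=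
  isMult_coord i (m := fun u ↦ bb (y * (u - a))) (by have := measurable_bb; fun_prop)
    fun _ ↦ norm_bb_le _

theorem isMult_hh (i : Fin d) (y a : ℝ) : IsMult (fun ξ : E d ↦ hh (y * (ξ i - a))) :=
  isMult_coord i (m := fun u ↦ hh (y * (u - a))) (by have := measurable_hh; fun_prop)
    fun _ ↦ (norm_hh_le _).trans (norm_bb_le _)

theorem isMult_ch (i : Fin d) (y a : ℝ) : IsMult (fun ξ : E d ↦ ch (y * (ξ i - a))) :=
  isMult_coord i (m := fun u ↦ ch (y * (u - a))) (by have := measurable_ch; fun_prop)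
    fun _ ↦ (norm_ch _).le

theorem Fm_ch_ae (y a : ℝ) (F : L2 d) :
    Fm (fun ξ ↦ ch (y * (ξ i - a))) F =ᵐ[volume] fun x ↦ ch (-(y * a)) * F (x - sg i y) := by
  have h := Fm_ft_ae (μ := Measure.dirac y) (κ := fun _ ↦ ch (-(y * a))) (i := i) measurable_const
    (integrable_const _) F
  have e : (fun ξ : E d ↦ ft (Measure.dirac y) (fun _ ↦ ch (-(y * a))) (ξ i)) =
      fun ξ ↦ ch (y * (ξ i - a)) := by
    ext ξ
    rw [ft, integral_dirac, ← ch_add]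
    congr 1; ring
  rw [e] at h
  filter_upwards [h] with x hx
  rw [hx, cv, integral_dirac]

/-- Averages over intervals of length `y`. -/
def bx (i : Fin d) (y : ℝ) (U : E d → ℝ≥0∞) (x : E d) : ℝ≥0∞ :=
  ENNReal.ofReal y⁻¹ * ∫⁻ t in Set.Ioc 0 y, U (x - sg i t)

@[fun_prop]
theorem measurable_bx {y : ℝ} {U : E d → ℝ≥0∞} (hU : Measurable U) : Measurable (bx i y U) := by
  unfold bx
  refine Measurable.const_mul ?_ _
  exact Measurable.lintegral_prod_right (measurable_shift hU i)

theorem bx_le {y : ℝ} (hy : 0 < y) {U : E d → ℝ≥0∞} {T : ℝ≥0∞} (hU : ∀ x, U x ≤ T) (x : E d) :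
    bx i y U x ≤ T := by
  calc _ ≤ ENNReal.ofReal y⁻¹ * ∫⁻ t in Set.Ioc 0 y, T := by
        unfold bx; gcongr; exact hU _
    _ = T := by
        rw [setLIntegral_const, Real.volume_Ioc, sub_zero, mul_comm T, ← mul_assoc,
          ← ENNReal.ofReal_mul (by positivity), inv_mul_cancel₀ hy.ne']
        simp

theorem bx_double {y : ℝ} (hy : 0 < y) (U : E d → ℝ≥0∞) (x : E d) :
    bx i (2 * y) U x = (bx i y U x + bx i y U (x - sg i y)) / 2 := by
  unfold bx
  have e : Set.Ioc 0 (2 * y) = Set.Ioc 0 y ∪ Set.Ioc y (2 * y) :=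
    (Set.Ioc_union_Ioc_eq_Ioc hy.le (by linarith)).symm
  rw [e, lintegral_union measurableSet_Ioc (Set.Ioc_disjoint_Ioc_of_le le_rfl)]
  have e2 : ∫⁻ t in Set.Ioc y (2 * y), U (x - sg i t) =
      ∫⁻ t in Set.Ioc 0 y, U (x - sg i y - sg i t) := by
    rw [← lintegral_indicator measurableSet_Ioc, ← lintegral_indicator measurableSet_Ioc,
      ← lintegral_add_right_eq_self _ y]
    refine lintegral_congr fun t ↦ ?_
    have : t + y ∈ Set.Ioc y (2 * y) ↔ t ∈ Set.Ioc 0 y := by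
      simp only [Set.mem_Ioc]; constructor <;> rintro ⟨h1, h2⟩ <;> constructor <;> linarith
    by_cases h : t ∈ Set.Ioc 0 y
    · rw [Set.indicator_of_mem h, Set.indicator_of_mem (this.2 h), sg_add]
      congr 1; abel
    · rw [Set.indicator_of_notMem h, Set.indicator_of_notMem (fun h' ↦ h (this.1 h'))]
  rw [e2, mul_inv, ENNReal.ofReal_mul (by positivity), ENNReal.ofReal_inv_of_pos (by norm_num),
    ENNReal.div_eq_inv_mul]
  simp only [ENNReal.ofReal_ofNat]
  ring

theorem Q_bx_step {θ : ℝ} (h0 : 1 / 2 ≤ θ) (h1 : θ < 1) {U : E d → ℝ≥0∞} (hU : Measurable U)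
    {T : ℝ≥0∞} (hT : T ≠ ∞) (hUT : ∀ x, U x ≤ T) {y : ℝ} (hy : 0 < y) (a : ℝ) (F : L2 d) :
    Q (fun x ↦ bx i y U x ^ θ) F ≤
      Q (fun x ↦ bx i (2 * y) U x ^ θ) (Fm (fun ξ ↦ (1 + ch (y * (ξ i - a))) / 2) F) +
      ENNReal.ofReal (5 / (1 - θ)) *
        Q (fun x ↦ bx i (2 * y) U x ^ θ) (Fm (fun ξ ↦ (1 - ch (y * (ξ i - a))) / 2) F) := by
  set G : E d → ℂ := fun x ↦ ch (-(y * a)) * F (x - sg i y) with hG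
  have hF := measurable_L2 F
  have hGm : Measurable G := by rw [hG]; fun_prop
  have hc := isMult_ch i y a
  have hp : Fm (fun ξ ↦ (1 + ch (y * (ξ i - a))) / 2) F =ᵐ[volume] fun x ↦ (F x + G x) / 2 := by
    have e : (fun ξ : E d ↦ (1 + ch (y * (ξ i - a))) / 2) =
        fun ξ ↦ (1 / 2 : ℂ) * ((fun _ ↦ 1) ξ + ch (y * (ξ i - a))) := by ext ξ; ring
    rw [e, Fm_const_mul _ ((IsMult.const 1).add hc), Fm_add (IsMult.const 1) hc, Fm_one]
    filter_upwards [Lp.coeFn_smul (1 / 2 : ℂ) (F + Fm (fun ξ ↦ ch (y * (ξ i - a))) F),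
      Lp.coeFn_add F (Fm (fun ξ ↦ ch (y * (ξ i - a))) F), Fm_ch_ae (i := i) y a F] with x a b c
    rw [a, Pi.smul_apply, b, Pi.add_apply, c, smul_eq_mul]; ring
  have hn : Fm (fun ξ ↦ (1 - ch (y * (ξ i - a))) / 2) F =ᵐ[volume] fun x ↦ (F x - G x) / 2 := by
    have e : (fun ξ : E d ↦ (1 - ch (y * (ξ i - a))) / 2) =
        fun ξ ↦ (1 / 2 : ℂ) * ((fun _ ↦ 1) ξ - ch (y * (ξ i - a))) := by ext ξ; ring
    rw [e, Fm_const_mul _ ((IsMult.const 1).sub hc), Fm_sub (IsMult.const 1) hc, Fm_one]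
    filter_upwards [Lp.coeFn_smul (1 / 2 : ℂ) (F - Fm (fun ξ ↦ ch (y * (ξ i - a))) F),
      Lp.coeFn_sub F (Fm (fun ξ ↦ ch (y * (ξ i - a))) F), Fm_ch_ae (i := i) y a F] with x a b c
    rw [a, Pi.smul_apply, b, Pi.sub_apply, c, smul_eq_mul]; ring
  rw [Q_congr hp, Q_congr hn]
  have hV : Measurable (bx i y U) := measurable_bx hU
  have hV2 : Measurable (bx i (2 * y) U) := measurable_bx hU
  have key : 2 * Q (fun x ↦ bx i y U x ^ θ) F ≤
      2 * (Q (fun x ↦ bx i (2 * y) U x ^ θ) (fun x ↦ (F x + G x) / 2) +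
      ENNReal.ofReal (5 / (1 - θ)) *
        Q (fun x ↦ bx i (2 * y) U x ^ θ) (fun x ↦ (F x - G x) / 2)) := by
    have eG : Q (fun x ↦ bx i y U x ^ θ) F =
        ∫⁻ x, ‖G x‖ₑ ^ 2 * bx i y U (x - sg i y) ^ θ := by
      rw [Q, ← lintegral_shift _ (sg i y)]
      refine lintegral_congr fun x ↦ ?_
      rw [hG, enorm_mul]
      simp [← ofReal_norm, norm_ch]
    rw [two_mul]
    nth_rw 2 [eG]
    unfold Q
    rw [← lintegral_add_left (by fun_prop), ← lintegral_const_mul _ (by fun_prop),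
      ← lintegral_add_left (by fun_prop), ← lintegral_const_mul _ (by fun_prop)]
    refine lintegral_mono fun x ↦ ?_
    beta_reduce
    rw [bx_double hy]
    exact two_point_enn h0 h1 _ _ ((bx_le hy hUT _).trans_lt hT.lt_top).ne
      ((bx_le hy hUT _).trans_lt hT.lt_top).ne
  exact (ENNReal.mul_le_mul_iff_right (by norm_num) (by norm_num)).1 key

/-- Weighted bounds for averages by means of differences of averages. -/
theorem Q_bx_le_tsum {θ : ℝ} (h0 : 1 / 2 ≤ θ) (h1 : θ < 1) {U : E d → ℝ≥0∞} (hU : Measurable U)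
    {T : ℝ≥0∞} (hT : T ≠ ∞) (hUT : ∀ x, U x ≤ T) {y : ℝ} (hy : 0 < y) (a : ℝ) (f : L2 d) :
    Q (fun x ↦ bx i y U x ^ θ) (Fm (fun ξ ↦ bb (y * (ξ i - a))) f) ≤
      ENNReal.ofReal (5 / (1 - θ)) * ∑' n : ℕ,
        Q (fun x ↦ bx i (2 ^ (n + 1) * y) U x ^ θ)
          (Fm (fun ξ ↦ hh (2 ^ n * y * (ξ i - a))) f) := by
  set c := ENNReal.ofReal (5 / (1 - θ))
  have hfin : ∀ N : ℕ, Q (fun x ↦ bx i y U x ^ θ) (Fm (fun ξ ↦ bb (y * (ξ i - a))) f) ≤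
      Q (fun x ↦ bx i (2 ^ N * y) U x ^ θ) (Fm (fun ξ ↦ bb (2 ^ N * y * (ξ i - a))) f) +
      c * ∑ n ∈ Finset.range N, Q (fun x ↦ bx i (2 ^ (n + 1) * y) U x ^ θ)
          (Fm (fun ξ ↦ hh (2 ^ n * y * (ξ i - a))) f) := by
    intro N
    induction N with
    | zero => simp
    | succ N ih =>
      refine ih.trans ?_
      have := Q_bx_step (i := i) h0 h1 hU hT hUT (by positivity : 0 < 2 ^ N * y) a
        (Fm (fun ξ ↦ bb (2 ^ N * y * (ξ i - a))) f)
      have hc := isMult_ch i (2 ^ N * y) a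
      have m1 : IsMult (fun ξ : E d ↦ (1 + ch (2 ^ N * y * (ξ i - a))) / 2) := by
        have := (IsMult.const (1 / 2)).mul ((IsMult.const 1).add hc)
        convert this using 2; ring
      have m2 : IsMult (fun ξ : E d ↦ (1 - ch (2 ^ N * y * (ξ i - a))) / 2) := by
        have := (IsMult.const (1 / 2)).mul ((IsMult.const 1).sub hc)
        convert this using 2; ring
      rw [Fm_Fm m1 (isMult_bb i _ a), Fm_Fm m2 (isMult_bb i _ a)] at this
      simp only [← bb_double] at this
      have e : ∀ u : ℝ, (1 - ch u) / 2 * bb u = hh u := fun u ↦ rfl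
      simp only [e] at this
      have e2 : (2 : ℝ) ^ (N + 1) * y = 2 * (2 ^ N * y) := by ring
      rw [Finset.sum_range_succ, mul_add, e2]
      have e3 : ∀ ξ : E d, 2 * (2 ^ N * y) * (ξ i - a) = 2 * (2 ^ N * y * (ξ i - a)) := fun ξ ↦ by
        ring
      simp only [e3]
      rw [add_left_comm, add_comm _ (c * _)]
      gcongr
  have htail : Filter.Tendsto (fun N : ℕ ↦ Q (fun x ↦ bx i (2 ^ N * y) U x ^ θ)
      (Fm (fun ξ ↦ bb (2 ^ N * y * (ξ i - a))) f)) Filter.atTop (nhds 0) := by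
    have hb : ∀ N : ℕ, Q (fun x ↦ bx i (2 ^ N * y) U x ^ θ)
        (Fm (fun ξ ↦ bb (2 ^ N * y * (ξ i - a))) f) ≤
        T ^ θ * Q (fun ξ ↦ ‖bb (2 ^ N * y * (ξ i - a))‖ₑ ^ 2) (𝓕 f : L2 d) := by
      intro N
      have hTθ : T ^ θ ≠ ∞ := ENNReal.rpow_ne_top_of_nonneg (by linarith) hT
      rw [← Q_Fm (isMult_bb i _ a), ← Q_const_mul _ _ hTθ]
      refine Q_mono _ fun x ↦ ?_
      rw [mul_one]
      exact ENNReal.rpow_le_rpow (bx_le (by positivity) hUT x) (by linarith)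
    refine tendsto_of_tendsto_of_tendsto_of_le_of_le tendsto_const_nhds ?_ (fun _ ↦ bot_le) hb
    rw [show (0 : ℝ≥0∞) = T ^ θ * 0 by simp]
    refine ENNReal.Tendsto.const_mul ?_
      (Or.inr (ENNReal.rpow_ne_top_of_nonneg (by linarith) hT))
    have hF := measurable_L2 (𝓕 f : L2 d)
    have hbm := measurable_bb
    have hz : ∫⁻ x : E d, (0 : ℝ≥0∞) = 0 := by simp
    rw [← hz]
    refine tendsto_lintegral_of_dominated_convergence (fun x ↦ ‖(𝓕 f : L2 d) x‖ₑ ^ 2)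
      (fun N ↦ by fun_prop) (fun N ↦ .of_forall fun x ↦ ?_) ?_ ?_
    · refine mul_le_of_le_one_right' ?_
      refine pow_le_one' ?_ 2
      rw [← ofReal_norm (bb _)]; exact ENNReal.ofReal_le_one.2 (norm_bb_le _)
    · have := (Q_one_lt_top (𝓕 f : L2 d)).ne
      simpa [Q] using this
    · have hnull : ∀ᵐ ξ : E d, ξ i ≠ a := by
        have h2 : ∀ᵐ z : Fin d → ℝ, z i ≠ a := by
          have := Measure.ae_eval_ne (μ := fun _ : Fin d ↦ (volume : Measure ℝ)) i a
          exact this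
        exact (PiLp.volume_preserving_ofLp (Fin d)).quasiMeasurePreserving.ae h2
      filter_upwards [hnull] with ξ hξ
      have hne : 0 < |y * (ξ i - a)| := by
        rw [abs_pos]; exact mul_ne_zero hy.ne' (sub_ne_zero.2 hξ)
      have hlim : Filter.Tendsto (fun N : ℕ ↦ ‖bb (2 ^ N * y * (ξ i - a))‖) Filter.atTop
          (nhds 0) := by
        have hle : ∀ N : ℕ, ‖bb (2 ^ N * y * (ξ i - a))‖ ≤
            |y * (ξ i - a)|⁻¹ * (1 / 2) ^ N := by
          intro N
          have := norm_bb_mul_le (2 ^ N * y * (ξ i - a))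
          rw [mul_assoc, abs_mul, abs_of_pos (by positivity : (0 : ℝ) < 2 ^ N)] at this
          rw [one_div, inv_pow, ← mul_inv, ← one_div, le_div_iff₀ (by positivity)]
          rw [mul_assoc]
          linarith
        refine squeeze_zero (fun _ ↦ norm_nonneg _) hle ?_
        have := (tendsto_pow_atTop_nhds_zero_of_lt_one (r := (1 / 2 : ℝ)) (by norm_num)
          (by norm_num)).const_mul (|y * (ξ i - a)|⁻¹)
        simpa using this
      have h3 : Filter.Tendsto (fun N : ℕ ↦ ‖(𝓕 f : L2 d) ξ‖ₑ ^ 2 *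
          ENNReal.ofReal ‖bb (2 ^ N * y * (ξ i - a))‖ ^ 2) Filter.atTop (nhds
          (‖(𝓕 f : L2 d) ξ‖ₑ ^ 2 * 0)) := by
        refine ENNReal.Tendsto.const_mul ?_ (Or.inr (by finiteness))
        have := ENNReal.Tendsto.pow (n := 2) (ENNReal.tendsto_ofReal hlim)
        simpa using this
      simpa [ofReal_norm] using h3
  have hle2 : ∀ N : ℕ, Q (fun x ↦ bx i y U x ^ θ) (Fm (fun ξ ↦ bb (y * (ξ i - a))) f) ≤
      Q (fun x ↦ bx i (2 ^ N * y) U x ^ θ) (Fm (fun ξ ↦ bb (2 ^ N * y * (ξ i - a))) f) +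
      c * ∑' n : ℕ, Q (fun x ↦ bx i (2 ^ (n + 1) * y) U x ^ θ)
          (Fm (fun ξ ↦ hh (2 ^ n * y * (ξ i - a))) f) := by
    intro N
    refine (hfin N).trans ?_
    gcongr
    exact ENNReal.sum_le_tsum _
  have := ge_of_tendsto' (htail.add_const _) hle2
  simpa using this

end

section

variable {d : ℕ} {i : Fin d}

/-- Two-sided geometric series. -/
def geo (ρ : ℝ) : ℝ≥0∞ := ∑' n : ℤ, ENNReal.ofReal (ρ ^ n.natAbs)

theorem geo_ne_top {ρ : ℝ} (h0 : 0 ≤ ρ) (h1 : ρ < 1) : geo ρ ≠ ∞ := by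
  have hs : Summable fun n : ℤ ↦ ρ ^ n.natAbs := by
    refine Summable.of_nat_of_neg ?_ ?_
    · simpa using summable_geometric_of_lt_one h0 h1
    · simpa using summable_geometric_of_lt_one h0 h1
  rw [geo, ← ENNReal.ofReal_tsum_of_nonneg (fun n ↦ by positivity) hs]
  exact ENNReal.ofReal_ne_top

theorem tsum_geo_shift (ρ : ℝ) (e : ℤ) :
    ∑' n : ℤ, ENNReal.ofReal (ρ ^ (n + e).natAbs) = geo ρ :=
  (Equiv.addRight e).tsum_eq fun n : ℤ ↦ ENNReal.ofReal (ρ ^ n.natAbs)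

/-- `min (|u|, 1 / |u|)`. -/
def mm (u : ℝ) : ℝ := min |u| |u|⁻¹

theorem mm_nonneg (u : ℝ) : 0 ≤ mm u := le_min (abs_nonneg u) (by positivity)

theorem mm_le_one (u : ℝ) : mm u ≤ 1 := by
  rcases le_total |u| 1 with h | h
  · exact (min_le_left _ _).trans h
  · exact (min_le_right _ _).trans (inv_le_one_of_one_le₀ h)

theorem two_zpow_neg_natAbs {j : ℤ} (hj : 0 ≤ j) : ((2 : ℝ) ^ j)⁻¹ = (1 / 2) ^ j.natAbs := by
  lift j to ℕ using hj
  simp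

theorem two_zpow_natAbs {j : ℤ} (hj : j ≤ 0) : (2 : ℝ) ^ j = (1 / 2) ^ j.natAbs := by
  have := two_zpow_neg_natAbs (j := -j) (by omega)
  rw [Int.natAbs_neg, zpow_neg, inv_inv] at this
  exact this

theorem mm_mul_le (j : ℤ) (u : ℝ) : mm (2 ^ j * u) * mm u ≤ (1 / 2) ^ j.natAbs := by
  rcases eq_or_ne u 0 with h | h
  · simp [h, mm]
  have hu : 0 < |u| := abs_pos.2 h
  have h2 : (0 : ℝ) < 2 ^ j := by positivity
  have e : |2 ^ j * u| = 2 ^ j * |u| := by rw [abs_mul, abs_of_pos h2]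
  rcases le_total 0 j with hj | hj
  · rw [← two_zpow_neg_natAbs hj]
    calc mm (2 ^ j * u) * mm u ≤ |2 ^ j * u|⁻¹ * |u| :=
          mul_le_mul (min_le_right _ _) (min_le_left _ _) (mm_nonneg u) (by positivity)
      _ = _ := by rw [e]; field_simp
  · rw [← two_zpow_natAbs hj]
    calc mm (2 ^ j * u) * mm u ≤ |2 ^ j * u| * |u|⁻¹ :=
          mul_le_mul (min_le_left _ _) (min_le_right _ _) (mm_nonneg u) (by positivity)
      _ = _ := by rw [e]; field_simp

theorem exists_mm_le {u : ℝ} (hu : u ≠ 0) :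
    ∃ e : ℤ, ∀ n : ℤ, mm (2 ^ n * u) ≤ 2 * (1 / 2) ^ (n + e).natAbs := by
  obtain ⟨e, he1, he2⟩ := exists_mem_Ico_zpow (abs_pos.2 hu) (one_lt_two (α := ℝ))
  refine ⟨e, fun n ↦ ?_⟩
  have h2 : (0 : ℝ) < 2 ^ n := by positivity
  have e0 : |2 ^ n * u| = 2 ^ n * |u| := by rw [abs_mul, abs_of_pos h2]
  have hp : (0 : ℝ) < 2 ^ (n + e) := by positivity
  rcases le_total 0 (n + e) with hj | hj
  · rw [← two_zpow_neg_natAbs hj]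
    refine (min_le_right _ _).trans ?_
    have : (2 : ℝ) ^ (n + e) ≤ |2 ^ n * u| := by
      rw [e0, zpow_add₀ (by norm_num)]; gcongr
    have := inv_anti₀ hp this
    have h3 : 0 < ((2 : ℝ) ^ (n + e))⁻¹ := by positivity
    linarith
  · rw [← two_zpow_natAbs hj]
    refine (min_le_left _ _).trans ?_
    rw [e0, zpow_add₀ (by norm_num)]
    rw [zpow_add₀ (by norm_num), zpow_one] at he2
    calc (2 : ℝ) ^ n * |u| ≤ 2 ^ n * (2 ^ e * 2) := by gcongr
      _ = _ := by ring

/-- `2^{-1/2}`. -/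
def rho : ℝ := Real.sqrt (1 / 2)

theorem rho_sq : rho ^ 2 = 1 / 2 := Real.sq_sqrt (by norm_num)
theorem rho_pos : 0 < rho := Real.sqrt_pos.2 (by norm_num)
theorem rho_lt_one : rho < 1 := by
  have := rho_sq; have := rho_pos; nlinarith

theorem tsum_mm_mul_le (j : ℤ) (u : ℝ) :
    ∑' n : ℤ, ENNReal.ofReal ((mm (2 ^ (j + n) * u) * mm (2 ^ n * u)) ^ 2) ≤
      ENNReal.ofReal (2 * rho ^ (3 * j.natAbs)) * geo rho := by
  rcases eq_or_ne u 0 with h | h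
  · simp [h, mm]
  obtain ⟨e, he⟩ := exists_mm_le h
  rw [← tsum_geo_shift rho e, ← ENNReal.tsum_mul_left]
  refine ENNReal.tsum_le_tsum fun n ↦ ?_
  have hr := rho_pos
  rw [← ENNReal.ofReal_mul (by positivity)]
  refine ENNReal.ofReal_le_ofReal ?_
  have h1 := mm_mul_le j (2 ^ n * u)
  rw [← mul_assoc, ← zpow_add₀ (by norm_num)] at h1
  set X := mm (2 ^ (j + n) * u) * mm (2 ^ n * u) with hX
  have h0 : 0 ≤ X := mul_nonneg (mm_nonneg _) (mm_nonneg _)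
  have h2 : X ≤ 2 * (1 / 2) ^ (n + e).natAbs :=
    (mul_le_of_le_one_left (mm_nonneg _) (mm_le_one _)).trans (he n)
  refine le_of_sq_le_sq ?_ (by positivity)
  calc (X ^ 2) ^ 2 = X ^ 3 * X := by ring
    _ ≤ ((1 / 2) ^ j.natAbs) ^ 3 * (2 * (1 / 2) ^ (n + e).natAbs) := by gcongr
    _ ≤ ((1 / 2) ^ j.natAbs) ^ 3 * (4 * (1 / 2) ^ (n + e).natAbs) := by gcongr; norm_num
    _ = _ := by rw [← rho_sq]; ring

theorem tsum_mm_sq_le (u : ℝ) :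
    ∑' n : ℤ, ENNReal.ofReal (mm (2 ^ n * u) ^ 2) ≤ 4 * geo (1 / 2) := by
  rcases eq_or_ne u 0 with h | h
  · simp [h, mm]
  obtain ⟨e, he⟩ := exists_mm_le h
  rw [← tsum_geo_shift _ e, ← ENNReal.tsum_mul_left]
  refine ENNReal.tsum_le_tsum fun n ↦ ?_
  rw [show (4 : ℝ≥0∞) = ENNReal.ofReal 4 by simp, ← ENNReal.ofReal_mul (by positivity)]
  refine ENNReal.ofReal_le_ofReal ?_
  have h1 : ((1 : ℝ) / 2) ^ (n + e).natAbs ≤ 1 := pow_le_one₀ (by norm_num) (by norm_num)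
  have h2 : 0 ≤ ((1 : ℝ) / 2) ^ (n + e).natAbs := by positivity
  nlinarith [he n, mm_nonneg (2 ^ n * u)]

theorem norm_bb_le_inv {u : ℝ} : ‖bb u‖ ≤ |u|⁻¹ ∨ u = 0 := by
  by_cases h : u = 0
  · exact Or.inr h
  · left
    rw [← one_div, le_div_iff₀ (abs_pos.2 h)]
    exact norm_bb_mul_le u

theorem norm_one_sub_ch_le (u : ℝ) : ‖(1 - ch u) / 2‖ ≤ 4 * |u| := by
  rw [← bb_mul]
  have hpi := Real.pi_le_four
  simp only [norm_div, norm_mul, Complex.norm_real, Complex.norm_I, Real.norm_eq_abs,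
    Complex.norm_ofNat, abs_of_pos Real.pi_pos]
  have := norm_bb_le u
  have h : ‖bb u‖ * (Real.pi * |u|) ≤ 1 * (4 * |u|) := by gcongr
  linarith

theorem norm_hh_le_mm (u : ℝ) : ‖hh u‖ ≤ 4 * mm u := by
  rcases eq_or_ne u 0 with h | h
  · simp [h, hh, mm, ch_zero]
  rw [mm, mul_min_of_nonneg _ _ (by norm_num)]
  refine le_min ?_ ?_
  · rw [hh, norm_mul]
    calc _ ≤ 4 * |u| * 1 := by
          gcongr
          exacts [norm_one_sub_ch_le u, norm_bb_le u]
      _ = _ := mul_one _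
  · have h1 := norm_hh_le u
    have h2 := (norm_bb_le_inv (u := u)).resolve_right h
    have : 0 ≤ |u|⁻¹ := by positivity
    linarith

theorem lk_bb : LK 1 bb := by
  refine ⟨(Set.Ioc (0 : ℝ) 1).indicator 1, (measurable_const (a := (1 : ℂ))).indicator
    measurableSet_Ioc, ?_, fun t ht ↦ ?_, fun u ↦ rfl⟩
  · exact (integrable_indicator_iff measurableSet_Ioc).2 (integrableOn_const (by simp))
  · refine Set.indicator_of_notMem (fun h ↦ ?_) _
    rw [abs_of_pos h.1] at ht
    exact absurd h.2 (not_le.2 ht)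

theorem lk_hh : LK 2 hh := by
  have h := (lk_bb).add ((lk_bb.dil (c := 2) (by norm_num)).const_mul (-1))
  norm_num at h
  convert h using 2 with u
  rw [bb_double, hh]; ring

/-- Averaging a local multiplier over dilations. -/
theorem lk_average {κ : ℝ → ℂ} (hκ : Measurable κ) (hb : ∀ t, ‖κ t‖ ≤ 1)
    (hs : ∀ t, 1 < |t| → κ t = 0) :
    LK 2 fun u ↦ ∫ r in Set.Ioc (1 : ℝ) 2, ((r⁻¹ : ℝ) : ℂ) * ft volume κ (r * u) := by
  have hcm := measurable_ch
  have hi : ∀ u : ℝ, Integrable (fun p : ℝ × ℝ ↦ ((p.2⁻¹ ^ 2 : ℝ) : ℂ) * κ (p.2⁻¹ * p.1) *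
      ch (p.1 * u)) (volume.prod (volume.restrict (Set.Ioc 1 2))) := by
    intro u
    have hg : Integrable (fun p : ℝ × ℝ ↦ (Set.Icc (-2 : ℝ) 2).indicator (fun _ ↦ (1 : ℝ)) p.1)
        (volume.prod (volume.restrict (Set.Ioc 1 2))) := by
      refine Integrable.comp_fst (f := (Set.Icc (-2 : ℝ) 2).indicator fun _ ↦ (1 : ℝ)) ?_ _
      exact (integrable_indicator_iff measurableSet_Icc).2 (integrableOn_const (by simp))
    refine hg.mono' (by fun_prop) ?_
    have h2 : ∀ᵐ p : ℝ × ℝ ∂(volume.prod (volume.restrict (Set.Ioc 1 2))),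
        p.2 ∈ Set.Ioc (1 : ℝ) 2 :=
      Measure.quasiMeasurePreserving_snd.ae (ae_restrict_mem measurableSet_Ioc)
    filter_upwards [h2] with p hp
    obtain ⟨p1, p2⟩ := hp
    rw [norm_mul, norm_ch, mul_one, norm_mul, Complex.norm_real, Real.norm_of_nonneg (by positivity)]
    have hr : p.2⁻¹ ≤ 1 := inv_le_one_of_one_le₀ p1.le
    have hr0 : 0 < p.2⁻¹ := by positivity
    by_cases h : p.1 ∈ Set.Icc (-2 : ℝ) 2
    · rw [Set.indicator_of_mem h]
      exact mul_le_one₀ (pow_le_one₀ hr0.le hr) (norm_nonneg _) (hb _)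
    · rw [Set.indicator_of_notMem h, hs, norm_zero, mul_zero]
      rw [Set.mem_Icc, ← abs_le, not_le] at h
      rw [abs_mul, abs_of_pos hr0, ← div_eq_inv_mul, lt_div_iff₀ (by linarith)]
      linarith
  have h0 := hi 0
  simp only [mul_zero, ch_zero, mul_one] at h0
  refine ⟨fun t ↦ ∫ r in Set.Ioc (1 : ℝ) 2, ((r⁻¹ ^ 2 : ℝ) : ℂ) * κ (r⁻¹ * t), ?_, ?_, ?_, ?_⟩
  · refine (StronglyMeasurable.integral_prod_right (f := fun (t r : ℝ) ↦
      ((r⁻¹ ^ 2 : ℝ) : ℂ) * κ (r⁻¹ * t)) ?_).measurable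
    exact Measurable.stronglyMeasurable (by fun_prop)
  · exact h0.integral_prod_left
  · intro t ht
    refine setIntegral_eq_zero_of_forall_eq_zero fun r hr ↦ ?_
    rw [hs, mul_zero]
    have hr0 : 0 < r := by linarith [hr.1]
    rw [abs_mul, abs_of_pos (inv_pos.2 hr0), ← div_eq_inv_mul, lt_div_iff₀ hr0]
    linarith [hr.2]
  · intro u
    rw [ft]
    simp only [← integral_mul_const]
    rw [integral_integral_swap (hi u)]
    refine setIntegral_congr_fun measurableSet_Ioc fun r hr ↦ ?_
    have hr0 : 0 < r := by linarith [hr.1]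
    have e : ∀ t : ℝ, ((r⁻¹ ^ 2 : ℝ) : ℂ) * κ (r⁻¹ * t) * ch (t * u) =
        ((r⁻¹ ^ 2 : ℝ) : ℂ) * (fun s ↦ κ s * ch (s * (r * u))) (r⁻¹ * t) := by
      intro t
      have : r⁻¹ * t * (r * u) = t * u := by field_simp
      simp only [this, mul_assoc]
    simp only [e]
    rw [integral_const_mul, Measure.integral_comp_mul_left (fun s ↦ κ s * ch (s * (r * u))), ft,
      inv_inv, abs_of_pos hr0, Complex.real_smul, ← mul_assoc, ← Complex.ofReal_mul]
    congr 2
    field_simp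

/-- The Fejér kernel. -/
def fj (u : ℝ) : ℝ := ‖bb u‖ ^ 2

theorem fj_nonneg (u : ℝ) : 0 ≤ fj u := by unfold fj; positivity

theorem fj_le_one (u : ℝ) : fj u ≤ 1 := pow_le_one₀ (norm_nonneg _) (norm_bb_le u)

theorem fj_le (u : ℝ) (hu : u ≠ 0) : fj u ≤ (u ^ 2)⁻¹ := by
  rw [← sq_abs, ← inv_pow]
  exact pow_le_pow_left₀ (norm_nonneg _) ((norm_bb_le_inv (u := u)).resolve_right hu) 2

theorem bb_neg (u : ℝ) : bb (-u) = (starRingEnd ℂ) (bb u) := by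
  rw [bb, bb, ft, ft, ← integral_conj]
  refine integral_congr_ae (.of_forall fun t ↦ ?_)
  have : ch (t * -u) = (starRingEnd ℂ) (ch (t * u)) := by
    rw [mul_neg, ch, ch, ← Complex.exp_conj]
    congr 1
    simp only [map_neg, map_mul, Complex.conj_I, Complex.conj_ofReal, Complex.ofReal_neg]
    rw [Complex.conj_ofNat]
    ring
  beta_reduce
  rw [this]
  by_cases h : t ∈ Set.Ioc (0 : ℝ) 1 <;> simp [h]

theorem fj_neg (u : ℝ) : fj (-u) = fj u := by
  rw [fj, fj, bb_neg, RCLike.norm_conj]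

@[fun_prop]
theorem measurable_fj : Measurable fj := by
  have := measurable_bb
  unfold fj; fun_prop

theorem bb_odd (u : ℝ) : (bb (-u) - bb u) / 2 = Real.pi * Complex.I * u * fj u := by
  rcases eq_or_ne u 0 with h | h
  · simp [h]
  have e1 := bb_mul u
  have e2 := bb_mul (-u)
  have e3 : ch u * ch (-u) = 1 := by rw [← ch_add, add_neg_cancel, ch_zero]
  have e4 : (fj u : ℂ) = bb (-u) * bb u := by
    rw [fj, bb_neg, ← Complex.normSq_eq_conj_mul_self, Complex.normSq_eq_norm_sq]
  have h2 : (2 * Real.pi * Complex.I * u : ℂ) ≠ 0 := by simp [h, Real.pi_ne_zero]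
  apply mul_right_cancel₀ h2
  rw [e4]
  push_cast at e2
  have e5 : bb (-u) * bb u * (2 * Real.pi * Complex.I * u) * (2 * Real.pi * Complex.I * u)
     = -(2 - ch u - ch (-u)) := by
    calc _ = -((bb u * (2 * Real.pi * Complex.I * u)) *
        (bb (-u) * (2 * Real.pi * Complex.I * -u))) := by ring
      _ = -((1 - ch u) * (1 - ch (-u))) := by rw [e1, e2]
      _ = _ := by linear_combination -e3
  linear_combination -e2 / 2 - e1 / 2 - e5 / 2

theorem integrable_fj : Integrable fj := by
  refine (integrable_inv_one_add_sq.const_mul 2).mono' measurable_fj.aestronglyMeasurable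
    (.of_forall fun x ↦ ?_)
  rw [Real.norm_of_nonneg (fj_nonneg x), ← div_eq_mul_inv, le_div_iff₀ (by positivity)]
  have h1 := fj_le_one x
  have h2 : fj x * x ^ 2 ≤ 1 := by
    rcases eq_or_ne x 0 with h | h
    · simp [h]
    have := mul_le_mul_of_nonneg_right (fj_le x h) (sq_nonneg x)
    rwa [inv_mul_cancel₀ (by positivity)] at this
  linarith

/-- The multiplier of a dyadic piece of the Hilbert transform. -/
def Ph (u : ℝ) : ℝ := ∫ v in u..2 * u, fj v

theorem Ph_neg (u : ℝ) : Ph (-u) = -Ph u := by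
  have := intervalIntegral.integral_comp_neg (f := fj) (a := u) (b := 2 * u)
  simp only [fj_neg] at this
  rw [Ph, Ph, this, mul_neg, intervalIntegral.integral_symm]

theorem abs_Ph_le (u : ℝ) : |Ph u| ≤ mm u := by
  wlog h : 0 ≤ u generalizing u
  · have := this (-u) (by linarith)
    rwa [Ph_neg, abs_neg, mm, abs_neg] at this
  rcases h.eq_or_lt with h | h
  · simp [← h, Ph, mm]
  rw [mm, abs_of_pos h]
  have e : |2 * u - u| = u := by rw [two_mul, add_sub_cancel_right, abs_of_pos h]
  refine le_min ?_ ?_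
  · have := intervalIntegral.norm_integral_le_of_norm_le_const (a := u) (b := 2 * u) (f := fj)
      (C := 1) fun x _ ↦ (by rw [Real.norm_of_nonneg (fj_nonneg x)]; exact fj_le_one x)
    rwa [e, one_mul] at this
  · have := intervalIntegral.norm_integral_le_of_norm_le_const (a := u) (b := 2 * u) (f := fj)
      (C := (u ^ 2)⁻¹) fun x hx ↦ (by
        rw [Set.uIoc_of_le (by linarith)] at hx
        rw [Real.norm_of_nonneg (fj_nonneg x)]
        refine (fj_le x (h.trans hx.1).ne').trans ?_
        exact inv_anti₀ (by positivity) (pow_le_pow_left₀ h.le hx.1.le 2))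
    rw [e] at this
    refine this.trans_eq ?_
    field_simp

theorem lk_Ph : LK 2 fun u ↦ (Ph u : ℂ) := by
  set κ : ℝ → ℂ := fun t ↦ ((Set.Ioc (0 : ℝ) 1).indicator 1 (-t) -
    (Set.Ioc (0 : ℝ) 1).indicator 1 t) / 2 with hκ
  have hind : Measurable ((Set.Ioc (0 : ℝ) 1).indicator (1 : ℝ → ℂ)) :=
    (measurable_const (a := (1 : ℂ))).indicator measurableSet_Ioc
  have hle : ∀ t, ‖(Set.Ioc (0 : ℝ) 1).indicator (1 : ℝ → ℂ) t‖ ≤ 1 := fun t ↦ by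
    by_cases h : t ∈ Set.Ioc (0 : ℝ) 1 <;> simp [h]
  have hInt : Integrable ((Set.Ioc (0 : ℝ) 1).indicator (1 : ℝ → ℂ)) :=
    (integrable_indicator_iff measurableSet_Ioc).2 (integrableOn_const (by simp))
  have hft : ∀ u, ft volume κ u = Real.pi * Complex.I * u * fj u := by
    intro u
    rw [← bb_odd, bb, bb, ft, ft, ft]
    have e1 : ∫ t, (Set.Ioc (0 : ℝ) 1).indicator (1 : ℝ → ℂ) t * ch (t * -u) =
        ∫ t, (Set.Ioc (0 : ℝ) 1).indicator (1 : ℝ → ℂ) (-t) * ch (t * u) := by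
      rw [← integral_neg_eq_self]; simp
    rw [e1, ← integral_sub (integrable_mul_ch hInt.comp_neg u) (integrable_mul_ch hInt u),
      ← integral_div]
    refine integral_congr_ae (.of_forall fun t ↦ ?_)
    simp only [hκ]; ring
  have h := (lk_average (κ := κ) (by fun_prop) (fun t ↦ ?_) (fun t ht ↦ ?_)).const_mul
    (Real.pi * Complex.I)⁻¹
  · convert h using 2 with u
    have e : ∫ r in Set.Ioc (1 : ℝ) 2, ((r⁻¹ : ℝ) : ℂ) * ft volume κ (r * u) =
        ∫ r in Set.Ioc (1 : ℝ) 2, (Real.pi * Complex.I) * ((u * fj (r * u) : ℝ) : ℂ) := by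
      refine setIntegral_congr_fun measurableSet_Ioc fun r hr ↦ ?_
      have hr0 : (r : ℂ) ≠ 0 := by exact_mod_cast (by linarith [hr.1] : r ≠ 0)
      rw [hft]; push_cast; field_simp
    rw [e, integral_const_mul, inv_mul_cancel_left₀ (by simp [Real.pi_ne_zero]),
      integral_complex_ofReal, ← intervalIntegral.integral_of_le one_le_two,
      intervalIntegral.integral_const_mul, Ph]
    congr 1
    have := intervalIntegral.smul_integral_comp_mul_right (a := 1) (b := 2) fj u
    rw [smul_eq_mul] at this
    rw [this, one_mul]
  · simp only [hκ, norm_div, Complex.norm_ofNat]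
    rw [div_le_one (by norm_num)]
    refine (norm_sub_le _ _).trans ?_
    linarith [hle t, hle (-t)]
  · have h1 : t ∉ Set.Ioc (0 : ℝ) 1 := fun h ↦ by
      rw [abs_of_pos h.1] at ht; exact absurd h.2 (not_le.2 ht)
    have h2 : -t ∉ Set.Ioc (0 : ℝ) 1 := fun h ↦ by
      rw [← abs_neg, abs_of_pos h.1] at ht; exact absurd h.2 (not_le.2 ht)
    simp [hκ, h1, h2]

/-- Half the integral of the Fejér kernel. -/
def fc : ℝ := ∫ v in Set.Ioi 0, fj v

theorem fj_pos {u : ℝ} (h0 : 0 < u) (h1 : u < 1) : 0 < fj u := by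
  have : bb u ≠ 0 := fun h ↦ by
    have e := bb_mul u
    rw [h, zero_mul, eq_comm, sub_eq_zero, ch, eq_comm, Complex.exp_eq_one_iff] at e
    obtain ⟨n, hn⟩ := e
    have hne : (2 * Real.pi * Complex.I : ℂ) ≠ 0 := by simp [Real.pi_ne_zero]
    have : (-u : ℂ) = n := by
      apply mul_right_cancel₀ hne
      rw [← hn]; ring
    have : -u = n := by exact_mod_cast this
    have a : (n : ℝ) < 0 := by linarith
    have b : (-1 : ℝ) < n := by linarith
    have a' : n < 0 := by exact_mod_cast a
    have b' : -1 < n := by exact_mod_cast b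
    omega
  unfold fj
  positivity

theorem fc_pos : 0 < fc := by
  rw [fc, setIntegral_pos_iff_support_of_nonneg_ae (.of_forall fj_nonneg)
    integrable_fj.integrableOn]
  have : Set.Ioo (0 : ℝ) 1 ⊆ Function.support fj ∩ Set.Ioi 0 := fun x hx ↦
    ⟨(fj_pos hx.1 hx.2).ne', hx.1⟩
  refine lt_of_lt_of_le ?_ (measure_mono this)
  simp

theorem Ph_sum (J : ℕ) (u : ℝ) : ∑ j ∈ Finset.Ico (-(J : ℤ)) J, Ph (2 ^ j * u) =
    ∫ v in (2 ^ (-(J : ℤ)) * u)..(2 ^ (J : ℤ) * u), fj v := by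
  have hi : ∀ a b : ℝ, IntervalIntegrable fj volume a b := fun a b ↦
    integrable_fj.intervalIntegrable
  induction J with
  | zero => simp
  | succ J ih =>
    have e : Finset.Ico (-((J + 1 : ℕ) : ℤ)) ((J + 1 : ℕ) : ℤ) =
        insert (-(J : ℤ) - 1) (insert (J : ℤ) (Finset.Ico (-(J : ℤ)) J)) := by
      ext n; simp only [Finset.mem_Ico, Finset.mem_insert]; push_cast; omega
    rw [e, Finset.sum_insert (by simp), Finset.sum_insert (by simp), ih, Ph, Ph]
    have e1 : 2 * ((2 : ℝ) ^ (-(J : ℤ) - 1) * u) = 2 ^ (-(J : ℤ)) * u := by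
      rw [zpow_sub₀ (by norm_num)]; ring
    have e2 : 2 * ((2 : ℝ) ^ (J : ℤ) * u) = 2 ^ ((J + 1 : ℕ) : ℤ) * u := by
      push_cast; rw [zpow_add₀ (by norm_num)]; ring
    have e3 : -((J + 1 : ℕ) : ℤ) = -(J : ℤ) - 1 := by push_cast; ring
    rw [e1, e2, e3]
    have a1 := intervalIntegral.integral_add_adjacent_intervals
      (hi (2 ^ (-(J : ℤ) - 1) * u) (2 ^ (-(J : ℤ)) * u)) (hi _ (2 ^ (J : ℤ) * u))
    have a2 := intervalIntegral.integral_add_adjacent_intervals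
      (hi (2 ^ (-(J : ℤ) - 1) * u) (2 ^ (J : ℤ) * u)) (hi _ (2 ^ ((J + 1 : ℕ) : ℤ) * u))
    linarith

theorem abs_Ph_sum_le (J : ℕ) (u : ℝ) : |∑ j ∈ Finset.Ico (-(J : ℤ)) J, Ph (2 ^ j * u)| ≤
    ∫ v, fj v := by
  rw [Ph_sum]
  have := intervalIntegral.norm_integral_le_integral_norm_uIoc (f := fj) (μ := volume)
    (a := 2 ^ (-(J : ℤ)) * u) (b := 2 ^ (J : ℤ) * u)
  refine this.trans ?_
  simp only [Real.norm_of_nonneg (fj_nonneg _)]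
  exact setIntegral_le_integral integrable_fj (.of_forall fj_nonneg)

theorem tendsto_Ph_sum {u : ℝ} (hu : u ≠ 0) :
    Filter.Tendsto (fun J : ℕ ↦ ∑ j ∈ Finset.Ico (-(J : ℤ)) J, Ph (2 ^ j * u)) Filter.atTop
      (nhds (fc * SignType.sign u)) := by
  wlog h : 0 < u generalizing u
  · have := this (neg_ne_zero.2 hu) (by
      rcases lt_or_gt_of_ne hu with h' | h' <;> [linarith; exact absurd h' h])
    have := this.neg
    simpa [Ph_neg, mul_neg, Left.sign_neg] using this
  simp only [Ph_sum]
  have hi : ∀ a b : ℝ, IntervalIntegrable fj volume a b := fun a b ↦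
    integrable_fj.intervalIntegrable
  have e : ∀ J : ℕ, ∫ v in (2 ^ (-(J : ℤ)) * u)..(2 ^ (J : ℤ) * u), fj v =
      (∫ v in (0 : ℝ)..(2 ^ (J : ℤ) * u), fj v) - ∫ v in (0 : ℝ)..(2 ^ (-(J : ℤ)) * u), fj v :=
    fun J ↦ (intervalIntegral.integral_interval_sub_left (hi _ _) (hi _ _)).symm
  simp only [e]
  rw [sign_pos h]
  have l1 : Filter.Tendsto (fun J : ℕ ↦ ∫ v in (0 : ℝ)..(2 ^ (J : ℤ) * u), fj v) Filter.atTop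
      (nhds fc) := by
    refine intervalIntegral_tendsto_integral_Ioi 0 integrable_fj.integrableOn ?_
    simp only [zpow_natCast]
    exact (tendsto_pow_atTop_atTop_of_one_lt (one_lt_two (α := ℝ))).atTop_mul_const h
  have l2 : Filter.Tendsto (fun J : ℕ ↦ ∫ v in (0 : ℝ)..(2 ^ (-(J : ℤ)) * u), fj v) Filter.atTop
      (nhds 0) := by
    have hle : ∀ J : ℕ, |∫ v in (0 : ℝ)..(2 ^ (-(J : ℤ)) * u), fj v| ≤ (1 / 2) ^ J * u := by
      intro J
      have := intervalIntegral.norm_integral_le_of_norm_le_const (a := 0)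
        (b := 2 ^ (-(J : ℤ)) * u) (f := fj)
        (C := 1) fun x _ ↦ (by rw [Real.norm_of_nonneg (fj_nonneg x)]; exact fj_le_one x)
      refine this.trans_eq ?_
      rw [one_mul, sub_zero, abs_of_pos (by positivity)]
      simp
    refine squeeze_zero_norm hle ?_
    have := (tendsto_pow_atTop_nhds_zero_of_lt_one (r := (1 / 2 : ℝ)) (by norm_num)
          (by norm_num)).mul_const u
    simpa using this
  simpa using l1.sub l2

theorem tsum_hh_Ph_le (j : ℤ) (u : ℝ) :
    ∑' n : ℤ, ‖hh (2 ^ n * u) * (Ph (2 ^ (j + n) * u) : ℂ)‖ₑ ^ 2 ≤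
      ENNReal.ofReal (32 * rho ^ (3 * j.natAbs)) * geo rho := by
  have e : ENNReal.ofReal (32 * rho ^ (3 * j.natAbs)) =
      16 * ENNReal.ofReal (2 * rho ^ (3 * j.natAbs)) := by
    rw [show (16 : ℝ≥0∞) = ENNReal.ofReal 16 by simp, ← ENNReal.ofReal_mul (by norm_num)]
    congr 1; ring
  rw [e, mul_assoc]
  refine le_trans ?_ (mul_le_mul_right (tsum_mm_mul_le j u) _)
  rw [← ENNReal.tsum_mul_left]
  refine ENNReal.tsum_le_tsum fun n ↦ ?_
  rw [show (16 : ℝ≥0∞) = ENNReal.ofReal 16 by simp, ← ENNReal.ofReal_mul (by norm_num),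
    ← ofReal_norm, ← ENNReal.ofReal_pow (norm_nonneg _)]
  refine ENNReal.ofReal_le_ofReal ?_
  rw [norm_mul, Complex.norm_real, Real.norm_eq_abs]
  calc _ ≤ (4 * mm (2 ^ n * u) * mm (2 ^ (j + n) * u)) ^ 2 := by
        have := mm_nonneg (2 ^ n * u)
        gcongr
        exacts [norm_hh_le_mm _, abs_Ph_le _]
    _ = _ := by ring

end

section

variable {d : ℕ} {i : Fin d}

theorem contDiff_ch : ContDiff ℝ (⊤ : ℕ∞) ch := by
  have h : ContDiff ℝ (⊤ : ℕ∞) fun u : ℝ ↦ (u : ℂ) := Complex.ofRealCLM.contDiff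
  unfold ch
  fun_prop

theorem contDiff_bb : ContDiff ℝ (⊤ : ℕ∞) bb := by
  have e : bb = 𝓕 ((Set.Ioc (0 : ℝ) 1).indicator (1 : ℝ → ℂ)) := by
    ext u; rw [fourier_eq_ft, bb]
  rw [e]
  refine Real.contDiff_fourier fun n _ ↦ ?_
  have hI : Integrable ((Set.Ioc (0 : ℝ) 1).indicator fun _ ↦ (1 : ℝ)) :=
    (integrable_indicator_iff measurableSet_Ioc).2 (integrableOn_const (by simp))
  have hm : Measurable ((Set.Ioc (0 : ℝ) 1).indicator (1 : ℝ → ℂ)) :=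
    (measurable_const (a := (1 : ℂ))).indicator measurableSet_Ioc
  refine hI.mono' (by fun_prop) (.of_forall fun t ↦ ?_)
  by_cases h : t ∈ Set.Ioc (0 : ℝ) 1
  · simp only [Set.indicator_of_mem h, Pi.one_apply, norm_one, mul_one, norm_pow, norm_norm]
    rw [Real.norm_of_nonneg h.1.le]
    exact pow_le_one₀ h.1.le h.2
  · simp [h]

theorem contDiff_hh : ContDiff ℝ (⊤ : ℕ∞) hh := by
  have := contDiff_bb
  have := contDiff_ch
  unfold hh; fun_prop

theorem bb_ne_zero {u : ℝ} (h : |u| < 1) : bb u ≠ 0 := by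
  rcases eq_or_ne u 0 with h0 | h0
  · simp [h0, bb_zero]
  have : fj |u| ≠ 0 := (fj_pos (abs_pos.2 h0) h).ne'
  have e : fj |u| = fj u := by rcases abs_cases u with h | h <;> simp [h, fj_neg]
  rw [e] at this
  intro hb
  simp [fj, hb] at this

theorem hh_eq (u : ℝ) : hh u = Real.pi * Complex.I * u * bb u ^ 2 := by
  rw [hh, ← bb_mul]; ring

theorem hh_ne_zero {u : ℝ} (h0 : u ≠ 0) (h : |u| < 1) : hh u ≠ 0 := by
  rw [hh_eq]
  simp [h0, Real.pi_ne_zero, bb_ne_zero h]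

/-- Multipliers which are smooth of compact support have good kernels. -/
theorem exists_sc {m : ℝ → ℂ} (hm : ContDiff ℝ (⊤ : ℕ∞) m) (hs : HasCompactSupport m) :
    ∃ c : ℝ≥0∞, c ≠ ∞ ∧ Sc c 1 m := by
  set M : SchwartzMap ℝ ℂ := hs.toSchwartzMap hm with hM
  set κ : SchwartzMap ℝ ℂ := 𝓕⁻ M with hκ
  obtain ⟨C, hC⟩ : ∃ C : ℝ, ∀ t, (1 + |t|) ^ 4 * ‖κ t‖ ≤ C := by
    refine ⟨2 ^ 4 * ((Finset.Iic (4, 0)).sup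
      fun m : ℕ × ℕ ↦ SchwartzMap.seminorm ℝ m.1 m.2) κ, fun t ↦ ?_⟩
    have := SchwartzMap.one_add_le_sup_seminorm_apply (𝕜 := ℝ) (m := (4, 0)) (k := 4) (n := 0)
      le_rfl le_rfl κ t
    rwa [norm_iteratedFDeriv_zero, Real.norm_eq_abs] at this
  refine ⟨ENNReal.ofReal C, ENNReal.ofReal_ne_top, κ, κ.continuous.measurable, fun t ↦ ?_, fun u ↦ ?_⟩
  · have h0 : 0 < 1 + |t| := by positivity
    rw [← ofReal_norm, kap, ← ENNReal.ofReal_mul (norm_nonneg _), div_one, mul_comm (ENNReal.ofReal C),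
      ← ENNReal.ofReal_mul (kr_pos one_pos t).le]
    refine ENNReal.ofReal_le_ofReal ?_
    rw [kr, div_mul_eq_mul_div, one_mul, le_div_iff₀ (by positivity)]
    refine le_trans (le_of_eq ?_) (hC t)
    ring
  · rw [← fourier_eq_ft, ← SchwartzMap.fourier_coe, hκ, FourierTransform.fourier_fourierInv_eq]
    rfl

/-- A smooth function which is `1` on `[-1, 1]` and vanishes outside of `[-2, 2]`. -/
def lam0 (u : ℝ) : ℝ := Real.smoothTransition ((4 - u ^ 2) / 3)

/-- A smooth function which is `1` for `1/2 ≤ |u| ≤ 1` and vanishes unless `1/4 ≤ |u| ≤ 2`. -/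
def lam (u : ℝ) : ℝ := Real.smoothTransition ((16 * u ^ 2 - 1) / 3) * lam0 u

theorem contDiff_lam0 : ContDiff ℝ (⊤ : ℕ∞) fun u ↦ (lam0 u : ℂ) := by
  refine Complex.ofRealCLM.contDiff.comp ?_
  exact Real.smoothTransition.contDiff.comp (by fun_prop)

theorem contDiff_lam : ContDiff ℝ (⊤ : ℕ∞) fun u ↦ (lam u : ℂ) := by
  refine Complex.ofRealCLM.contDiff.comp ?_
  exact (Real.smoothTransition.contDiff.comp (by fun_prop)).mul
    (Real.smoothTransition.contDiff.comp (by fun_prop))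

theorem lam0_eq_one {u : ℝ} (h : |u| ≤ 1) : lam0 u = 1 := by
  refine Real.smoothTransition.one_of_one_le ?_
  have : u ^ 2 ≤ 1 := (sq_le_one_iff_abs_le_one u).2 h
  linarith

theorem lam0_eq_zero {u : ℝ} (h : 2 < |u|) : lam0 u = 0 := by
  refine Real.smoothTransition.zero_of_nonpos ?_
  have : 2 ^ 2 < |u| ^ 2 := by gcongr
  rw [sq_abs] at this
  linarith

theorem lam_eq_one {u : ℝ} (h' : 1 / 2 ≤ |u|) (h : |u| ≤ 1) : lam u = 1 := by
  rw [lam, lam0_eq_one h, mul_one]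
  refine Real.smoothTransition.one_of_one_le ?_
  have : (1 / 2) ^ 2 ≤ |u| ^ 2 := by gcongr
  rw [sq_abs] at this
  linarith

theorem lam_eq_zero {u : ℝ} (h : 2 < |u|) : lam u = 0 := by
  rw [lam, lam0_eq_zero h, mul_zero]

theorem lam_eq_zero' {u : ℝ} (h : |u| < 1 / 4) : lam u = 0 := by
  rw [lam, Real.smoothTransition.zero_of_nonpos, zero_mul]
  have : |u| ^ 2 < (1 / 4) ^ 2 := by gcongr
  rw [sq_abs] at this
  linarith

theorem exists_sc_div {l g : ℝ → ℂ} (hl : ContDiff ℝ (⊤ : ℕ∞) l) (hg : ContDiff ℝ (⊤ : ℕ∞) g)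
    {S : Set ℝ} (hS : IsCompact S) (hlS : ∀ u, u ∉ S → l u = 0) (hgS : ∀ u ∈ S, g u ≠ 0) :
    ∃ c : ℝ≥0∞, c ≠ ∞ ∧ Sc c 1 (fun u ↦ l u / g u) := by
  have hz : ∀ u, u ∉ S → l u / g u = 0 := fun u hu ↦ by rw [hlS u hu, zero_div]
  refine exists_sc (contDiff_iff_contDiffAt.2 fun u ↦ ?_) (HasCompactSupport.intro hS hz)
  by_cases hu : u ∈ S
  · simp only [div_eq_mul_inv]
    exact hl.contDiffAt.mul (hg.contDiffAt.inv (hgS u hu))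
  · refine (contDiffAt_const (c := (0 : ℂ))).congr_of_eventuallyEq ?_
    filter_upwards [hS.isClosed.isOpen_compl.mem_nhds hu] with v hv
    exact hz v hv

theorem exists_sc_lam {g : ℝ → ℂ} (hg : ContDiff ℝ (⊤ : ℕ∞) g)
    (h : ∀ u : ℝ, 1 / 4 ≤ |u| → |u| ≤ 2 → g u ≠ 0) :
    ∃ c : ℝ≥0∞, c ≠ ∞ ∧ Sc c 1 (fun u ↦ (lam u : ℂ) / g u) := by
  refine exists_sc_div (S := {u | 1 / 4 ≤ |u|} ∩ Set.Icc (-2) 2) contDiff_lam hg ?_ ?_ ?_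
  · exact isCompact_Icc.inter_left (isClosed_le continuous_const continuous_abs)
  · intro u hu
    simp only [Set.mem_inter_iff, Set.mem_ofPred_eq, not_and_or, Set.mem_Icc, ← abs_le,
      not_le] at hu
    rcases hu with hu | hu
    · rw [lam_eq_zero' hu, Complex.ofReal_zero]
    · rw [lam_eq_zero hu, Complex.ofReal_zero]
  · rintro u ⟨h1, h2⟩
    exact h u h1 (abs_le.2 h2)

theorem bx_le_wk {y : ℝ} (hy : 0 < y) (U : E d → ℝ≥0∞) (x : E d) :
    bx i y U x ≤ 4 * wk i y U x := by
  have e : (4 : ℝ≥0∞) = ENNReal.ofReal 4 := by simp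
  rw [bx, wk, ← lintegral_const_mul' _ _ ENNReal.ofReal_ne_top,
    ← lintegral_const_mul' _ _ (by norm_num)]
  refine le_trans ?_ (setLIntegral_le_lintegral (Set.Ioc 0 y) _)
  refine setLIntegral_mono' measurableSet_Ioc fun t ht ↦ ?_
  rw [← mul_assoc]
  refine mul_le_mul_left ?_ _
  rw [kap, e, ← ENNReal.ofReal_mul (by norm_num)]
  refine ENNReal.ofReal_le_ofReal ?_
  rw [kr, abs_of_pos ht.1, inv_eq_one_div, ← mul_div_assoc, div_le_div_iff₀ hy (by nlinarith [ht.1])]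
  nlinarith [ht.1, ht.2]

theorem wk_le_bx {y Y : ℝ} (hy : 0 < y) (hY : y ≤ Y) {W : E d → ℝ≥0∞} (hW : Measurable W)
    (x : E d) : wk i Y W x ≤ 4 * bx i y (wk i Y W) x := by
  have hY0 : 0 < Y := hy.trans_le hY
  have h1 : ∫⁻ _ in Set.Ioc (0 : ℝ) y, wk i Y W x ≤
      ∫⁻ t in Set.Ioc (0 : ℝ) y, 4 * wk i Y W (x - sg i t) := by
    refine setLIntegral_mono' measurableSet_Ioc fun t ht ↦ ?_
    have := wk_harnack (i := i) hY0 hW (x - sg i t) t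
    rw [sub_add_cancel] at this
    refine this.trans (mul_le_mul_left ?_ _)
    rw [show (4 : ℝ≥0∞) = ENNReal.ofReal 4 by simp]
    refine ENNReal.ofReal_le_ofReal ?_
    have h2 : |t| / Y ≤ 1 := by
      rw [abs_of_pos ht.1, div_le_one hY0]; exact ht.2.trans hY
    have h3 : 0 ≤ |t| / Y := by positivity
    nlinarith
  rw [setLIntegral_const, Real.volume_Ioc, sub_zero, lintegral_const_mul' _ _ (by norm_num)] at h1
  calc wk i Y W x = ENNReal.ofReal y⁻¹ * (wk i Y W x * ENNReal.ofReal y) := by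
        rw [mul_left_comm, ← ENNReal.ofReal_mul (by positivity), inv_mul_cancel₀ hy.ne']
        simp
    _ ≤ ENNReal.ofReal y⁻¹ * (4 * ∫⁻ t in Set.Ioc (0 : ℝ) y, wk i Y W (x - sg i t)) := by gcongr
    _ = _ := by rw [bx]; ring

theorem bx_wk_le {y Y : ℝ} (hy : 0 < y) (hY : 0 < Y) {W : E d → ℝ≥0∞} (hW : Measurable W)
    (x : E d) : bx i y (wk i Y W) x ≤ 512 * wk i (max y Y) W x := by
  refine (bx_le_wk hy _ x).trans ?_
  refine (mul_le_mul_right (wk_wk_le hy hY hW x) _).trans_eq ?_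
  rw [← mul_assoc]; norm_num

theorem rpow_const_mul_le {c : ℝ} (hc : 1 ≤ c) {θ : ℝ} (h0 : 0 ≤ θ) (h1 : θ ≤ 1) {a b : ℝ≥0∞}
    (h : a ≤ ENNReal.ofReal c * b) : a ^ θ ≤ ENNReal.ofReal c * b ^ θ :=
  (ENNReal.rpow_le_rpow h h0).trans (rpow_harnack hc h1 h0)

/-- Averages are dominated by differences in weighted `L²`. -/
theorem Q_wk_bb_le {θ : ℝ} (h0 : 1 / 2 ≤ θ) (h1 : θ < 1) {W : E d → ℝ≥0∞} (hW : Measurable W)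
    {T : ℝ≥0∞} (hT : T ≠ ∞) (hWT : ∀ x, W x ≤ T) {y Y : ℝ} (hy : 0 < y) (hY : y ≤ Y) (a : ℝ)
    (f : L2 d) :
    Q (fun x ↦ wk i Y W x ^ θ) (Fm (fun ξ ↦ bb (y * (ξ i - a))) f) ≤
      ENNReal.ofReal (10240 / (1 - θ)) * ∑' n : ℕ,
        Q (fun x ↦ wk i (max (2 ^ (n + 1) * y) Y) W x ^ θ)
          (Fm (fun ξ ↦ hh (2 ^ n * y * (ξ i - a))) f) := by
  have hY0 : 0 < Y := hy.trans_le hY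
  have hθ : 0 ≤ θ := by linarith
  have hU : Measurable (wk i Y W) := measurable_wk hW
  have hUT : ∀ x, wk i Y W x ≤ 4 * T :=
    fun x ↦ (wk_mono hWT x).trans (wk_const_le hY0 T x)
  have s1 : Q (fun x ↦ wk i Y W x ^ θ) (Fm (fun ξ ↦ bb (y * (ξ i - a))) f) ≤
      ENNReal.ofReal 4 * Q (fun x ↦ bx i y (wk i Y W) x ^ θ)
        (Fm (fun ξ ↦ bb (y * (ξ i - a))) f) := by
    rw [← Q_const_mul _ _ ENNReal.ofReal_ne_top]
    refine Q_mono _ fun x ↦ rpow_const_mul_le (by norm_num) hθ h1.le ?_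
    simpa using wk_le_bx hy hY hW x
  have s2 := Q_bx_le_tsum (i := i) h0 h1 hU (T := 4 * T) (by finiteness) hUT hy a f
  have s3 : ∀ n : ℕ, Q (fun x ↦ bx i (2 ^ (n + 1) * y) (wk i Y W) x ^ θ)
          (Fm (fun ξ ↦ hh (2 ^ n * y * (ξ i - a))) f) ≤ ENNReal.ofReal 512 *
      Q (fun x ↦ wk i (max (2 ^ (n + 1) * y) Y) W x ^ θ)
          (Fm (fun ξ ↦ hh (2 ^ n * y * (ξ i - a))) f) := by
    intro n
    rw [← Q_const_mul _ _ ENNReal.ofReal_ne_top]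
    refine Q_mono _ fun x ↦ rpow_const_mul_le (by norm_num) hθ h1.le ?_
    simpa using bx_wk_le (i := i) (by positivity : 0 < 2 ^ (n + 1) * y) hY0 hW x
  have he : 0 ≤ 5 / (1 - θ) := div_nonneg (by norm_num) (by linarith)
  calc _ ≤ _ := s1
    _ ≤ _ := mul_le_mul_right s2 _
    _ ≤ ENNReal.ofReal 4 * (ENNReal.ofReal (5 / (1 - θ)) * ∑' n : ℕ, ENNReal.ofReal 512 *
        Q (fun x ↦ wk i (max (2 ^ (n + 1) * y) Y) W x ^ θ)
          (Fm (fun ξ ↦ hh (2 ^ n * y * (ξ i - a))) f)) := by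
        gcongr with n; exact s3 n
    _ = _ := by
        rw [ENNReal.tsum_mul_left, ← mul_assoc, ← mul_assoc, ← ENNReal.ofReal_mul (by norm_num),
          ← ENNReal.ofReal_mul (by positivity)]
        congr 2; ring

end

section

variable {d : ℕ} {i : Fin d}

theorem Q_sum_le {ι : Type*} (s : Finset ι) {w : ι → ℝ} (hw : ∀ j, 0 < w j) {g : ι → E d → ℂ}
    (hg : ∀ j, Measurable (g j)) {ω : E d → ℝ≥0∞} (hω : Measurable ω) :
    Q ω (fun x ↦ ∑ j ∈ s, g j x) ≤
      (∑ j ∈ s, ENNReal.ofReal (w j)⁻¹) * ∑ j ∈ s, ENNReal.ofReal (w j) * Q ω (g j) := by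
  have hp : ∀ x, ‖∑ j ∈ s, g j x‖ₑ ^ 2 ≤
      (∑ j ∈ s, ENNReal.ofReal (w j)⁻¹) * ∑ j ∈ s, ENNReal.ofReal (w j) * ‖g j x‖ₑ ^ 2 := by
    intro x
    have h1 : ‖∑ j ∈ s, g j x‖ ^ 2 ≤ (∑ j ∈ s, (w j)⁻¹) * ∑ j ∈ s, w j * ‖g j x‖ ^ 2 := by
      refine (pow_le_pow_left₀ (norm_nonneg _) (norm_sum_le _ _) 2).trans ?_
      refine Finset.sum_sq_le_sum_mul_sum_of_sq_le_mul s (fun j _ ↦ (inv_pos.2 (hw j)).le)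
        (fun j _ ↦ mul_nonneg (hw j).le (by positivity)) fun j _ ↦ ?_
      rw [← mul_assoc, inv_mul_cancel₀ (hw j).ne', one_mul]
    have h2 := ENNReal.ofReal_le_ofReal h1
    rw [ENNReal.ofReal_pow (norm_nonneg _), ofReal_norm,
      ENNReal.ofReal_mul (Finset.sum_nonneg fun j _ ↦ (inv_pos.2 (hw j)).le),
      ENNReal.ofReal_sum_of_nonneg fun j _ ↦ (inv_pos.2 (hw j)).le,
      ENNReal.ofReal_sum_of_nonneg fun j _ ↦ mul_nonneg (hw j).le (by positivity)] at h2
    simpa only [ENNReal.ofReal_mul (hw _).le, ENNReal.ofReal_pow (norm_nonneg _),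
      ofReal_norm] using h2
  refine (lintegral_mono fun x ↦ mul_le_mul_left (hp x) _).trans_eq ?_
  generalize (∑ j ∈ s, ENNReal.ofReal (w j)⁻¹) = K
  simp only [mul_assoc, Finset.sum_mul]
  rw [lintegral_const_mul _ (by fun_prop), lintegral_finsetSum _ (by fun_prop)]
  simp only [Q, lintegral_const_mul' _ _ ENNReal.ofReal_ne_top]

theorem Q_sum_Lp_le {ι : Type*} (s : Finset ι) {w : ι → ℝ} (hw : ∀ j, 0 < w j) (g : ι → L2 d)
    {ω : E d → ℝ≥0∞} (hω : Measurable ω) :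
    Q ω (∑ j ∈ s, g j : L2 d) ≤
      (∑ j ∈ s, ENNReal.ofReal (w j)⁻¹) * ∑ j ∈ s, ENNReal.ofReal (w j) * Q ω (g j) := by
  rw [Q_congr (Lp.coeFn_finsetSum s g)]
  refine le_trans (le_of_eq ?_) (Q_sum_le s hw (fun j ↦ measurable_L2 (g j)) hω)
  congr 1; ext x; simp

/-- Series of multipliers in weighted `L²`. -/
theorem Q_series_le {m : E d → ℂ} {μ : ℤ → E d → ℂ} (hm : IsMult m) (hμ : ∀ j, IsMult (μ j))
    {C : ℝ} (hC : ∀ (J : ℕ) ξ, ‖∑ j ∈ Finset.Ico (-(J : ℤ)) J, μ j ξ‖ ≤ C)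
    (hlim : ∀ᵐ ξ, Filter.Tendsto (fun J : ℕ ↦ ∑ j ∈ Finset.Ico (-(J : ℤ)) J, μ j ξ) Filter.atTop
      (nhds (m ξ)))
    {w : ℤ → ℝ} (hw : ∀ j, 0 < w j) {ω : E d → ℝ≥0∞} (hω : Measurable ω) {T : ℝ≥0∞} (hT : T ≠ ∞)
    (hωT : ∀ x, ω x ≤ T) (f : L2 d) :
    Q ω (Fm m f) ≤ 2 * ((∑' j, ENNReal.ofReal (w j)⁻¹) *
      ∑' j, ENNReal.ofReal (w j) * Q ω (Fm (μ j) f)) := by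
  set s : ℕ → E d → ℂ := fun J ξ ↦ ∑ j ∈ Finset.Ico (-(J : ℤ)) J, μ j ξ with hs
  have hsm : ∀ J, IsMult (s J) := fun J ↦ IsMult.finsum fun j _ ↦ hμ j
  set r : ℕ → ℝ≥0∞ := fun J ↦ Q (fun ξ ↦ ‖m ξ - s J ξ‖ₑ ^ 2) (𝓕 f : L2 d) with hr
  obtain ⟨C', hC'⟩ := hm.bdd
  have hr0 : Filter.Tendsto r Filter.atTop (nhds 0) := by
    have e : (0 : ℝ≥0∞) = ∫⁻ _ : E d, 0 := by simp
    rw [e, hr]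
    refine tendsto_lintegral_of_dominated_convergence
      (fun ξ ↦ ENNReal.ofReal (C' + C) ^ 2 * (‖(𝓕 f : L2 d) ξ‖ₑ ^ 2 * 1)) (fun J ↦ ?_) (fun J ↦ ?_) ?_ ?_
    · have := measurable_L2 (𝓕 f : L2 d)
      have := hm.meas
      have := (hsm J).meas
      fun_prop
    · refine .of_forall fun ξ ↦ ?_
      beta_reduce
      rw [mul_one, mul_comm]
      refine mul_le_mul_left ?_ _
      gcongr
      rw [← ofReal_norm]
      exact ENNReal.ofReal_le_ofReal ((norm_sub_le _ _).trans (add_le_add (hC' ξ) (hC J ξ)))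
    · rw [lintegral_const_mul' _ _ (by finiteness)]
      exact ENNReal.mul_ne_top (by finiteness) (Q_one_lt_top _).ne
    · filter_upwards [hlim] with ξ hξ
      have h1 : Filter.Tendsto (fun J ↦ m ξ - s J ξ) Filter.atTop (nhds 0) := by
        simpa using hξ.const_sub (m ξ)
      have h2 : Filter.Tendsto (fun J ↦ ‖m ξ - s J ξ‖ₑ ^ 2) Filter.atTop (nhds 0) := by
        simpa using ENNReal.Tendsto.pow (n := 2) h1.enorm
      simpa using ENNReal.Tendsto.const_mul h2 (Or.inr (by finiteness))
  have key : ∀ J, Q ω (Fm m f) ≤ 2 * ((∑' j, ENNReal.ofReal (w j)⁻¹) *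
      ∑' j, ENNReal.ofReal (w j) * Q ω (Fm (μ j) f)) + 2 * (T * r J) := by
    intro J
    have e : Fm m f = Fm (s J) f + Fm (fun ξ ↦ m ξ - s J ξ) f := by
      rw [Fm_sub hm (hsm J)]; abel
    have h1 : Q ω (Fm (fun ξ ↦ m ξ - s J ξ) f) ≤ T * r J := by
      rw [hr]; beta_reduce
      rw [← Q_Fm (hm.sub (hsm J)), ← Q_const_mul _ _ hT]
      exact Q_mono _ fun x ↦ by simpa using hωT x
    have h2 : Q ω (Fm (s J) f) ≤ (∑' j, ENNReal.ofReal (w j)⁻¹) *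
        ∑' j, ENNReal.ofReal (w j) * Q ω (Fm (μ j) f) := by
      rw [hs]; beta_reduce
      rw [Fm_sum hμ]
      refine (Q_sum_Lp_le _ hw _ hω).trans ?_
      exact mul_le_mul' (ENNReal.sum_le_tsum _) (ENNReal.sum_le_tsum _)
    rw [e, Q_congr (Lp.coeFn_add _ _)]
    refine (Q_add_le (measurable_L2 _).aemeasurable hω.aemeasurable).trans ?_
    gcongr
  have := (ENNReal.Tendsto.const_mul (a := 2) (b := T * 0) (ENNReal.Tendsto.const_mul (a := T) hr0
    (Or.inr hT)) (Or.inr (by norm_num))).const_add (2 * ((∑' j, ENNReal.ofReal (w j)⁻¹) *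
      ∑' j, ENNReal.ofReal (w j) * Q ω (Fm (μ j) f)))
  rw [mul_zero, mul_zero, add_zero] at this
  exact ge_of_tendsto' this key

end

section

variable {d : ℕ} {i : Fin d}

/-- The `A₁` condition with constant `A` in the direction of the `i`-th axis. -/
def A1 (i : Fin d) (A : ℝ) (W : E d → ℝ≥0∞) : Prop :=
  ∀ y : ℝ, 0 < y → ∀ x, wk i y W x ≤ ENNReal.ofReal A * W x

theorem Q_smul (ω : E d → ℝ≥0∞) (c : ℂ) (f : L2 d) : Q ω (c • f : L2 d) = ‖c‖ₑ ^ 2 * Q ω f := by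
  rw [Q_congr (Lp.coeFn_smul c f), Q, Q, ← lintegral_const_mul' _ _ (by finiteness)]
  refine lintegral_congr fun x ↦ ?_
  simp only [Pi.smul_apply, smul_eq_mul, enorm_mul]
  ring

theorem ae_coord_ne (i : Fin d) (a : ℝ) : ∀ᵐ ξ : E d, ξ i ≠ a := by
  have h := PiLp.volume_preserving_ofLp (Fin d)
  have h1 : ∀ᵐ v : Fin d → ℝ, v i ≠ a := by
    rw [ae_iff]; simpa using! Measure.pi_hyperplane (fun _ : Fin d ↦ (volume : Measure ℝ)) i a
  exact h.quasiMeasurePreserving.ae h1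

/-- The sign function, complex valued. -/
def sgn (u : ℝ) : ℂ := ((SignType.sign u : ℝ) : ℂ)

theorem norm_sgn_le (u : ℝ) : ‖sgn u‖ ≤ 1 := by
  rw [sgn]; rcases lt_trichotomy u 0 with h | h | h <;> simp [h]

theorem measurable_sgn : Measurable sgn := by
  refine Complex.measurable_ofReal.comp ?_
  have e : (fun u : ℝ ↦ ((SignType.sign u : SignType) : ℝ)) =
      fun u ↦ if 0 < u then 1 else if u < 0 then -1 else 0 := by
    ext u
    rcases lt_trichotomy u 0 with h | h | h <;> simp [h, h.not_gt]
  rw [e]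
  exact Measurable.ite measurableSet_Ioi measurable_const
    (Measurable.ite measurableSet_Iio measurable_const measurable_const)

theorem isMult_sgn (i : Fin d) (a : ℝ) : IsMult (fun ξ : E d ↦ sgn (ξ i - a)) :=
  isMult_coord i (m := fun u ↦ sgn (u - a)) (by have := measurable_sgn; fun_prop)
    fun _ ↦ norm_sgn_le _

theorem isMult_Ph (i : Fin d) (y a : ℝ) : IsMult (fun ξ : E d ↦ (Ph (y * (ξ i - a)) : ℂ)) :=
  isMult_coord i (m := fun u ↦ (Ph (y * (u - a)) : ℂ)) 
    (lk_Ph.measurable.comp (by fun_prop : Measurable fun u : ℝ ↦ y * (u - a)))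
    (C := 1) fun u ↦ by
      rw [Complex.norm_real]; exact (abs_Ph_le _).trans (mm_le_one _)

/-- The square root of `rho`. -/
def sig : ℝ := Real.sqrt rho

theorem sig_sq : sig ^ 2 = rho := Real.sq_sqrt rho_pos.le
theorem sig_pos : 0 < sig := Real.sqrt_pos.2 rho_pos
theorem sig_lt_one : sig < 1 := by
  rw [sig, Real.sqrt_lt' one_pos]; simpa using rho_lt_one

/-- The constant arising from the expansion of the sign function. -/
def cSgn : ℝ≥0∞ := ENNReal.ofReal (fc⁻¹ ^ 2) * 2 * geo sig

theorem Q_sgn_le {ω : E d → ℝ≥0∞} (hω : Measurable ω) {T : ℝ≥0∞} (hT : T ≠ ∞)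
    (hωT : ∀ x, ω x ≤ T) {X : ℝ} (hX : 0 < X) (a : ℝ) {g : E d → ℂ} (hg : IsMult g) (f : L2 d) :
    Q ω (Fm (fun ξ ↦ sgn (ξ i - a) * g ξ) f) ≤ cSgn * ∑' j : ℤ,
      ENNReal.ofReal (sig ^ j.natAbs)⁻¹ *
        Q ω (Fm (fun ξ ↦ (Ph (2 ^ j * X * (ξ i - a)) : ℂ) * g ξ) f) := by
  have hw : ∀ j : ℤ, 0 < (sig ^ j.natAbs)⁻¹ := fun j ↦ inv_pos.2 (pow_pos sig_pos _)
  have hs : IsMult fun ξ : E d ↦ sgn (ξ i - a) * g ξ := (isMult_sgn i a).mul hg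
  obtain ⟨C, hC⟩ := hg.bdd
  have e1 : Fm (fun ξ ↦ sgn (ξ i - a) * g ξ) f =
      ((fc⁻¹ : ℝ) : ℂ) • Fm (fun ξ ↦ (fc : ℂ) * (sgn (ξ i - a) * g ξ)) f := by
    rw [Fm_const_mul _ hs, smul_smul, ← Complex.ofReal_mul, inv_mul_cancel₀ fc_pos.ne',
      Complex.ofReal_one, one_smul]
  have e2 : ‖((fc⁻¹ : ℝ) : ℂ)‖ₑ ^ 2 = ENNReal.ofReal (fc⁻¹ ^ 2) := by
    rw [← ofReal_norm, Complex.norm_real, ← ENNReal.ofReal_pow (norm_nonneg _), Real.norm_eq_abs,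
      sq_abs]
  have hsum : ∀ (J : ℕ) (ξ : E d), ∑ j ∈ Finset.Ico (-(J : ℤ)) J,
      (Ph (2 ^ j * X * (ξ i - a)) : ℂ) * g ξ =
      ((∑ j ∈ Finset.Ico (-(J : ℤ)) J, Ph (2 ^ j * (X * (ξ i - a))) : ℝ) : ℂ) * g ξ := by
    intro J ξ
    rw [← Finset.sum_mul]; push_cast; simp only [mul_assoc]
  rw [e1, Q_smul, e2]
  refine (mul_le_mul_right (Q_series_le ((IsMult.const _).mul hs)
    (fun j ↦ (isMult_Ph i (2 ^ j * X) a).mul hg) (C := (∫ v, fj v) * C) ?_ ?_ hw hω hT hωT f)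
    _).trans_eq ?_
  · intro J ξ
    rw [hsum, norm_mul, Complex.norm_real]
    exact mul_le_mul (abs_Ph_sum_le _ _) (hC ξ) (norm_nonneg _)
      (integral_nonneg fun _ ↦ fj_nonneg _)
  · filter_upwards [ae_coord_ne i a] with ξ hξ
    simp only [hsum]
    have h1 := tendsto_Ph_sum (u := X * (ξ i - a)) (mul_ne_zero hX.ne' (sub_ne_zero.2 hξ))
    have h2 := ((Complex.continuous_ofReal.tendsto _).comp h1).mul_const (g ξ)
    have e3 : (fc : ℂ) * (sgn (ξ i - a) * g ξ) =
        ((fc * SignType.sign (X * (ξ i - a)) : ℝ) : ℂ) * g ξ := by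
      rw [sgn, sign_mul, sign_pos hX, one_mul, Complex.ofReal_mul, mul_assoc]
    rw [e3]
    exact h2
  · simp only [inv_inv]
    rw [cSgn, geo]; ring

theorem lk_local (j : ℤ) {y : ℝ} (hy : 0 < y) (a : ℝ) (n : ℕ) :
    LK (2 ^ n * y * (6 + 2 * 2 ^ j)) fun u ↦ (Ph (2 ^ j * (2 ^ n * y) * (u - a)) : ℂ) *
      (hh (2 ^ n * y * (u - a)) * hh (2 * y * u)) := by
  have h1 := (lk_Ph.dil (by positivity : 0 < (2 : ℝ) ^ j * (2 ^ n * y))).trans a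
  have h2 := (lk_hh.dil (by positivity : 0 < (2 : ℝ) ^ n * y)).trans a
  have h3 := lk_hh.dil (by positivity : 0 < 2 * y)
  refine (h1.mul (h2.mul h3)).mono ?_
  have : (1 : ℝ) ≤ 2 ^ n := one_le_pow₀ (by norm_num)
  nlinarith

theorem three_add_le (j : ℤ) : (3 + (2 : ℝ) ^ j) * rho ^ (3 * j.natAbs) ≤ 4 * rho ^ j.natAbs := by
  have e : rho ^ (3 * j.natAbs) = rho ^ j.natAbs * (1 / 2) ^ j.natAbs := by
    rw [← rho_sq, ← pow_mul, ← pow_add]; ring_nf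
  have h : (2 : ℝ) ^ j * (1 / 2) ^ j.natAbs ≤ 1 := by
    rcases le_total 0 j with hj | hj
    · rw [← two_zpow_neg_natAbs hj, mul_inv_cancel₀ (by positivity)]
    · rw [two_zpow_natAbs hj, ← pow_add]
      exact pow_le_one₀ (by norm_num) (by norm_num)
  have h' : (1 / 2 : ℝ) ^ j.natAbs ≤ 1 := pow_le_one₀ (by norm_num) (by norm_num)
  have : 0 ≤ rho ^ j.natAbs := pow_nonneg rho_pos.le _
  rw [e]; nlinarith

/-- The constant arising from the summation of local pieces. -/
def cLoc : ℝ≥0∞ := 16 * (4 * geo (1 / 2)) * (32 * geo rho) * 16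

theorem tsum_pieces_le (a : ℤ → ℝ) (j : ℤ) (u : ℝ) :
    ∑' p : ℤ × ℕ, ‖(Ph (2 ^ j * (2 ^ p.2 * (2 ^ (-p.1) / 8)) * (u - a p.1)) : ℂ) *
      (hh (2 ^ p.2 * (2 ^ (-p.1) / 8) * (u - a p.1)) * hh (2 * (2 ^ (-p.1) / 8) * u))‖ₑ ^ 2 ≤
    16 * (4 * geo (1 / 2)) * (ENNReal.ofReal (32 * rho ^ (3 * j.natAbs)) * geo rho) := by
  rw [ENNReal.tsum_prod']
  have h2 : ∀ k : ℤ, ∑' n : ℕ, ‖(Ph (2 ^ j * (2 ^ n * (2 ^ (-k) / 8)) * (u - a k)) : ℂ) *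
      (hh (2 ^ n * (2 ^ (-k) / 8) * (u - a k)) * hh (2 * (2 ^ (-k) / 8) * u))‖ₑ ^ 2 ≤
      16 * ENNReal.ofReal (mm (2 ^ (-k) * (u / 4)) ^ 2) *
        (ENNReal.ofReal (32 * rho ^ (3 * j.natAbs)) * geo rho) := by
    intro k
    have h3 : ‖hh (2 * (2 ^ (-k) / 8) * u)‖ₑ ^ 2 ≤
        16 * ENNReal.ofReal (mm (2 ^ (-k) * (u / 4)) ^ 2) := by
      have e : 2 * ((2 : ℝ) ^ (-k) / 8) * u = 2 ^ (-k) * (u / 4) := by ring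
      rw [e, ← ofReal_norm, ← ENNReal.ofReal_pow (norm_nonneg _),
        show (16 : ℝ≥0∞) = ENNReal.ofReal 16 by simp, ← ENNReal.ofReal_mul (by norm_num)]
      refine ENNReal.ofReal_le_ofReal ?_
      have := pow_le_pow_left₀ (norm_nonneg _) (norm_hh_le_mm (2 ^ (-k) * (u / 4))) 2
      linarith
    have h4 := (ENNReal.tsum_comp_le_tsum_of_injective Nat.cast_injective fun n : ℤ ↦
      ‖hh (2 ^ n * ((2 ^ (-k) / 8) * (u - a k))) *
        (Ph (2 ^ (j + n) * ((2 ^ (-k) / 8) * (u - a k))) : ℂ)‖ₑ ^ 2).trans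
      (tsum_hh_Ph_le j ((2 ^ (-k) / 8) * (u - a k)))
    refine le_trans (le_of_eq ?_) (mul_le_mul' h3 h4)
    rw [← ENNReal.tsum_mul_left]
    refine tsum_congr fun n ↦ ?_
    rw [← mul_pow, ← enorm_mul]
    congr 2
    rw [zpow_add₀ two_ne_zero, zpow_natCast]
    ring_nf
  refine (ENNReal.tsum_le_tsum h2).trans ?_
  rw [ENNReal.tsum_mul_right, ENNReal.tsum_mul_left]
  have e : ∑' k : ℤ, ENNReal.ofReal (mm (2 ^ (-k) * (u / 4)) ^ 2) =
      ∑' k : ℤ, ENNReal.ofReal (mm (2 ^ k * (u / 4)) ^ 2) :=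
    (Equiv.neg ℤ).tsum_eq fun k : ℤ ↦ ENNReal.ofReal (mm (2 ^ k * (u / 4)) ^ 2)
  rw [e]
  gcongr
  exact tsum_mm_sq_le _

theorem wk_local_le {θ : ℝ} (h0 : 0 ≤ θ) (h1 : θ ≤ 1) {W : E d → ℝ≥0∞} (hW : Measurable W)
    {A : ℝ} (hA : 1 ≤ A) (hWA : A1 i A W) {b : ℝ} (hb : 0 < b) {y Z : ℝ} (hy0 : 0 < y) {n : ℕ}
    (hZ' : 2 ^ (n + 1) * y ≤ Z) {x : E d} {t : ℝ} (ht : |t| ≤ 2 ^ n * y * (6 + 2 * b)) :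
    wk i Z W x ^ θ ≤ ENNReal.ofReal (4 * (3 + b) * A) * W (x - sg i t) ^ θ := by
  have hD : 1 ≤ 4 * (3 + b) * A := by nlinarith
  refine rpow_const_mul_le hD h0 h1 ?_
  have hy : 0 < (2 : ℝ) ^ (n + 1) * y := by positivity
  have hz : 0 < Z := hy.trans_le hZ'
  have hzz : Z ≤ (3 + b) * Z := by nlinarith
  have hz' : 0 < (3 + b) * Z := hz.trans_le hzz
  have htz : |t| ≤ (3 + b) * Z := by
    rw [pow_succ] at hZ'
    nlinarith
  have s1 := wk_le_dil (i := i) hz hzz hW x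
  rw [mul_div_assoc, div_self hz.ne', mul_one] at s1
  have s2 := wk_harnack (i := i) hz' hW (x - sg i t) t
  rw [sub_add_cancel] at s2
  have s3 : (1 + |t| / ((3 + b) * Z)) ^ 2 ≤ 4 := by
    have : |t| / ((3 + b) * Z) ≤ 1 := (div_le_one hz').2 htz
    have : 0 ≤ |t| / ((3 + b) * Z) := by positivity
    nlinarith
  calc wk i (Z) W x ≤ ENNReal.ofReal (3 + b) * (ENNReal.ofReal 4 *
        (ENNReal.ofReal A * W (x - sg i t))) := by
        refine s1.trans (mul_le_mul_right (s2.trans ?_) _)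
        exact mul_le_mul' (ENNReal.ofReal_le_ofReal s3) (hWA _ hz' _)
    _ = _ := by
        rw [ENNReal.ofReal_mul (by positivity), ENNReal.ofReal_mul (by norm_num)]; ring

theorem tsum_Q_pieces_le {θ : ℝ} (h0 : 0 ≤ θ) (h1 : θ ≤ 1) {W : E d → ℝ≥0∞} (hW : Measurable W)
    {A : ℝ} (hA : 1 ≤ A) (hWA : A1 i A W) (a : ℤ → ℝ) {Z : ℤ × ℕ → ℝ}
    (hZ : ∀ p, 2 ^ (p.2 + 1) * (2 ^ (-p.1) / 8) ≤ Z p) (j : ℤ) (f : L2 d) :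
    ∑' p : ℤ × ℕ, Q (fun x ↦ wk i (Z p) W x ^ θ)
      (Fm (fun ξ ↦ (Ph (2 ^ j * (2 ^ p.2 * (2 ^ (-p.1) / 8)) * (ξ i - a p.1)) : ℂ) *
        (hh (2 ^ p.2 * (2 ^ (-p.1) / 8) * (ξ i - a p.1)) * hh (2 * (2 ^ (-p.1) / 8) * ξ i))) f) ≤
    cLoc * ENNReal.ofReal (rho ^ j.natAbs) * ENNReal.ofReal A * Q (fun x ↦ W x ^ θ) f := by
  have hyp : ∀ k : ℤ, 0 < (2 : ℝ) ^ (-k) / 8 := fun k ↦ by positivity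
  have hj0 : (0 : ℝ) < 2 ^ j := by positivity
  have hc := fun u ↦ tsum_pieces_le a j u
  set m : ℤ × ℕ → ℝ → ℂ := fun p u ↦ (Ph (2 ^ j * (2 ^ p.2 * (2 ^ (-p.1) / 8)) * (u - a p.1)) : ℂ) *
    (hh (2 ^ p.2 * (2 ^ (-p.1) / 8) * (u - a p.1)) * hh (2 * (2 ^ (-p.1) / 8) * u)) with hm
  have hlk : ∀ p : ℤ × ℕ, LK (2 ^ p.2 * (2 ^ (-p.1) / 8) * (6 + 2 * 2 ^ j)) (m p) :=
    fun p ↦ lk_local j (hyp p.1) (a p.1) p.2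
  have hct : 16 * (4 * geo (1 / 2)) * (ENNReal.ofReal (32 * rho ^ (3 * j.natAbs)) * geo rho) ≠ ∞ := by
    have := geo_ne_top rho_pos.le rho_lt_one
    have := geo_ne_top (ρ := 1 / 2) (by norm_num) (by norm_num)
    finiteness
  have hωV : ∀ (p : ℤ × ℕ) (x : E d) (t : ℝ), |t| ≤ 2 ^ p.2 * (2 ^ (-p.1) / 8) * (6 + 2 * 2 ^ j) →
      wk i (Z p) W x ^ θ ≤ ENNReal.ofReal (4 * (3 + 2 ^ j) * A) * W (x - sg i t) ^ θ :=
    fun p x t ht ↦ wk_local_le h0 h1 hW hA hWA hj0 (hyp p.1) (hZ p) ht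
  have key := tsum_Q_local_le i hlk hct hc (ω := fun p x ↦ wk i (Z p) W x ^ θ)
    (V := fun x ↦ ENNReal.ofReal (4 * (3 + 2 ^ j) * A) * W x ^ θ)
    (fun p ↦ (measurable_wk hW).pow_const _) (by fun_prop) hωV f
  refine key.trans ?_
  rw [Q_const_mul _ _ ENNReal.ofReal_ne_top]
  have e : ENNReal.ofReal (32 * rho ^ (3 * j.natAbs)) * ENNReal.ofReal (4 * (3 + 2 ^ j) * A) ≤
      32 * 16 * ENNReal.ofReal (rho ^ j.natAbs) * ENNReal.ofReal A := by
    have hr : 0 ≤ rho ^ (3 * j.natAbs) := pow_nonneg rho_pos.le _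
    rw [show (32 : ℝ≥0∞) * 16 = ENNReal.ofReal (32 * 16) by norm_num,
      ← ENNReal.ofReal_mul (by positivity), ← ENNReal.ofReal_mul (by norm_num),
      ← ENNReal.ofReal_mul (mul_nonneg (by norm_num) (pow_nonneg rho_pos.le _))]
    refine ENNReal.ofReal_le_ofReal ?_
    have := mul_le_mul_of_nonneg_right (three_add_le j) (by linarith : 0 ≤ A)
    linarith
  calc _ = 16 * (4 * geo (1 / 2)) * geo rho * (ENNReal.ofReal (32 * rho ^ (3 * j.natAbs)) *
        ENNReal.ofReal (4 * (3 + 2 ^ j) * A)) * Q (fun x ↦ W x ^ θ) f := by ring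
    _ ≤ 16 * (4 * geo (1 / 2)) * geo rho * (32 * 16 * ENNReal.ofReal (rho ^ j.natAbs) *
        ENNReal.ofReal A) * Q (fun x ↦ W x ^ θ) f := by gcongr
    _ = _ := by rw [cLoc]; ring

end

section

variable {d : ℕ} {i : Fin d}

theorem cSgn_ne_top : cSgn ≠ ∞ := by
  have := geo_ne_top sig_pos.le sig_lt_one
  unfold cSgn; finiteness

theorem cLoc_ne_top : cLoc ≠ ∞ := by
  have := geo_ne_top rho_pos.le rho_lt_one
  have := geo_ne_top (ρ := 1 / 2) (by norm_num) (by norm_num)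
  unfold cLoc; finiteness

theorem abs_le_of_lam_ne_zero {u : ℝ} (h : lam u ≠ 0) : 1 / 4 ≤ |u| ∧ |u| ≤ 2 :=
  ⟨not_lt.1 fun h' ↦ h (lam_eq_zero' h'), not_lt.1 fun h' ↦ h (lam_eq_zero h')⟩

theorem exists_sc_jump {α : ℝ} (hα : |α| ≤ 1) :
    ∃ c : ℝ≥0∞, c ≠ ∞ ∧ Sc c 1 (fun u ↦ (lam u : ℂ) / (bb ((u - α) / 8) * hh (u / 4))) := by
  refine exists_sc_lam ((contDiff_bb.comp (by fun_prop)).mul (contDiff_hh.comp (by fun_prop)))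
    fun u h1 h2 ↦ mul_ne_zero (bb_ne_zero ?_) (hh_ne_zero ?_ ?_)
  · rw [abs_div, div_lt_one (by norm_num)]
    have := abs_sub u α
    rw [abs_of_pos (by norm_num : (0 : ℝ) < 8)]; linarith
  · intro h0
    rw [_root_.div_eq_zero_iff] at h0
    rcases h0 with h0 | h0
    · rw [h0] at h1; norm_num at h1
    · norm_num at h0
  · rw [abs_div, div_lt_one (by norm_num), abs_of_pos (by norm_num : (0 : ℝ) < 4)]; linarith

theorem isMult_lam (i : Fin d) (y : ℝ) : IsMult (fun ξ : E d ↦ (lam (y * ξ i) : ℂ)) := by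
  refine isMult_coord i (m := fun u ↦ (lam (y * u) : ℂ)) ?_ (C := 1) fun u ↦ ?_
  · have := contDiff_lam.continuous.measurable
    exact this.comp (by fun_prop : Measurable fun u : ℝ ↦ y * u)
  · rw [Complex.norm_real, Real.norm_eq_abs, lam, lam0, abs_mul]
    refine mul_le_one₀ ?_ (abs_nonneg _) ?_ <;>
    · rw [abs_of_nonneg (Real.smoothTransition.nonneg _)]
      exact Real.smoothTransition.le_one _

theorem lam_factor {α : ℝ} (hα : |α| ≤ 1) (k : ℤ) (ξ : ℝ) :
    (lam (2 ^ (-k) * ξ) : ℂ) = (lam (2 ^ (-k) * ξ) : ℂ) /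
      (bb ((2 ^ (-k) * ξ - α) / 8) * hh (2 ^ (-k) * ξ / 4)) *
      (bb (2 ^ (-k) / 8 * (ξ - α * 2 ^ k)) * hh (2 * (2 ^ (-k) / 8) * ξ)) := by
  have e1 : (2 : ℝ) ^ (-k) / 8 * (ξ - α * 2 ^ k) = (2 ^ (-k) * ξ - α) / 8 := by
    rw [zpow_neg]; field_simp
  have e2 : 2 * ((2 : ℝ) ^ (-k) / 8) * ξ = 2 ^ (-k) * ξ / 4 := by ring
  rw [e1, e2]
  clear e1 e2
  generalize (2 : ℝ) ^ (-k) * ξ = u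
  by_cases h : lam u = 0
  · simp [h]
  obtain ⟨h1, h2⟩ := abs_le_of_lam_ne_zero h
  have hb : bb ((u - α) / 8) ≠ 0 := by
    refine bb_ne_zero ?_
    rw [abs_div, div_lt_one (by norm_num)]
    have := abs_sub u α
    rw [abs_of_pos (by norm_num : (0 : ℝ) < 8)]; linarith
  have hh' : hh (u / 4) ≠ 0 := by
    refine hh_ne_zero ?_ ?_
    · intro h0
      rw [_root_.div_eq_zero_iff] at h0
      rcases h0 with h0 | h0
      · rw [h0] at h1; norm_num at h1
      · norm_num at h0
    · rw [abs_div, div_lt_one (by norm_num), abs_of_pos (by norm_num : (0 : ℝ) < 4)]; linarith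
  field_simp

/-- The multiplier of a half-line, cut off smoothly to frequencies of size `2 ^ k`. -/
def jump (i : Fin d) (α : ℝ) (k : ℤ) (ξ : E d) : ℂ :=
  lam (2 ^ (-k) * ξ i) * sgn (ξ i - α * 2 ^ k)

theorem isMult_jump (i : Fin d) (α : ℝ) (k : ℤ) : IsMult (jump i α k) :=
  (isMult_lam i _).mul (isMult_sgn i _)

theorem Q_jump_le {α : ℝ} (hα : |α| ≤ 1) {c : ℝ≥0∞} (hct : c ≠ ∞)
    (hc : Sc c 1 (fun u ↦ (lam u : ℂ) / (bb ((u - α) / 8) * hh (u / 4))))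
    {θ : ℝ} (h0 : 1 / 2 ≤ θ) (h1 : θ < 1) {W : E d → ℝ≥0∞} (hW : Measurable W)
    {T : ℝ≥0∞} (hT : T ≠ ∞) (hWT : ∀ x, W x ≤ T) (k : ℤ) {y : ℝ} (hy : 2 ^ (-k) ≤ y) (f : L2 d) :
    Q (fun x ↦ wk i y W x ^ θ) (Fm (jump i α k) f) ≤
      (4 * c) ^ 2 * (ENNReal.ofReal (10240 / (1 - θ)) * ∑' n : ℕ, cSgn * ∑' j : ℤ,
        ENNReal.ofReal (sig ^ j.natAbs)⁻¹ *
        Q (fun x ↦ wk i (max (2 ^ (n + 1) * (2 ^ (-k) / 8)) y) W x ^ θ)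
          (Fm (fun ξ ↦ (Ph (2 ^ j * (2 ^ n * (2 ^ (-k) / 8)) * (ξ i - α * 2 ^ k)) : ℂ) *
            (hh (2 ^ n * (2 ^ (-k) / 8) * (ξ i - α * 2 ^ k)) * hh (2 * (2 ^ (-k) / 8) * ξ i))) f)) := by
  have hk : (0 : ℝ) < 2 ^ (-k) := by positivity
  have hy0 : 0 < y := hk.trans_le hy
  have hθ : 0 ≤ θ := by linarith
  have hr : Sc c (2 ^ (-k)) (fun u ↦ (lam (2 ^ (-k) * u) : ℂ) /
      (bb ((2 ^ (-k) * u - α) / 8) * hh (2 ^ (-k) * u / 4))) := hc.dil hk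
  have hm1 := hr.isMult i
  have hm2 := isMult_bb i (2 ^ (-k) / 8) (α * 2 ^ k)
  have hm3 : IsMult fun ξ : E d ↦ hh (2 * (2 ^ (-k) / 8) * ξ i) := by
    simpa using isMult_hh i (2 * (2 ^ (-k) / 8)) 0
  have hm4 := isMult_sgn i (α * 2 ^ k)
  have hm34 := hm3.mul hm4
  set F : L2 d := Fm (fun ξ ↦ hh (2 * (2 ^ (-k) / 8) * ξ i) * sgn (ξ i - α * 2 ^ k)) f with hF
  have e : Fm (jump i α k) f = Fm (fun ξ ↦ (lam (2 ^ (-k) * ξ i) : ℂ) /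
      (bb ((2 ^ (-k) * ξ i - α) / 8) * hh (2 ^ (-k) * ξ i / 4)))
      (Fm (fun ξ ↦ bb (2 ^ (-k) / 8 * (ξ i - α * 2 ^ k))) F) := by
    rw [hF, Fm_Fm hm2 hm34, Fm_Fm hm1 (hm2.mul hm34)]
    congr 1; ext ξ
    rw [jump]; linear_combination sgn (ξ i - α * 2 ^ k) * lam_factor hα k (ξ i)
  rw [e]
  refine (Q_wk_Sc_le hct hk hy hr hθ h1.le hW _).trans (mul_le_mul_right ?_ _)
  refine (Q_wk_bb_le h0 h1 hW hT hWT (by positivity) (by linarith) _ F).trans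
    (mul_le_mul_right (ENNReal.tsum_le_tsum fun n ↦ ?_) _)
  have hm5 := isMult_hh i (2 ^ n * (2 ^ (-k) / 8)) (α * 2 ^ k)
  have e2 : Fm (fun ξ ↦ hh (2 ^ n * (2 ^ (-k) / 8) * (ξ i - α * 2 ^ k))) F =
      Fm (fun ξ ↦ sgn (ξ i - α * 2 ^ k) * (hh (2 ^ n * (2 ^ (-k) / 8) * (ξ i - α * 2 ^ k)) *
        hh (2 * (2 ^ (-k) / 8) * ξ i))) f := by
    rw [hF, Fm_Fm hm5 hm34]
    congr 1; ext ξ; ring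
  rw [e2]
  refine Q_sgn_le ((measurable_wk hW).pow_const _) (T := (4 * T) ^ θ) (by finiteness) (fun x ↦ ?_)
    (by positivity) _ (hm5.mul hm3) f
  exact ENNReal.rpow_le_rpow
    ((wk_mono hWT x).trans (wk_const_le (lt_max_of_lt_right hy0) T x)) hθ

theorem exists_tsum_jump_le {α : ℝ} (hα : |α| ≤ 1) : ∃ C : ℝ≥0∞, C ≠ ∞ ∧
    ∀ {d : ℕ} (i : Fin d) {θ : ℝ}, 1 / 2 ≤ θ → θ < 1 → ∀ {W : E d → ℝ≥0∞}, Measurable W →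
    ∀ {T : ℝ≥0∞}, T ≠ ∞ → (∀ x, W x ≤ T) → ∀ {A : ℝ}, 1 ≤ A → A1 i A W →
    ∀ {y : ℤ → ℝ}, (∀ k, 2 ^ (-k) ≤ y k) → ∀ f : L2 d,
    ∑' k : ℤ, Q (fun x ↦ wk i (y k) W x ^ θ) (Fm (jump i α k) f) ≤
      C * ENNReal.ofReal (A / (1 - θ)) * Q (fun x ↦ W x ^ θ) f := by
  obtain ⟨c, hct, hc⟩ := exists_sc_jump hα
  have hs := geo_ne_top sig_pos.le sig_lt_one
  have h2 := cSgn_ne_top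
  have h3 := cLoc_ne_top
  refine ⟨(4 * c) ^ 2 * (10240 * (cSgn * (cLoc * geo sig))), by finiteness, ?_⟩
  intro d i θ h0 h1 W hW T hT hWT A hA hWA y hy f
  have hθ : 0 ≤ θ := by linarith
  set q : ℤ → ℤ → ℕ → ℝ≥0∞ := fun j k n ↦
    Q (fun x ↦ wk i (max (2 ^ (n + 1) * (2 ^ (-k) / 8)) (y k)) W x ^ θ)
      (Fm (fun ξ ↦ (Ph (2 ^ j * (2 ^ n * (2 ^ (-k) / 8)) * (ξ i - α * 2 ^ k)) : ℂ) *
        (hh (2 ^ n * (2 ^ (-k) / 8) * (ξ i - α * 2 ^ k)) * hh (2 * (2 ^ (-k) / 8) * ξ i))) f)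
    with hq
  have hj : ∀ j : ℤ, ∑' k, ∑' n, q j k n ≤
      cLoc * ENNReal.ofReal (rho ^ j.natAbs) * ENNReal.ofReal A * Q (fun x ↦ W x ^ θ) f := by
    intro j
    have := tsum_Q_pieces_le (i := i) hθ h1.le hW hA hWA (fun k ↦ α * 2 ^ k)
      (Z := fun p ↦ max (2 ^ (p.2 + 1) * (2 ^ (-p.1) / 8)) (y p.1)) (fun p ↦ le_max_left _ _) j f
    rw [ENNReal.tsum_prod'] at this
    exact this
  have hw : ∀ j : ℤ, ENNReal.ofReal (sig ^ j.natAbs)⁻¹ * ENNReal.ofReal (rho ^ j.natAbs) =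
      ENNReal.ofReal (sig ^ j.natAbs) := by
    intro j
    have hp : 0 < sig ^ j.natAbs := pow_pos sig_pos _
    rw [← ENNReal.ofReal_mul (by positivity), ← sig_sq, pow_right_comm, sq,
      inv_mul_cancel_left₀ hp.ne']
  calc ∑' k : ℤ, Q (fun x ↦ wk i (y k) W x ^ θ) (Fm (jump i α k) f)
      ≤ ∑' k, (4 * c) ^ 2 * (ENNReal.ofReal (10240 / (1 - θ)) * ∑' n : ℕ, cSgn * ∑' j : ℤ,
        ENNReal.ofReal (sig ^ j.natAbs)⁻¹ * q j k n) :=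
        ENNReal.tsum_le_tsum fun k ↦ Q_jump_le hα hct hc h0 h1 hW hT hWT k (hy k) f
    _ = (4 * c) ^ 2 * (ENNReal.ofReal (10240 / (1 - θ)) * (cSgn * ∑' j : ℤ,
        ENNReal.ofReal (sig ^ j.natAbs)⁻¹ * ∑' k, ∑' n, q j k n)) := by
        simp only [ENNReal.tsum_mul_left]
        congr 3
        have : ∀ k, ∑' n, ∑' j : ℤ, ENNReal.ofReal (sig ^ j.natAbs)⁻¹ * q j k n =
            ∑' j : ℤ, ENNReal.ofReal (sig ^ j.natAbs)⁻¹ * ∑' n, q j k n := by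
          intro k
          rw [ENNReal.tsum_comm]; simp only [ENNReal.tsum_mul_left]
        simp only [this]
        rw [ENNReal.tsum_comm]; simp only [ENNReal.tsum_mul_left]
    _ ≤ (4 * c) ^ 2 * (ENNReal.ofReal (10240 / (1 - θ)) * (cSgn * ∑' j : ℤ,
        ENNReal.ofReal (sig ^ j.natAbs)⁻¹ * (cLoc * ENNReal.ofReal (rho ^ j.natAbs) *
          ENNReal.ofReal A * Q (fun x ↦ W x ^ θ) f))) := by
        gcongr with j; exact hj j
    _ = (4 * c) ^ 2 * (ENNReal.ofReal (10240 / (1 - θ)) * (cSgn * ∑' j : ℤ,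
        ENNReal.ofReal (sig ^ j.natAbs) * (cLoc *
          ENNReal.ofReal A * Q (fun x ↦ W x ^ θ) f))) := by
        congr 4 with j
        rw [← hw]; ring
    _ = _ := by
        rw [ENNReal.tsum_mul_right, ← geo, div_eq_mul_inv, div_eq_mul_inv,
          ENNReal.ofReal_mul (by norm_num), ENNReal.ofReal_mul (by linarith)]
        rw [show ENNReal.ofReal 10240 = 10240 by simp]
        ring

end

section

variable {d : ℕ} {i : Fin d}

/-- The multiplier `1_I(ξ_i)` for the dyadic interval `I` with parameters `k, s`. -/
def cut (i : Fin d) (s : Bool) (k : ℤ) (ξ : E d) : ℂ := (dyadicInterval k s).indicator 1 (ξ i)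

theorem measurableSet_dyadicInterval (k : ℤ) (s : Bool) : MeasurableSet (dyadicInterval k s) := by
  cases s <;> simp [dyadicInterval]

theorem isMult_cut (i : Fin d) (s : Bool) (k : ℤ) : IsMult (cut i s k) := by
  refine isMult_coord i (m := (dyadicInterval k s).indicator 1) ?_ (C := 1) fun u ↦ ?_
  · exact measurable_one.indicator (measurableSet_dyadicInterval k s)
  · refine (norm_indicator_le_norm_self _ _).trans (by simp)

theorem zpow_neg_mul_abs_mem {k : ℤ} {s : Bool} {u : ℝ} (h : u ∈ dyadicInterval k s) :
    1 / 2 ≤ |(2 : ℝ) ^ (-k) * u| ∧ |(2 : ℝ) ^ (-k) * u| ≤ 1 := by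
  have hk : (0 : ℝ) < 2 ^ k := by positivity
  have e : (2 : ℝ) ^ (k - 1) = 2 ^ k / 2 := by rw [zpow_sub_one₀ (by norm_num)]; rfl
  have e2 : |(2 : ℝ) ^ (-k) * u| = |u| / 2 ^ k := by
    rw [abs_mul, abs_of_pos (by positivity), zpow_neg]; field_simp
  rw [e2, le_div_iff₀ hk, div_le_iff₀ hk]
  cases s
  · simp only [dyadicInterval, e] at h
    have h' : -2 ^ k < u ∧ u ≤ -(2 ^ k / 2) := h
    rw [abs_of_neg (by linarith)]; constructor <;> linarith
  · simp only [dyadicInterval, e] at h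
    have h' : 2 ^ k / 2 ≤ u ∧ u < 2 ^ k := h
    rw [abs_of_pos (by linarith)]; constructor <;> linarith

theorem cut_eq_zero_or {s : Bool} {k : ℤ} {ξ : E d} :
    cut i s k ξ = 0 ∨ ξ i ∈ dyadicInterval k s := by
  by_cases h : ξ i ∈ dyadicInterval k s
  · exact Or.inr h
  · exact Or.inl (Set.indicator_of_notMem h _)

/-- The position, in units of `2 ^ k`, of the left endpoint. -/
def lft (s : Bool) : ℝ := if s then 1 / 2 else -1

/-- The position, in units of `2 ^ k`, of the right endpoint. -/
def rgt (s : Bool) : ℝ := if s then 1 else -1 / 2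

theorem abs_lft_le (s : Bool) : |lft s| ≤ 1 := by
  cases s <;> norm_num [lft]

theorem abs_rgt_le (s : Bool) : |rgt s| ≤ 1 := by
  cases s <;> norm_num [rgt]

theorem sgn_of_pos {u : ℝ} (h : 0 < u) : sgn u = 1 := by simp [sgn, h]

theorem sgn_of_neg {u : ℝ} (h : u < 0) : sgn u = -1 := by simp [sgn, h]

theorem cut_eq_jump (i : Fin d) (s : Bool) (k : ℤ) :
    cut i s k =ᵐ[volume] fun ξ ↦ 1 / 2 * jump i (lft s) k ξ + -(1 / 2) * jump i (rgt s) k ξ := by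
  have hk : (0 : ℝ) < 2 ^ k := by positivity
  have e : (2 : ℝ) ^ (k - 1) = 2 ^ k / 2 := by rw [zpow_sub_one₀ (by norm_num)]; rfl
  filter_upwards [ae_coord_ne i (lft s * 2 ^ k), ae_coord_ne i (rgt s * 2 ^ k)] with ξ h1 h2
  have hmem : ξ i ∈ dyadicInterval k s ↔ lft s * 2 ^ k < ξ i ∧ ξ i < rgt s * 2 ^ k := by
    cases s
    · simp only [lft, rgt] at h1 h2
      simp only [dyadicInterval, e, lft, rgt]
      constructor
      · rintro ⟨h3, h4⟩
        exact ⟨by simpa using h3, lt_of_le_of_ne (by norm_num; linarith) h2⟩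
      · rintro ⟨h3, h4⟩
        norm_num at h3 h4
        constructor <;> linarith
    · simp only [lft, rgt] at h1 h2
      simp only [dyadicInterval, e, lft, rgt]
      constructor
      · rintro ⟨h3, h4⟩
        exact ⟨lt_of_le_of_ne (by norm_num; linarith) h1.symm, by simpa using h4⟩
      · rintro ⟨h3, h4⟩
        norm_num at h3 h4
        constructor <;> linarith
  have hlr : lft s * 2 ^ k < rgt s * 2 ^ k := by
    refine mul_lt_mul_of_pos_right ?_ hk
    cases s <;> norm_num [lft, rgt]
  by_cases h : ξ i ∈ dyadicInterval k s
  · obtain ⟨h3, h4⟩ := hmem.1 h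
    obtain ⟨h5, h6⟩ := zpow_neg_mul_abs_mem h
    rw [cut, Set.indicator_of_mem h, jump, jump, lam_eq_one h5 h6, sgn_of_pos (by linarith),
      sgn_of_neg (by linarith)]
    norm_num
  · rw [cut, Set.indicator_of_notMem h, jump, jump]
    rw [hmem, not_and_or, not_lt, not_lt] at h
    rcases h with h | h
    · have := lt_of_le_of_ne h h1
      rw [sgn_of_neg (by linarith), sgn_of_neg (by linarith)]; ring
    · have := lt_of_le_of_ne h h2.symm
      rw [sgn_of_pos (by linarith), sgn_of_pos (by linarith)]; ring

theorem Q_cut_le_jump (s : Bool) (k : ℤ) {ω : E d → ℝ≥0∞} (hω : Measurable ω) (f : L2 d) :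
    Q ω (Fm (cut i s k) f) ≤ Q ω (Fm (jump i (lft s) k) f) + Q ω (Fm (jump i (rgt s) k) f) := by
  have h1 := isMult_jump i (lft s) k
  have h2 := isMult_jump i (rgt s) k
  have h3 := (IsMult.const (d := d) (1 / 2)).mul h1
  have h4 := (IsMult.const (d := d) (-(1 / 2))).mul h2
  rw [Fm_congr_ae (isMult_cut i s k) (h3.add h4) (cut_eq_jump i s k), Fm_add h3 h4,
    Fm_const_mul _ h1, Fm_const_mul _ h2, Q_congr (Lp.coeFn_add _ _)]
  refine (Q_add_le (measurable_L2 _).aemeasurable hω.aemeasurable).trans ?_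
  rw [Q_smul, Q_smul]
  have e : ∀ c : ℂ, ‖c‖ = 1 / 2 → 2 * ‖c‖ₑ ^ 2 ≤ 1 := by
    intro c hc
    rw [← ofReal_norm, hc, ← ENNReal.ofReal_pow (by norm_num),
      show (2 : ℝ≥0∞) = ENNReal.ofReal 2 by simp, ← ENNReal.ofReal_mul (by norm_num),
      ← ENNReal.ofReal_one]
    exact ENNReal.ofReal_le_ofReal (by norm_num)
  rw [← mul_assoc, ← mul_assoc]
  refine add_le_add (mul_le_of_le_one_left bot_le (e _ (by norm_num)))
    (mul_le_of_le_one_left bot_le (e _ (by norm_num)))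

theorem exists_tsum_cut_le : ∃ C : ℝ≥0∞, C ≠ ∞ ∧
    ∀ {d : ℕ} (i : Fin d) (s : Bool) {θ : ℝ}, 1 / 2 ≤ θ → θ < 1 →
    ∀ {W : E d → ℝ≥0∞}, Measurable W →
    ∀ {T : ℝ≥0∞}, T ≠ ∞ → (∀ x, W x ≤ T) → ∀ {A : ℝ}, 1 ≤ A → A1 i A W →
    ∀ {y : ℤ → ℝ}, (∀ k, 2 ^ (-k) ≤ y k) → ∀ f : L2 d,
    ∑' k : ℤ, Q (fun x ↦ wk i (y k) W x ^ θ) (Fm (cut i s k) f) ≤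
      C * ENNReal.ofReal (A / (1 - θ)) * Q (fun x ↦ W x ^ θ) f := by
  choose C1 hC1 h1 using fun s ↦ exists_tsum_jump_le (abs_lft_le s)
  choose C2 hC2 h2 using fun s ↦ exists_tsum_jump_le (abs_rgt_le s)
  have := hC1 true
  have := hC1 false
  have := hC2 true
  have := hC2 false
  refine ⟨C1 true + C1 false + (C2 true + C2 false), by finiteness, ?_⟩
  intro d i s θ hθ0 hθ1 W hW T hT hWT A hA hWA y hy f
  calc ∑' k : ℤ, Q (fun x ↦ wk i (y k) W x ^ θ) (Fm (cut i s k) f)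
      ≤ ∑' k : ℤ, (Q (fun x ↦ wk i (y k) W x ^ θ) (Fm (jump i (lft s) k) f) +
          Q (fun x ↦ wk i (y k) W x ^ θ) (Fm (jump i (rgt s) k) f)) :=
        ENNReal.tsum_le_tsum fun k ↦ Q_cut_le_jump s k ((measurable_wk hW).pow_const _) f
    _ ≤ (C1 s + C2 s) * ENNReal.ofReal (A / (1 - θ)) * Q (fun x ↦ W x ^ θ) f := by
        rw [ENNReal.tsum_add, add_mul, add_mul]
        exact add_le_add (h1 s i hθ0 hθ1 hW hT hWT hA hWA hy f)
          (h2 s i hθ0 hθ1 hW hT hWT hA hWA hy f)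
    _ ≤ _ := by
        refine mul_le_mul_left (mul_le_mul_left (add_le_add ?_ ?_) _) _
        · cases s
          · exact le_add_self
          · exact le_self_add
        · cases s
          · exact le_add_self
          · exact le_self_add

theorem lam_mul_cut (s : Bool) (k : ℤ) (ξ : E d) :
    (lam (2 ^ (-k) * ξ i) : ℂ) * cut i s k ξ = cut i s k ξ := by
  rcases cut_eq_zero_or (i := i) (s := s) (k := k) (ξ := ξ) with h | h
  · rw [h, mul_zero]
  · obtain ⟨h5, h6⟩ := zpow_neg_mul_abs_mem h
    rw [lam_eq_one h5 h6]; simp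

/-- The one-parameter weighted square function estimate. -/
theorem exists_tsum_Q_cut_le : ∃ C : ℝ≥0∞, C ≠ ∞ ∧
    ∀ {d : ℕ} (i : Fin d) (s : Bool) {θ : ℝ}, 1 / 2 ≤ θ → θ < 1 →
    ∀ {W : E d → ℝ≥0∞}, Measurable W →
    ∀ {T : ℝ≥0∞}, T ≠ ∞ → (∀ x, W x ≤ T) → ∀ {A : ℝ}, 1 ≤ A → A1 i A W →
    ∀ f : L2 d, ∑' k : ℤ, Q (fun x ↦ W x ^ θ) (Fm (cut i s k) f) ≤
      C * ENNReal.ofReal (A / (1 - θ)) * Q (fun x ↦ W x ^ θ) f := by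
  obtain ⟨C, hC, h⟩ := exists_tsum_cut_le
  obtain ⟨c, hct, hc⟩ := exists_sc_lam (g := fun _ ↦ 1) contDiff_const
    (fun _ _ _ ↦ one_ne_zero)
  simp only [div_one] at hc
  refine ⟨(4 * c) ^ 2 * C, by finiteness, ?_⟩
  intro d i s θ hθ0 hθ1 W hW T hT hWT A hA hWA f
  have key : ∀ k : ℤ, Q (fun x ↦ W x ^ θ) (Fm (cut i s k) f) ≤
      (4 * c) ^ 2 * Q (fun x ↦ wk i (2 ^ (-k)) W x ^ θ) (Fm (cut i s k) f) := by
    intro k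
    have hk : (0 : ℝ) < 2 ^ (-k) := by positivity
    have e : Fm (cut i s k) f = Fm (fun ξ ↦ (lam (2 ^ (-k) * ξ i) : ℂ)) (Fm (cut i s k) f) := by
      rw [Fm_Fm (isMult_lam i _) (isMult_cut i s k)]
      congr 1; ext ξ; exact (lam_mul_cut s k ξ).symm
    conv_lhs => rw [e]
    exact Q_rpow_Sc_le hct hk (hc.dil hk) (by linarith) hθ1.le hW _
  refine (ENNReal.tsum_le_tsum key).trans ?_
  rw [ENNReal.tsum_mul_left, mul_assoc, mul_assoc]
  refine mul_le_mul_right ((h i s hθ0 hθ1 hW hT hWT hA hWA (fun k ↦ le_rfl) f).trans ?_) _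
  rw [mul_assoc]

/-! ### The dual estimate -/

theorem Q_wk_ch_le {v Z θ : ℝ} (hv : 0 < v) (hZ : v ≤ Z) (h0 : 0 ≤ θ) (h1 : θ ≤ 1)
    {W : E d → ℝ≥0∞} (hW : Measurable W) (f : L2 d) :
    Q (fun x ↦ wk i Z W x ^ θ) (Fm (fun ξ ↦ 1 - ch (v * ξ i)) f) ≤
      34 * Q (fun x ↦ wk i Z W x ^ θ) f := by
  have hm1 : IsMult fun ξ : E d ↦ ch (v * ξ i) := by simpa using isMult_ch i v 0
  have hZ0 : 0 < Z := hv.trans_le hZ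
  have e1 : (fun ξ : E d ↦ 1 - ch (v * ξ i)) = fun ξ ↦ 1 + (-1) * ch (v * ξ i) := by
    ext ξ; ring
  have e2 : (fun ξ : E d ↦ ch (v * ξ i)) = fun ξ ↦ ft (Measure.dirac v) (fun _ ↦ 1) (ξ i) := by
    ext ξ; simp [ft]
  have hmo : IsMult fun _ : E d ↦ (1 : ℂ) := IsMult.const 1
  rw [e1, Fm_add hmo ((IsMult.const _).mul hm1), Fm_one, Fm_const_mul _ hm1,
    Q_congr (Lp.coeFn_add _ _)]
  refine (Q_add_le (measurable_L2 _).aemeasurable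
    ((measurable_wk hW).pow_const _).aemeasurable).trans ?_
  rw [Q_smul, e2]
  have := Q_wk_ft_le (i := i) (μ := Measure.dirac v) (κ := fun _ ↦ 1) measurable_const (c := 4)
    (by finiteness) hZ0 (by
      rw [lintegral_dirac]
      simp only [enorm_one, one_mul]
      rw [show (4 : ℝ≥0∞) = ENNReal.ofReal (2 ^ 2) by norm_num]
      refine ENNReal.ofReal_le_ofReal (pow_le_pow_left₀ (by positivity) ?_ 2)
      rw [abs_of_pos hv]
      have := (div_le_one hZ0).2 hZ
      linarith) h0 h1 hW f
  calc _ ≤ 2 * Q (fun x ↦ wk i Z W x ^ θ) f + 2 * (‖(-1 : ℂ)‖ₑ ^ 2 *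
        (4 ^ 2 * Q (fun x ↦ wk i Z W x ^ θ) f)) := by gcongr
    _ = _ := by rw [enorm_neg, enorm_one]; ring

theorem Q_wk_box_le {v Z θ : ℝ} (hv : 0 < v) (hZ : v ≤ Z) (h0 : 0 ≤ θ) (h1 : θ ≤ 1)
    {W : E d → ℝ≥0∞} (hW : Measurable W) (f : L2 d) :
    Q (fun x ↦ wk i Z W x ^ θ) (Fm (fun ξ ↦ bb (v * ξ i)) f) ≤
      16 * Q (fun x ↦ wk i Z W x ^ θ) f := by
  have hZ0 : 0 < Z := hv.trans_le hZ
  have hmv : Measurable fun t : ℝ ↦ v * t := by fun_prop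
  have e2 : (fun ξ : E d ↦ bb (v * ξ i)) = fun ξ ↦
      ft ((volume.restrict (Set.Ioc 0 1)).map (fun t : ℝ ↦ v * t)) (fun _ ↦ 1) (ξ i) := by
    ext ξ
    have hc : Continuous fun t : ℝ ↦ (1 : ℂ) * ch (t * ξ i) :=
      continuous_const.mul (continuous_ch.comp (by fun_prop))
    rw [ft, integral_map hmv.aemeasurable hc.aestronglyMeasurable, bb_eq,
      intervalIntegral.integral_of_le zero_le_one]
    congr 1; ext t; rw [one_mul]; congr 1; ring
  have : SFinite ((volume.restrict (Set.Ioc (0 : ℝ) 1)).map (fun t : ℝ ↦ v * t)) := inferInstance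
  rw [e2]
  have := Q_wk_ft_le (i := i) (μ := (volume.restrict (Set.Ioc 0 1)).map (fun t : ℝ ↦ v * t))
    (κ := fun _ ↦ 1) measurable_const (c := 4) (by finiteness) hZ0 (by
      rw [lintegral_map (by fun_prop) hmv]
      simp only [enorm_one, one_mul]
      calc _ ≤ ∫⁻ t in Set.Ioc (0 : ℝ) 1, 4 := by
            refine setLIntegral_mono measurable_const fun t ht ↦ ?_
            rw [show (4 : ℝ≥0∞) = ENNReal.ofReal (2 ^ 2) by norm_num]
            refine ENNReal.ofReal_le_ofReal (pow_le_pow_left₀ (by positivity) ?_ 2)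
            have h3 : v * t ≤ Z := (mul_le_of_le_one_right hv.le ht.2).trans hZ
            rw [abs_of_pos (mul_pos hv ht.1)]
            have := (div_le_one hZ0).2 h3
            linarith
        _ = 4 := by simp) h0 h1 hW f
  refine this.trans (le_of_eq ?_)
  norm_num

end

section

variable {d : ℕ} {i : Fin d}

theorem hh_eq_inv {ρ u : ℝ} (hρ : ρ ≠ 0) (hu : u ≠ 0) :
    hh (ρ * u) = (ρ : ℂ)⁻¹ * ((1 - ch (ρ * u)) * ((1 - ch (ρ * u)) *
      (1 / (4 * Real.pi * Complex.I * u)))) := by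
  have hπ : (Real.pi : ℂ) ≠ 0 := by exact_mod_cast Real.pi_ne_zero
  have hu' : (u : ℂ) ≠ 0 := by exact_mod_cast hu
  have hρ' : (ρ : ℂ) ≠ 0 := by exact_mod_cast hρ
  have h1 : hh (ρ * u) = (1 - ch (ρ * u)) / 2 * bb (ρ * u) := rfl
  have h2 := bb_mul (ρ * u)
  rw [h1]
  generalize ch (ρ * u) = c at *
  generalize bb (ρ * u) = b at *
  push_cast at h2
  rw [← h2]
  field_simp
  ring

theorem zpow_neg_eq_natAbs {e : ℤ} (h : 0 ≤ e) : (2 : ℝ) ^ (-e) = (1 / 2) ^ e.natAbs := by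
  lift e to ℕ using h
  simp

theorem zpow_eq_natAbs {e : ℤ} (h : e ≤ 0) : (2 : ℝ) ^ e = (1 / 2) ^ e.natAbs := by
  have := zpow_neg_eq_natAbs (e := -e) (by omega)
  rwa [neg_neg, Int.natAbs_neg] at this

theorem enorm_pow_two_ofReal {x : ℝ} (h : 0 ≤ x) (n : ℕ) (hx : x = (1 / 2) ^ n) :
    ‖(x : ℂ)‖ₑ ^ 2 = ENNReal.ofReal ((1 / 4) ^ n) := by
  rw [← ofReal_norm, Complex.norm_real, Real.norm_of_nonneg h, ← ENNReal.ofReal_pow h, hx,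
    ← pow_mul, mul_comm n 2, pow_mul]
  norm_num

theorem exists_Q_hh_cut_le : ∃ C : ℝ≥0∞, C ≠ ∞ ∧
    ∀ {d : ℕ} (i : Fin d) (s : Bool) {θ : ℝ}, 0 ≤ θ → θ ≤ 1 →
    ∀ {W : E d → ℝ≥0∞}, Measurable W → ∀ (n k : ℤ) {Z : ℝ}, 2 ^ n ≤ Z → ∀ f : L2 d,
    Q (fun x ↦ wk i Z W x ^ θ) (Fm (fun ξ ↦ hh (2 ^ n * ξ i)) (Fm (cut i s k) f)) ≤
      C * ENNReal.ofReal ((1 / 4) ^ (n + k).natAbs) *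
        Q (fun x ↦ wk i (max (2 ^ (-k)) Z) W x ^ θ) (Fm (cut i s k) f) := by
  have hπ : (Real.pi : ℂ) ≠ 0 := by exact_mod_cast Real.pi_ne_zero
  obtain ⟨c2, hct2, hc2⟩ := exists_sc_lam (g := fun u ↦ 4 * Real.pi * Complex.I * u)
    (contDiff_const.mul Complex.ofRealCLM.contDiff) (by
      intro u h1 _ h0
      rw [mul_eq_zero] at h0
      rcases h0 with h0 | h0
      · simp [hπ] at h0
      · rw [Complex.ofReal_eq_zero] at h0
        rw [h0] at h1; norm_num at h1)
  obtain ⟨c3, hct3, hc3⟩ := exists_sc (m := fun u ↦ (lam u : ℂ) * (Real.pi * Complex.I * u))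
    (contDiff_lam.mul (contDiff_const.mul Complex.ofRealCLM.contDiff))
    (HasCompactSupport.intro (isCompact_Icc (a := (-2 : ℝ)) (b := 2)) fun u hu ↦ by
      rw [Set.mem_Icc, ← abs_le, not_le] at hu
      rw [lam_eq_zero hu]; simp)
  refine ⟨34 ^ 2 * (128 * (4 * c2) ^ 2) + 16 ^ 2 * (128 * (4 * c3) ^ 2), by finiteness, ?_⟩
  intro d i s θ h0 h1 W hW n k Z hZ f
  have hk : (0 : ℝ) < 2 ^ (-k) := by positivity
  have hn : (0 : ℝ) < 2 ^ n := by positivity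
  have hZ0 : 0 < Z := hn.trans_le hZ
  have hρ : (2 : ℝ) ^ n = 2 ^ (n + k) * 2 ^ (-k) := by
    rw [← zpow_add₀ (by norm_num)]; congr 1; ring
  have hcut := isMult_cut i s k
  have hh1 : IsMult fun ξ : E d ↦ hh (2 ^ n * ξ i) := by simpa using isMult_hh i (2 ^ n) 0
  have hh2 : IsMult fun ξ : E d ↦ bb (2 ^ n * ξ i) := by simpa using isMult_bb i (2 ^ n) 0
  have hh3 : IsMult fun ξ : E d ↦ 1 - ch (2 ^ n * ξ i) :=
    (IsMult.const 1).sub (by simpa using isMult_ch i (2 ^ n) 0)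
  set G := Fm (cut i s k) f with hG
  set X := Q (fun x ↦ wk i (max (2 ^ (-k)) Z) W x ^ θ) G with hX
  rcases le_total 0 (n + k) with hnk | hnk
  · have hS := hc2.dil hk
    have hm2 := hS.isMult i
    have e : Fm (fun ξ ↦ hh (2 ^ n * ξ i)) G = (((2 : ℝ) ^ (-(n + k)) : ℝ) : ℂ) •
        Fm (fun ξ ↦ 1 - ch (2 ^ n * ξ i)) (Fm (fun ξ ↦ 1 - ch (2 ^ n * ξ i))
          (Fm (fun ξ ↦ (lam (2 ^ (-k) * ξ i) : ℂ) /
            (4 * Real.pi * Complex.I * (2 ^ (-k) * ξ i : ℝ))) G)) := by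
      rw [hG, Fm_Fm hm2 hcut, Fm_Fm hh3 (hm2.mul hcut), Fm_Fm hh3 (hh3.mul (hm2.mul hcut)),
        ← Fm_const_mul _ (hh3.mul (hh3.mul (hm2.mul hcut))), Fm_Fm hh1 hcut]
      congr 1; ext ξ
      rcases cut_eq_zero_or (i := i) (s := s) (k := k) (ξ := ξ) with h | h
      · rw [h]; ring
      · obtain ⟨h5, h6⟩ := zpow_neg_mul_abs_mem h
        have hu : (2 : ℝ) ^ (-k) * ξ i ≠ 0 := by
          intro h0; rw [h0] at h5; norm_num at h5
        rw [lam_eq_one h5 h6, hρ, mul_assoc, hh_eq_inv (by positivity) hu, zpow_neg _ (n + k),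
          Complex.ofReal_inv, Complex.ofReal_one]
        ring
    rw [e, Q_smul, enorm_pow_two_ofReal (by positivity) _ (zpow_neg_eq_natAbs hnk)]
    calc _ ≤ ENNReal.ofReal ((1 / 4) ^ (n + k).natAbs) *
          (34 * (34 * (128 * (4 * c2) ^ 2 * X))) := by
          refine mul_le_mul_right ?_ _
          refine (Q_wk_ch_le hn hZ h0 h1 hW _).trans (mul_le_mul_right ?_ _)
          refine (Q_wk_ch_le hn hZ h0 h1 hW _).trans (mul_le_mul_right ?_ _)
          exact Q_wk_Sc_le' hct2 hk hZ0 hS h0 h1 hW _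
      _ = 34 ^ 2 * (128 * (4 * c2) ^ 2) * ENNReal.ofReal ((1 / 4) ^ (n + k).natAbs) * X := by ring
      _ ≤ _ := by gcongr; exact le_self_add
  · have hS := hc3.dil hk
    have hm2 := hS.isMult i
    have e : Fm (fun ξ ↦ hh (2 ^ n * ξ i)) G = (((2 : ℝ) ^ (n + k) : ℝ) : ℂ) •
        Fm (fun ξ ↦ bb (2 ^ n * ξ i)) (Fm (fun ξ ↦ bb (2 ^ n * ξ i))
          (Fm (fun ξ ↦ (lam (2 ^ (-k) * ξ i) : ℂ) *
            (Real.pi * Complex.I * (2 ^ (-k) * ξ i : ℝ))) G)) := by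
      rw [hG, Fm_Fm hm2 hcut, Fm_Fm hh2 (hm2.mul hcut), Fm_Fm hh2 (hh2.mul (hm2.mul hcut)),
        ← Fm_const_mul _ (hh2.mul (hh2.mul (hm2.mul hcut))), Fm_Fm hh1 hcut]
      congr 1; ext ξ
      rcases cut_eq_zero_or (i := i) (s := s) (k := k) (ξ := ξ) with h | h
      · rw [h]; ring
      · obtain ⟨h5, h6⟩ := zpow_neg_mul_abs_mem h
        rw [lam_eq_one h5 h6, hh_eq]
        have : ((2 ^ n * ξ i : ℝ) : ℂ) = ((2 : ℝ) ^ (n + k) : ℝ) * ((2 ^ (-k) * ξ i : ℝ) : ℂ) := by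
          rw [← Complex.ofReal_mul, hρ, mul_assoc]
        rw [this, Complex.ofReal_one]
        ring
    rw [e, Q_smul, enorm_pow_two_ofReal (by positivity) _ (zpow_eq_natAbs hnk)]
    calc _ ≤ ENNReal.ofReal ((1 / 4) ^ (n + k).natAbs) *
          (16 * (16 * (128 * (4 * c3) ^ 2 * X))) := by
          refine mul_le_mul_right ?_ _
          refine (Q_wk_box_le hn hZ h0 h1 hW _).trans (mul_le_mul_right ?_ _)
          refine (Q_wk_box_le hn hZ h0 h1 hW _).trans (mul_le_mul_right ?_ _)
          exact Q_wk_Sc_le' hct3 hk hZ0 hS h0 h1 hW _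
      _ = 16 ^ 2 * (128 * (4 * c3) ^ 2) * ENNReal.ofReal ((1 / 4) ^ (n + k).natAbs) * X := by ring
      _ ≤ _ := by gcongr; exact le_add_self

theorem exists_Q_sum_cut_le : ∃ C : ℝ≥0∞, C ≠ ∞ ∧
    ∀ {d : ℕ} (i : Fin d) (s : Bool) {θ : ℝ}, 1 / 2 ≤ θ → θ < 1 →
    ∀ {W : E d → ℝ≥0∞}, Measurable W →
    ∀ {T : ℝ≥0∞}, T ≠ ∞ → (∀ x, W x ≤ T) → ∀ {A : ℝ}, 1 ≤ A → A1 i A W →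
    ∀ (K : Finset ℤ) (g : ℤ → L2 d), Q (fun x ↦ W x ^ θ) (∑ k ∈ K, Fm (cut i s k) (g k) : L2 d) ≤
      C * ENNReal.ofReal (A / (1 - θ) ^ 2) * ∑ k ∈ K, Q (fun x ↦ W x ^ θ) (g k) := by
  obtain ⟨C, hC, hmain⟩ := exists_tsum_cut_le
  obtain ⟨C', hC', hpiece⟩ := exists_Q_hh_cut_le
  obtain ⟨c, hct, hc⟩ := exists_sc_div (l := fun u ↦ (lam0 u : ℂ)) (g := fun u ↦ bb (u / 4))
    contDiff_lam0 (contDiff_bb.comp (by fun_prop)) (isCompact_Icc (a := (-2 : ℝ)) (b := 2))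
    (fun u hu ↦ by
      rw [Set.mem_Icc, ← abs_le, not_le] at hu
      rw [lam0_eq_zero hu]; simp)
    (fun u hu ↦ bb_ne_zero (by
      rw [Set.mem_Icc, ← abs_le] at hu
      rw [abs_div, div_lt_one (by norm_num), abs_of_pos (by norm_num : (0 : ℝ) < 4)]; linarith))
  have hg1 := geo_ne_top (ρ := 1 / 2) (by norm_num) (by norm_num)
  refine ⟨(4 * c) ^ 2 * (10240 * (geo (1 / 2) * (C' * C * geo (1 / 2)))), by finiteness, ?_⟩
  intro d i s θ h0 h1 W hW T hT hWT A hA hWA K g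
  have hθ : 0 ≤ θ := by linarith
  obtain ⟨M, hM⟩ : ∃ M : ℤ, ∀ k ∈ K, k ≤ M := K.exists_le
  set F : L2 d := ∑ k ∈ K, Fm (cut i s k) (g k) with hF
  have hMp : (0 : ℝ) < 2 ^ (-M) := by positivity
  have hr := hc.dil hMp
  have hm1 := hr.isMult i
  have hm2 : IsMult fun ξ : E d ↦ bb (2 ^ (-M) / 4 * (ξ i - 0)) := isMult_bb i _ 0
  have e : Fm (fun ξ ↦ (lam0 (2 ^ (-M) * ξ i) : ℂ) / bb (2 ^ (-M) * ξ i / 4))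
      (Fm (fun ξ ↦ bb (2 ^ (-M) / 4 * (ξ i - 0))) F) = F := by
    rw [Fm_Fm hm1 hm2, hF, Fm_sum_right (hm1.mul hm2)]
    refine Finset.sum_congr rfl fun k hk ↦ ?_
    rw [Fm_Fm (hm1.mul hm2) (isMult_cut i s k)]
    congr 1; ext ξ
    rcases cut_eq_zero_or (i := i) (s := s) (k := k) (ξ := ξ) with h | h
    · rw [h]; ring
    · obtain ⟨-, h6⟩ := zpow_neg_mul_abs_mem h
      have h7 : |(2 : ℝ) ^ (-M) * ξ i| ≤ 1 := by
        refine le_trans ?_ h6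
        rw [abs_mul, abs_mul, abs_of_pos hMp, abs_of_pos (by positivity : (0 : ℝ) < 2 ^ (-k))]
        have := hM k hk
        exact mul_le_mul_of_nonneg_right (zpow_le_zpow_right₀ (by norm_num) (by omega))
          (abs_nonneg _)
      have e3 : (2 : ℝ) ^ (-M) / 4 * (ξ i - 0) = 2 ^ (-M) * ξ i / 4 := by ring
      rw [e3, lam0_eq_one h7]
      have hb : bb (2 ^ (-M) * ξ i / 4) ≠ 0 := bb_ne_zero (by
        rw [abs_div, div_lt_one (by norm_num), abs_of_pos (by norm_num : (0 : ℝ) < 4)]; linarith)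
      generalize bb (2 ^ (-M) * ξ i / 4) = b at *
      field_simp
      simp
  set Z : ℕ → ℝ := fun n ↦ max (2 ^ (n + 1) * (2 ^ (-M) / 4)) (2 ^ (-M)) with hZ
  set B := C' * C * ENNReal.ofReal (A / (1 - θ)) with hB
  have hsingle : ∀ (n : ℕ) (k : ℤ), Q (fun x ↦ wk i (Z n) W x ^ θ)
      (Fm (fun ξ ↦ hh (2 ^ n * (2 ^ (-M) / 4) * (ξ i - 0))) (Fm (cut i s k) (g k))) ≤
      ENNReal.ofReal ((1 / 4) ^ (n + (k - M - 2)).natAbs) * (B * Q (fun x ↦ W x ^ θ) (g k)) := by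
    intro n k
    have e1 : ∀ u : ℝ, (2 : ℝ) ^ n * (2 ^ (-M) / 4) * (u - 0) = 2 ^ (n - M - 2 : ℤ) * u := by
      intro u
      rw [zpow_sub₀ (by norm_num), zpow_sub₀ (by norm_num), zpow_natCast, zpow_neg]
      norm_num; left; ring
    have e2 : (2 : ℝ) ^ (n - M - 2 : ℤ) ≤ Z n := by
      have := e1 1
      rw [sub_zero, mul_one, mul_one] at this
      rw [← this]
      refine le_trans ?_ (le_max_left _ _)
      gcongr <;> norm_num
    simp only [e1]
    refine (hpiece i s hθ h1.le hW (n - M - 2) k e2 (g k)).trans ?_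
    have h3 := (ENNReal.le_tsum k).trans (hmain i s h0 h1 hW hT hWT hA hWA
      (y := fun k ↦ max (2 ^ (-k)) (Z n)) (fun k ↦ le_max_left _ _) (g k))
    rw [show (n - M - 2 + k : ℤ) = n + (k - M - 2) by ring]
    calc _ ≤ C' * ENNReal.ofReal ((1 / 4) ^ ((n : ℤ) + (k - M - 2)).natAbs) * (C *
          ENNReal.ofReal (A / (1 - θ)) * Q (fun x ↦ W x ^ θ) (g k)) := mul_le_mul_right h3 _
      _ = _ := by rw [hB]; ring
  have hn : ∀ n : ℕ, Q (fun x ↦ wk i (Z n) W x ^ θ)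
      (Fm (fun ξ ↦ hh (2 ^ n * (2 ^ (-M) / 4) * (ξ i - 0))) F) ≤
      geo (1 / 2) * ∑ k ∈ K, ENNReal.ofReal ((1 / 2) ^ (n + (k - M - 2)).natAbs) *
        (B * Q (fun x ↦ W x ^ θ) (g k)) := by
    intro n
    rw [hF, Fm_sum_right (isMult_hh i _ 0)]
    refine (Q_sum_Lp_le K (w := fun k : ℤ ↦ 2 ^ (n + (k - M - 2)).natAbs) (by intro; positivity) _
      ((measurable_wk hW).pow_const _)).trans (mul_le_mul' ?_ (Finset.sum_le_sum fun k _ ↦ ?_))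
    · calc _ = ∑ k ∈ K, ENNReal.ofReal ((1 / 2) ^ (k + (n - M - 2)).natAbs) := by
            refine Finset.sum_congr rfl fun k _ ↦ ?_
            rw [one_div, inv_pow, show (n + (k - M - 2) : ℤ) = k + (n - M - 2) by ring]
        _ ≤ _ := (ENNReal.sum_le_tsum K).trans (tsum_geo_shift (1 / 2) _).le
    · refine (mul_le_mul_right (hsingle n k) _).trans (le_of_eq ?_)
      rw [← mul_assoc, ← ENNReal.ofReal_mul (by positivity), ← mul_pow]
      norm_num
  have hsum : ∀ k : ℤ, ∑' n : ℕ, ENNReal.ofReal ((1 / 2) ^ ((n : ℤ) + (k - M - 2)).natAbs) ≤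
      geo (1 / 2) := fun k ↦
    (ENNReal.tsum_comp_le_tsum_of_injective (Nat.cast_injective (R := ℤ))
      fun n : ℤ ↦ ENNReal.ofReal ((1 / 2) ^ (n + (k - M - 2)).natAbs)).trans
      (tsum_geo_shift (1 / 2) _).le
  calc Q (fun x ↦ W x ^ θ) F
      = Q (fun x ↦ W x ^ θ) (Fm (fun ξ ↦ (lam0 (2 ^ (-M) * ξ i) : ℂ) / bb (2 ^ (-M) * ξ i / 4))
        (Fm (fun ξ ↦ bb (2 ^ (-M) / 4 * (ξ i - 0))) F)) := by rw [e]
    _ ≤ (4 * c) ^ 2 * Q (fun x ↦ wk i (2 ^ (-M)) W x ^ θ)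
        (Fm (fun ξ ↦ bb (2 ^ (-M) / 4 * (ξ i - 0))) F) :=
        Q_rpow_Sc_le hct hMp hr hθ h1.le hW _
    _ ≤ (4 * c) ^ 2 * (ENNReal.ofReal (10240 / (1 - θ)) * ∑' n : ℕ,
        Q (fun x ↦ wk i (Z n) W x ^ θ)
          (Fm (fun ξ ↦ hh (2 ^ n * (2 ^ (-M) / 4) * (ξ i - 0))) F)) := by
        refine mul_le_mul_right ?_ _
        exact Q_wk_bb_le h0 h1 hW hT hWT (by positivity) (by linarith) 0 F
    _ ≤ (4 * c) ^ 2 * (ENNReal.ofReal (10240 / (1 - θ)) * ∑' n : ℕ, (geo (1 / 2) * ∑ k ∈ K,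
        ENNReal.ofReal ((1 / 2) ^ (n + (k - M - 2)).natAbs) *
          (B * Q (fun x ↦ W x ^ θ) (g k)))) := by
        gcongr with n; exact hn n
    _ = (4 * c) ^ 2 * (ENNReal.ofReal (10240 / (1 - θ)) * (geo (1 / 2) * ∑ k ∈ K,
        (∑' n : ℕ, ENNReal.ofReal ((1 / 2) ^ (n + (k - M - 2)).natAbs)) *
          (B * Q (fun x ↦ W x ^ θ) (g k)))) := by
        rw [ENNReal.tsum_mul_left, Summable.tsum_finsetSum (fun _ _ ↦ ENNReal.summable)]
        simp only [ENNReal.tsum_mul_right]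
    _ ≤ (4 * c) ^ 2 * (ENNReal.ofReal (10240 / (1 - θ)) * (geo (1 / 2) * ∑ k ∈ K,
        geo (1 / 2) * (B * Q (fun x ↦ W x ^ θ) (g k)))) := by
        gcongr with k; exact hsum k
    _ = _ := by
        have hp : 0 < 1 - θ := by linarith
        rw [← Finset.mul_sum, ← Finset.mul_sum, hB]
        have : ENNReal.ofReal (10240 / (1 - θ)) * ENNReal.ofReal (A / (1 - θ)) =
            10240 * ENNReal.ofReal (A / (1 - θ) ^ 2) := by
          rw [show (10240 : ℝ≥0∞) = ENNReal.ofReal 10240 by simp,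
            ← ENNReal.ofReal_mul (by positivity), ← ENNReal.ofReal_mul (by norm_num)]
          congr 1; field_simp
        set S := ∑ k ∈ K, Q (fun x ↦ W x ^ θ) (g k)
        calc _ = (4 * c) ^ 2 * geo (1 / 2) * geo (1 / 2) * C' * C * S *
              (ENNReal.ofReal (10240 / (1 - θ)) * ENNReal.ofReal (A / (1 - θ))) := by ring
          _ = _ := by rw [this]; ring

end

section

variable {d : ℕ} {i : Fin d}

/-- The multiplier of a product of dyadic intervals in the directions `c`. -/
def cuts {n : ℕ} (c : Fin n → Fin d) (r : Fin n → ℤ × Bool) (ξ : E d) : ℂ :=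
  ∏ j, cut (c j) (r j).2 (r j).1 ξ

theorem cuts_cons {n : ℕ} (c : Fin (n + 1) → Fin d) (a : ℤ × Bool) (r : Fin n → ℤ × Bool) :
    cuts c (Fin.cons a r) = fun ξ ↦ cut (c 0) a.2 a.1 ξ * cuts (fun j ↦ c j.succ) r ξ := by
  ext ξ
  simp [cuts, Fin.prod_univ_succ]

theorem isMult_cuts {n : ℕ} (c : Fin n → Fin d) (r : Fin n → ℤ × Bool) : IsMult (cuts c r) := by
  induction n with
  | zero =>
    have : cuts c r = fun _ ↦ 1 := by ext; simp [cuts]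
    rw [this]; exact IsMult.const 1
  | succ n ih =>
    rw [← Fin.cons_self_tail r, cuts_cons]
    exact (isMult_cut _ _ _).mul (ih _ _)

theorem tsum_Q_cuts_le {N : ℝ≥0∞} {ω : E d → ℝ≥0∞} {n : ℕ} (c : Fin n → Fin d)
    (h : ∀ j s (f : L2 d), ∑' k : ℤ, Q ω (Fm (cut (c j) s k) f) ≤ N * Q ω f) (f : L2 d) :
    ∑' r, Q ω (Fm (cuts c r) f) ≤ (2 * N) ^ n * Q ω f := by
  induction n with
  | zero =>
    have : ∀ r, cuts c r = fun _ ↦ 1 := by intro r; ext; simp [cuts]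
    simp [this, Fm_one]
  | succ n ih =>
    rw [← (Fin.consEquiv fun _ : Fin (n + 1) ↦ ℤ × Bool).tsum_eq, ENNReal.tsum_prod',
      ENNReal.tsum_comm]
    calc _ ≤ ∑' r : Fin n → ℤ × Bool, 2 * N * Q ω (Fm (cuts (fun j ↦ c j.succ) r) f) := by
          refine ENNReal.tsum_le_tsum fun r ↦ ?_
          have e : ∀ a : ℤ × Bool, Q ω (Fm (cuts c (Fin.consEquiv (fun _ ↦ ℤ × Bool) (a, r))) f) =
              Q ω (Fm (cut (c 0) a.2 a.1) (Fm (cuts (fun j ↦ c j.succ) r) f)) := by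
            intro a
            rw [Fm_Fm (isMult_cut _ _ _) (isMult_cuts _ _), ← cuts_cons]
            rfl
          simp only [e]
          rw [ENNReal.tsum_prod', ENNReal.tsum_comm]
          calc _ ≤ ∑' s : Bool, N * Q ω (Fm (cuts (fun j ↦ c j.succ) r) f) :=
                ENNReal.tsum_le_tsum fun s ↦ h 0 s _
            _ = _ := by rw [tsum_fintype, Fintype.sum_bool]; ring
      _ ≤ _ := by
          rw [ENNReal.tsum_mul_left, pow_succ', mul_assoc (2 * N)]
          exact mul_le_mul_right (ih _ fun j ↦ h j.succ) _

theorem Q_sum_cuts_le {N : ℝ≥0∞} {ω : E d → ℝ≥0∞} (hω : Measurable ω) (K : Finset ℤ) {n : ℕ}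
    (c : Fin n → Fin d)
    (h : ∀ j s (g : ℤ → L2 d),
      Q ω (∑ k ∈ K, Fm (cut (c j) s k) (g k) : L2 d) ≤ N * ∑ k ∈ K, Q ω (g k))
    (g : (Fin n → K × Bool) → L2 d) :
    Q ω (∑ r, Fm (cuts c fun j ↦ ((r j).1, (r j).2)) (g r) : L2 d) ≤
      (2 * N) ^ n * ∑ r, Q ω (g r) := by
  induction n with
  | zero =>
    have : ∀ r, cuts c r = fun _ ↦ 1 := by intro r; ext; simp [cuts]
    simp [this, Fm_one]
  | succ n ih =>
    set F : K × Bool → L2 d := fun a ↦ ∑ r : Fin n → K × Bool,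
      Fm (cuts (fun j ↦ c j.succ) fun j ↦ ((r j).1, (r j).2)) (g (Fin.cons a r)) with hF
    have e1 : ∑ r, Fm (cuts c fun j ↦ (((r j).1 : ℤ), (r j).2)) (g r) =
        ∑ s : Bool, ∑ k : K, Fm (cut (c 0) s k) (F (k, s)) := by
      rw [← (Fin.consEquiv fun _ : Fin (n + 1) ↦ K × Bool).sum_comp, Fintype.sum_prod_type,
        Fintype.sum_prod_type, Finset.sum_comm]
      refine Finset.sum_congr rfl fun s _ ↦ Finset.sum_congr rfl fun k _ ↦ ?_
      rw [hF, Fm_sum_right (isMult_cut _ _ _)]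
      refine Finset.sum_congr rfl fun r _ ↦ ?_
      rw [Fm_Fm (isMult_cut _ _ _) (isMult_cuts _ _),
        ← cuts_cons c ((k : ℤ), s) fun j ↦ (((r j).1 : ℤ), (r j).2)]
      congr 2
      ext j
      · refine Fin.cases ?_ (fun j ↦ ?_) j <;> simp [Fin.consEquiv]
      · refine Fin.cases ?_ (fun j ↦ ?_) j <;> simp [Fin.consEquiv]
    have e2 : ∑ r, Q ω (g r) = ∑ s : Bool, ∑ k : K, ∑ r : Fin n → K × Bool,
        Q ω (g (Fin.cons (k, s) r)) := by
      rw [← (Fin.consEquiv fun _ : Fin (n + 1) ↦ K × Bool).sum_comp, Fintype.sum_prod_type,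
        Fintype.sum_prod_type, Finset.sum_comm]
      rfl
    have h1 : ∀ s, Q ω (∑ k : K, Fm (cut (c 0) s k) (F (k, s)) : L2 d) ≤
        N * ∑ k : K, Q ω (F (k, s)) := by
      intro s
      have := h 0 s fun k ↦ if hk : k ∈ K then F (⟨k, hk⟩, s) else 0
      rw [← Finset.sum_coe_sort K fun k ↦ Fm (cut ((c 0)) s k)
        (if hk : k ∈ K then F (⟨k, hk⟩, s) else 0), ← Finset.sum_coe_sort K] at this
      simpa only [Finset.coe_mem, dite_true, Subtype.coe_eta] using this
    rw [e1, e2]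
    calc _ ≤ 2 * ∑ s : Bool, Q ω (∑ k : K, Fm (cut (c 0) s k) (F (k, s)) : L2 d) := by
          have := Q_sum_Lp_le Finset.univ (w := fun _ : Bool ↦ 1) (fun _ ↦ one_pos)
            (fun s ↦ ∑ k : K, Fm (cut (c 0) s k) (F (k, s))) hω
          simpa [one_add_one_eq_two] using this
      _ ≤ 2 * ∑ s : Bool, N * ∑ k : K, (2 * N) ^ n * ∑ r : Fin n → K × Bool,
            Q ω (g (Fin.cons (k, s) r)) := by
          refine mul_le_mul_right (Finset.sum_le_sum fun s _ ↦ (h1 s).trans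
            (mul_le_mul_right (Finset.sum_le_sum fun k _ ↦ ?_) _)) _
          exact ih (fun j ↦ c j.succ) (fun j ↦ h j.succ) fun r ↦ g (Fin.cons (k, s) r)
      _ = _ := by
          simp only [← Finset.mul_sum]
          ring

/-- The multiplier of a dyadic rectangle. -/
abbrev rct (r : Fin d → ℤ × Bool) : E d → ℂ := cuts id r

theorem rct_eq (r : Fin d → ℤ × Bool) :
    rct r = (dyadicRect d (fun j ↦ (r j).1) fun j ↦ (r j).2).indicator 1 := by
  ext ξ
  by_cases h : ∀ j, ξ j ∈ dyadicInterval (r j).1 (r j).2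
  · rw [Set.indicator_of_mem (by exact h)]
    refine Finset.prod_eq_one fun j _ ↦ ?_
    simp [cut, h j]
  · rw [Set.indicator_of_notMem (by exact h)]
    push Not at h
    obtain ⟨j, hj⟩ := h
    refine Finset.prod_eq_zero (Finset.mem_univ j) ?_
    simp [cut, hj]

theorem exists_tsum_Q_rct_le : ∃ C : ℝ, 1 ≤ C ∧ ∀ {d : ℕ} {θ : ℝ}, 1 / 2 ≤ θ → θ < 1 →
    ∀ {W : E d → ℝ≥0∞}, Measurable W →
    ∀ {T : ℝ≥0∞}, T ≠ ∞ → (∀ x, W x ≤ T) → ∀ {A : ℝ}, 1 ≤ A → (∀ i, A1 i A W) →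
    ∀ f : L2 d, ∑' r, Q (fun x ↦ W x ^ θ) (Fm (rct r) f) ≤
      ENNReal.ofReal (C * (A / (1 - θ))) ^ d * Q (fun x ↦ W x ^ θ) f := by
  obtain ⟨C, hC, h⟩ := exists_tsum_Q_cut_le
  refine ⟨2 * C.toReal + 1, by linarith [C.toReal_nonneg], ?_⟩
  intro d θ h0 h1 W hW T hT hWT A hA hWA f
  refine (tsum_Q_cuts_le id (fun j s ↦ h j s h0 h1 hW hT hWT hA (hWA j)) f).trans ?_
  refine mul_le_mul_left (pow_le_pow_left₀ bot_le ?_ _) _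
  have hp : 0 < 1 - θ := by linarith
  rw [ENNReal.ofReal_mul (by positivity), ← mul_assoc]
  refine mul_le_mul_left ?_ _
  rw [ENNReal.ofReal_add (by positivity) one_pos.le, ENNReal.ofReal_mul (by norm_num),
    ENNReal.ofReal_toReal hC]
  simp

theorem exists_Q_sum_rct_le : ∃ C : ℝ, 1 ≤ C ∧ ∀ {d : ℕ} {θ : ℝ}, 1 / 2 ≤ θ → θ < 1 →
    ∀ {W : E d → ℝ≥0∞}, Measurable W →
    ∀ {T : ℝ≥0∞}, T ≠ ∞ → (∀ x, W x ≤ T) → ∀ {A : ℝ}, 1 ≤ A → (∀ i, A1 i A W) →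
    ∀ (K : Finset ℤ) (g : (Fin d → K × Bool) → L2 d),
    Q (fun x ↦ W x ^ θ) (∑ r, Fm (rct fun j ↦ ((r j).1, (r j).2)) (g r) : L2 d) ≤
      ENNReal.ofReal (C * (A / (1 - θ) ^ 2)) ^ d * ∑ r, Q (fun x ↦ W x ^ θ) (g r) := by
  obtain ⟨C, hC, h⟩ := exists_Q_sum_cut_le
  refine ⟨2 * C.toReal + 1, by linarith [C.toReal_nonneg], ?_⟩
  intro d θ h0 h1 W hW T hT hWT A hA hWA K g
  refine (Q_sum_cuts_le (hW.pow_const _) K id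
    (fun j s ↦ h j s h0 h1 hW hT hWT hA (hWA j) K) g).trans ?_
  refine mul_le_mul_left (pow_le_pow_left₀ bot_le ?_ _) _
  have hp : 0 < 1 - θ := by linarith
  rw [ENNReal.ofReal_mul (by positivity), ← mul_assoc]
  refine mul_le_mul_left ?_ _
  rw [ENNReal.ofReal_add (by positivity) one_pos.le, ENNReal.ofReal_mul (by norm_num),
    ENNReal.ofReal_toReal hC]
  simp

end

section

variable {d : ℕ} {i : Fin d}

/-- The weak type `(1, 1)` bound for the centred maximal function on the line. -/
theorem mul_volume_exists_lt_le {v : ℝ → ℝ≥0∞} {l : ℝ} (hl : 0 < l) :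
    ENNReal.ofReal l * volume {t : ℝ | ∃ r : ℝ, 0 < r ∧
      ENNReal.ofReal (l * (2 * r)) < ∫⁻ s in Metric.closedBall t r, v s} ≤ 4 * ∫⁻ s, v s := by
  by_cases hI : ∫⁻ s, v s = ∞
  · simp [hI]
  set S := {t : ℝ | ∃ r : ℝ, 0 < r ∧
    ENNReal.ofReal (l * (2 * r)) < ∫⁻ s in Metric.closedBall t r, v s} with hS
  choose! r hr0 hr using fun t (ht : t ∈ S) ↦ ht
  have hb : ∀ t ∈ S, r t ≤ (∫⁻ s, v s).toReal / (2 * l) := by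
    intro t ht
    have h1 : ENNReal.ofReal (l * (2 * r t)) ≤ ∫⁻ s, v s :=
      (hr t ht).le.trans (setLIntegral_le_lintegral _ _)
    rw [ENNReal.ofReal_le_iff_le_toReal hI] at h1
    rw [le_div_iff₀ (by positivity)]; linarith
  obtain ⟨u, hu, hd, hc⟩ := Vitali.exists_disjoint_subfamily_covering_enlargement_closedBall
    S id r _ hb 4 (by norm_num)
  have hcount : u.Countable := hd.countable_of_nonempty_interior fun t ht ↦ by
    refine ⟨t, Metric.ball_subset_interior_closedBall ?_⟩
    exact Metric.mem_ball_self (hr0 t (hu ht))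
  have hd' : u.PairwiseDisjoint fun b ↦ Metric.closedBall b (r b) := hd
  have hsub : S ⊆ ⋃ b ∈ u, Metric.closedBall b (4 * r b) := by
    intro t ht
    obtain ⟨b, hb, hb'⟩ := hc t ht
    exact Set.mem_biUnion hb (hb' (Metric.mem_closedBall_self (hr0 t ht).le))
  calc ENNReal.ofReal l * volume S
      ≤ ENNReal.ofReal l * ∑' b : u, volume (Metric.closedBall (b : ℝ) (4 * r b)) := by
        gcongr
        exact (measure_mono hsub).trans (measure_biUnion_le _ hcount _)
    _ = ∑' b : u, 4 * ENNReal.ofReal (l * (2 * r b)) := by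
        rw [← ENNReal.tsum_mul_left]
        refine tsum_congr fun b ↦ ?_
        rw [Real.volume_closedBall, ← ENNReal.ofReal_mul hl.le,
          show (4 : ℝ≥0∞) = ENNReal.ofReal 4 by norm_num, ← ENNReal.ofReal_mul (by norm_num)]
        congr 1; ring
    _ ≤ ∑' b : u, 4 * ∫⁻ s in Metric.closedBall (b : ℝ) (r b), v s :=
        ENNReal.tsum_le_tsum fun b ↦ by gcongr; exact (hr b (hu b.2)).le
    _ = 4 * ∫⁻ s in ⋃ b ∈ u, Metric.closedBall b (r b), v s := by
        rw [ENNReal.tsum_mul_left, lintegral_biUnion hcount (fun b _ ↦ measurableSet_closedBall) hd']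
    _ ≤ _ := mul_le_mul_right (setLIntegral_le_lintegral _ _) 4

theorem lintegral_le_of_slices {F G : E d → ℝ≥0∞} (hF : Measurable F) (hG : Measurable G)
    (i : Fin d) (h : ∀ x, ∫⁻ t, F (x - sg i t) ≤ ∫⁻ t, G (x - sg i t)) :
    ∫⁻ x, F x ≤ ∫⁻ x, G x := by
  have key : ∀ H : E d → ℝ≥0∞,
      ∫⁻ x, H x = ∫⁻ y : Fin d → ℝ, H (WithLp.toLp 2 y) := fun H ↦
    ((PiLp.volume_preserving_toLp (Fin d)).lintegral_comp_emb
      (MeasurableEquiv.toLp 2 (Fin d → ℝ)).measurableEmbedding H).symm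
  rw [key, key]
  have hm : Measurable fun y : Fin d → ℝ ↦ (WithLp.toLp 2 y : E d) :=
    (MeasurableEquiv.toLp 2 (Fin d → ℝ)).measurable
  refine lintegral_le_of_lmarginal_le {i} (hF.comp hm) (hG.comp hm) fun x ↦ ?_
  have e : ∀ H : E d → ℝ≥0∞, ∫⁻ t, H (WithLp.toLp 2 (Function.update x i t)) =
      ∫⁻ t, H (WithLp.toLp 2 x - sg i t) := by
    intro H
    rw [← lintegral_sub_left_eq_self _ (x i)]
    refine lintegral_congr fun t ↦ ?_
    congr 1
    ext j
    rcases eq_or_ne j i with rfl | hj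
    · simp [sg]
    · simp [sg, hj]
  rw [lmarginal_singleton, lmarginal_singleton]
  exact (e F).trans_le ((h _).trans_eq (e G).symm)

/-- The average of `u` over the segment of radius `r` centred at `x` in the direction `i`. -/
def av (i : Fin d) (r : ℝ) (u : E d → ℝ≥0∞) (x : E d) : ℝ≥0∞ :=
  (ENNReal.ofReal (2 * r))⁻¹ * ∫⁻ t in Metric.closedBall 0 r, u (x - sg i t)

/-- The directional maximal function over dyadic radii. -/
def Mx (i : Fin d) (u : E d → ℝ≥0∞) (x : E d) : ℝ≥0∞ := ⨆ m : ℤ, av i (2 ^ m) u x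

theorem measurable_av {r : ℝ} {u : E d → ℝ≥0∞} (hu : Measurable u) : Measurable (av i r u) := by
  refine Measurable.const_mul ?_ _
  exact Measurable.lintegral_prod_right (f := fun (x : E d) (t : ℝ) ↦ u (x - sg i t))
    (measurable_shift hu i)

theorem measurable_Mx {u : E d → ℝ≥0∞} (hu : Measurable u) : Measurable (Mx i u) :=
  .iSup fun _ ↦ measurable_av hu

theorem setLIntegral_shift_line (u : E d → ℝ≥0∞) (x : E d) (t r : ℝ) :
    ∫⁻ s in Metric.closedBall 0 r, u (x - sg i t - sg i s) =
      ∫⁻ s in Metric.closedBall t r, u (x - sg i s) := by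
  rw [← lintegral_indicator measurableSet_closedBall,
    ← lintegral_indicator measurableSet_closedBall,
    ← lintegral_sub_right_eq_self _ t]
  refine lintegral_congr fun s ↦ ?_
  by_cases h : s ∈ Metric.closedBall t r
  · rw [Set.indicator_of_mem h, Set.indicator_of_mem (by simpa [dist_eq_norm] using h)]
    congr 1
    rw [sub_sub, ← sg_add]; congr 2; ring
  · rw [Set.indicator_of_notMem h, Set.indicator_of_notMem (by simpa [dist_eq_norm] using h)]

theorem mul_volume_Mx_lt_le {u : E d → ℝ≥0∞} (hu : Measurable u) {l : ℝ} (hl : 0 < l) :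
    ENNReal.ofReal l * volume {x | ENNReal.ofReal l < Mx i u x} ≤ 4 * ∫⁻ x, u x := by
  have hms : MeasurableSet {x | ENNReal.ofReal l < Mx i u x} :=
    measurableSet_lt measurable_const (measurable_Mx hu)
  rw [← lintegral_indicator_const hms, ← lintegral_const_mul _ hu]
  refine lintegral_le_of_slices (measurable_const.indicator hms) (hu.const_mul _) i fun x ↦ ?_
  have hm1 : Measurable fun t ↦ x - sg i t := measurable_const.sub (measurable_sg i)
  rw [lintegral_const_mul (r := 4) (f := fun t ↦ u (x - sg i t)) (hu.comp hm1)]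
  refine le_trans ?_ (mul_volume_exists_lt_le (v := fun t ↦ u (x - sg i t)) hl)
  have e : ∫⁻ t, {x | ENNReal.ofReal l < Mx i u x}.indicator (fun _ ↦ ENNReal.ofReal l)
      (x - sg i t) = ENNReal.ofReal l *
        volume {t | x - sg i t ∈ {x | ENNReal.ofReal l < Mx i u x}} := by
    exact lintegral_indicator_const (hm1 hms) _
  rw [e]
  · refine mul_le_mul_right (measure_mono fun t ht ↦ ?_) _
    have ht' : ENNReal.ofReal l < ⨆ m : ℤ, av i (2 ^ m) u (x - sg i t) := ht
    obtain ⟨m, hm⟩ := lt_iSup_iff.1 ht'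
    have h2 : (0 : ℝ) < 2 ^ m := by positivity
    refine ⟨2 ^ m, h2, ?_⟩
    rw [av, setLIntegral_shift_line, mul_comm, ← div_eq_mul_inv, ENNReal.lt_div_iff_mul_lt
      (.inl (by simpa using h2)) (.inl (by finiteness)), ← ENNReal.ofReal_mul hl.le] at hm
    exact hm

/-- A real interpolation argument. -/
theorem lintegral_rpow_le_of_weak {F u : E d → ℝ≥0∞} (hF : Measurable F) (hu : Measurable u)
    (hFt : ∀ x, F x ≠ ∞) (hut : ∀ x, u x ≠ ∞) {c : ℝ} (hc : 0 ≤ c)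
    (h : ∀ l : ℝ, 0 < l → volume {x | ENNReal.ofReal l < F x} ≤
      ENNReal.ofReal (c / l) * ∫⁻ x in {x | ENNReal.ofReal l < 2 * u x}, u x) {s : ℝ} (hs : 1 < s) :
    ∫⁻ x, F x ^ s ≤ ENNReal.ofReal (c * (s / (s - 1)) * 2 ^ (s - 1)) * ∫⁻ x, u x ^ s := by
  have hs0 : 0 < s := by linarith
  have hs1 : 0 < s - 1 := by linarith
  have e1 : ∫⁻ x, F x ^ s = ENNReal.ofReal s *
      ∫⁻ l in Set.Ioi (0 : ℝ), volume {x | l < (F x).toReal} * ENNReal.ofReal (l ^ (s - 1)) := by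
    rw [← lintegral_rpow_eq_lintegral_meas_lt_mul volume (.of_forall fun x ↦ toReal_nonneg)
      hF.ennreal_toReal.aemeasurable hs0]
    refine lintegral_congr fun x ↦ ?_
    rw [← ENNReal.ofReal_rpow_of_nonneg toReal_nonneg hs0.le, ENNReal.ofReal_toReal (hFt x)]
  have e2 : ∀ l ∈ Set.Ioi (0 : ℝ), volume {x | l < (F x).toReal} * ENNReal.ofReal (l ^ (s - 1)) ≤
      ∫⁻ x, u x * (Set.Ioo 0 (2 * (u x).toReal)).indicator
        (fun l ↦ ENNReal.ofReal (c * l ^ (s - 2))) l := by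
    intro l (hl : 0 < l)
    have a1 : {x | l < (F x).toReal} = {x | ENNReal.ofReal l < F x} := by
      ext x; exact (ENNReal.ofReal_lt_iff_lt_toReal hl.le (hFt x)).symm
    have hms : MeasurableSet {x | ENNReal.ofReal l < 2 * u x} :=
      measurableSet_lt measurable_const (hu.const_mul _)
    have a2 : ∀ x, u x * (Set.Ioo 0 (2 * (u x).toReal)).indicator
        (fun l ↦ ENNReal.ofReal (c * l ^ (s - 2))) l = ENNReal.ofReal (c * l ^ (s - 2)) *
          {x | ENNReal.ofReal l < 2 * u x}.indicator u x := by
      intro x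
      have a3 : ENNReal.ofReal l < 2 * u x ↔ l < 2 * (u x).toReal := by
        rw [ENNReal.ofReal_lt_iff_lt_toReal hl.le (ENNReal.mul_ne_top (by simp) (hut x))]
        simp
      by_cases hx : ENNReal.ofReal l < 2 * u x
      · rw [Set.indicator_of_mem (show l ∈ Set.Ioo 0 _ from ⟨hl, a3.1 hx⟩),
          Set.indicator_of_mem (by exact hx), mul_comm]
      · rw [Set.indicator_of_notMem (fun h ↦ hx (a3.2 h.2)),
          Set.indicator_of_notMem (by exact hx)]; simp
    rw [a1, lintegral_congr a2, lintegral_const_mul _ (hu.indicator hms), lintegral_indicator hms]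
    calc _ ≤ ENNReal.ofReal (c / l) * (∫⁻ x in {x | ENNReal.ofReal l < 2 * u x}, u x) *
          ENNReal.ofReal (l ^ (s - 1)) := by gcongr; exact h l hl
      _ = _ := by
        rw [mul_right_comm, ← ENNReal.ofReal_mul (by positivity)]
        congr 2
        rw [show s - 1 = (s - 2) + 1 by ring, Real.rpow_add_one hl.ne']
        field_simp
  have e3 : ∀ x, ∫⁻ l in Set.Ioi (0 : ℝ), u x * (Set.Ioo 0 (2 * (u x).toReal)).indicator
        (fun l ↦ ENNReal.ofReal (c * l ^ (s - 2))) l ≤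
      ENNReal.ofReal (c * (1 / (s - 1)) * 2 ^ (s - 1)) * u x ^ s := by
    intro x
    set w := (u x).toReal with hw
    have hw0 : 0 ≤ w := toReal_nonneg
    have hux : u x = ENNReal.ofReal w := (ENNReal.ofReal_toReal (hut x)).symm
    have b1 : ∫⁻ l in Set.Ioi (0 : ℝ), (Set.Ioo 0 (2 * w)).indicator
        (fun l ↦ ENNReal.ofReal (c * l ^ (s - 2))) l =
        ENNReal.ofReal (c * ((2 * w) ^ (s - 1) / (s - 1))) := by
      rw [setLIntegral_indicator measurableSet_Ioo, Set.inter_eq_left.2 fun _ h ↦ h.1,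
        ← ofReal_integral_eq_lintegral_ofReal]
      · rw [← integral_Ioc_eq_integral_Ioo, ← intervalIntegral.integral_of_le (by positivity),
          intervalIntegral.integral_const_mul, integral_rpow (.inl (by linarith)),
          Real.zero_rpow (by linarith), sub_zero]
        rw [show s - 2 + 1 = s - 1 by ring]
      · have := (intervalIntegral.intervalIntegrable_rpow' (a := 0) (b := 2 * w) (r := s - 2)
          (by linarith)).1
        exact (this.mono_set Set.Ioo_subset_Ioc_self).const_mul c
      · refine (ae_restrict_mem measurableSet_Ioo).mono fun l hl ↦ ?_
        have := hl.1.le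
        positivity
    rw [lintegral_const_mul' _ _ (hut x), b1, hux, ENNReal.ofReal_rpow_of_nonneg hw0 hs0.le,
      ← ENNReal.ofReal_mul hw0, ← ENNReal.ofReal_mul (by positivity)]
    refine ENNReal.ofReal_le_ofReal (le_of_eq ?_)
    rw [Real.mul_rpow (by norm_num) hw0]
    rcases hw0.eq_or_lt with h0 | h0
    · rw [← h0, Real.zero_rpow hs0.ne']; ring
    · rw [show w ^ s = w ^ (s - 1) * w by rw [← Real.rpow_add_one h0.ne']; congr 1; ring]
      ring
  have hmeas : Measurable fun q : ℝ × E d ↦ u q.2 * (Set.Ioo 0 (2 * (u q.2).toReal)).indicator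
        (fun l ↦ ENNReal.ofReal (c * l ^ (s - 2))) q.1 := by
    refine (hu.comp measurable_snd).mul ?_
    have : MeasurableSet {q : ℝ × E d | 0 < q.1 ∧ q.1 < 2 * (u q.2).toReal} :=
      (measurableSet_lt measurable_const measurable_fst).inter
        (measurableSet_lt measurable_fst ((hu.comp measurable_snd).ennreal_toReal.const_mul _))
    exact Measurable.indicator (f := fun q : ℝ × E d ↦ ENNReal.ofReal (c * q.1 ^ (s - 2)))
      (by fun_prop) this
  calc ∫⁻ x, F x ^ s ≤ ENNReal.ofReal s * ∫⁻ l in Set.Ioi (0 : ℝ),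
        ∫⁻ x, u x * (Set.Ioo 0 (2 * (u x).toReal)).indicator
          (fun l ↦ ENNReal.ofReal (c * l ^ (s - 2))) l := by
        rw [e1]; exact mul_le_mul_right (setLIntegral_mono' measurableSet_Ioi e2) _
    _ = ENNReal.ofReal s * ∫⁻ x, ∫⁻ l in Set.Ioi (0 : ℝ),
        u x * (Set.Ioo 0 (2 * (u x).toReal)).indicator
          (fun l ↦ ENNReal.ofReal (c * l ^ (s - 2))) l := by
        rw [lintegral_lintegral_swap hmeas.aemeasurable]
    _ ≤ ENNReal.ofReal s * (ENNReal.ofReal (c * (1 / (s - 1)) * 2 ^ (s - 1)) *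
          ∫⁻ x, u x ^ s) := by
        refine mul_le_mul_right ?_ _
        rw [← lintegral_const_mul _ (by fun_prop)]
        exact lintegral_mono e3
    _ = _ := by
        rw [← mul_assoc, ← ENNReal.ofReal_mul hs0.le]; congr 2; ring

theorem Mx_add_le {u v : E d → ℝ≥0∞} (hu : Measurable u) (x : E d) :
    Mx i (fun x ↦ u x + v x) x ≤ Mx i u x + Mx i v x := by
  refine iSup_le fun m ↦ ?_
  rw [av, lintegral_add_left (f := fun t ↦ u (x - sg i t)) (measurable_wk_aux hu x), mul_add]
  exact add_le_add (le_iSup (fun m : ℤ ↦ av i (2 ^ m) u x) m)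
    (le_iSup (fun m : ℤ ↦ av i (2 ^ m) v x) m)

theorem Mx_mono {u v : E d → ℝ≥0∞} (h : ∀ x, u x ≤ v x) (x : E d) : Mx i u x ≤ Mx i v x :=
  iSup_mono fun _ ↦ mul_le_mul_right (lintegral_mono fun _ ↦ h _) _

theorem Mx_const_le (c : ℝ≥0∞) (x : E d) : Mx i (fun _ ↦ c) x ≤ c := by
  refine iSup_le fun m ↦ ?_
  have h2 : (0 : ℝ) < 2 ^ m := by positivity
  rw [av, setLIntegral_const, Real.volume_closedBall, mul_comm c, ← mul_assoc,
    ENNReal.inv_mul_cancel (by simpa using h2) (by finiteness), one_mul]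

theorem volume_Mx_lt_le {u : E d → ℝ≥0∞} (hu : Measurable u) {l : ℝ} (hl : 0 < l) :
    volume {x | ENNReal.ofReal l < Mx i u x} ≤
      ENNReal.ofReal (8 / l) * ∫⁻ x in {x | ENNReal.ofReal l < 2 * u x}, u x := by
  have hms : MeasurableSet {x | ENNReal.ofReal l < 2 * u x} :=
    measurableSet_lt measurable_const (hu.const_mul _)
  set w := {x | ENNReal.ofReal l < 2 * u x}.indicator u with hw
  have hwm : Measurable w := hu.indicator hms
  have h1 : ∀ x, u x ≤ ENNReal.ofReal (l / 2) + w x := by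
    intro x
    by_cases hx : ENNReal.ofReal l < 2 * u x
    · rw [hw, Set.indicator_of_mem (by exact hx)]; exact le_add_self
    · refine le_add_right ?_
      rw [ENNReal.ofReal_div_of_pos (by norm_num), ENNReal.le_div_iff_mul_le (by simp) (by simp)]
      rw [mul_comm]; simpa using not_lt.1 hx
  have h2 : {x | ENNReal.ofReal l < Mx i u x} ⊆ {x | ENNReal.ofReal (l / 2) < Mx i w x} := by
    intro x (hx : ENNReal.ofReal l < Mx i u x)
    show ENNReal.ofReal (l / 2) < Mx i w x
    by_contra! hn
    refine hx.not_ge ((Mx_mono h1 x).trans ((Mx_add_le measurable_const x).trans ?_))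
    refine (add_le_add (Mx_const_le _ x) hn).trans ?_
    rw [← ENNReal.ofReal_add (by positivity) (by positivity), add_halves]
  have h3 := mul_volume_Mx_lt_le (i := i) hwm (half_pos hl)
  rw [hw, lintegral_indicator hms, ← hw] at h3
  calc _ ≤ volume {x | ENNReal.ofReal (l / 2) < Mx i w x} := measure_mono h2
    _ = ENNReal.ofReal (2 / l) * (ENNReal.ofReal (l / 2) *
        volume {x | ENNReal.ofReal (l / 2) < Mx i w x}) := by
      rw [← mul_assoc, ← ENNReal.ofReal_mul (by positivity), div_mul_div_cancel₀ hl.ne']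
      simp
    _ ≤ ENNReal.ofReal (2 / l) * (4 * ∫⁻ x in {x | ENNReal.ofReal l < 2 * u x}, u x) :=
      mul_le_mul_right h3 _
    _ = _ := by
      rw [← mul_assoc, show (4 : ℝ≥0∞) = ENNReal.ofReal 4 by norm_num,
        ← ENNReal.ofReal_mul (by positivity)]
      congr 2; ring

/-- The strong type bound for the directional maximal function. -/
theorem lintegral_Mx_rpow_le {u : E d → ℝ≥0∞} (hu : Measurable u) {T : ℝ≥0∞} (hT : T ≠ ∞)
    (huT : ∀ x, u x ≤ T) {s : ℝ} (hs : 1 < s) :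
    ∫⁻ x, Mx i u x ^ s ≤ ENNReal.ofReal (8 * (s / (s - 1)) * 2 ^ (s - 1)) * ∫⁻ x, u x ^ s :=
  lintegral_rpow_le_of_weak (measurable_Mx hu) hu
    (fun x ↦ ne_top_of_le_ne_top hT ((Mx_mono huT x).trans (Mx_const_le T x)))
    (fun x ↦ ne_top_of_le_ne_top hT (huT x)) (by norm_num) (fun _ hl ↦ volume_Mx_lt_le hu hl) hs

theorem kap_le_tsum {y : ℝ} (hy : 0 < y) (t : ℝ) : kap y t ≤ ∑' j : ℕ,
    ENNReal.ofReal (8 * (1 / 2) ^ j) * ((ENNReal.ofReal (2 * (2 ^ j * y)))⁻¹ *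
      (Metric.closedBall (0 : ℝ) (2 ^ j * y)).indicator 1 t) := by
  obtain ⟨j, hj1, hj2⟩ : ∃ j : ℕ, |t| ≤ 2 ^ j * y ∧ (2 ^ j * y) ≤ 2 * (y + |t|) := by
    obtain ⟨n, hn1, hn2⟩ := exists_nat_pow_near (x := 1 + |t| / y)
      (by have := abs_nonneg t; have : 0 ≤ |t| / y := by positivity
          linarith) (one_lt_two)
    refine ⟨n + 1, ?_, ?_⟩
    · have : |t| / y ≤ 2 ^ (n + 1) := by linarith
      rwa [div_le_iff₀ hy] at this
    · rw [pow_succ]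
      have : 2 ^ n * y ≤ (1 + |t| / y) * y := by gcongr
      rw [add_mul, div_mul_cancel₀ _ hy.ne'] at this
      linarith
  refine le_trans ?_ (ENNReal.le_tsum j)
  rw [Set.indicator_of_mem (by simpa [dist_eq_norm] using hj1), Pi.one_apply, mul_one,
    ← ENNReal.ofReal_inv_of_pos (by positivity), ← ENNReal.ofReal_mul (by positivity), kap]
  refine ENNReal.ofReal_le_ofReal ?_
  unfold kr
  have h0 : 0 < y + |t| := by have := abs_nonneg t; linarith
  have h1 : (2 ^ j * y) ^ 2 ≤ 4 * (y + |t|) ^ 2 := by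
    have : (2 ^ j * y) ^ 2 ≤ (2 * (y + |t|)) ^ 2 := by gcongr
    linarith
  have e : 8 * (1 / 2) ^ j * (2 * (2 ^ j * y))⁻¹ = 4 * y / (2 ^ j * y) ^ 2 := by
    rw [one_div, inv_pow]; field_simp; norm_num
  rw [e, div_le_div_iff₀ (by positivity) (by positivity)]
  nlinarith

theorem wk_le_Mx {u : E d → ℝ≥0∞} (hu : Measurable u) (m : ℤ) (x : E d) :
    wk i (2 ^ m) u x ≤ 16 * Mx i u x := by
  have hum : Measurable fun t ↦ u (x - sg i t) := measurable_wk_aux hu x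
  have h2 : (0 : ℝ) < 2 ^ m := by positivity
  calc wk i (2 ^ m) u x
      ≤ ∫⁻ t, ∑' j : ℕ, ENNReal.ofReal (8 * (1 / 2) ^ j) *
          ((ENNReal.ofReal (2 * (2 ^ j * 2 ^ m)))⁻¹ *
          (Metric.closedBall (0 : ℝ) (2 ^ j * 2 ^ m)).indicator (fun t ↦ u (x - sg i t)) t) := by
        refine lintegral_mono fun t ↦ ?_
        refine (mul_le_mul_left (kap_le_tsum h2 t) _).trans_eq ?_
        rw [← ENNReal.tsum_mul_right]
        refine tsum_congr fun j ↦ ?_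
        by_cases ht : t ∈ Metric.closedBall (0 : ℝ) (2 ^ j * 2 ^ m)
        · rw [Set.indicator_of_mem ht, Set.indicator_of_mem ht]; simp [mul_assoc]
        · rw [Set.indicator_of_notMem ht, Set.indicator_of_notMem ht]; simp
    _ = ∑' j : ℕ, ENNReal.ofReal (8 * (1 / 2) ^ j) * av i (2 ^ j * 2 ^ m) u x := by
        rw [lintegral_tsum fun j ↦ ((((hum.indicator measurableSet_closedBall).const_mul _).const_mul
          _).aemeasurable)]
        refine tsum_congr fun j ↦ ?_
        rw [lintegral_const_mul _ ((hum.indicator measurableSet_closedBall).const_mul _),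
          lintegral_const_mul _ (hum.indicator measurableSet_closedBall),
          lintegral_indicator measurableSet_closedBall, av]
    _ ≤ ∑' j : ℕ, ENNReal.ofReal (8 * (1 / 2) ^ j) * Mx i u x := by
        refine ENNReal.tsum_le_tsum fun j ↦ mul_le_mul_right ?_ _
        have e : (2 : ℝ) ^ j * 2 ^ m = 2 ^ ((j : ℤ) + m) := by
          rw [zpow_add₀ two_ne_zero, zpow_natCast]
        rw [e]
        exact le_iSup (fun m : ℤ ↦ av i (2 ^ m) u x) _
    _ = _ := by
        rw [ENNReal.tsum_mul_right, ← ENNReal.ofReal_tsum_of_nonneg (fun j ↦ by positivity)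
          (summable_geometric_two.mul_left 8), tsum_mul_left, tsum_geometric_two]
        norm_num

end

section

variable {d : ℕ} {i : Fin d}

/-- The `L^s` norm of an extended nonnegative function. -/
def nm (s : ℝ) (u : E d → ℝ≥0∞) : ℝ≥0∞ := (∫⁻ x, u x ^ s) ^ (1 / s)

theorem nm_mono {s : ℝ} (hs : 0 ≤ s) {u v : E d → ℝ≥0∞} (h : ∀ x, u x ≤ v x) : nm s u ≤ nm s v :=
  ENNReal.rpow_le_rpow (lintegral_mono fun x ↦ ENNReal.rpow_le_rpow (h x) hs) (by positivity)

theorem nm_const_mul {s : ℝ} (hs : 0 < s) {c : ℝ≥0∞} (hc : c ≠ ∞) (u : E d → ℝ≥0∞) :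
    nm s (fun x ↦ c * u x) = c * nm s u := by
  unfold nm
  simp only [ENNReal.mul_rpow_of_nonneg _ _ hs.le]
  rw [lintegral_const_mul' _ _ (by finiteness), ENNReal.mul_rpow_of_nonneg _ _ (by positivity),
    ← ENNReal.rpow_mul, mul_one_div_cancel hs.ne', ENNReal.rpow_one]

theorem nm_add_le {s : ℝ} (hs : 1 ≤ s) {u v : E d → ℝ≥0∞} (hu : Measurable u)
    (hv : Measurable v) : nm s (fun x ↦ u x + v x) ≤ nm s u + nm s v :=
  ENNReal.lintegral_Lp_add_le hu.aemeasurable hv.aemeasurable hs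

theorem nm_sum_le {ι : Type*} {s : ℝ} (hs : 1 ≤ s) (S : Finset ι) {u : ι → E d → ℝ≥0∞}
    (hu : ∀ j, Measurable (u j)) : nm s (fun x ↦ ∑ j ∈ S, u j x) ≤ ∑ j ∈ S, nm s (u j) := by
  classical
  induction S using Finset.induction_on with
  | empty => simp [nm, ENNReal.zero_rpow_of_pos (show 0 < s by linarith),
      show 0 < s by linarith]
  | insert a S ha ih =>
    simp only [Finset.sum_insert ha]
    exact (nm_add_le hs (hu a) (Finset.measurable_fun_sum S fun j _ ↦ hu j)).trans (by gcongr)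

theorem nm_Mx_le {u : E d → ℝ≥0∞} (hu : Measurable u) {T : ℝ≥0∞} (hT : T ≠ ∞)
    (huT : ∀ x, u x ≤ T) {s : ℝ} (hs : 1 < s) :
    nm s (Mx i u) ≤ ENNReal.ofReal (16 * (s / (s - 1))) * nm s u := by
  have hs0 : 0 < s := by linarith
  have hs1 : 0 < s - 1 := by linarith
  have h1 : 1 ≤ s / (s - 1) := by rw [one_le_div hs1]; linarith
  refine (ENNReal.rpow_le_rpow (lintegral_Mx_rpow_le hu hT huT hs) (by positivity)).trans ?_
  rw [ENNReal.mul_rpow_of_nonneg _ _ (by positivity), ENNReal.ofReal_rpow_of_nonneg (by positivity)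
    (by positivity)]
  refine mul_le_mul_left (ENNReal.ofReal_le_ofReal ?_) _
  rw [one_div, Real.rpow_inv_le_iff_of_pos (by positivity) (by positivity) hs0,
    show 16 * (s / (s - 1)) = (8 * (s / (s - 1))) * 2 by ring,
    Real.mul_rpow (by positivity) (by norm_num)]
  gcongr
  · refine Real.self_le_rpow_of_one_le (by linarith) hs.le
  · norm_num
  · linarith

/-- The iteration defining the Rubio de Francia majorant. -/
def rdf (c : ℝ≥0∞) (u : E d → ℝ≥0∞) : ℕ → E d → ℝ≥0∞
  | 0 => u
  | N + 1 => fun x ↦ u x + c * ∑ i, Mx i (rdf c u N) x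

variable {c : ℝ≥0∞} {u : E d → ℝ≥0∞}

theorem measurable_rdf (hu : Measurable u) (N : ℕ) : Measurable (rdf c u N) := by
  induction N with
  | zero => exact hu
  | succ N ih => exact hu.add ((Finset.measurable_fun_sum _ fun i _ ↦ measurable_Mx ih).const_mul c)

theorem rdf_le_succ (N : ℕ) (x : E d) : rdf c u N x ≤ rdf c u (N + 1) x := by
  induction N generalizing x with
  | zero => exact le_self_add
  | succ N ih =>
    exact add_le_add le_rfl (mul_le_mul_right (Finset.sum_le_sum fun i _ ↦ Mx_mono ih x) c)

theorem exists_rdf_le (hc : c ≠ ∞) {T : ℝ≥0∞} (hT : T ≠ ∞) (huT : ∀ x, u x ≤ T) (N : ℕ) :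
    ∃ T' : ℝ≥0∞, T' ≠ ∞ ∧ ∀ x, rdf c u N x ≤ T' := by
  induction N with
  | zero => exact ⟨T, hT, huT⟩
  | succ N ih =>
    obtain ⟨T', hT', h⟩ := ih
    refine ⟨T + c * ∑ _i : Fin d, T', ENNReal.add_ne_top.2 ⟨hT, ENNReal.mul_ne_top hc
      (ENNReal.sum_ne_top.2 fun _ _ ↦ hT')⟩, fun x ↦ add_le_add (huT x)
      (mul_le_mul_right (Finset.sum_le_sum fun i _ ↦ ?_) c)⟩
    exact (Mx_mono h x).trans (Mx_const_le T' x)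

theorem nm_rdf_le (hu : Measurable u) {T : ℝ≥0∞} (hT : T ≠ ∞) (huT : ∀ x, u x ≤ T) {s : ℝ}
    (hs : 1 < s) (hc : c = ENNReal.ofReal (1 / (32 * (d + 1) * (s / (s - 1))))) (N : ℕ) :
    nm s (rdf c u N) ≤ 2 * nm s u := by
  have hs1 : 0 < s - 1 := by linarith
  have hs0 : 0 < s := by linarith
  have hct : c ≠ ∞ := by rw [hc]; finiteness
  induction N with
  | zero => rw [two_mul]; exact le_self_add
  | succ N ih =>
    obtain ⟨T', hT', h⟩ := exists_rdf_le hct hT huT N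
    have hm : ∀ i, Measurable (Mx i (rdf c u N)) := fun i ↦ measurable_Mx (measurable_rdf hu N)
    have hcd : c * ∑ _i : Fin d, ENNReal.ofReal (16 * (s / (s - 1))) ≤ ENNReal.ofReal (1 / 2) := by
      rw [Finset.sum_const, Finset.card_univ, Fintype.card_fin, nsmul_eq_mul, hc,
        ← ENNReal.ofReal_natCast, ← ENNReal.ofReal_mul (by positivity),
        ← ENNReal.ofReal_mul (by positivity)]
      refine ENNReal.ofReal_le_ofReal ?_
      have : (0 : ℝ) ≤ d := by positivity
      rw [show 1 / (32 * ((d : ℝ) + 1) * (s / (s - 1))) * (d * (16 * (s / (s - 1)))) =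
        (d / (d + 1)) * (1 / 2) by field_simp; ring]
      have : (d : ℝ) / (d + 1) ≤ 1 := by rw [div_le_one (by positivity)]; linarith
      linarith
    calc nm s (rdf c u (N + 1))
        ≤ nm s u + nm s (fun x ↦ c * ∑ i, Mx i (rdf c u N) x) :=
          nm_add_le hs.le hu ((Finset.measurable_fun_sum _ fun i _ ↦ hm i).const_mul c)
      _ ≤ nm s u + c * ∑ _i : Fin d, ENNReal.ofReal (16 * (s / (s - 1))) * nm s (rdf c u N) := by
          rw [nm_const_mul hs0 hct]
          gcongr
          refine (nm_sum_le hs.le _ hm).trans (Finset.sum_le_sum fun i _ ↦ ?_)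
          exact nm_Mx_le (measurable_rdf hu N) hT' h hs
      _ ≤ nm s u + ENNReal.ofReal (1 / 2) * (2 * nm s u) := by
          rw [← Finset.sum_mul, ← mul_assoc]
          gcongr
      _ = 2 * nm s u := by
          rw [← mul_assoc, show ENNReal.ofReal (1 / 2) * 2 = 1 by
            rw [show (2 : ℝ≥0∞) = ENNReal.ofReal 2 by norm_num, ← ENNReal.ofReal_mul (by norm_num)]
            norm_num, one_mul, two_mul]

theorem A1_iSup_rdf (hu : Measurable u) {K : ℝ} (hK : 0 < K) (i : Fin d) :
    A1 i (32 * K) (fun x ↦ ⨆ N, rdf (ENNReal.ofReal (1 / K)) u N x) := by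
  set c := ENNReal.ofReal (1 / K) with hc
  have hmono : ∀ x, Monotone fun N ↦ rdf c u N x := fun x ↦
    monotone_nat_of_le_succ fun N ↦ rdf_le_succ N x
  have hmeas : Measurable fun x ↦ ⨆ N, rdf c u N x := .iSup fun N ↦ measurable_rdf hu N
  have h1 : ∀ x, Mx i (fun x ↦ ⨆ N, rdf c u N x) x ≤ ENNReal.ofReal K * ⨆ N, rdf c u N x := by
    intro x
    refine iSup_le fun m ↦ ?_
    rw [av, lintegral_iSup (fun N ↦ measurable_wk_aux (measurable_rdf hu N) x)
      fun a b hab t ↦ hmono _ hab, ENNReal.mul_iSup]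
    refine iSup_le fun N ↦ ?_
    have h2 : av i (2 ^ m) (rdf c u N) x ≤ Mx i (rdf c u N) x :=
      le_iSup (fun m : ℤ ↦ av i (2 ^ m) (rdf c u N) x) m
    have h3 : c * Mx i (rdf c u N) x ≤ ⨆ N, rdf c u N x := by
      refine le_trans ?_ (le_iSup (fun N ↦ rdf c u N x) (N + 1))
      refine le_trans ?_ le_add_self
      exact mul_le_mul_right (Finset.single_le_sum (f := fun i ↦ Mx i (rdf c u N) x)
        (fun _ _ ↦ bot_le) (Finset.mem_univ i)) c
    calc _ ≤ Mx i (rdf c u N) x := h2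
      _ = ENNReal.ofReal K * (c * Mx i (rdf c u N) x) := by
        rw [← mul_assoc, hc, ← ENNReal.ofReal_mul hK.le, mul_one_div_cancel hK.ne']; simp
      _ ≤ _ := mul_le_mul_right h3 _
  intro y hy x
  obtain ⟨m, hm1, hm2⟩ := exists_mem_Ioc_zpow (x := y) (y := 2) hy one_lt_two
  have h2 : ∀ t, kap y t ≤ 2 * kap (2 ^ (m + 1)) t := fun t ↦ by
    refine (kap_le_dil' hy hm2 t).trans (mul_le_mul_left ?_ _)
    rw [show (2 : ℝ≥0∞) = ENNReal.ofReal 2 by norm_num]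
    refine ENNReal.ofReal_le_ofReal ?_
    rw [div_le_iff₀ hy, zpow_add_one₀ two_ne_zero]; linarith
  calc wk i y (fun x ↦ ⨆ N, rdf c u N x) x
      ≤ 2 * wk i (2 ^ (m + 1)) (fun x ↦ ⨆ N, rdf c u N x) x := by
        unfold wk
        rw [← lintegral_const_mul' _ _ (by simp)]
        refine lintegral_mono fun t ↦ ?_
        rw [← mul_assoc]
        exact mul_le_mul_left (h2 t) _
    _ ≤ 2 * (16 * (ENNReal.ofReal K * ⨆ N, rdf c u N x)) := by
        gcongr
        exact (wk_le_Mx hmeas _ x).trans (mul_le_mul_right (h1 x) _)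
    _ = _ := by
        rw [ENNReal.ofReal_mul (by norm_num), show ENNReal.ofReal 32 = 2 * 16 by norm_num]
        simp only [mul_assoc]

theorem A1_min {A : ℝ} (hA : 4 ≤ A) {W : E d → ℝ≥0∞} (h : A1 i A W) (T : ℝ≥0∞) :
    A1 i A (fun x ↦ min (W x) T) := by
  intro y hy x
  rw [mul_min]
  refine le_min ((wk_mono (fun x ↦ min_le_left _ _) x).trans (h y hy x))
    ((wk_mono (fun x ↦ min_le_right _ _) x).trans ((wk_const_le hy T x).trans ?_))
  refine mul_le_mul_left ?_ _
  rw [show (4 : ℝ≥0∞) = ENNReal.ofReal 4 by norm_num]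
  exact ENNReal.ofReal_le_ofReal hA

/-- Every bounded function has a bounded `A₁` majorant with comparable `L^s` norm. -/
theorem exists_A1_majorant (hu : Measurable u) {T : ℝ≥0∞} (hT : T ≠ ∞) (huT : ∀ x, u x ≤ T)
    {s : ℝ} (hs : 1 < s) : ∃ W : E d → ℝ≥0∞, Measurable W ∧ (∀ x, u x ≤ W x) ∧
      (∀ x, W x ≤ T) ∧ (∀ i, A1 i (1024 * (d + 1) * (s / (s - 1))) W) ∧ nm s W ≤ 2 * nm s u := by
  have hs1 : 0 < s - 1 := by linarith
  have hs0 : 0 < s := by linarith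
  have h1 : 1 ≤ s / (s - 1) := by rw [one_le_div hs1]; linarith
  have hd : (0 : ℝ) ≤ d := by positivity
  set K : ℝ := 32 * (d + 1) * (s / (s - 1)) with hK
  have hK4 : 4 ≤ 32 * K := by
    have : 1 * 1 ≤ ((d : ℝ) + 1) * (s / (s - 1)) := by gcongr; linarith
    rw [hK]; nlinarith
  set R := fun x ↦ ⨆ N, rdf (ENNReal.ofReal (1 / K)) u N x with hR
  have hRm : Measurable R := .iSup fun N ↦ measurable_rdf hu N
  refine ⟨fun x ↦ min (R x) T, hRm.min measurable_const, fun x ↦ le_min ?_ (huT x),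
    fun x ↦ min_le_right _ _, fun i ↦ ?_, ?_⟩
  · exact le_iSup (fun N ↦ rdf (ENNReal.ofReal (1 / K)) u N x) 0
  · rw [show 1024 * ((d : ℝ) + 1) * (s / (s - 1)) = 32 * K by rw [hK]; ring]
    exact A1_min hK4 (A1_iSup_rdf hu (by linarith) i) T
  · refine (nm_mono hs0.le fun x ↦ min_le_left _ _).trans ?_
    have hle : ∀ N, nm s (rdf (ENNReal.ofReal (1 / K)) u N) ≤ 2 * nm s u :=
      fun N ↦ nm_rdf_le hu hT huT hs rfl N
    have e : ∫⁻ x, R x ^ s = ⨆ N, ∫⁻ x, rdf (ENNReal.ofReal (1 / K)) u N x ^ s := by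
      rw [← lintegral_iSup (fun N ↦ (measurable_rdf hu N).pow_const s)
        fun a b hab x ↦ ENNReal.rpow_le_rpow
          (monotone_nat_of_le_succ (f := fun N ↦ rdf (ENNReal.ofReal (1 / K)) u N x)
            (fun N ↦ rdf_le_succ N x) hab) hs0.le]
      refine lintegral_congr fun x ↦ ?_
      exact (ENNReal.orderIsoRpow s hs0).map_iSup _
    have e' : nm s R = (⨆ N, ∫⁻ x, rdf (ENNReal.ofReal (1 / K)) u N x ^ s) ^ s⁻¹ := by
      rw [nm, e, one_div s]
    refine e'.trans_le ?_
    rw [ENNReal.rpow_inv_le_iff hs0]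
    refine iSup_le fun N ↦ ?_
    have := hle N
    rwa [nm, one_div s, ENNReal.rpow_inv_le_iff hs0] at this

end

section

variable {d : ℕ} {i : Fin d}

/-- The bound obtained by extrapolation, for the truncations of `X`. -/
theorem lintegral_min_rpow_le {q : ℝ} (hq : 2 < q) {X Y : E d → ℝ≥0∞} (hX : Measurable X)
    (hY : Measurable Y) (hX2 : ∫⁻ x, X x ^ 2 ≠ ∞) {N : ℝ≥0∞}
    (h : ∀ W : E d → ℝ≥0∞, Measurable W → ∀ T : ℝ≥0∞, T ≠ ∞ → (∀ x, W x ≤ T) →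
      (∀ i, A1 i (1024 * (d + 1) * (q - 1)) W) →
      ∫⁻ x, X x ^ 2 * W x ^ (1 - 1 / q) ≤ N ^ 2 * ∫⁻ x, Y x ^ 2 * W x ^ (1 - 1 / q))
    {T : ℝ≥0∞} (hT : T ≠ ∞) :
    (∫⁻ x, (min (X x) T) ^ q) ^ (1 / q) ≤ 2 * N * nm q Y := by
  have hq0 : 0 < q := by linarith
  have hq2 : 0 < q - 2 := by linarith
  set θ := 1 - 1 / q with hθ
  have hθ0 : 0 < θ := by
    have : 1 / q < 1 := by rw [div_lt_one hq0]; linarith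
    rw [hθ]; linarith
  have hθq : θ = (q - 1) / q := by rw [hθ]; field_simp
  set s := (q - 1) / (q - 2) with hs
  have hs1 : 1 < s := by rw [hs, one_lt_div hq2]; linarith
  have hs0 : 0 < s := by linarith
  have hss : s / (s - 1) = q - 1 := by
    have : s - 1 = 1 / (q - 2) := by rw [hs]; field_simp; ring
    rw [this, hs]; field_simp
  set m : E d → ℝ≥0∞ := fun x ↦ min (X x) T with hm
  have hmm : Measurable m := hX.min measurable_const
  set u : E d → ℝ≥0∞ := fun x ↦ m x ^ ((q - 2) / θ) with hu
  have hα : 0 ≤ (q - 2) / θ := by positivity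
  obtain ⟨W, hW, huW, hWT, hWA, hWs⟩ := exists_A1_majorant (hmm.pow_const ((q - 2) / θ))
    (T := T ^ ((q - 2) / θ)) (by finiteness) (fun x ↦ by gcongr; exact min_le_right _ _)
    hs1
  rw [hss] at hWA
  set I := ∫⁻ x, m x ^ q with hI
  have hus : nm s u = I ^ (1 / s) := by
    rw [nm, hI]
    congr 1
    refine lintegral_congr fun x ↦ ?_
    rw [hu, ← ENNReal.rpow_mul]
    congr 1
    rw [hθq, hs]
    have : q - 1 ≠ 0 := by linarith
    field_simp
  have e1 : I ≤ ∫⁻ x, X x ^ 2 * W x ^ θ := by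
    refine lintegral_mono fun x ↦ ?_
    have e : m x ^ q = m x ^ 2 * u x ^ θ := by
      rw [hu, ← ENNReal.rpow_mul, div_mul_cancel₀ _ hθ0.ne', ← ENNReal.rpow_natCast,
        ← ENNReal.rpow_add_of_nonneg _ _ (by norm_num) hq2.le]
      congr 1; push_cast; ring
    beta_reduce
    rw [e]
    gcongr
    · exact min_le_left _ _
    · exact huW x
  have hpq : (q / 2).HolderConjugate (q / (q - 2)) := by
    rw [Real.holderConjugate_iff]
    refine ⟨by linarith, ?_⟩
    field_simp; ring
  have e2 : ∫⁻ x, Y x ^ 2 * W x ^ θ ≤ nm q Y ^ 2 * (2 * I ^ ((q - 2) / q)) := by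
    refine (ENNReal.lintegral_mul_le_Lp_mul_Lq volume hpq (hY.pow_const 2).aemeasurable
      (hW.pow_const θ).aemeasurable).trans ?_
    gcongr
    · refine le_of_eq ?_
      rw [nm, ← ENNReal.rpow_natCast, ← ENNReal.rpow_mul]
      congr 1
      · refine lintegral_congr fun x ↦ ?_
        rw [← ENNReal.rpow_natCast, ← ENNReal.rpow_mul]
        congr 1; push_cast; ring
      · push_cast; field_simp
    · have e3 : (∫⁻ x, (W x ^ θ) ^ (q / (q - 2))) ^ (1 / (q / (q - 2))) = nm s W ^ θ := by
        rw [nm, ← ENNReal.rpow_mul]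
        congr 1
        · refine lintegral_congr fun x ↦ ?_
          rw [← ENNReal.rpow_mul]
          congr 1; rw [hθq, hs]; field_simp
        · rw [hθq, hs]
          have : q - 1 ≠ 0 := by linarith
          field_simp
      rw [e3]
      calc nm s W ^ θ ≤ (2 * I ^ (1 / s)) ^ θ := by
            rw [← hus]; exact ENNReal.rpow_le_rpow hWs hθ0.le
        _ = 2 ^ θ * I ^ ((q - 2) / q) := by
            rw [ENNReal.mul_rpow_of_nonneg _ _ hθ0.le, ← ENNReal.rpow_mul]
            congr 2
            rw [hθq, hs]
            have : q - 1 ≠ 0 := by linarith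
            field_simp
        _ ≤ _ := by
            gcongr
            conv_rhs => rw [← ENNReal.rpow_one 2]
            refine ENNReal.rpow_le_rpow_of_exponent_le (by norm_num) ?_
            have : 0 ≤ 1 / q := by positivity
            rw [hθ]; linarith
  have e4 : I ≤ (2 * N ^ 2 * nm q Y ^ 2) * I ^ ((q - 2) / q) := by
    calc I ≤ N ^ 2 * (nm q Y ^ 2 * (2 * I ^ ((q - 2) / q))) :=
          e1.trans ((h W hW _ (by finiteness) hWT hWA).trans (mul_le_mul_right e2 _))
      _ = _ := by ring
  have hIt : I ≠ ∞ := by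
    refine ne_top_of_le_ne_top (b := T ^ (q - 2) * ∫⁻ x, X x ^ 2) (by finiteness) ?_
    rw [← lintegral_const_mul' _ _ (by finiteness)]
    refine lintegral_mono fun x ↦ ?_
    have e : m x ^ q = m x ^ (q - 2) * m x ^ 2 := by
      rw [← ENNReal.rpow_natCast, ← ENNReal.rpow_add_of_nonneg _ _ hq2.le (by norm_num)]
      congr 1; push_cast; ring
    beta_reduce
    rw [e]
    gcongr
    · exact min_le_right _ _
    · exact min_le_left _ _
  rcases eq_or_ne I 0 with h0 | h0
  · rw [h0, ENNReal.zero_rpow_of_pos (by positivity)]; exact bot_le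
  have e5 : I = I ^ (2 / q) * I ^ ((q - 2) / q) := by
    rw [← ENNReal.rpow_add _ _ h0 hIt, ← add_div, add_sub_cancel, div_self hq0.ne',
      ENNReal.rpow_one]
  have hJ0 : I ^ ((q - 2) / q) ≠ 0 := by simp [h0, hIt]
  have e6 : I ^ (2 / q) ≤ 2 * N ^ 2 * nm q Y ^ 2 := by
    have e6 := e5.symm.trans_le e4
    exact (ENNReal.mul_le_mul_iff_left hJ0 (by finiteness)).1 e6
  have e7 : I ^ (1 / q) ≤ 2 * N * nm q Y := by
    rw [← ENNReal.pow_le_pow_left_iff two_ne_zero, ← ENNReal.rpow_natCast,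
      ← ENNReal.rpow_mul]
    calc _ = I ^ (2 / q) := by congr 1; push_cast; ring
      _ ≤ _ := e6
      _ ≤ _ := by
        rw [mul_pow, mul_pow]
        gcongr
        norm_num
  exact e7

/-- Extrapolation from weighted `L²` bounds with `A₁` weights. -/
theorem nm_le_of_A1 {q : ℝ} (hq : 2 < q) {X Y : E d → ℝ≥0∞} (hX : Measurable X)
    (hY : Measurable Y) (hX2 : ∫⁻ x, X x ^ 2 ≠ ∞) {N : ℝ≥0∞}
    (h : ∀ W : E d → ℝ≥0∞, Measurable W → ∀ T : ℝ≥0∞, T ≠ ∞ → (∀ x, W x ≤ T) →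
      (∀ i, A1 i (1024 * (d + 1) * (q - 1)) W) →
      ∫⁻ x, X x ^ 2 * W x ^ (1 - 1 / q) ≤ N ^ 2 * ∫⁻ x, Y x ^ 2 * W x ^ (1 - 1 / q)) :
    nm q X ≤ 2 * N * nm q Y := by
  have hq0 : 0 < q := by linarith
  have e : ∫⁻ x, X x ^ q = ⨆ n : ℕ, ∫⁻ x, (min (X x) n) ^ q := by
    rw [← lintegral_iSup (fun n ↦ (hX.min measurable_const).pow_const q)
      fun a b hab x ↦ ENNReal.rpow_le_rpow (min_le_min le_rfl (by exact_mod_cast hab)) hq0.le]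
    refine lintegral_congr fun x ↦ ?_
    have : X x = ⨆ n : ℕ, min (X x) n := by
      rw [← inf_iSup_eq, ENNReal.iSup_natCast]; simp
    conv_lhs => rw [this]
    exact (ENNReal.orderIsoRpow q hq0).map_iSup _
  rw [nm, e, one_div, ENNReal.rpow_inv_le_iff hq0]
  refine iSup_le fun n ↦ ?_
  have := lintegral_min_rpow_le hq hX hY hX2 h (T := n) (by finiteness)
  rwa [one_div q, ENNReal.rpow_inv_le_iff hq0] at this

end

section

variable {d : ℕ} {i : Fin d}

/-- The square function of `f`, with values in `[0, ∞]`. -/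
def sqf (f : L2 d) (x : E d) : ℝ≥0∞ := (∑' r, ‖Fm (rct r) f x‖ₑ ^ 2) ^ (1 / 2 : ℝ)

theorem rpow_half_sq (a : ℝ≥0∞) : (a ^ (1 / 2 : ℝ)) ^ 2 = a := by
  rw [← ENNReal.rpow_natCast, ← ENNReal.rpow_mul]; simp

theorem measurable_sqf (f : L2 d) : Measurable (sqf f) :=
  (Measurable.tsum fun _ ↦ (measurable_L2 _).enorm.pow_const 2).pow_const _

theorem lintegral_sqf_sq_mul (f : L2 d) {ω : E d → ℝ≥0∞} (hω : Measurable ω) :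
    ∫⁻ x, sqf f x ^ 2 * ω x = ∑' r, Q ω (Fm (rct r) f) := by
  simp only [sqf, rpow_half_sq, ← ENNReal.tsum_mul_right]
  exact lintegral_tsum fun r ↦ (((measurable_L2 _).enorm.pow_const 2).mul hω).aemeasurable

theorem A1_one (i : Fin d) : A1 i 4 (fun _ ↦ 1) := fun y hy x ↦
  (wk_const_le hy 1 x).trans (by norm_num)

theorem exists_lintegral_sqf_sq_le : ∃ C : ℝ, 1 ≤ C ∧ ∀ {d : ℕ} (f : L2 d),
    ∫⁻ x, sqf f x ^ 2 ≤ ENNReal.ofReal C ^ d * ∫⁻ x, ‖f x‖ₑ ^ 2 := by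
  obtain ⟨C, hC, h⟩ := exists_tsum_Q_rct_le
  refine ⟨C * (4 / (1 - 1 / 2)), by linarith, fun {d} f ↦ ?_⟩
  have := h (θ := 1 / 2) le_rfl (by norm_num) (W := fun _ ↦ 1) measurable_const
    (T := 1) (by simp) (fun _ ↦ le_rfl) (A := 4) (by norm_num) A1_one f
  rw [← lintegral_sqf_sq_mul f (by fun_prop)] at this
  simpa [Q] using this

theorem exists_nm_sqf_le : ∃ C : ℝ, 1 ≤ C ∧ ∀ {d : ℕ} {q : ℝ}, 2 < q → ∀ f : L2 d,
    nm q (sqf f) ≤ 2 * ENNReal.ofReal ((C * (d + 1) * q) ^ d) * nm q (fun x ↦ ‖f x‖ₑ) := by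
  obtain ⟨C, hC, h⟩ := exists_tsum_Q_rct_le
  obtain ⟨C', hC', h'⟩ := exists_lintegral_sqf_sq_le
  refine ⟨C * 1024, by linarith, fun {d} {q} hq f ↦ ?_⟩
  have hd : (0 : ℝ) ≤ d := by positivity
  refine nm_le_of_A1 hq (measurable_sqf f) (measurable_L2 f).enorm
    (ne_top_of_le_ne_top ?_ (h' f)) ?_
  · have := Q_one_lt_top f
    simp only [Q, mul_one] at this
    finiteness
  intro W hW T hT hWT hA
  have hq1 : 1 / q ≤ 1 / 2 := one_div_le_one_div_of_le (by norm_num) hq.le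
  have hq2 : 0 < 1 / q := by positivity
  have h1 : (1 : ℝ) ≤ 1024 * (d + 1) * (q - 1) := by nlinarith
  rw [lintegral_sqf_sq_mul f (by fun_prop)]
  refine (h (by linarith) (by linarith) hW hT hWT h1 hA f).trans ?_
  refine mul_le_mul_left ?_ _
  have hq3 : 0 < q - 1 := by linarith
  rw [show 1 - (1 - 1 / q) = 1 / q by ring, ← ENNReal.ofReal_pow (by positivity),
    ← ENNReal.ofReal_pow (by positivity)]
  · refine ENNReal.ofReal_le_ofReal ?_
    rw [← pow_mul, mul_comm d 2, pow_mul]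
    gcongr
    rw [div_div_eq_mul_div, div_one]
    have e : 1 ≤ C * 1024 * ((d : ℝ) + 1) := by nlinarith
    calc C * (1024 * (d + 1) * (q - 1) * q) = (C * 1024 * (d + 1)) * 1 * ((q - 1) * q) := by ring
      _ ≤ (C * 1024 * (d + 1)) * (C * 1024 * (d + 1)) * (q * q) := by gcongr; linarith
      _ = _ := by ring

/-- The square function of a finite family. -/
def sqs {ι : Type*} [Fintype ι] (g : ι → L2 d) (x : E d) : ℝ≥0∞ :=
  (∑ r, ‖g r x‖ₑ ^ 2) ^ (1 / 2 : ℝ)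

theorem measurable_sqs {ι : Type*} [Fintype ι] (g : ι → L2 d) : Measurable (sqs g) :=
  (Finset.measurable_fun_sum _ fun _ _ ↦ (measurable_L2 _).enorm.pow_const 2).pow_const _

theorem lintegral_sqs_sq_mul {ι : Type*} [Fintype ι] (g : ι → L2 d) {ω : E d → ℝ≥0∞}
    (hω : Measurable ω) : ∫⁻ x, sqs g x ^ 2 * ω x = ∑ r, Q ω (g r) := by
  simp only [sqs, rpow_half_sq, Finset.sum_mul]
  exact lintegral_finsetSum _ fun r _ ↦ ((measurable_L2 _).enorm.pow_const 2).mul hω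

theorem exists_nm_sum_rct_le : ∃ C : ℝ, 1 ≤ C ∧ ∀ {d : ℕ} {q : ℝ}, 2 < q →
    ∀ (K : Finset ℤ) (g : (Fin d → K × Bool) → L2 d),
    nm q (fun x ↦ ‖(∑ r, Fm (rct fun j ↦ ((r j).1, (r j).2)) (g r) : L2 d) x‖ₑ) ≤
      2 * ENNReal.ofReal ((C * (d + 1)) ^ d * q ^ (3 * (d : ℝ) / 2)) * nm q (sqs g) := by
  obtain ⟨C, hC, h⟩ := exists_Q_sum_rct_le
  refine ⟨C * 1024, by linarith, fun {d} {q} hq K g ↦ ?_⟩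
  have hd : (0 : ℝ) ≤ d := by positivity
  refine nm_le_of_A1 hq (measurable_L2 _).enorm (measurable_sqs g) ?_ ?_
  · have := Q_one_lt_top (∑ r, Fm (rct fun j ↦ ((r j).1, (r j).2)) (g r) : L2 d)
    simp only [Q, mul_one] at this
    exact this.ne
  intro W hW T hT hWT hA
  have hq0 : 0 < q := by linarith
  have hq1 : 1 / q ≤ 1 / 2 := one_div_le_one_div_of_le (by norm_num) hq.le
  have hq2 : 0 < 1 / q := by positivity
  have h1 : (1 : ℝ) ≤ 1024 * (d + 1) * (q - 1) := by nlinarith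
  rw [lintegral_sqs_sq_mul g (by fun_prop)]
  refine (h (by linarith) (by linarith) hW hT hWT h1 hA K g).trans ?_
  refine mul_le_mul_left ?_ _
  have hq3 : 0 < q - 1 := by linarith
  rw [show 1 - (1 - 1 / q) = 1 / q by ring, ← ENNReal.ofReal_pow (by positivity),
    ← ENNReal.ofReal_pow (by positivity)]
  refine ENNReal.ofReal_le_ofReal ?_
  have e0 : (q ^ (3 * (d : ℝ) / 2)) ^ 2 = (q ^ 3) ^ d := by
    rw [← Real.rpow_natCast, ← Real.rpow_mul hq0.le, ← pow_mul, ← Real.rpow_natCast]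
    congr 1; push_cast; ring
  rw [mul_pow ((C * 1024 * ((d : ℝ) + 1)) ^ d), e0, ← pow_mul, mul_comm d 2, pow_mul,
    ← mul_pow (_ ^ 2)]
  refine pow_le_pow_left₀ (by positivity) ?_ d
  rw [one_div, inv_pow, div_inv_eq_mul]
  have e : 1 ≤ C * 1024 * ((d : ℝ) + 1) := by nlinarith
  calc C * (1024 * (d + 1) * (q - 1) * q ^ 2)
      = (C * 1024 * (d + 1)) * 1 * ((q - 1) * q ^ 2) := by ring
    _ ≤ (C * 1024 * (d + 1)) * (C * 1024 * (d + 1)) * (q * q ^ 2) := by gcongr; linarith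
    _ = _ := by ring

end

section

variable {d : ℕ} {i : Fin d}

theorem inner_Fm {m : E d → ℂ} (hm : IsMult m) (hr : ∀ ξ, (starRingEnd ℂ) (m ξ) = m ξ)
    (f g : L2 d) : inner ℂ (Fm m f) g = inner ℂ f (Fm m g) := by
  rw [← Lp.inner_fourier_eq (Fm m f), ← Lp.inner_fourier_eq f, L2.inner_def, L2.inner_def]
  refine integral_congr_ae ?_
  filter_upwards [fourier_Fm hm f, fourier_Fm hm g] with ξ h1 h2
  rw [h1, h2]
  simp only [RCLike.inner_apply, map_mul, hr]
  ring

theorem conj_rct (r : Fin d → ℤ × Bool) (ξ : E d) : (starRingEnd ℂ) (rct r ξ) = rct r ξ := by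
  rw [rct_eq]
  by_cases h : ξ ∈ dyadicRect d (fun j ↦ (r j).1) fun j ↦ (r j).2
  · rw [Set.indicator_of_mem h]; simp
  · rw [Set.indicator_of_notMem h]; simp

theorem isMult_rct (r : Fin d → ℤ × Bool) : IsMult (rct r) := isMult_cuts _ _

theorem enorm_inner_le (f g : L2 d) {p q : ℝ} (hpq : q.HolderConjugate p) :
    ‖(inner ℂ g f : ℂ)‖ₑ ≤ nm q (fun x ↦ ‖g x‖ₑ) * nm p (fun x ↦ ‖f x‖ₑ) := by
  rw [L2.inner_def]
  refine (enorm_integral_le_lintegral_enorm _).trans ?_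
  refine le_trans (lintegral_mono fun x ↦ ?_) (ENNReal.lintegral_mul_le_Lp_mul_Lq volume hpq
    (measurable_L2 g).enorm.aemeasurable (measurable_L2 f).enorm.aemeasurable)
  rw [RCLike.inner_apply, enorm_mul, mul_comm]
  simp

/-- The pointwise length of a finite family. -/
def len {ι : Type*} [Fintype ι] (S : ι → L2 d) (x : E d) : ℝ := Real.sqrt (∑ r, ‖S r x‖ ^ 2)

theorem len_nonneg {ι : Type*} [Fintype ι] (S : ι → L2 d) (x : E d) : 0 ≤ len S x :=
  Real.sqrt_nonneg _

theorem len_sq {ι : Type*} [Fintype ι] (S : ι → L2 d) (x : E d) :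
    len S x ^ 2 = ∑ r, ‖S r x‖ ^ 2 :=
  Real.sq_sqrt (Finset.sum_nonneg fun _ _ ↦ by positivity)

theorem measurable_len {ι : Type*} [Fintype ι] (S : ι → L2 d) : Measurable (len S) :=
  Measurable.sqrt (Finset.measurable_fun_sum _ fun _ _ ↦ (measurable_L2 _).norm.pow_const 2)

theorem norm_le_len {ι : Type*} [Fintype ι] (S : ι → L2 d) (r : ι) (x : E d) :
    ‖S r x‖ ≤ len S x := by
  refine Real.le_sqrt_of_sq_le ?_
  exact Finset.single_le_sum (f := fun r ↦ ‖S r x‖ ^ 2) (fun _ _ ↦ by positivity)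
    (Finset.mem_univ r)

theorem len_le_sum {ι : Type*} [Fintype ι] (S : ι → L2 d) (x : E d) :
    len S x ≤ ∑ r, ‖S r x‖ :=
  Real.sqrt_le_iff.2 ⟨Finset.sum_nonneg fun _ _ ↦ norm_nonneg _,
    Finset.sum_sq_le_sq_sum_of_nonneg fun _ _ ↦ norm_nonneg _⟩

theorem sqs_eq_ofReal {ι : Type*} [Fintype ι] {g : ι → L2 d} {x : E d} {y : ℝ} (hy : 0 ≤ y)
    (h : y ^ 2 = ∑ r, ‖g r x‖ ^ 2) : sqs g x = ENNReal.ofReal y := by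
  have : ∑ r, ‖g r x‖ₑ ^ 2 = ENNReal.ofReal y ^ 2 := by
    rw [← ENNReal.ofReal_pow hy, h, ENNReal.ofReal_sum_of_nonneg fun _ _ ↦ by positivity]
    refine Finset.sum_congr rfl fun r _ ↦ ?_
    rw [ENNReal.ofReal_pow (norm_nonneg _), ofReal_norm]
  rw [sqs, this, ← ENNReal.rpow_natCast, ← ENNReal.rpow_mul]
  simp

/-- The extremal family `1_B |S|^{p-2} S r` for the duality between `p` and `p'`. -/
def extremal {ι : Type*} [Fintype ι] (S : ι → L2 d) (p : ℝ) (B : Set (E d)) (r : ι) : E d → ℂ :=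
  B.indicator fun x ↦ ((len S x ^ (p - 2) : ℝ) : ℂ) * S r x

theorem norm_extremal_le {ι : Type*} [Fintype ι] (S : ι → L2 d) {p : ℝ} (hp : 1 < p) (hp2 : p < 2)
    (B : Set (E d)) (r : ι) (x : E d) :
    ‖extremal S p B r x‖ ≤ B.indicator (fun _ ↦ (1 : ℝ)) x + ∑ r, ‖S r x‖ := by
  have hX0 := len_nonneg S x
  have hsum : 0 ≤ ∑ r, ‖S r x‖ := Finset.sum_nonneg fun _ _ ↦ norm_nonneg _
  by_cases hx : x ∈ B
  · rw [extremal, Set.indicator_of_mem hx, Set.indicator_of_mem hx, norm_mul, Complex.norm_real,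
      Real.norm_eq_abs, abs_of_nonneg (Real.rpow_nonneg hX0 _)]
    rcases hX0.eq_or_lt with h0 | h0
    · rw [← h0, Real.zero_rpow (by linarith)]; linarith
    · have h2 : len S x ^ (p - 2) * ‖S r x‖ ≤ len S x ^ (p - 1) := by
        calc _ ≤ len S x ^ (p - 2) * len S x := by gcongr; exact norm_le_len S r x
          _ = _ := by rw [← Real.rpow_add_one h0.ne']; congr 1; ring
      have h3 : len S x ^ (p - 1) ≤ 1 + len S x := by
        calc len S x ^ (p - 1) ≤ (1 + len S x) ^ (p - 1) :=
              Real.rpow_le_rpow hX0 (by linarith) (by linarith)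
          _ ≤ (1 + len S x) ^ (1 : ℝ) :=
            Real.rpow_le_rpow_of_exponent_le (by linarith) (by linarith)
          _ = _ := Real.rpow_one _
      linarith [len_le_sum S x]
  · rw [extremal, Set.indicator_of_notMem hx, norm_zero, Set.indicator_of_notMem hx]
    linarith

theorem memLp_extremal {ι : Type*} [Fintype ι] (S : ι → L2 d) {p : ℝ} (hp : 1 < p) (hp2 : p < 2)
    {B : Set (E d)} (hB : MeasurableSet B) (hBv : volume B ≠ ∞) (r : ι) :
    MemLp (extremal S p B r) 2 volume := by
  have h1 : MemLp (B.indicator (fun _ ↦ (1 : ℝ))) 2 (volume : Measure (E d)) :=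
    memLp_indicator_const 2 hB 1 (.inr hBv)
  have h2 : MemLp (fun x ↦ ∑ r, ‖S r x‖) 2 (volume : Measure (E d)) :=
    memLp_finsetSum _ fun r _ ↦ (Lp.memLp (S r)).norm
  refine (h1.add h2).mono' ?_ (.of_forall fun x ↦ norm_extremal_le S hp hp2 B r x)
  refine Measurable.aestronglyMeasurable (Measurable.indicator ?_ hB)
  exact (Complex.measurable_ofReal.comp ((measurable_len S).pow_const _)).mul (measurable_L2 _)

theorem sum_inner_extremal {ι : Type*} [Fintype ι] (S : ι → L2 d) {p : ℝ} (hp : 1 < p)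
    (B : Set (E d)) (x : E d) : ∑ r, (inner ℂ (extremal S p B r x) (S r x) : ℂ) =
      ((B.indicator (fun x ↦ len S x ^ p) x : ℝ) : ℂ) := by
  have hX0 := len_nonneg S x
  by_cases hxB : x ∈ B
  · simp only [extremal, Set.indicator_of_mem hxB, RCLike.inner_apply, map_mul, Complex.conj_ofReal]
    have e : ∀ r, S r x * (((len S x ^ (p - 2) : ℝ) : ℂ) * (starRingEnd ℂ) (S r x)) =
        ((len S x ^ (p - 2) * ‖S r x‖ ^ 2 : ℝ) : ℂ) := by
      intro r
      rw [mul_left_comm, Complex.mul_conj, Complex.normSq_eq_norm_sq]; push_cast; ring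
    simp only [e]
    rw [← Complex.ofReal_sum, ← Finset.mul_sum, ← len_sq]
    congr 1
    rcases hX0.eq_or_lt with h0 | h0
    · rw [← h0, Real.zero_rpow (by linarith : p ≠ 0)]; simp
    · rw [← Real.rpow_natCast, ← Real.rpow_add h0]; congr 1; push_cast; ring
  · simp [extremal, Set.indicator_of_notMem hxB]

theorem sum_norm_extremal_sq {ι : Type*} [Fintype ι] (S : ι → L2 d) {p : ℝ} (hp : 1 < p)
    (B : Set (E d)) (x : E d) : ∑ r, ‖extremal S p B r x‖ ^ 2 =
      (B.indicator (fun x ↦ len S x ^ (p - 1)) x) ^ 2 := by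
  have hX0 := len_nonneg S x
  by_cases hxB : x ∈ B
  · simp only [extremal, Set.indicator_of_mem hxB, norm_mul, mul_pow, ← Finset.mul_sum, ← len_sq,
      Complex.norm_real, Real.norm_eq_abs, abs_of_nonneg (Real.rpow_nonneg hX0 _)]
    rcases hX0.eq_or_lt with h0 | h0
    · rw [← h0, Real.zero_rpow (by linarith : p - 1 ≠ 0)]; simp
    · rw [← mul_pow, ← Real.rpow_add_one h0.ne']; congr 2; ring
  · simp [extremal, Set.indicator_of_notMem hxB]

theorem setLIntegral_sqs_rpow {ι : Type*} [Fintype ι] (S : ι → L2 d) {p : ℝ} (hp : 0 < p)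
    {B : Set (E d)} (hB : MeasurableSet B) : ∫⁻ x in B, sqs S x ^ p =
      ∫⁻ x, ENNReal.ofReal (B.indicator (fun x ↦ len S x ^ p) x) := by
  rw [← lintegral_indicator hB]
  refine lintegral_congr fun x ↦ ?_
  by_cases hx : x ∈ B
  · rw [Set.indicator_of_mem hx, Set.indicator_of_mem hx,
      sqs_eq_ofReal (len_nonneg S x) (len_sq S x), ENNReal.ofReal_rpow_of_nonneg (len_nonneg S x) hp.le]
  · rw [Set.indicator_of_notMem hx, Set.indicator_of_notMem hx, ENNReal.ofReal_zero]

theorem nm_sqs_of_ae_extremal {ι : Type*} [Fintype ι] (S h : ι → L2 d) {p q : ℝ} (hp : 1 < p)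
    (hpq : q.HolderConjugate p) {B : Set (E d)} (hB : MeasurableSet B)
    (hae : ∀ᵐ x, ∀ r, h r x = extremal S p B r x) :
    nm q (sqs h) = (∫⁻ x in B, sqs S x ^ p) ^ (1 / q) := by
  have hq0 : 0 < q := hpq.pos
  rw [setLIntegral_sqs_rpow S (by linarith) hB, nm]
  congr 1
  refine lintegral_congr_ae ?_
  filter_upwards [hae] with x hx
  have e : sqs h x = ENNReal.ofReal (B.indicator (fun x ↦ len S x ^ (p - 1)) x) := by
    refine sqs_eq_ofReal
      (Set.indicator_nonneg (fun x _ ↦ Real.rpow_nonneg (len_nonneg S x) _) x) ?_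
    simp only [hx]
    exact (sum_norm_extremal_sq S hp B x).symm
  rw [e]
  by_cases hxB : x ∈ B
  · rw [Set.indicator_of_mem hxB, Set.indicator_of_mem hxB,
      ENNReal.ofReal_rpow_of_nonneg (Real.rpow_nonneg (len_nonneg S x) _) hq0.le,
      ← Real.rpow_mul (len_nonneg S x), hpq.symm.sub_one_mul_conj]
  · rw [Set.indicator_of_notMem hxB, Set.indicator_of_notMem hxB, ENNReal.ofReal_zero,
      ENNReal.zero_rpow_of_pos hq0]

theorem sum_inner_of_ae_extremal {ι : Type*} [Fintype ι] (S h : ι → L2 d) {p : ℝ} (hp : 1 < p)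
    {B : Set (E d)} (hB : MeasurableSet B) (hae : ∀ᵐ x, ∀ r, h r x = extremal S p B r x) :
    ∫⁻ x in B, sqs S x ^ p ≠ ∞ ∧
      ∫⁻ x in B, sqs S x ^ p = ‖∑ r, (inner ℂ (h r) (S r) : ℂ)‖ₑ := by
  set ρ : E d → ℝ := B.indicator fun x ↦ len S x ^ p with hρ
  have hρ0 : ∀ x, 0 ≤ ρ x := fun x ↦
    Set.indicator_nonneg (fun x _ ↦ Real.rpow_nonneg (len_nonneg S x) _) x
  have hin : ∀ᵐ x, ∑ r, (inner ℂ (h r x) (S r x) : ℂ) = (ρ x : ℂ) := by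
    filter_upwards [hae] with x hx
    simp only [hx]
    exact sum_inner_extremal S hp B x
  have hInt : Integrable (fun x ↦ (ρ x : ℂ)) := by
    refine (integrable_finsetSum Finset.univ fun r _ ↦
      L2.integrable_inner (𝕜 := ℂ) (h r) (S r)).congr ?_
    filter_upwards [hin] with x hx
    exact hx
  have hInt' : Integrable ρ := by simpa using hInt.re
  have hρe : ∫⁻ x, ENNReal.ofReal (ρ x) = ENNReal.ofReal (∫ x, ρ x) :=
    (ofReal_integral_eq_lintegral_ofReal hInt' (.of_forall hρ0)).symm
  have e : ∑ r, (inner ℂ (h r) (S r) : ℂ) = ((∫ x, ρ x : ℝ) : ℂ) := by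
    simp only [L2.inner_def]
    rw [← integral_finsetSum _ fun r _ ↦ L2.integrable_inner (𝕜 := ℂ) _ _]
    exact (integral_congr_ae hin).trans integral_ofReal
  rw [setLIntegral_sqs_rpow S (by linarith) hB, hρe]
  exact ⟨by finiteness, by rw [e, ← ofReal_norm, Complex.norm_real, Real.norm_of_nonneg (integral_nonneg hρ0)]⟩

/-- Duality: testing `∑ r, ⟪h r, S r⟫` against `h r = 1_B |S|^{p-2} S r`. -/
theorem exists_dual {ι : Type*} [Fintype ι] (S : ι → L2 d) {p q : ℝ} (hp : 1 < p) (hp2 : p < 2)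
    (hpq : q.HolderConjugate p) {B : Set (E d)} (hB : MeasurableSet B) (hBv : volume B ≠ ∞) :
    ∃ h : ι → L2 d, ∫⁻ x in B, sqs S x ^ p ≠ ∞ ∧
      ∫⁻ x in B, sqs S x ^ p = ‖∑ r, (inner ℂ (h r) (S r) : ℂ)‖ₑ ∧
      nm q (sqs h) = (∫⁻ x in B, sqs S x ^ p) ^ (1 / q) := by
  have hae : ∀ᵐ x, ∀ r, (memLp_extremal S hp hp2 hB hBv r).toLp _ x = extremal S p B r x :=
    ae_all_iff.2 fun r ↦ (memLp_extremal S hp hp2 hB hBv r).coeFn_toLp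
  have h := sum_inner_of_ae_extremal S _ hp hB hae
  exact ⟨_, h.1, h.2, nm_sqs_of_ae_extremal S _ hp hpq hB hae⟩

end

section

variable {d : ℕ} {i : Fin d}

/-- The part of the square function coming from the indices in `K`. -/
def sqk (K : Finset ℤ) (f : L2 d) : E d → ℝ≥0∞ :=
  sqs fun r : Fin d → K × Bool ↦ Fm (rct fun j ↦ ((r j).1, (r j).2)) f

theorem lintegral_sqk_le {N : ℝ≥0∞} {p q : ℝ} (hp : 1 < p) (hp2 : p < 2)
    (hpq : q.HolderConjugate p) (K : Finset ℤ)
    (hN : ∀ g : (Fin d → K × Bool) → L2 d,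
      nm q (fun x ↦ ‖(∑ r, Fm (rct fun j ↦ ((r j).1, (r j).2)) (g r) : L2 d) x‖ₑ) ≤ N * nm q (sqs g))
    {B : Set (E d)} (hB : MeasurableSet B) (hBv : volume B ≠ ∞) (f : L2 d) :
    ∫⁻ x in B, sqk K f x ^ p ≤ (N * nm p (fun x ↦ ‖f x‖ₑ)) ^ p := by
  obtain ⟨h, hJ, hJe, hn⟩ := exists_dual
    (fun r : Fin d → K × Bool ↦ Fm (rct fun j ↦ ((r j).1, (r j).2)) f) hp hp2 hpq hB hBv
  change ∫⁻ x in B, sqk K f x ^ p ≠ ∞ at hJ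
  change ∫⁻ x in B, sqk K f x ^ p = _ at hJe
  change _ = (∫⁻ x in B, sqk K f x ^ p) ^ (1 / q) at hn
  have e : ∑ r, (inner ℂ (h r) (Fm (rct fun j ↦ ((r j).1, (r j).2)) f) : ℂ) =
      inner ℂ (∑ r, Fm (rct fun j ↦ ((r j).1, (r j).2)) (h r) : L2 d) f := by
    rw [sum_inner]
    exact Finset.sum_congr rfl fun r _ ↦ (inner_Fm (isMult_rct _) (conj_rct _) _ _).symm
  rw [e] at hJe
  set J := ∫⁻ x in B, sqk K f x ^ p with hJdef
  have hp0 : 0 < p := by linarith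
  have h1 : J ≤ N * J ^ (1 / q) * nm p (fun x ↦ ‖f x‖ₑ) := by
    refine hJe.le.trans ((enorm_inner_le _ _ hpq).trans ?_)
    refine mul_le_mul_left ?_ _
    rw [← hn]
    exact hN h
  rcases eq_or_ne J 0 with h0 | h0
  · rw [h0]; exact bot_le
  have hJq0 : J ^ (1 / q) ≠ 0 := by
    rw [Ne, ENNReal.rpow_eq_zero_iff_of_pos (one_div_pos.2 hpq.pos)]; exact h0
  have hJqt : J ^ (1 / q) ≠ ∞ := ENNReal.rpow_ne_top_of_nonneg (one_div_pos.2 hpq.pos).le hJ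
  have hsum : 1 / p + 1 / q = 1 := by
    have := hpq.inv_add_inv_eq_one
    simp only [one_div]; linarith
  have h2 : J ^ (1 / p) * J ^ (1 / q) ≤ (N * nm p (fun x ↦ ‖f x‖ₑ)) * J ^ (1 / q) := by
    rw [← ENNReal.rpow_add_of_nonneg _ _ (by positivity) (one_div_pos.2 hpq.pos).le, hsum,
      ENNReal.rpow_one]
    refine h1.trans (le_of_eq ?_)
    ring
  have h3 := (ENNReal.mul_le_mul_iff_left hJq0 hJqt).1 h2
  calc J = (J ^ (1 / p)) ^ p := by
        rw [← ENNReal.rpow_mul, one_div_mul_cancel hp0.ne', ENNReal.rpow_one]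
    _ ≤ _ := ENNReal.rpow_le_rpow h3 hp0.le

theorem sqk_eq (K : Finset ℤ) (f : L2 d) (x : E d) : sqk K f x =
    (∑ r ∈ Fintype.piFinset fun _ : Fin d ↦ K ×ˢ (Finset.univ : Finset Bool),
      ‖Fm (rct r) f x‖ₑ ^ 2) ^ (1 / 2 : ℝ) := by
  rw [sqk, sqs]
  congr 1
  refine Finset.sum_bij (fun r _ j ↦ ((r j).1.1, (r j).2)) ?_ ?_ ?_ ?_
  · intro r _
    simp
  · intro r _ s _ h
    funext j
    have := congrFun h j
    simp only [Prod.mk.injEq] at this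
    exact Prod.ext (Subtype.ext this.1) this.2
  · intro r hr
    simp only [Fintype.mem_piFinset, Finset.mem_product, Finset.mem_univ, and_true] at hr
    exact ⟨fun j ↦ (⟨(r j).1, hr j⟩, (r j).2), Finset.mem_univ _, rfl⟩
  · intro r _
    rfl

theorem tendsto_sqk (f : L2 d) (x : E d) : Filter.Tendsto
    (fun n : ℕ ↦ sqk (Finset.Icc (-n : ℤ) n) f x) Filter.atTop (nhds (sqf f x)) := by
  simp only [sqk_eq, sqf]
  refine (ENNReal.continuous_rpow_const.tendsto _).comp ?_
  refine (ENNReal.summable.hasSum (f := fun r ↦ ‖Fm (rct r) f x‖ₑ ^ 2)).comp ?_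
  refine Filter.tendsto_atTop_finset_of_monotone ?_ ?_
  · intro m n hmn
    refine Fintype.piFinset_subset _ _ fun _ ↦ Finset.product_subset_product ?_ subset_rfl
    exact Finset.Icc_subset_Icc (by simpa using hmn) (by exact_mod_cast hmn)
  · intro r
    refine ⟨∑ j, (r j).1.natAbs, ?_⟩
    simp only [Fintype.mem_piFinset, Finset.mem_product, Finset.mem_univ, and_true, Finset.mem_Icc]
    intro j
    have := Finset.single_le_sum (f := fun j ↦ (r j).1.natAbs) (fun _ _ ↦ Nat.zero_le _)
      (Finset.mem_univ j)
    constructor <;> omega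

theorem nm_sqf_le_of_lintegral_sqk_le {p : ℝ} (hp : 0 < p) {M : ℝ≥0∞} (f : L2 d)
    (h : ∀ (K : Finset ℤ) {B : Set (E d)}, MeasurableSet B → volume B ≠ ∞ →
      ∫⁻ x in B, sqk K f x ^ p ≤ M ^ p) : nm p (sqf f) ≤ M := by
  have h1 : ∫⁻ x, sqf f x ^ p ≤ M ^ p := by
    have ht : ∀ x, sqf f x ^ p = Filter.liminf (fun n : ℕ ↦ (Metric.closedBall 0 (n : ℝ)).indicator
        (fun x ↦ sqk (Finset.Icc (-n : ℤ) n) f x ^ p) x) Filter.atTop := by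
      intro x
      refine (Filter.Tendsto.liminf_eq ?_).symm
      have := (ENNReal.continuous_rpow_const (y := p).tendsto _).comp (tendsto_sqk f x)
      refine this.congr' ?_
      obtain ⟨n, hn⟩ := exists_nat_ge ‖x‖
      filter_upwards [Filter.eventually_ge_atTop n] with m hm
      rw [Set.indicator_of_mem]
      · rfl
      · simp only [mem_closedBall_zero_iff]
        exact hn.trans (by exact_mod_cast hm)
    simp only [ht]
    refine (lintegral_liminf_le fun n ↦ ?_).trans ?_
    · exact ((measurable_sqs _).pow_const _).indicator Metric.isClosed_closedBall.measurableSet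
    · refine Filter.liminf_le_of_le (by isBoundedDefault) fun b hb ↦ ?_
      obtain ⟨n, hn⟩ := hb.exists
      refine hn.trans ?_
      rw [lintegral_indicator Metric.isClosed_closedBall.measurableSet]
      exact h _ Metric.isClosed_closedBall.measurableSet
        (isCompact_closedBall _ _).measure_lt_top.ne
  calc nm p (sqf f) ≤ (M ^ p) ^ (1 / p) := ENNReal.rpow_le_rpow h1 (by positivity)
    _ = M := by rw [← ENNReal.rpow_mul, mul_one_div_cancel hp.ne', ENNReal.rpow_one]

theorem exists_nm_sqf_le_of_lt_two : ∃ C : ℝ, 1 ≤ C ∧ ∀ {d : ℕ} {p : ℝ}, 1 < p → p < 2 →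
    ∀ f : L2 d, nm p (sqf f) ≤
      2 * ENNReal.ofReal ((C * (d + 1)) ^ d * (p / (p - 1)) ^ (3 * (d : ℝ) / 2)) *
        nm p (fun x ↦ ‖f x‖ₑ) := by
  obtain ⟨C, hC, h⟩ := exists_nm_sum_rct_le
  refine ⟨C, hC, fun {d} {p} hp hp2 f ↦ ?_⟩
  have hpq := (Real.HolderConjugate.conjExponent hp).symm
  have hq : 2 < p.conjExponent := by
    rw [Real.conjExponent, lt_div_iff₀ (by linarith)]; linarith
  exact nm_sqf_le_of_lintegral_sqk_le (by linarith) f fun K B hB hBv ↦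
    lintegral_sqk_le hp hp2 hpq K (fun g ↦ h hq K g) hB hBv f

end

section

variable {d : ℕ} {i : Fin d}

theorem exists_toLp {f : E d → ℂ} (hf : ContDiff ℝ (⊤ : ℕ∞) f) (hc : HasCompactSupport f) :
    ∃ F : L2 d, F =ᵐ[volume] f ∧ ∀ᵐ x, ∀ r : Fin d → ℤ × Bool,
      Fm (rct r) F x = dyadicPartialSum d (fun j ↦ (r j).1) (fun j ↦ (r j).2) f x := by
  refine ⟨(hc.toSchwartzMap hf).toLp 2, (hc.toSchwartzMap hf).coeFn_toLp 2 volume,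
    ae_all_iff.2 fun r ↦ ?_⟩
  filter_upwards [Fm_toLp_ae (isMult_rct r) (hc.toSchwartzMap hf)] with x hx
  rw [hx, dyadicPartialSum]
  refine congrArg (fun g : E d → ℂ ↦ 𝓕⁻ g x) (funext fun ξ ↦ ?_)
  rw [rct_eq]
  by_cases hξ : ξ ∈ dyadicRect d (fun j ↦ (r j).1) fun j ↦ (r j).2
  · rw [Set.indicator_of_mem hξ, Set.indicator_of_mem hξ]; exact one_mul _
  · rw [Set.indicator_of_notMem hξ, Set.indicator_of_notMem hξ]; exact zero_mul _

theorem enorm_sqrt_tsum {ι : Type*} {a : ι → ℝ} (h0 : ∀ i, 0 ≤ a i)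
    (h : ∑' i, ENNReal.ofReal (a i) ≠ ∞) :
    ‖Real.sqrt (∑' i, a i)‖ₑ = (∑' i, ENNReal.ofReal (a i)) ^ (1 / 2 : ℝ) := by
  have hs : Summable a := by
    have := ENNReal.summable_toReal h
    simpa only [ENNReal.toReal_ofReal (h0 _)] using this
  rw [Real.enorm_of_nonneg (Real.sqrt_nonneg _), Real.sqrt_eq_rpow,
    ← ENNReal.ofReal_rpow_of_nonneg (tsum_nonneg h0) (by norm_num),
    ENNReal.ofReal_tsum_of_nonneg h0 hs]

theorem sqf_lt_top_ae (f : L2 d) : ∀ᵐ x, sqf f x < ∞ := by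
  obtain ⟨C, -, h⟩ := exists_lintegral_sqf_sq_le
  have h1 := Q_one_lt_top f
  simp only [Q, mul_one] at h1
  have h2 : ∫⁻ x, sqf f x ^ 2 ≠ ∞ := ne_top_of_le_ne_top (by finiteness) (h f)
  filter_upwards [ae_lt_top ((measurable_sqf f).pow_const 2) h2] with x hx
  exact (ENNReal.pow_lt_top_iff.1 hx).resolve_right two_ne_zero

theorem exists_enorm_dyadicSquareFn_eq {f : E d → ℂ} (hf : ContDiff ℝ (⊤ : ℕ∞) f)
    (hc : HasCompactSupport f) : ∃ F : L2 d, F =ᵐ[volume] f ∧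
      (∀ᵐ x, ∀ r : Fin d → ℤ × Bool,
        Fm (rct r) F x = dyadicPartialSum d (fun j ↦ (r j).1) (fun j ↦ (r j).2) f x) ∧
      ∀ᵐ x, ‖dyadicSquareFn d f x‖ₑ = sqf F x := by
  obtain ⟨F, hF, h⟩ := exists_toLp hf hc
  refine ⟨F, hF, h, ?_⟩
  filter_upwards [h, sqf_lt_top_ae F] with x hx ht
  have e : ∑' r : Fin d → ℤ × Bool, ‖Fm (rct r) F x‖ₑ ^ 2 =
      ∑' ks : (Fin d → ℤ) × (Fin d → Bool),
        ENNReal.ofReal (‖dyadicPartialSum d ks.1 ks.2 f x‖ ^ 2) := by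
    rw [← (Equiv.arrowProdEquivProdArrow (Fin d) (fun _ ↦ ℤ) fun _ ↦ Bool).tsum_eq]
    refine tsum_congr fun r ↦ ?_
    rw [hx, ENNReal.ofReal_pow (norm_nonneg _), ofReal_norm]
    rfl
  rw [sqf, e] at ht ⊢
  rw [dyadicSquareFn]
  refine enorm_sqrt_tsum (fun _ ↦ by positivity) ?_
  intro h0
  rw [h0, ENNReal.top_rpow_of_pos (by norm_num)] at ht
  exact lt_irrefl _ ht

theorem eLpNorm_eq_nm {F : Type*} [NormedAddCommGroup F] {p : ℝ} (hp : 0 < p) (f : E d → F) :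
    eLpNorm f (ENNReal.ofReal p) volume = nm p fun x ↦ ‖f x‖ₑ := by
  rw [eLpNorm_eq_lintegral_rpow_enorm_toReal (by simpa using hp) ENNReal.ofReal_ne_top,
    ENNReal.toReal_ofReal hp.le, nm]

theorem nm_congr_ae {s : ℝ} {u v : E d → ℝ≥0∞} (h : u =ᵐ[volume] v) : nm s u = nm s v := by
  rw [nm, nm]
  exact congrArg (· ^ (1 / s)) (lintegral_congr_ae (h.fun_comp fun a ↦ a ^ s))

theorem dyadicUpperConst_le {p : ℝ} (hp : 0 < p) {M : ℝ≥0∞}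
    (h : ∀ f : L2 d, nm p (sqf f) ≤ M * nm p fun x ↦ ‖f x‖ₑ) : dyadicUpperConst d p ≤ M := by
  refine sInf_le fun f hf hc ↦ ?_
  obtain ⟨F, hF, -, hS⟩ := exists_enorm_dyadicSquareFn_eq hf hc
  rw [eLpNorm_eq_nm hp, eLpNorm_eq_nm hp, nm_congr_ae hS]
  refine (h F).trans_eq (congrArg (M * ·) (nm_congr_ae ?_))
  exact hF.fun_comp fun a ↦ ‖a‖ₑ

theorem exists_dyadicUpperConst_le (d : ℕ) : ∃ C : ℝ, 0 < C ∧ ∀ p : ℝ, 1 < p →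
    (p ≤ 2 → dyadicUpperConst d p ≤ ENNReal.ofReal (C * (p / (p - 1)) ^ (3 * (d : ℝ) / 2))) ∧
    (2 < p → dyadicUpperConst d p ≤ ENNReal.ofReal (C * p ^ (d : ℕ))) := by
  obtain ⟨C₁, hC₁, h1⟩ := exists_nm_sqf_le_of_lt_two
  obtain ⟨C₂, hC₂, h2⟩ := exists_lintegral_sqf_sq_le
  obtain ⟨C₃, hC₃, h3⟩ := exists_nm_sqf_le
  have hd : (0 : ℝ) ≤ d := by positivity
  have p1 : 0 < 2 * (C₁ * (d + 1)) ^ d := by positivity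
  have p2 : 0 < C₂ ^ d := by positivity
  have p3 : 0 < 2 * (C₃ * (d + 1)) ^ d := by positivity
  refine ⟨2 * (C₁ * (d + 1)) ^ d + C₂ ^ d + 2 * (C₃ * (d + 1)) ^ d, by positivity,
    fun p hp ↦ ⟨fun hp2 ↦ ?_, fun hp2 ↦ ?_⟩⟩
  · have hq : 0 < p / (p - 1) := div_pos (by linarith) (by linarith)
    rcases hp2.lt_or_eq with hlt | heq
    · refine (dyadicUpperConst_le (by linarith) (h1 hp hlt)).trans ?_
      rw [← ENNReal.ofReal_ofNat 2, ← ENNReal.ofReal_mul (by norm_num)]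
      refine ENNReal.ofReal_le_ofReal ?_
      rw [← mul_assoc]
      gcongr
      linarith
    · refine (dyadicUpperConst_le (M := ENNReal.ofReal (C₂ ^ d)) (by linarith) fun f ↦ ?_).trans ?_
      · rw [heq, nm, nm]
        simp only [ENNReal.rpow_ofNat]
        have e : ENNReal.ofReal (C₂ ^ d) = (ENNReal.ofReal (C₂ ^ d) ^ 2) ^ (1 / 2 : ℝ) := by
          rw [← ENNReal.rpow_ofNat, ← ENNReal.rpow_mul]; simp
        rw [e, ← ENNReal.mul_rpow_of_nonneg _ _ (by norm_num)]
        refine ENNReal.rpow_le_rpow ((h2 f).trans ?_) (by norm_num)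
        refine mul_le_mul_left ?_ _
        rw [← ENNReal.ofReal_pow (by positivity), ← ENNReal.ofReal_pow (by positivity)]
        exact ENNReal.ofReal_le_ofReal (le_self_pow₀ (one_le_pow₀ hC₂) two_ne_zero)
      · refine ENNReal.ofReal_le_ofReal ?_
        have h1q : 1 ≤ p / (p - 1) := by rw [le_div_iff₀] <;> linarith
        calc C₂ ^ d = C₂ ^ d * 1 := by ring
          _ ≤ _ := mul_le_mul (by linarith) (Real.one_le_rpow h1q (by positivity)) (by norm_num)
            (by positivity)
  · refine (dyadicUpperConst_le (by linarith) (h3 hp2)).trans ?_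
    rw [← ENNReal.ofReal_ofNat 2, ← ENNReal.ofReal_mul (by norm_num)]
    refine ENNReal.ofReal_le_ofReal ?_
    rw [mul_pow, ← mul_assoc]
    gcongr
    linarith

end

section

variable {d : ℕ} {i : Fin d}

theorem lintegral_fin_prod (f : Fin d → ℝ → ℝ≥0∞) (hf : ∀ i, Measurable (f i)) :
    ∫⁻ x : Fin d → ℝ, ∏ i, f i (x i) = ∏ i, ∫⁻ t, f i t := by
  induction d with
  | zero => simp [volume_pi, Measure.pi_of_empty (x := fun a : Fin 0 ↦ a.elim0)]
  | succ n ih =>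
      calc
        _ = ∫⁻ x : ℝ × (Fin n → ℝ), f 0 x.1 * ∏ i : Fin n, f (Fin.succ i) (x.2 i)
            ∂(volume.prod volume) := by
          rw [← ((volume_preserving_piFinSuccAbove (fun _ : Fin (n + 1) ↦ ℝ) 0).symm).lintegral_comp
            (f := fun x : Fin (n + 1) → ℝ ↦ ∏ i, f i (x i)) (Finset.measurable_fun_prod _ fun i _ ↦ (hf i).comp (measurable_pi_apply i))]
          simp_rw [MeasurableEquiv.piFinSuccAbove_symm_apply, Fin.insertNthEquiv,
            Fin.prod_univ_succ, Fin.insertNth_zero, Equiv.coe_fn_mk, Fin.cons_succ,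
            Fin.cons_zero]
          rfl
        _ = (∫⁻ t, f 0 t) * ∏ i : Fin n, ∫⁻ t, f (Fin.succ i) t := by
          rw [← ih _ fun i ↦ hf _, ← lintegral_prod_mul (hf 0).aemeasurable]
          exact (Finset.measurable_fun_prod _
            fun i _ ↦ (hf _).comp (measurable_pi_apply i)).aemeasurable
        _ = ∏ i, ∫⁻ t, f i t := by rw [Fin.prod_univ_succ]

theorem lintegral_euclidean_prod {f : ℝ → ℝ≥0∞} (hf : Measurable f) :
    ∫⁻ x : E d, ∏ i, f (x i) = (∫⁻ t, f t) ^ d := by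
  rw [← (PiLp.volume_preserving_toLp (Fin d)).lintegral_comp
    (f := fun x : E d ↦ ∏ i, f (x i)) (Finset.measurable_fun_prod _ fun i _ ↦ hf.comp (by fun_prop))]
  simpa using lintegral_fin_prod (fun _ : Fin d ↦ f) fun _ ↦ hf

theorem integral_euclidean_prod (f : Fin d → ℝ → ℂ) :
    ∫ x : E d, ∏ i, f i (x i) = ∏ i, ∫ t, f i t := by
  rw [← (EuclideanSpace.volume_preserving_symm_measurableEquiv_toLp (Fin d)).symm.integral_comp']
  exact integral_fintype_prod_volume_eq_prod f

theorem fourier_prod (h : Fin d → ℝ → ℂ) (ξ : E d) :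
    𝓕 (fun x : E d ↦ ∏ i, h i (x i)) ξ = ∏ i, 𝓕 (h i) (ξ i) := by
  simp only [Real.fourier_eq', smul_eq_mul]
  rw [← integral_euclidean_prod]
  refine integral_congr_ae (.of_forall fun x ↦ ?_)
  beta_reduce
  rw [Finset.prod_mul_distrib, ← Complex.exp_sum]
  congr 2
  rw [← Finset.sum_mul, ← Complex.ofReal_sum, ← Finset.mul_sum]
  simp [PiLp.inner_apply]

theorem fourierInv_prod (h : Fin d → ℝ → ℂ) (ξ : E d) :
    𝓕⁻ (fun x : E d ↦ ∏ i, h i (x i)) ξ = ∏ i, 𝓕⁻ (h i) (ξ i) := by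
  simp only [Real.fourierInv_eq', smul_eq_mul]
  rw [← integral_euclidean_prod]
  refine integral_congr_ae (.of_forall fun x ↦ ?_)
  beta_reduce
  rw [Finset.prod_mul_distrib, ← Complex.exp_sum]
  congr 2
  rw [← Finset.sum_mul, ← Complex.ofReal_sum, ← Finset.mul_sum]
  simp [PiLp.inner_apply]

/-- The partial Fourier integral of `g` over the frequencies `[l, 2 l]`. -/
def psum (l : ℝ) (g : ℝ → ℂ) (t : ℝ) : ℂ :=
  ∫ ξ in l..2 * l, Complex.exp ((2 * Real.pi * (ξ * t) : ℝ) * Complex.I) * 𝓕 g ξ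

theorem fourierInv_indicator_eq_psum (k : ℤ) (g : ℝ → ℂ) (t : ℝ) :
    𝓕⁻ ((dyadicInterval k true).indicator (𝓕 g)) t = psum (2 ^ (k - 1)) g t := by
  have h2 : (2 : ℝ) * 2 ^ (k - 1) = 2 ^ k := by
    rw [← zpow_one_add₀ two_ne_zero]; congr 1; ring
  have hl : (2 : ℝ) ^ (k - 1) ≤ 2 * 2 ^ (k - 1) := by
    have : (0 : ℝ) < 2 ^ (k - 1) := by positivity
    linarith
  rw [psum, intervalIntegral.integral_of_le hl, ← integral_Ico_eq_integral_Ioc,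
    Real.fourierInv_eq', ← integral_indicator measurableSet_Ico, h2]
  refine integral_congr_ae (.of_forall fun ξ ↦ ?_)
  simp only [dyadicInterval, if_true, Set.indicator_apply, smul_eq_mul, mul_ite, mul_zero]
  split_ifs
  · congr 5
    simp [mul_comm]
  · rfl

/-- The tensor power of a function of one variable. -/
def tens (d : ℕ) (g : ℝ → ℂ) (x : E d) : ℂ := ∏ i, g (x i)

theorem dyadicPartialSum_tens (k : Fin d → ℤ) (g : ℝ → ℂ) (x : E d) :
    dyadicPartialSum d k (fun _ ↦ true) (tens d g) x = ∏ i, psum (2 ^ (k i - 1)) g (x i) := by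
  simp only [← fourierInv_indicator_eq_psum]
  rw [← fourierInv_prod, dyadicPartialSum]
  refine congrArg (fun h : E d → ℂ ↦ 𝓕⁻ h x) (funext fun ξ ↦ ?_)
  by_cases h : ξ ∈ dyadicRect d k fun _ ↦ true
  · rw [Set.indicator_of_mem h]
    refine (fourier_prod _ ξ).trans (Finset.prod_congr rfl fun i _ ↦ ?_)
    rw [Set.indicator_of_mem (h i)]
  · rw [Set.indicator_of_notMem h]
    simp only [dyadicRect, Set.mem_ofPred_eq, not_forall] at h
    obtain ⟨i, hi⟩ := h
    exact (Finset.prod_eq_zero (Finset.mem_univ i) (Set.indicator_of_notMem hi _)).symm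

theorem contDiff_tens {g : ℝ → ℂ} (hg : ContDiff ℝ (⊤ : ℕ∞) g) :
    ContDiff ℝ (⊤ : ℕ∞) (tens d g) := by
  refine contDiff_prod fun i _ ↦ hg.comp ?_
  fun_prop

theorem hasCompactSupport_tens {g : ℝ → ℂ} (hg : HasCompactSupport g) :
    HasCompactSupport (tens d g) := by
  have hK : IsCompact (Set.univ.pi fun _ : Fin d ↦ tsupport g) :=
    isCompact_univ_pi fun _ ↦ hg
  refine HasCompactSupport.intro (K := WithLp.toLp 2 '' Set.univ.pi fun _ : Fin d ↦ tsupport g)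
    (hK.image (PiLp.continuous_toLp 2 _)) fun x hx ↦ ?_
  by_contra h
  refine hx ⟨WithLp.ofLp x, fun i _ ↦ ?_, rfl⟩
  by_contra hi
  exact h (Finset.prod_eq_zero (Finset.mem_univ i) (image_eq_zero_of_notMem_tsupport hi))

theorem continuous_psum {g : ℝ → ℂ} (hg : Continuous (𝓕 g)) (l : ℝ) : Continuous (psum l g) := by
  refine intervalIntegral.continuous_parametric_intervalIntegral_of_continuous' ?_ _ _
  fun_prop

end

section

variable {d : ℕ} {i : Fin d}

theorem continuous_fourier_real {g : ℝ → ℂ} (hg : Integrable g) : Continuous (𝓕 g) :=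
  VectorFourier.fourierIntegral_continuous (L := innerₗ ℝ) Real.continuous_fourierChar
    (by simp only [innerₗ_apply_apply]; fun_prop) hg

/-- The square function over the positive frequencies in finitely many dyadic intervals. -/
def psq (T : Finset ℤ) (g : ℝ → ℂ) (t : ℝ) : ℝ≥0∞ :=
  (∑ k ∈ T, ‖psum (2 ^ (k - 1)) g t‖ₑ ^ 2) ^ (1 / 2 : ℝ)

theorem measurable_psq (T : Finset ℤ) {g : ℝ → ℂ} (hg : Integrable g) : Measurable (psq T g) :=
  (Finset.measurable_fun_sum _ fun _ _ ↦
    ((continuous_psum (continuous_fourier_real hg) _).measurable.enorm.pow_const 2)).pow_const _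

theorem prod_psq_le (T : Finset ℤ) (g : ℝ → ℂ) {F : L2 d} {x : E d}
    (hx : ∀ r : Fin d → ℤ × Bool,
      Fm (rct r) F x = dyadicPartialSum d (fun j ↦ (r j).1) (fun j ↦ (r j).2) (tens d g) x) :
    ∏ i, psq T g (x i) ≤ sqf F x := by
  simp only [psq, sqf]
  rw [ENNReal.prod_rpow_of_nonneg (by norm_num)]
  refine ENNReal.rpow_le_rpow ?_ (by norm_num)
  rw [Finset.prod_univ_sum]
  calc ∑ k ∈ Fintype.piFinset fun _ ↦ T, ∏ i, ‖psum (2 ^ (k i - 1)) g (x i)‖ₑ ^ 2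
      = ∑ k ∈ Fintype.piFinset fun _ ↦ T, ‖Fm (rct fun i ↦ (k i, true)) F x‖ₑ ^ 2 := by
        refine Finset.sum_congr rfl fun k _ ↦ ?_
        rw [hx, dyadicPartialSum_tens, Finset.prod_pow]
        congr 1
        simp only [← ofReal_norm]
        rw [norm_prod, ENNReal.ofReal_prod_of_nonneg fun _ _ ↦ norm_nonneg _]
    _ ≤ ∑' k : Fin d → ℤ, ‖Fm (rct fun i ↦ (k i, true)) F x‖ₑ ^ 2 := ENNReal.sum_le_tsum _
    _ ≤ _ := ENNReal.tsum_comp_le_tsum_of_injective (f := fun (k : Fin d → ℤ) i ↦ (k i, true))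
        (fun k l h ↦ funext fun i ↦ (Prod.mk.inj (congrFun h i)).1)
        fun r : Fin d → ℤ × Bool ↦ ‖Fm (rct r) F x‖ₑ ^ 2

theorem lintegral_prod_rpow {u : ℝ → ℝ≥0∞} (hu : Measurable u) {p : ℝ} (hp : 0 ≤ p) :
    ∫⁻ x : E d, (∏ i, u (x i)) ^ p = (∫⁻ t, u t ^ p) ^ d := by
  rw [← lintegral_euclidean_prod (hu.pow_const p)]
  refine lintegral_congr fun x ↦ ?_
  rw [ENNReal.prod_rpow_of_nonneg hp]

/-- Lower bounds for the best constant in one variable tensorize. -/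
theorem le_dyadicUpperConst {p : ℝ} (hp : 0 < p) {g : ℝ → ℂ} (hg : ContDiff ℝ (⊤ : ℕ∞) g)
    (hc : HasCompactSupport g) (h0 : ∫⁻ t, ‖g t‖ₑ ^ p ≠ 0) (T : Finset ℤ) {A : ℝ≥0∞}
    (h : A ^ p * ∫⁻ t, ‖g t‖ₑ ^ p ≤ ∫⁻ t, psq T g t ^ p) : A ^ d ≤ dyadicUpperConst d p := by
  refine le_sInf fun C hC ↦ ?_
  have hgi : Integrable g := hg.continuous.integrable_of_hasCompactSupport hc
  have hmain := hC (tens d g) (contDiff_tens hg) (hasCompactSupport_tens hc)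
  obtain ⟨F, -, hF, hS⟩ := exists_enorm_dyadicSquareFn_eq (contDiff_tens (d := d) hg)
    (hasCompactSupport_tens hc)
  rw [eLpNorm_eq_nm hp, eLpNorm_eq_nm hp, nm_congr_ae hS] at hmain
  have h1 : (∫⁻ t, psq T g t ^ p) ^ d ≤ ∫⁻ x, sqf F x ^ p := by
    rw [← lintegral_prod_rpow (measurable_psq T hgi) hp.le]
    refine lintegral_mono_ae ?_
    filter_upwards [hF] with x hx
    exact ENNReal.rpow_le_rpow (prod_psq_le T g hx) hp.le
  have h2 : ∫⁻ x, ‖tens d g x‖ₑ ^ p = (∫⁻ t, ‖g t‖ₑ ^ p) ^ d := by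
    rw [← lintegral_prod_rpow hg.continuous.measurable.enorm hp.le]
    refine lintegral_congr fun x ↦ ?_
    simp only [tens, ← ofReal_norm]
    rw [norm_prod, ENNReal.ofReal_prod_of_nonneg fun _ _ ↦ norm_nonneg _]
  have hI : ∫⁻ t, ‖g t‖ₑ ^ p ≠ ∞ := by
    have := (hg.continuous.memLp_of_hasCompactSupport (p := ENNReal.ofReal p) (μ := volume)
      hc).eLpNorm_lt_top
    rw [eLpNorm_eq_lintegral_rpow_enorm_toReal (by simpa using hp) ENNReal.ofReal_ne_top,
      ENNReal.toReal_ofReal hp.le] at this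
    intro h
    rw [h, ENNReal.top_rpow_of_pos (by positivity)] at this
    exact lt_irrefl _ this
  set I := ∫⁻ t, ‖g t‖ₑ ^ p with hIdef
  have h3 : ∫⁻ x, sqf F x ^ p ≤ C ^ p * I ^ d := by
    have := ENNReal.rpow_le_rpow hmain hp.le
    rwa [nm, nm, h2, ENNReal.mul_rpow_of_nonneg _ _ hp.le, ← ENNReal.rpow_mul, ← ENNReal.rpow_mul,
      one_div_mul_cancel hp.ne', ENNReal.rpow_one, ENNReal.rpow_one] at this
  have h4 : (A ^ d) ^ p * I ^ d ≤ C ^ p * I ^ d := by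
    refine le_trans ?_ h3
    refine le_trans ?_ h1
    refine le_trans (le_of_eq ?_) (pow_le_pow_left₀ bot_le h d)
    rw [mul_pow, ← ENNReal.rpow_natCast A, ← ENNReal.rpow_natCast (A ^ p), ← ENNReal.rpow_mul,
      ← ENNReal.rpow_mul, mul_comm (d : ℝ)]
  have h5 := (ENNReal.mul_le_mul_iff_left (pow_ne_zero d h0) (by finiteness)).1 h4
  exact (ENNReal.rpow_le_rpow_iff hp).1 h5

end

section

variable {d : ℕ} {i : Fin d}

/-- The character `e^{2π i u}`. -/
def ex (u : ℝ) : ℂ := Complex.exp ((2 * Real.pi * u : ℝ) * Complex.I)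

theorem norm_ex (u : ℝ) : ‖ex u‖ = 1 := Complex.norm_exp_ofReal_mul_I _

theorem ex_add (u v : ℝ) : ex (u + v) = ex u * ex v := by
  rw [ex, ex, ex, ← Complex.exp_add]; congr 1; push_cast; ring

theorem continuous_ex : Continuous ex := by unfold ex; fun_prop

theorem contDiff_ex : ContDiff ℝ (⊤ : ℕ∞) ex := by
  unfold ex
  have : ContDiff ℝ (⊤ : ℕ∞) fun u : ℝ ↦ ((2 * Real.pi * u : ℝ) : ℂ) :=
    Complex.ofRealCLM.contDiff.comp (contDiff_const.mul contDiff_id)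
  exact (this.mul contDiff_const).cexp

theorem integral_ex (l u : ℝ) (hu : u ≠ 0) :
    ∫ ξ in l..2 * l, ex (ξ * u) = ex (l * u) * ((ex (l * u) - 1) * (2 * Real.pi * u * Complex.I)⁻¹) := by
  have hc : (2 * Real.pi * u * Complex.I : ℂ) ≠ 0 := by
    have := Real.pi_ne_zero
    simp [hu]
  have e : ∀ ξ : ℝ, ex (ξ * u) = Complex.exp ((2 * Real.pi * u * Complex.I) * ξ) := by
    intro ξ; rw [ex]; congr 1; push_cast; ring
  simp only [e]
  rw [integral_exp_mul_complex hc]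
  push_cast
  rw [show (2 * Real.pi * u * Complex.I * (2 * l) : ℂ) = 2 * Real.pi * u * Complex.I * l +
    2 * Real.pi * u * Complex.I * l by ring, Complex.exp_add]
  field_simp

theorem fourier_eq_ex (g : ℝ → ℂ) (ξ : ℝ) : 𝓕 g ξ = ∫ y, ex (-(y * ξ)) * g y := by
  rw [Real.fourier_eq']
  refine integral_congr_ae (.of_forall fun y ↦ ?_)
  simp only [ex, smul_eq_mul]
  congr 3
  simp [mul_comm]

theorem psum_eq (l : ℝ) (g : ℝ → ℂ) (t : ℝ) :
    psum l g t = ∫ ξ in l..2 * l, ex (ξ * t) * 𝓕 g ξ := rfl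

theorem psum_eq_integral {l : ℝ} (hl : 0 ≤ l) {g : ℝ → ℂ} (hg : Integrable g) (t : ℝ) :
    psum l g t = ∫ y, (∫ ξ in l..2 * l, ex (ξ * (t - y))) * g y := by
  have h2 : l ≤ 2 * l := by linarith
  rw [psum_eq]
  simp only [fourier_eq_ex, intervalIntegral.integral_of_le h2, ← integral_const_mul,
    ← integral_mul_const]
  rw [integral_integral_swap]
  · refine integral_congr_ae (.of_forall fun y ↦ ?_)
    refine integral_congr_ae (.of_forall fun ξ ↦ ?_)
    beta_reduce
    rw [← mul_assoc, ← ex_add]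
    congr 2; ring
  · have h1 : Integrable (fun z : ℝ × ℝ ↦ (1 : ℂ) * g z.2)
        ((volume.restrict (Set.Ioc l (2 * l))).prod volume) :=
      Integrable.mul_prod (integrable_const 1) hg
    refine h1.mono ?_ (.of_forall fun z ↦ ?_)
    · have hc := continuous_ex
      refine AEStronglyMeasurable.mul (by fun_prop) (AEStronglyMeasurable.mul (by fun_prop) ?_)
      exact hg.aestronglyMeasurable.comp_snd
    · simp [Function.uncurry, norm_ex]

theorem psum_ex_mul {l : ℝ} (hl : 0 ≤ l) {G : ℝ → ℝ} (hG : Integrable G) {t : ℝ} (ht : t < 0)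
    (hs : ∀ y, G y ≠ 0 → 0 ≤ y) :
    psum l (fun y ↦ ex (l * y) * G y) t =
      ex (l * t) * ∫ y, (ex (l * (t - y)) - 1) * (G y * (2 * Real.pi * (t - y) * Complex.I)⁻¹) := by
  have hc := continuous_ex
  have hi : Integrable (fun y ↦ ex (l * y) * (G y : ℂ)) := by
    have hG' : Integrable (fun y ↦ (G y : ℂ)) := hG.ofReal
    refine hG'.mono ?_ (.of_forall fun y ↦ ?_)
    · exact AEStronglyMeasurable.mul (by fun_prop) hG'.aestronglyMeasurable
    · simp [norm_ex]
  rw [psum_eq_integral hl hi, ← integral_const_mul]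
  refine integral_congr_ae (.of_forall fun y ↦ ?_)
  beta_reduce
  by_cases hy : G y = 0
  · simp [hy]
  have : t - y ≠ 0 := by have := hs y hy; linarith
  rw [integral_ex _ _ this, show l * t = l * (t - y) + l * y by ring, ex_add]
  push_cast
  ring

theorem integrable_div_sub {G : ℝ → ℝ} (hG : Integrable G) {t : ℝ} (ht : t < 0)
    (hs : ∀ y, G y ≠ 0 → 0 ≤ y) :
    Integrable fun y ↦ (G y : ℂ) * (2 * Real.pi * (t - y) * Complex.I)⁻¹ := by
  refine Integrable.mono' (hG.norm.mul_const (2 * Real.pi * (-t))⁻¹) ?_ (.of_forall fun y ↦ ?_)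
  · refine hG.ofReal.aestronglyMeasurable.mul (Measurable.aestronglyMeasurable ?_)
    fun_prop
  · by_cases hy : G y = 0
    · simp [hy]
    have hy0 := hs y hy
    rw [norm_mul, Complex.norm_real]
    refine mul_le_mul_of_nonneg_left ?_ (norm_nonneg _)
    rw [norm_inv, norm_mul, norm_mul, norm_mul, Complex.norm_I, ← Complex.ofReal_sub,
      Complex.norm_real, Complex.norm_real, Complex.norm_ofNat, Real.norm_of_nonneg Real.pi_pos.le,
      mul_one]
    have h1 : -t ≤ ‖t - y‖ := by
      rw [Real.norm_eq_abs]
      exact (by linarith : -t ≤ -(t - y)).trans (neg_le_abs _)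
    have : 0 < -t := by linarith
    have := Real.pi_pos
    gcongr

theorem tendsto_enorm_psum {G : ℝ → ℝ} (hG : Integrable G) (h0 : ∀ y, 0 ≤ G y) {t : ℝ}
    (ht : t < 0) (hs : ∀ y, G y ≠ 0 → 0 ≤ y) : Filter.Tendsto
      (fun l : ℝ ↦ ‖psum l (fun y ↦ ex (l * y) * G y) t‖ₑ) Filter.atTop
      (nhds (ENNReal.ofReal ((2 * Real.pi)⁻¹ * ∫ y, G y * (y - t)⁻¹))) := by
  set h : ℝ → ℂ := fun y ↦ (G y : ℂ) * (2 * Real.pi * (t - y) * Complex.I)⁻¹ with hh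
  have hi : Integrable h := integrable_div_sub hG ht hs
  have hRL := (Real.tendsto_integral_exp_smul_cocompact h).mono_left
    (atTop_le_cocompact (α := ℝ))
  have hH : ∫ y, h y = (((2 * Real.pi)⁻¹ * ∫ y, G y * (y - t)⁻¹ : ℝ) : ℂ) * Complex.I := by
    rw [← integral_const_mul, ← integral_complex_ofReal, ← integral_mul_const]
    refine integral_congr_ae (.of_forall fun y ↦ ?_)
    simp only [hh]
    push_cast
    rw [mul_inv, Complex.inv_I, mul_inv, ← neg_sub (y : ℂ) t, inv_neg]
    ring
  have hr : 0 ≤ (2 * Real.pi)⁻¹ * ∫ y, G y * (y - t)⁻¹ := by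
    refine mul_nonneg (by positivity) (integral_nonneg fun y ↦ ?_)
    by_cases hy : G y = 0
    · simp [hy]
    · have := hs y hy
      exact mul_nonneg (h0 y) (inv_nonneg.2 (by linarith))
  have key : ∀ l : ℝ, 0 ≤ l → ‖psum l (fun y ↦ ex (l * y) * G y) t‖ =
      ‖ex (l * t) * (∫ y, Real.fourierChar (-(y * l)) • h y) - ∫ y, h y‖ := by
    intro l hl
    have hc := continuous_ex
    rw [psum_ex_mul hl hG ht hs, norm_mul, norm_ex, one_mul, ← integral_const_mul,
      ← integral_sub _ hi]
    · refine congrArg _ (integral_congr_ae (.of_forall fun y ↦ ?_))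
      simp only [Circle.smul_def, Real.fourierChar_apply, smul_eq_mul]
      rw [show l * (t - y) = l * t + (-(y * l)) by ring, ex_add, sub_mul, one_mul, mul_assoc]
      rfl
    · refine Integrable.const_mul ?_ _
      refine hi.mono ?_ (.of_forall fun y ↦ by simp)
      exact AEStronglyMeasurable.smul (by fun_prop) hi.aestronglyMeasurable
  have h1 : Filter.Tendsto (fun l : ℝ ↦
      ex (l * t) * (∫ y, Real.fourierChar (-(y * l)) • h y) - ∫ y, h y) Filter.atTop
      (nhds (0 - ∫ y, h y)) := by
    refine Filter.Tendsto.sub_const ?_ _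
    refine squeeze_zero_norm (fun l ↦ ?_) (tendsto_zero_iff_norm_tendsto_zero.1 hRL)
    rw [norm_mul, norm_ex, one_mul]
  have h2 := (continuous_enorm.tendsto _).comp h1
  have h3 : ‖(0 : ℂ) - ∫ y, h y‖ₑ =
      ENNReal.ofReal ((2 * Real.pi)⁻¹ * ∫ y, G y * (y - t)⁻¹) := by
    rw [zero_sub, enorm_neg, hH, ← ofReal_norm, norm_mul, Complex.norm_real, Complex.norm_I,
      mul_one, Real.norm_of_nonneg hr]
  rw [← h3]
  refine h2.congr' ?_
  filter_upwards [Filter.eventually_ge_atTop 0] with l hl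
  simp only [Function.comp, ← ofReal_norm, key l hl]

end

section

variable {d : ℕ} {i : Fin d}

theorem psq_singleton (k : ℤ) (g : ℝ → ℂ) (t : ℝ) : psq {k} g t = ‖psum (2 ^ (k - 1)) g t‖ₑ := by
  rw [psq, Finset.sum_singleton, ← ENNReal.rpow_natCast, ← ENNReal.rpow_mul]
  norm_num

theorem le_integral_mul_inv {G : ℝ → ℝ} (hG : Integrable G) (h0 : ∀ y, 0 ≤ G y) {e t : ℝ}
    (he : 0 < e) (he1 : e ≤ 1) (ht : t < 0) (het : -e ≤ t) (hs : ∀ y, G y ≠ 0 → 0 ≤ y)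
    (h1 : ∀ y ∈ Set.Icc e 1, G y = 1) :
    -Real.log (2 * e) ≤ ∫ y, G y * (y - t)⁻¹ := by
  have hi : Integrable fun y ↦ G y * (y - t)⁻¹ := by
    refine Integrable.mono' (hG.norm.mul_const (-t)⁻¹) ?_ (.of_forall fun y ↦ ?_)
    · exact hG.aestronglyMeasurable.mul (Measurable.aestronglyMeasurable (by fun_prop))
    · by_cases hy : G y = 0
      · simp [hy]
      have hy0 := hs y hy
      have h3 : 0 < -t := by linarith
      have h4 : -t ≤ y - t := by linarith
      rw [norm_mul, norm_inv, Real.norm_of_nonneg (h3.le.trans h4)]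
      gcongr
  have h2 : ∫ y in e..1, (y + e)⁻¹ = Real.log ((1 + e) / (2 * e)) := by
    rw [intervalIntegral.integral_comp_add_right (fun y ↦ y⁻¹), integral_inv_of_pos (by linarith)
      (by linarith)]
    ring_nf
  have h3 : -Real.log (2 * e) ≤ Real.log ((1 + e) / (2 * e)) := by
    rw [Real.log_div (by positivity) (by positivity)]
    have := Real.log_nonneg (by linarith : (1 : ℝ) ≤ 1 + e)
    linarith
  refine h3.trans (h2.symm.le.trans ?_)
  rw [intervalIntegral.integral_of_le he1, ← integral_indicator measurableSet_Ioc]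
  refine integral_mono_of_nonneg (.of_forall fun y ↦ ?_) hi (.of_forall fun y ↦ ?_)
  · refine Set.indicator_nonneg (fun y hy ↦ ?_) y
    have := hy.1
    exact inv_nonneg.2 (by linarith)
  · by_cases hy : y ∈ Set.Ioc e 1
    · rw [Set.indicator_of_mem hy]
      beta_reduce
      have := hy.1
      rw [h1 y ⟨hy.1.le, hy.2⟩, one_mul]
      exact inv_anti₀ (by linarith) (by linarith)
    · rw [Set.indicator_of_notMem hy]
      by_cases hy : G y = 0
      · simp [hy]
      · have := hs y hy
        exact mul_nonneg (h0 y) (inv_nonneg.2 (by linarith))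

theorem exists_le_lintegral_psq {p : ℝ} (hp : 2 < p) : ∃ (g : ℝ → ℂ) (k : ℤ),
    ContDiff ℝ (⊤ : ℕ∞) g ∧ HasCompactSupport g ∧ ∫⁻ t, ‖g t‖ₑ ^ p ≠ 0 ∧
    ENNReal.ofReal (p / (8 * Real.pi * Real.exp 1)) ^ p * ∫⁻ t, ‖g t‖ₑ ^ p ≤
      ∫⁻ t, psq {k} g t ^ p := by
  have hp0 : 0 < p := by linarith
  set e : ℝ := Real.exp (-p) / 2 with he
  have he0 : 0 < e := by positivity
  have he1 : e ≤ 1 / 2 := by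
    have : Real.exp (-p) ≤ 1 := Real.exp_le_one_iff.2 (by linarith)
    linarith
  let b : ContDiffBump ((1 + e) / 2 : ℝ) := ⟨(1 - e) / 2, (1 + e) / 2, by linarith, by linarith⟩
  have hb1 : ∀ y ∈ Set.Icc e 1, b y = 1 := fun y hy ↦ by
    refine b.one_of_mem_closedBall ?_
    rw [Metric.mem_closedBall, Real.dist_eq, abs_le]
    have h1 := hy.1
    have h2 := hy.2
    constructor <;> simp only [b] <;> linarith
  have hsupp : ∀ y, b y ≠ 0 → y ∈ Metric.ball ((1 + e) / 2 : ℝ) ((1 + e) / 2) := fun y hy ↦ by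
    have : y ∈ Function.support b := hy
    rwa [b.support_eq] at this
  have hs : ∀ y, b y ≠ 0 → 0 ≤ y := fun y hy ↦ by
    have := hsupp y hy
    rw [Metric.mem_ball, Real.dist_eq, abs_lt] at this
    linarith [this.1]
  have hbi : Integrable b := b.continuous.integrable_of_hasCompactSupport b.hasCompactSupport
  have hpi := Real.pi_pos
  let g : ℕ → ℝ → ℂ := fun n y ↦ ex (2 ^ n * y) * b y
  have hgs : ∀ n, ContDiff ℝ (⊤ : ℕ∞) (g n) := fun n ↦
    (contDiff_ex.comp (contDiff_const.mul contDiff_id)).mul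
      (Complex.ofRealCLM.contDiff.comp b.contDiff)
  have hgc : ∀ n, HasCompactSupport (g n) := fun n ↦ by
    refine HasCompactSupport.mul_left ?_
    exact b.hasCompactSupport.comp_left (g := fun x : ℝ ↦ (x : ℂ)) (by simp)
  have hgn : ∀ n y, ‖g n y‖ₑ = ENNReal.ofReal (b y) := fun n y ↦ by
    rw [← ofReal_norm, norm_mul, norm_ex, one_mul, Complex.norm_real,
      Real.norm_of_nonneg b.nonneg]
  have hI2 : ∀ n, ∫⁻ t, ‖g n t‖ₑ ^ p ≤ 2 := fun n ↦ by
    have : ∀ t, ‖g n t‖ₑ ^ p ≤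
        (Metric.ball ((1 + e) / 2 : ℝ) ((1 + e) / 2)).indicator (fun _ ↦ 1) t := fun t ↦ by
      rw [hgn]
      by_cases ht : b t = 0
      · simp [ht, hp0]
      · rw [Set.indicator_of_mem (hsupp t ht)]
        exact ENNReal.rpow_le_one (ENNReal.ofReal_le_one.2 b.le_one) hp0.le
    refine (lintegral_mono this).trans ?_
    rw [lintegral_indicator Metric.isOpen_ball.measurableSet, setLIntegral_one, Real.volume_ball]
    exact ENNReal.ofReal_le_of_le_toReal (by norm_num; linarith)
  have hI0 : ∀ n, ∫⁻ t, ‖g n t‖ₑ ^ p ≠ 0 := fun n ↦ by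
    have : ∀ t, (Set.Icc e 1).indicator (fun _ ↦ (1 : ℝ≥0∞)) t ≤ ‖g n t‖ₑ ^ p := fun t ↦ by
      by_cases ht : t ∈ Set.Icc e 1
      · rw [Set.indicator_of_mem ht, hgn, hb1 t ht]; simp
      · rw [Set.indicator_of_notMem ht]; exact bot_le
    have h := lintegral_mono (μ := volume) this
    rw [lintegral_indicator measurableSet_Icc, setLIntegral_one, Real.volume_Icc] at h
    intro h'
    rw [h', nonpos_iff_eq_zero, ENNReal.ofReal_eq_zero] at h
    linarith
  have hlim : ∀ t ∈ Set.Ioo (-e) 0, ENNReal.ofReal (p / (2 * Real.pi)) ^ p ≤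
      Filter.liminf (fun n : ℕ ↦ psq {(n : ℤ) + 1} (g n) t ^ p) Filter.atTop := fun t ht ↦ by
    have h1 := (tendsto_enorm_psum hbi (fun y ↦ b.nonneg) ht.2 hs).comp
      (tendsto_pow_atTop_atTop_of_one_lt (one_lt_two (α := ℝ)))
    have h2 := (ENNReal.continuous_rpow_const (y := p)).tendsto _ |>.comp h1
    have h3 : (fun n : ℕ ↦ psq {(n : ℤ) + 1} (g n) t ^ p) = ((fun x ↦ x ^ p) ∘
      (fun l : ℝ ↦ ‖psum l (fun y ↦ ex (l * y) * b y) t‖ₑ) ∘ fun n : ℕ ↦ (2 : ℝ) ^ n) := by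
      funext n
      simp [psq_singleton, g]
    rw [h3, h2.liminf_eq]
    refine ENNReal.rpow_le_rpow (ENNReal.ofReal_le_ofReal ?_) hp0.le
    have := le_integral_mul_inv hbi (fun y ↦ b.nonneg) he0 (by linarith) ht.2 ht.1.le hs hb1
    have hlog : Real.log (2 * e) = -p := by
      rw [he, mul_div_cancel₀ _ two_ne_zero, Real.log_exp]
    rw [hlog, neg_neg] at this
    rw [div_eq_inv_mul]
    gcongr
  have hF : ENNReal.ofReal (p / (2 * Real.pi)) ^ p * ENNReal.ofReal e ≤
      Filter.liminf (fun n : ℕ ↦ ∫⁻ t in Set.Ioo (-e) 0, psq {(n : ℤ) + 1} (g n) t ^ p)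
        Filter.atTop := by
    refine le_trans ?_ (lintegral_liminf_le fun n ↦ (measurable_psq _
      ((hgs n).continuous.integrable_of_hasCompactSupport (hgc n))).pow_const p)
    calc _ = ∫⁻ t in Set.Ioo (-e) 0, ENNReal.ofReal (p / (2 * Real.pi)) ^ p := by
            rw [setLIntegral_const, Real.volume_Ioo]; simp
      _ ≤ _ := setLIntegral_mono' measurableSet_Ioo hlim
  have hA : ENNReal.ofReal (p / (8 * Real.pi * Real.exp 1)) ^ p * 2 <
      ENNReal.ofReal (p / (2 * Real.pi)) ^ p * ENNReal.ofReal e := by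
    rw [ENNReal.ofReal_rpow_of_pos (by positivity), ENNReal.ofReal_rpow_of_pos (by positivity),
      ← ENNReal.ofReal_ofNat 2, ← ENNReal.ofReal_mul (by positivity),
      ← ENNReal.ofReal_mul (by positivity)]
    refine (ENNReal.ofReal_lt_ofReal_iff (by positivity)).2 ?_
    have h1 : p / (8 * Real.pi * Real.exp 1) = p / (2 * Real.pi) * ((1 / 4) * Real.exp (-1)) := by
      rw [Real.exp_neg]; field_simp; norm_num
    have h2 : ((1 / 4 : ℝ)) ^ p < 1 / 4 := by
      have := Real.rpow_lt_rpow_of_exponent_gt (x := 1 / 4) (by norm_num) (by norm_num)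
        (by linarith : 1 < p)
      rwa [Real.rpow_one] at this
    rw [h1, Real.mul_rpow (by positivity) (by positivity),
      Real.mul_rpow (by positivity) (by positivity), ← Real.exp_mul, neg_one_mul, he, mul_assoc]
    refine mul_lt_mul_of_pos_left ?_ (by positivity)
    nlinarith [Real.exp_pos (-p)]
  obtain ⟨n, hn⟩ := (Filter.eventually_lt_of_lt_liminf (hA.trans_le hF)).exists
  refine ⟨g n, n + 1, hgs n, hgc n, hI0 n, ?_⟩
  refine (mul_le_mul_right (hI2 n) _).trans (hn.le.trans ?_)
  exact setLIntegral_le_lintegral _ _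

theorem exists_le_dyadicUpperConst_of_two_lt : ∃ c : ℝ, 0 < c ∧ ∀ (d : ℕ) (p : ℝ), 2 < p →
    ENNReal.ofReal (c * p) ^ d ≤ dyadicUpperConst d p := by
  refine ⟨(8 * Real.pi * Real.exp 1)⁻¹, by positivity, fun d p hp ↦ ?_⟩
  obtain ⟨g, k, h1, h2, h3, h4⟩ := exists_le_lintegral_psq hp
  rw [← div_eq_inv_mul]
  exact le_dyadicUpperConst (by linarith) h1 h2 h3 {k} h4

end

section

variable {d : ℕ} {i : Fin d}

theorem norm_ex_sub_one_le (u : ℝ) : ‖ex u - 1‖ ≤ 2 * Real.pi * |u| := by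
  rw [ex, mul_comm]
  refine Real.norm_exp_I_mul_ofReal_sub_one_le.trans (le_of_eq ?_)
  rw [norm_mul, Real.norm_eq_abs u, Real.norm_of_nonneg Real.two_pi_pos.le]

theorem norm_ex_sub_one_sq (u : ℝ) : ‖ex u - 1‖ ^ 2 = 2 - 2 * Real.cos (2 * Real.pi * u) := by
  have h : ∀ c s : ℝ, ‖(c + s * Complex.I - 1 : ℂ)‖ ^ 2 = (c - 1) ^ 2 + s ^ 2 := fun c s ↦ by
    rw [← Complex.normSq_eq_norm_sq, Complex.normSq_apply]
    simp
    ring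
  rw [ex, Complex.exp_mul_I, ← Complex.ofReal_cos, ← Complex.ofReal_sin, h]
  linear_combination Real.sin_sq_add_cos_sq (2 * Real.pi * u)

theorem norm_fourier_sub_one_le {g : ℝ → ℝ} (hg : Integrable g) (h0 : ∀ y, 0 ≤ g y)
    (h1 : ∫ y, g y = 1) (hs : ∀ y, g y ≠ 0 → |y| ≤ 1) (ξ : ℝ) :
    ‖𝓕 (fun y ↦ (g y : ℂ)) ξ - 1‖ ≤ 2 * Real.pi * |ξ| := by
  have hc := continuous_ex
  have hg' : Integrable (fun y ↦ (g y : ℂ)) := hg.ofReal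
  have h2 : (1 : ℂ) = ∫ y, (g y : ℂ) := by rw [integral_complex_ofReal, h1]; simp
  rw [fourier_eq_ex, h2, ← integral_sub _ hg']
  · refine (norm_integral_le_of_norm_le (g := fun y ↦ g y * (2 * Real.pi * |ξ|))
      (hg.mul_const _) (.of_forall fun y ↦ ?_)).trans ?_
    · by_cases hy : g y = 0
      · simp [hy]
      · have e : ex (-(y * ξ)) * (g y : ℂ) - g y = g y * (ex (-(y * ξ)) - 1) := by ring
        rw [e, norm_mul, Complex.norm_real, Real.norm_of_nonneg (h0 y)]
        refine mul_le_mul_of_nonneg_left ((norm_ex_sub_one_le _).trans ?_) (h0 y)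
        rw [abs_neg, abs_mul]
        have := mul_le_of_le_one_left (abs_nonneg ξ) (hs y hy)
        have := Real.pi_pos
        gcongr
    · rw [integral_mul_const, h1, one_mul]
  · refine hg'.mono ?_ (.of_forall fun y ↦ by simp [norm_ex])
    exact AEStronglyMeasurable.mul (by fun_prop) hg'.aestronglyMeasurable

theorem norm_psum_sub_le {g : ℝ → ℝ} (hg : Integrable g) (h0 : ∀ y, 0 ≤ g y)
    (h1 : ∫ y, g y = 1) (hs : ∀ y, g y ≠ 0 → |y| ≤ 1) {l : ℝ} (hl : 0 < l) {x : ℝ} (hx : 0 < x) :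
    ‖psum l (fun y ↦ (g y : ℂ)) x -
      ex (l * x) * ((ex (l * x) - 1) * (2 * Real.pi * x * Complex.I)⁻¹)‖ ≤
      4 * Real.pi * l ^ 2 := by
  have hc := continuous_ex
  have hg' : Integrable (fun y ↦ (g y : ℂ)) := hg.ofReal
  have hf := continuous_fourier_real hg'
  rw [← integral_ex l x hx.ne', psum_eq, ← intervalIntegral.integral_sub]
  · refine (intervalIntegral.norm_integral_le_of_norm_le_const (C := 4 * Real.pi * l)
      fun ξ hξ ↦ ?_).trans (le_of_eq ?_)
    · rw [Set.uIoc_of_le (by linarith)] at hξ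
      rw [show ex (ξ * x) * 𝓕 (fun y ↦ (g y : ℂ)) ξ - ex (ξ * x) =
        ex (ξ * x) * (𝓕 (fun y ↦ (g y : ℂ)) ξ - 1) by ring, norm_mul, norm_ex, one_mul]
      refine (norm_fourier_sub_one_le hg h0 h1 hs ξ).trans ?_
      rw [abs_of_pos (hl.trans hξ.1)]
      nlinarith [hξ.2, Real.pi_pos]
    · rw [show 2 * l - l = l by ring, abs_of_pos hl]; ring
  · exact Continuous.intervalIntegrable (by fun_prop) _ _
  · exact Continuous.intervalIntegrable (by fun_prop) _ _

/-- The sum of the squared moduli of `e^{2π i λ x} - 1` over the frequencies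
`λ = 2 ^ (-(2 m + i + 1))`, `i < m`. -/
def lac (m : ℕ) (x : ℝ) : ℝ :=
  ∑ i ∈ Finset.range m, (2 - 2 * Real.cos (2 * Real.pi * ((2 : ℝ)⁻¹ ^ (2 * m + i + 1) * x)))

theorem lac_le (m : ℕ) (x : ℝ) : lac m x ≤ 4 * m := by
  refine (Finset.sum_le_card_nsmul _ _ 4 fun i _ ↦ ?_).trans (by simp [mul_comm])
  linarith [Real.neg_one_le_cos (2 * Real.pi * ((2 : ℝ)⁻¹ ^ (2 * m + i + 1) * x))]

theorem continuous_lac (m : ℕ) : Continuous (lac m) := by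
  unfold lac; fun_prop

theorem integral_lac {m n : ℕ} (hn : 3 * m ≤ n) :
    ∫ x in (2 : ℝ) ^ n..2 ^ (n + 1), (lac m x - m) = 2 ^ n * m := by
  have h1 : ∀ i ∈ Finset.range m, ∫ x in (2 : ℝ) ^ n..2 ^ (n + 1),
      (2 - 2 * Real.cos (2 * Real.pi * ((2 : ℝ)⁻¹ ^ (2 * m + i + 1) * x))) = 2 * 2 ^ n := by
    intro i hi
    rw [Finset.mem_range] at hi
    obtain ⟨r, rfl⟩ : ∃ r, n = r + (2 * m + i + 1) := ⟨n - (2 * m + i + 1), by omega⟩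
    set s := 2 * m + i + 1
    have hpi := Real.pi_ne_zero
    have hs : (2 : ℝ)⁻¹ ^ s * 2 ^ s = 1 := by rw [← mul_pow]; norm_num
    have hsin : ∀ k : ℕ, Real.sin (2 * Real.pi * (2 : ℝ)⁻¹ ^ s * 2 ^ (k + s)) = 0 := by
      intro k
      rw [show 2 * Real.pi * (2 : ℝ)⁻¹ ^ s * 2 ^ (k + s) = ((2 * 2 ^ k : ℕ) : ℝ) * Real.pi by
        rw [pow_add]; push_cast; linear_combination 2 * Real.pi * 2 ^ k * hs]
      exact Real.sin_nat_mul_pi _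
    have hc : ∫ x in (2 : ℝ) ^ (r + s)..2 ^ (r + s + 1),
        Real.cos (2 * Real.pi * (2 : ℝ)⁻¹ ^ s * x) = 0 := by
      rw [intervalIntegral.integral_comp_mul_left (fun x ↦ Real.cos x) (by positivity),
        integral_cos, show r + s + 1 = (r + 1) + s by ring, hsin, hsin]
      simp
    simp only [← mul_assoc]
    rw [intervalIntegral.integral_sub, intervalIntegral.integral_const_mul, hc]
    · simp [pow_succ]; ring
    · simp
    · exact Continuous.intervalIntegrable (by fun_prop) _ _
  have hc := continuous_lac m
  rw [intervalIntegral.integral_sub (hc.intervalIntegrable _ _) (by simp)]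
  unfold lac
  rw [intervalIntegral.integral_finsetSum, Finset.sum_congr rfl h1]
  · simp [pow_succ]; ring
  · exact fun i _ ↦ Continuous.intervalIntegrable (by fun_prop) _ _

end

section

variable {d : ℕ} {i : Fin d}

theorem ofReal_integral_le_lintegral {α : Type*} [MeasurableSpace α] {μ : Measure α} {f : α → ℝ}
    (hf : Integrable f μ) : ENNReal.ofReal (∫ x, f x ∂μ) ≤ ∫⁻ x, ENNReal.ofReal (f x) ∂μ := by
  refine ENNReal.ofReal_le_of_le_toReal ?_
  rw [integral_eq_lintegral_pos_part_sub_lintegral_neg_part hf]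
  exact sub_le_self _ ENNReal.toReal_nonneg

theorem sum_inv_sixteen_pow_le (m : ℕ) : ∑ i ∈ Finset.range m, ((16 : ℝ)⁻¹ ^ (i + 1)) ≤ 1 := by
  have : ∀ m : ℕ, ∑ i ∈ Finset.range m, ((16 : ℝ)⁻¹ ^ (i + 1)) ≤ 1 - 16⁻¹ ^ m := by
    intro m
    induction m with
    | zero => simp
    | succ k ih =>
      rw [Finset.sum_range_succ, pow_succ]
      have : (0 : ℝ) < 16⁻¹ ^ k := by positivity
      linarith
  have h := this m
  have : (0 : ℝ) < 16⁻¹ ^ m := by positivity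
  linarith

theorem le_sum_norm_psum_sq {g : ℝ → ℝ} (hg : Integrable g) (h0 : ∀ y, 0 ≤ g y)
    (h1 : ∫ y, g y = 1) (hs : ∀ y, g y ≠ 0 → |y| ≤ 1) {m : ℕ} {x : ℝ} (hx : 0 < x)
    (hx4 : x ≤ 16 ^ m) :
    (lac m x / (8 * Real.pi ^ 2) - 16 * Real.pi ^ 2) / x ^ 2 ≤
      ∑ i ∈ Finset.range m, ‖psum ((2 : ℝ)⁻¹ ^ (2 * m + i + 1)) (fun y ↦ (g y : ℂ)) x‖ ^ 2 := by
  have hpi := Real.pi_pos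
  have hterm : ∀ i ∈ Finset.range m,
      ((2 - 2 * Real.cos (2 * Real.pi * ((2 : ℝ)⁻¹ ^ (2 * m + i + 1) * x))) / (8 * Real.pi ^ 2) -
        16 * Real.pi ^ 2 * (16 : ℝ)⁻¹ ^ (i + 1)) / x ^ 2 ≤
      ‖psum ((2 : ℝ)⁻¹ ^ (2 * m + i + 1)) (fun y ↦ (g y : ℂ)) x‖ ^ 2 := by
    intro i _
    set l : ℝ := (2 : ℝ)⁻¹ ^ (2 * m + i + 1) with hl
    have hl0 : 0 < l := by positivity
    set u := psum l (fun y ↦ (g y : ℂ)) x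
    set v := ex (l * x) * ((ex (l * x) - 1) * (2 * Real.pi * x * Complex.I)⁻¹) with hv
    have he : ‖u - v‖ ≤ 4 * Real.pi * l ^ 2 := norm_psum_sub_le hg h0 h1 hs hl0 hx
    have hl2 : l ^ 2 * x ≤ (4 : ℝ)⁻¹ ^ (i + 1) := by
      have e : l ^ 2 = (16 : ℝ)⁻¹ ^ m * 4⁻¹ ^ (i + 1) := by
        rw [hl, ← pow_mul, show (2 * m + i + 1) * 2 = 4 * m + 2 * (i + 1) by ring, pow_add, pow_mul,
          pow_mul]
        norm_num
      rw [e]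
      calc (16 : ℝ)⁻¹ ^ m * 4⁻¹ ^ (i + 1) * x ≤ (16 : ℝ)⁻¹ ^ m * 4⁻¹ ^ (i + 1) * 16 ^ m := by gcongr
        _ = 4⁻¹ ^ (i + 1) := by
          rw [mul_right_comm, ← mul_pow]; norm_num
    have hvn : ‖v‖ ^ 2 = (2 - 2 * Real.cos (2 * Real.pi * (l * x))) / (4 * Real.pi ^ 2) / x ^ 2 := by
      rw [hv, norm_mul, norm_ex, one_mul, norm_mul, mul_pow, norm_ex_sub_one_sq, norm_inv, norm_mul,
        norm_mul, norm_mul, Complex.norm_I, Complex.norm_real, Complex.norm_real,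
        Complex.norm_ofNat, Real.norm_of_nonneg hpi.le, Real.norm_of_nonneg hx.le]
      field_simp
      ring
    have he2 : ‖u - v‖ ^ 2 * x ^ 2 ≤ 16 * Real.pi ^ 2 * (16 : ℝ)⁻¹ ^ (i + 1) := by
      rw [← mul_pow]
      have : ‖u - v‖ * x ≤ 4 * Real.pi * (4 : ℝ)⁻¹ ^ (i + 1) := by
        refine (mul_le_mul_of_nonneg_right he hx.le).trans ?_
        rw [mul_assoc]
        gcongr
      refine (pow_le_pow_left₀ (by positivity) this 2).trans (le_of_eq ?_)
      rw [mul_pow, mul_pow, ← pow_mul, mul_comm (i + 1), pow_mul]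
      norm_num
    have htri : ‖v‖ ≤ ‖u‖ + ‖u - v‖ := by
      rw [← norm_sub_rev]
      simpa using norm_add_le u (v - u)
    have hsq : ‖v‖ ^ 2 / 2 - ‖u - v‖ ^ 2 ≤ ‖u‖ ^ 2 := by
      nlinarith [norm_nonneg u, norm_nonneg v, norm_nonneg (u - v), sq_nonneg (‖u‖ - ‖u - v‖)]
    refine le_trans ?_ hsq
    rw [hvn, div_le_iff₀ (by positivity), sub_mul]
    have : (2 - 2 * Real.cos (2 * Real.pi * (l * x))) / (4 * Real.pi ^ 2) / x ^ 2 / 2 * x ^ 2 =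
      (2 - 2 * Real.cos (2 * Real.pi * (l * x))) / (8 * Real.pi ^ 2) := by
      field_simp; ring
    rw [this]
    linarith
  refine le_trans ?_ (Finset.sum_le_sum hterm)
  rw [← Finset.sum_div, Finset.sum_sub_distrib, ← Finset.sum_div, ← Finset.mul_sum, ← lac]
  have := mul_le_of_le_one_right (by positivity : (0 : ℝ) ≤ 16 * Real.pi ^ 2)
    (sum_inv_sixteen_pow_le m)
  gcongr

/-- The indices of the dyadic intervals `[2 ^ (k - 1), 2 ^ k)` with
`k - 1 = -(2 m + i + 1)`, `i < m`. -/
def lacIndex (m : ℕ) : Finset ℤ := (Finset.range m).image fun i : ℕ ↦ -(2 * m + i : ℤ)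

theorem psq_lacIndex (m : ℕ) (g : ℝ → ℂ) (x : ℝ) : psq (lacIndex m) g x =
    ENNReal.ofReal (∑ i ∈ Finset.range m, ‖psum ((2 : ℝ)⁻¹ ^ (2 * m + i + 1)) g x‖ ^ 2) ^
      (1 / 2 : ℝ) := by
  rw [psq, lacIndex, Finset.sum_image (fun a _ b _ h ↦ by simpa using h),
    ENNReal.ofReal_sum_of_nonneg fun _ _ ↦ by positivity]
  congr 1
  refine Finset.sum_congr rfl fun i _ ↦ ?_
  rw [ENNReal.ofReal_pow (norm_nonneg _), ofReal_norm]
  congr 3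
  rw [show (-(2 * m + i : ℤ) - 1) = -((2 * m + i + 1 : ℕ) : ℤ) by push_cast; ring, zpow_neg,
    zpow_natCast, inv_pow]

theorem le_psq_rpow {g : ℝ → ℝ} (hg : Integrable g) (h0 : ∀ y, 0 ≤ g y)
    (h1 : ∫ y, g y = 1) (hs : ∀ y, g y ≠ 0 → |y| ≤ 1) {m : ℕ} (hm : 256 * Real.pi ^ 4 ≤ m)
    {p : ℝ} (hp : 0 < p) {n : ℕ} (hn : n < 4 * m) {x : ℝ} (hx0 : 0 < x) (hx : x ≤ 2 ^ (n + 1)) :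
    ENNReal.ofReal ((m / (16 * Real.pi ^ 2)) ^ (p / 2) * (((2 : ℝ) ^ (n + 1)) ^ p)⁻¹ *
      ((lac m x - m) * (3 * (m : ℝ))⁻¹)) ≤ psq (lacIndex m) (fun y ↦ (g y : ℂ)) x ^ p := by
  have hpi := Real.pi_pos
  have hm0 : (0 : ℝ) < m := lt_of_lt_of_le (by positivity) hm
  by_cases ha : lac m x ≤ m
  · rw [ENNReal.ofReal_of_nonpos]
    · exact bot_le
    · refine mul_nonpos_of_nonneg_of_nonpos (by positivity) ?_
      exact mul_nonpos_of_nonpos_of_nonneg (by linarith) (by positivity)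
  rw [not_le] at ha
  have hx16 : x ≤ 16 ^ m := by
    refine hx.trans ?_
    rw [show (16 : ℝ) = 2 ^ 4 by norm_num, ← pow_mul]
    exact pow_le_pow_right₀ one_le_two hn
  have hl := le_sum_norm_psum_sq hg h0 h1 hs hx0 hx16
  rw [psq_lacIndex, ← ENNReal.rpow_mul,
    ENNReal.ofReal_rpow_of_nonneg (Finset.sum_nonneg fun _ _ ↦ by positivity) (by positivity)]
  refine ENNReal.ofReal_le_ofReal ?_
  have h2 : m / (16 * Real.pi ^ 2) / x ^ 2 ≤
      ∑ i ∈ Finset.range m, ‖psum ((2 : ℝ)⁻¹ ^ (2 * m + i + 1)) (fun y ↦ (g y : ℂ)) x‖ ^ 2 := by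
    refine le_trans ?_ hl
    gcongr
    have e1 : (m : ℝ) / (8 * Real.pi ^ 2) ≤ lac m x / (8 * Real.pi ^ 2) := by gcongr
    have e2 : 16 * Real.pi ^ 2 ≤ m / (16 * Real.pi ^ 2) := by
      rw [le_div_iff₀ (by positivity)]; nlinarith
    have e3 : (m : ℝ) / (8 * Real.pi ^ 2) = 2 * (m / (16 * Real.pi ^ 2)) := by field_simp; norm_num
    linarith
  rw [show 1 / 2 * p = p / 2 by ring]
  refine le_trans ?_ (Real.rpow_le_rpow (by positivity) h2 (by positivity))
  rw [Real.div_rpow (y := x ^ 2) (by positivity) (by positivity), ← Real.rpow_natCast x 2, ← Real.rpow_mul hx0.le,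
    show ((2 : ℕ) : ℝ) * (p / 2) = p by push_cast; ring, div_eq_mul_inv _ (x ^ p)]
  have h3 : (lac m x - m) * (3 * (m : ℝ))⁻¹ ≤ 1 := by
    rw [← div_eq_mul_inv, div_le_one (by positivity)]
    linarith [lac_le m x]
  refine (mul_le_of_le_one_right (by positivity) h3).trans ?_
  gcongr

theorem le_setLIntegral_psq {g : ℝ → ℝ} (hg : Integrable g) (h0 : ∀ y, 0 ≤ g y)
    (h1 : ∫ y, g y = 1) (hs : ∀ y, g y ≠ 0 → |y| ≤ 1) {m : ℕ} (hm : 256 * Real.pi ^ 4 ≤ m)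
    {p : ℝ} (hp : 0 < p) {n : ℕ} (hn3 : 3 * m ≤ n) (hn : n < 4 * m) :
    ENNReal.ofReal ((m / (16 * Real.pi ^ 2)) ^ (p / 2) * (((2 : ℝ) ^ (n + 1)) ^ p)⁻¹ *
      (2 ^ n / 3)) ≤
    ∫⁻ x in Set.Ioc ((2 : ℝ) ^ n) (2 ^ (n + 1)), psq (lacIndex m) (fun y ↦ (g y : ℂ)) x ^ p := by
  have hm0 : (0 : ℝ) < m := lt_of_lt_of_le (by have := Real.pi_pos; positivity) hm
  have hc := continuous_lac m
  have hle : (2 : ℝ) ^ n ≤ 2 ^ (n + 1) := pow_le_pow_right₀ one_le_two (by omega)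
  have h2 : (∫ x in Set.Ioc ((2 : ℝ) ^ n) (2 ^ (n + 1)), ((m / (16 * Real.pi ^ 2)) ^ (p / 2) *
      (((2 : ℝ) ^ (n + 1)) ^ p)⁻¹ * ((lac m x - m) * (3 * (m : ℝ))⁻¹))) =
      (m / (16 * Real.pi ^ 2)) ^ (p / 2) * (((2 : ℝ) ^ (n + 1)) ^ p)⁻¹ * (2 ^ n / 3) := by
    rw [← intervalIntegral.integral_of_le hle, intervalIntegral.integral_const_mul,
      intervalIntegral.integral_mul_const, integral_lac hn3]
    field_simp
  rw [← h2]
  refine (ofReal_integral_le_lintegral ?_).trans ?_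
  · exact (Continuous.integrableOn_Icc (by fun_prop)).mono_set Set.Ioc_subset_Icc_self
  · refine setLIntegral_mono' measurableSet_Ioc fun x hx ↦ ?_
    exact le_psq_rpow hg h0 h1 hs hm hp hn (lt_trans (by positivity) hx.1) hx.2

theorem le_lintegral_psq {g : ℝ → ℝ} (hg : Integrable g) (h0 : ∀ y, 0 ≤ g y)
    (h1 : ∫ y, g y = 1) (hs : ∀ y, g y ≠ 0 → |y| ≤ 1) {m : ℕ} (hm : 256 * Real.pi ^ 4 ≤ m)
    {p : ℝ} (hp : 1 < p) (hp2 : p ≤ 2) :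
    ENNReal.ofReal ((m : ℝ) ^ (1 + p / 2) * (192 * Real.pi ^ 2)⁻¹ *
      ((2 : ℝ) ^ (4 * m * (p - 1)))⁻¹) ≤
    ∫⁻ x, psq (lacIndex m) (fun y ↦ (g y : ℂ)) x ^ p := by
  have hpi := Real.pi_pos
  have hm0 : (0 : ℝ) < m := lt_of_lt_of_le (by positivity) hm
  set c : ℝ := (m : ℝ) ^ (p / 2) * (192 * Real.pi ^ 2)⁻¹ * ((2 : ℝ) ^ (4 * m * (p - 1)))⁻¹ with hc
  have hblock : ∀ n ∈ Finset.Ico (3 * m) (4 * m), ENNReal.ofReal c ≤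
      ∫⁻ x in Set.Ioc ((2 : ℝ) ^ n) (2 ^ (n + 1)),
        psq (lacIndex m) (fun y ↦ (g y : ℂ)) x ^ p := by
    intro n hn
    rw [Finset.mem_Ico] at hn
    refine le_trans (ENNReal.ofReal_le_ofReal ?_)
      (le_setLIntegral_psq hg h0 h1 hs hm (by linarith) hn.1 hn.2)
    have e1 : (m : ℝ) ^ (p / 2) * (16 * Real.pi ^ 2)⁻¹ ≤ (m / (16 * Real.pi ^ 2)) ^ (p / 2) := by
      rw [Real.div_rpow hm0.le (by positivity), div_eq_mul_inv _ ((16 * Real.pi ^ 2) ^ (p / 2))]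
      have : (16 * Real.pi ^ 2) ^ (p / 2) ≤ (16 * Real.pi ^ 2) ^ (1 : ℝ) := by
        refine Real.rpow_le_rpow_of_exponent_le ?_ (by linarith)
        nlinarith [Real.pi_gt_three]
      rw [Real.rpow_one] at this
      gcongr
    have e2 : (12 : ℝ)⁻¹ * ((2 : ℝ) ^ (4 * m * (p - 1)))⁻¹ ≤
        (((2 : ℝ) ^ (n + 1)) ^ p)⁻¹ * (2 ^ n / 3) := by
      have h2 : (0 : ℝ) < 2 := two_pos
      have e3 : ((2 : ℝ) ^ (n + 1)) ^ p = 2 ^ p * 2 ^ n * 2 ^ (n * (p - 1)) := by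
        rw [← Real.rpow_natCast, ← Real.rpow_natCast, ← Real.rpow_mul h2.le, ← Real.rpow_add h2,
          ← Real.rpow_add h2]
        congr 1; push_cast; ring
      have e4 : (2 : ℝ) ^ p ≤ 4 := by
        refine (Real.rpow_le_rpow_of_exponent_le one_le_two hp2).trans (by norm_num)
      have e5 : (2 : ℝ) ^ (n * (p - 1)) ≤ 2 ^ (4 * m * (p - 1)) := by
        refine Real.rpow_le_rpow_of_exponent_le one_le_two ?_
        have : (n : ℝ) ≤ 4 * m := by exact_mod_cast hn.2.le
        exact mul_le_mul_of_nonneg_right this (by linarith)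
      rw [e3, ← mul_inv, mul_inv _ ((2 : ℝ) ^ (n * (p - 1))), mul_inv ((2 : ℝ) ^ p)]
      rw [show ((2 : ℝ) ^ p)⁻¹ * (2 ^ n)⁻¹ * (2 ^ (n * (p - 1)))⁻¹ * (2 ^ n / 3) =
        (3 * (2 : ℝ) ^ p * 2 ^ (n * (p - 1)))⁻¹ by field_simp]
      refine inv_anti₀ (by positivity) ?_
      exact mul_le_mul (by linarith) e5 (by positivity) (by norm_num)
    calc c = (m : ℝ) ^ (p / 2) * (16 * Real.pi ^ 2)⁻¹ *
          ((12 : ℝ)⁻¹ * ((2 : ℝ) ^ (4 * m * (p - 1)))⁻¹) := by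
            rw [hc, show (192 : ℝ) * Real.pi ^ 2 = (16 * Real.pi ^ 2) * 12 by ring,
              mul_inv (16 * Real.pi ^ 2)]
            ring
      _ ≤ _ := by
            rw [mul_assoc ((m / (16 * Real.pi ^ 2)) ^ (p / 2))]
            exact mul_le_mul e1 e2 (by positivity) (by positivity)
  have hdisj : Set.PairwiseDisjoint (↑(Finset.Ico (3 * m) (4 * m)))
      fun n : ℕ ↦ Set.Ioc ((2 : ℝ) ^ n) (2 ^ (n + 1)) :=
    ((pow_right_mono₀ (one_le_two (α := ℝ))).pairwise_disjoint_on_Ioc_succ).set_pairwise _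
  calc _ = ∑ n ∈ Finset.Ico (3 * m) (4 * m), ENNReal.ofReal c := by
        rw [Finset.sum_const, Nat.card_Ico, nsmul_eq_mul, ← ENNReal.ofReal_natCast,
          ← ENNReal.ofReal_mul (by positivity), show 4 * m - 3 * m = m by omega, hc,
          Real.rpow_add hm0, Real.rpow_one]
        congr 1; ring
    _ ≤ _ := Finset.sum_le_sum hblock
    _ = _ := (lintegral_biUnion_finset hdisj (fun _ _ ↦ measurableSet_Ioc) _).symm
    _ ≤ _ := setLIntegral_le_lintegral _ _

end

section

variable {d : ℕ} {i : Fin d}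

theorem exists_smooth_approx : ∃ g : ℝ → ℝ, ContDiff ℝ (⊤ : ℕ∞) g ∧ HasCompactSupport g ∧
    (∀ y, 0 ≤ g y) ∧ ∫ y, g y = 1 ∧ ∀ y, g y ≠ 0 → |y| ≤ 1 := by
  let b : ContDiffBump (0 : ℝ) := ⟨1 / 2, 1, by norm_num, by norm_num⟩
  refine ⟨b.normed volume, b.contDiff_normed, b.hasCompactSupport_normed, b.nonneg_normed,
    b.integral_normed, fun y hy ↦ ?_⟩
  have : y ∈ Function.support (b.normed volume) := hy
  rw [b.support_normed_eq] at this
  simpa [Real.dist_eq] using (Metric.mem_ball.1 this).le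

theorem exists_lintegral_rpow_le {g : ℝ → ℝ} (hg : Continuous g) (hc : HasCompactSupport g)
    (hs : ∀ y, g y ≠ 0 → |y| ≤ 1) : ∃ D : ℝ, 0 < D ∧ ∀ p : ℝ, 1 < p → p ≤ 2 →
    ∫⁻ y, ‖(g y : ℂ)‖ₑ ^ p ≤ ENNReal.ofReal D := by
  obtain ⟨M, hM⟩ := hc.exists_bound_of_continuous hg
  set N := max M 1
  have hN : 1 ≤ N := le_max_right _ _
  refine ⟨N ^ 2 * 2, by positivity, fun p hp hp2 ↦ ?_⟩
  have : ∀ y, ‖(g y : ℂ)‖ₑ ^ p ≤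
      (Set.Icc (-1 : ℝ) 1).indicator (fun _ ↦ ENNReal.ofReal (N ^ 2)) y := fun y ↦ by
    rw [← ofReal_norm, Complex.norm_real]
    have hp0 : 0 < p := by linarith
    by_cases hy : g y = 0
    · simp [hy, hp0]
    rw [Set.indicator_of_mem (Set.mem_Icc.2 (abs_le.1 (hs y hy))), ENNReal.ofReal_rpow_of_nonneg (norm_nonneg _)
      (by linarith), ← Real.rpow_natCast]
    refine ENNReal.ofReal_le_ofReal ?_
    calc ‖g y‖ ^ p ≤ N ^ p :=
          Real.rpow_le_rpow (norm_nonneg _) ((hM y).trans (le_max_left _ _)) (by linarith)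
      _ ≤ _ := Real.rpow_le_rpow_of_exponent_le hN (by exact_mod_cast hp2)
  refine (lintegral_mono this).trans (le_of_eq ?_)
  rw [lintegral_indicator measurableSet_Icc, setLIntegral_const, Real.volume_Icc,
    ← ENNReal.ofReal_mul (by positivity)]
  norm_num

theorem exists_le_dyadicUpperConst_of_le_two : ∃ c : ℝ, 0 < c ∧ ∀ (d : ℕ) (p : ℝ), 1 < p → p ≤ 2 →
    ENNReal.ofReal (c * (p / (p - 1)) ^ (3 / 2 : ℝ)) ^ d ≤ dyadicUpperConst d p := by
  obtain ⟨g, hg, hc, h0, h1, hs⟩ := exists_smooth_approx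
  obtain ⟨D, hD, hDp⟩ := exists_lintegral_rpow_le hg.continuous hc hs
  have hgi : Integrable g := hg.continuous.integrable_of_hasCompactSupport hc
  obtain ⟨n, hn⟩ := exists_nat_ge (256 * Real.pi ^ 4)
  have hpi := Real.pi_pos
  set B : ℝ := n + 2 with hB
  set c₁ : ℝ := (192 * Real.pi ^ 2)⁻¹ * ((2 : ℝ) ^ (4 * B))⁻¹ with hc₁
  have hc₁0 : 0 < c₁ := by positivity
  set c : ℝ := min 1 (c₁ / (D * (8 * 2 ^ B))) with hcdef
  have hc0 : 0 < c := lt_min one_pos (by positivity)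
  have hcc : c * D * (8 * 2 ^ B) ≤ c₁ := by
    have := min_le_right 1 (c₁ / (D * (8 * 2 ^ B)))
    rw [← hcdef, le_div_iff₀ (by positivity)] at this
    linarith
  refine ⟨c, hc0, fun d p hp hp2 ↦ ?_⟩
  have hp1 : 0 < p - 1 := by linarith
  set m : ℕ := n + ⌈1 / (p - 1)⌉₊ with hm
  have hceil := Nat.le_ceil (1 / (p - 1))
  have hceil' := Nat.ceil_lt_add_one (by positivity : 0 ≤ 1 / (p - 1))
  have hmr : (m : ℝ) = n + (⌈1 / (p - 1)⌉₊ : ℝ) := by rw [hm]; push_cast; rfl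
  have hn0 : (0 : ℝ) < n := lt_of_lt_of_le (by positivity) hn
  have hmn : 256 * Real.pi ^ 4 ≤ m := by
    have : (0 : ℝ) ≤ (⌈1 / (p - 1)⌉₊ : ℝ) := Nat.cast_nonneg _
    linarith
  have hm0 : (0 : ℝ) < m := lt_of_lt_of_le (by positivity) hmn
  have hmB : m * (p - 1) ≤ B := by
    have e : 1 / (p - 1) * (p - 1) = 1 := by field_simp
    rw [hmr, hB]
    nlinarith
  have hq : p / (p - 1) ≤ 2 * m := by
    have : p / (p - 1) ≤ 2 * (1 / (p - 1)) := by
      rw [mul_one_div]; gcongr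
    linarith
  refine le_dyadicUpperConst (g := fun y ↦ (g y : ℂ)) (by linarith)
    (Complex.ofRealCLM.contDiff.comp hg) (hc.comp_left (g := fun x : ℝ ↦ (x : ℂ)) (by simp))
    ?_ (lacIndex m) ?_
  · intro h
    have hp0 : 0 < p := by linarith
    rw [lintegral_eq_zero_iff (by have := hg.continuous; fun_prop)] at h
    have : ∫ y, g y = ∫ y : ℝ, (0 : ℝ) := integral_congr_ae (h.mono fun y hy ↦ by
      simpa [hp0, hp0.not_gt] using hy)
    rw [h1, integral_zero] at this
    exact one_ne_zero this
  · refine (mul_le_mul_right (hDp p hp hp2) _).trans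
      (le_trans ?_ (le_lintegral_psq hgi h0 h1 hs hmn hp hp2))
    have hp0 : 0 < p := by linarith
    rw [ENNReal.ofReal_rpow_of_nonneg (by positivity) hp0.le, ← ENNReal.ofReal_mul (by positivity)]
    refine ENNReal.ofReal_le_ofReal ?_
    have hq0 : 0 ≤ p / (p - 1) := by positivity
    have e1 : c ^ p ≤ c := by
      have := Real.rpow_le_rpow_of_exponent_ge hc0 (min_le_left _ _) hp.le
      rwa [Real.rpow_one] at this
    have e2 : ((p / (p - 1)) ^ (3 / 2 : ℝ)) ^ p ≤ 8 * 2 ^ B * (m : ℝ) ^ (1 + p / 2) := by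
      rw [← Real.rpow_mul hq0]
      calc (p / (p - 1)) ^ (3 / 2 * p) ≤ (2 * m) ^ (3 / 2 * p) :=
            Real.rpow_le_rpow hq0 hq (by positivity)
        _ = 2 ^ (3 / 2 * p) * ((m : ℝ) ^ (p - 1) * (m : ℝ) ^ (1 + p / 2)) := by
            rw [Real.mul_rpow two_pos.le hm0.le, ← Real.rpow_add hm0]
            congr 2; ring
        _ ≤ 8 * (2 ^ B * (m : ℝ) ^ (1 + p / 2)) := by
            have f1 : (2 : ℝ) ^ (3 / 2 * p) ≤ 8 := by
              refine (Real.rpow_le_rpow_of_exponent_le one_le_two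
                (by linarith : 3 / 2 * p ≤ (3 : ℝ))).trans (by norm_num)
            have f2 : (m : ℝ) ^ (p - 1) ≤ 2 ^ B := by
              have : (m : ℝ) ≤ 2 ^ (m : ℝ) := by
                rw [Real.rpow_natCast]; exact_mod_cast (Nat.lt_two_pow_self).le
              refine (Real.rpow_le_rpow hm0.le this hp1.le).trans ?_
              rw [← Real.rpow_mul two_pos.le]
              exact Real.rpow_le_rpow_of_exponent_le one_le_two hmB
            gcongr
        _ = _ := by ring
    have e3 : ((2 : ℝ) ^ (4 * B))⁻¹ ≤ ((2 : ℝ) ^ (4 * m * (p - 1)))⁻¹ := by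
      refine inv_anti₀ (by positivity) (Real.rpow_le_rpow_of_exponent_le one_le_two ?_)
      linarith
    calc (c * (p / (p - 1)) ^ (3 / 2 : ℝ)) ^ p * D
        = c ^ p * ((p / (p - 1)) ^ (3 / 2 : ℝ)) ^ p * D := by
          rw [Real.mul_rpow hc0.le (by positivity)]
      _ ≤ c * (8 * 2 ^ B * (m : ℝ) ^ (1 + p / 2)) * D := by gcongr
      _ = c * D * (8 * 2 ^ B) * (m : ℝ) ^ (1 + p / 2) := by ring
      _ ≤ c₁ * (m : ℝ) ^ (1 + p / 2) := by gcongr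
      _ = (m : ℝ) ^ (1 + p / 2) * (192 * Real.pi ^ 2)⁻¹ * ((2 : ℝ) ^ (4 * B))⁻¹ := by
          rw [hc₁]; ring
      _ ≤ _ := by gcongr

end

end DyadicLP

/-- Optimal order of the best constant `L^Δ_{c,p,d}` in the upper dyadic Littlewood–Paley
inequality on `ℝ^d`: `L^Δ_{c,p,d} ≈_d (p')^{3d/2}` for `1 < p ≤ 2` and
`L^Δ_{c,p,d} ≈_d p^d` for `2 < p < ∞`. -/
theorem dyadicUpperConst_optimal_order :
    ∀ (d : ℕ), 0 < d → ∃ C : ℝ, 0 < C ∧ ∀ p : ℝ, 1 < p →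
      (p ≤ 2 →
        ENNReal.ofReal ((p / (p - 1)) ^ (3 * (d : ℝ) / 2)) ≤
          ENNReal.ofReal C * dyadicUpperConst d p ∧
        dyadicUpperConst d p ≤ ENNReal.ofReal (C * (p / (p - 1)) ^ (3 * (d : ℝ) / 2))) ∧
      (2 < p →
        ENNReal.ofReal (p ^ (d : ℕ)) ≤ ENNReal.ofReal C * dyadicUpperConst d p ∧
        dyadicUpperConst d p ≤ ENNReal.ofReal (C * p ^ (d : ℕ))) := by
  intro d _
  obtain ⟨C₀, hC₀, hup⟩ := DyadicLP.exists_dyadicUpperConst_le d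
  obtain ⟨a, ha, hlo₁⟩ := DyadicLP.exists_le_dyadicUpperConst_of_le_two
  obtain ⟨b, hb, hlo₂⟩ := DyadicLP.exists_le_dyadicUpperConst_of_two_lt
  have lower : ∀ {e x : ℝ} {L : ℝ≥0∞}, 0 < e → ENNReal.ofReal (e * x) ^ d ≤ L → 0 ≤ x →
      ∀ C, (e⁻¹) ^ d ≤ C → ENNReal.ofReal (x ^ d) ≤ ENNReal.ofReal C * L := by
    intro e x L he hL hx C hC
    have h1 : x ^ d = (e⁻¹) ^ d * (e * x) ^ d := by
      rw [← mul_pow, inv_mul_cancel_left₀ he.ne']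
    rw [h1, ENNReal.ofReal_mul (by positivity), ENNReal.ofReal_pow (by positivity : 0 ≤ e * x)]
    gcongr
  refine ⟨max C₀ (max ((a⁻¹) ^ d) ((b⁻¹) ^ d)), lt_max_of_lt_left hC₀, fun p hp ↦
    ⟨fun hp2 ↦ ⟨?_, ?_⟩, fun hp2 ↦ ⟨?_, ?_⟩⟩⟩
  · have hq : 0 ≤ p / (p - 1) := div_nonneg (by linarith) (by linarith)
    have h1 : (p / (p - 1)) ^ (3 * (d : ℝ) / 2) = ((p / (p - 1)) ^ (3 / 2 : ℝ)) ^ d := by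
      rw [← Real.rpow_natCast _ d, ← Real.rpow_mul hq]
      congr 1; ring
    rw [h1]
    exact lower ha (hlo₁ d p hp hp2) (by positivity) _
      ((le_max_left _ _).trans (le_max_right _ _))
  · have hq : 0 ≤ p / (p - 1) := div_nonneg (by linarith) (by linarith)
    refine ((hup p hp).1 hp2).trans (ENNReal.ofReal_le_ofReal ?_)
    gcongr
    exact le_max_left _ _
  · exact lower hb (hlo₂ d p hp2) (by linarith) _ ((le_max_right _ _).trans (le_max_right _ _))
  · refine ((hup p hp).2 hp2).trans (ENNReal.ofReal_le_ofReal ?_)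
    gcongr
    exact le_max_left _ _
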